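/- Let p be a prime, e ≥ 1 and q = p^e. Let φ be a first-order formula in the language of rings with k free variables. For each m ≥ 1 let c_m be the number of k-tuples x ∈ (GaloisField p (e·m))^k at which φ is satisfied in the finite field GaloisField p (e·m) (the field with q^m elements). Then the formal power series Σ_{m≥1} c_m t^m ∈ ℚ[[t]] is rational. -/

import Mathlib

section
open FirstOrder PowerSeries

/-- The number of `k`-tuples of a (finite) ring `K` satisfying the ring-language formula `φ`,
where `K` is viewed as a structure for the language of rings via `compatibleRingOfRing`. -/
noncomputable def ringFormulaCount {k : ℕ} (φ : Language.ring.Formula (Fin k))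
    (K : Type*) [Add K] [Mul K] [Neg K] [One K] [Zero K] : ℕ :=
  letI := Ring.compatibleRingOfRing K
  Nat.card {x : Fin k → K // φ.Realize x}

end

set_option linter.style.haveILetI false
set_option linter.unusedVariables false
set_option linter.unusedSectionVars false

namespace PRat

open Matrix

/-- The Hankel matrix of size `M` starting at `k`. -/
def hank {R : Type*} (c : ℕ → R) (k M : ℕ) : Matrix (Fin M) (Fin M) R :=
  Matrix.of fun i j => c (k + i + j)

/-- A sequence whose generating series is rational. -/
def IsRat (c : ℕ → ℚ) : Prop :=
  ∃ a b : Polynomial ℚ, b ≠ 0 ∧ (b : PowerSeries ℚ) * PowerSeries.mk c = (a : PowerSeries ℚ)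

lemma eq_poly_of_coeff_zero {R : Type*} [CommRing R] (G : PowerSeries R) (N : ℕ)
    (h : ∀ n, N ≤ n → PowerSeries.coeff n G = 0) : ∃ a : Polynomial R, G = (a : PowerSeries R) := by
  refine ⟨PowerSeries.trunc N G, ?_⟩
  ext n
  rw [Polynomial.coeff_coe, PowerSeries.coeff_trunc]
  split_ifs with hn
  · rfl
  · exact h n (not_lt.mp hn)

lemma isRat_of_rec (c : ℕ → ℚ) (M k1 : ℕ) (q : Fin (M + 1) → ℚ) (hq : q (Fin.last M) = 1)
    (h : ∀ n, k1 ≤ n → ∑ j : Fin (M + 1), c (n + j) * q j = 0) : IsRat c := by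
  set b : Polynomial ℚ := ∑ j : Fin (M + 1), Polynomial.monomial (M - j) (q j) with hb
  have hb0 : b.coeff 0 = 1 := by
    rw [hb, Polynomial.finsetSum_coeff]
    rw [Finset.sum_eq_single (Fin.last M)]
    · simp [hq]
    · intro j _ hj
      rw [Polynomial.coeff_monomial, if_neg]
      have : (j : ℕ) < M := by
        rcases lt_or_eq_of_le (Nat.lt_succ_iff.mp j.2) with h | h
        · exact h
        · exact absurd (Fin.ext h) hj
      omega
    · simp
  have hbne : b ≠ 0 := by
    intro h0; rw [h0] at hb0; simp at hb0
  obtain ⟨a, ha⟩ := eq_poly_of_coeff_zero ((b : PowerSeries ℚ) * PowerSeries.mk c) (k1 + M) (by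
    intro n hn
    obtain ⟨n, rfl⟩ : ∃ n', n = n' + M := ⟨n - M, by omega⟩
    rw [hb, ← Polynomial.coeToPowerSeries.ringHom_apply, map_sum, Finset.sum_mul, map_sum]
    rw [← h n (by omega)]
    refine Finset.sum_congr rfl fun j _ => ?_
    have hj : (j : ℕ) ≤ M := Nat.lt_succ_iff.mp j.2
    rw [Polynomial.coeToPowerSeries.ringHom_apply, ← Polynomial.C_mul_X_pow_eq_monomial,
      Polynomial.coe_mul, Polynomial.coe_C, Polynomial.coe_pow, Polynomial.coe_X,
      mul_assoc, PowerSeries.coeff_C_mul]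
    rw [show n + M = (n + j) + (M - j) by omega, PowerSeries.coeff_X_pow_mul, PowerSeries.coeff_mk]
    ring)
  exact ⟨a, b, hbne, ha⟩

lemma hank_step (c : ℕ → ℚ) (k M : ℕ) (h0 : (hank c k (M + 1)).det = 0)
    (h1 : (hank c (k + 1) M).det ≠ 0) : (hank c (k + 2) M).det ≠ 0 := by
  obtain ⟨q, hq0, hq⟩ := Matrix.exists_mulVec_eq_zero_iff.mpr h0
  have key : ∀ v : Fin (M + 1) → ℚ, (∀ i : Fin M, (hank c k (M + 1) *ᵥ v) i.castSucc = 0) →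
      v 0 = 0 → v = 0 := by
    intro v hv hv0
    by_contra hne
    apply h1
    refine Matrix.exists_mulVec_eq_zero_iff.mp ⟨fun i => v i.succ, ?_, ?_⟩
    · intro h
      apply hne
      funext i
      refine Fin.cases hv0 (fun i => ?_) i
      exact congrFun h i
    · funext i
      have := hv i
      simp only [mulVec, dotProduct, hank, of_apply, Fin.sum_univ_succ, hv0, mul_zero,
        zero_add, Fin.val_castSucc, Fin.val_succ] at this ⊢
      rw [Pi.zero_apply, ← this]
      refine Finset.sum_congr rfl fun j _ => ?_
      congr 2; ring
  have hq0' : q 0 ≠ 0 := by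
    intro h
    exact hq0 (key q (fun i => by rw [hq]; rfl) h)
  intro h2
  obtain ⟨v, hv0, hv⟩ := Matrix.exists_mulVec_eq_zero_iff.mpr h2
  set w : Fin (M + 1) → ℚ := Fin.cons 0 v with hw
  have hs : ∀ i : Fin M, (hank c k (M + 1) *ᵥ w) i.succ = 0 := by
    intro i
    have := congrFun hv i
    simp only [mulVec, dotProduct, hank, of_apply, Fin.sum_univ_succ, hw, Fin.cons_zero, mul_zero,
        zero_add, Fin.cons_succ, Fin.val_succ, Pi.zero_apply] at this ⊢
    rw [← this]
    refine Finset.sum_congr rfl fun j _ => ?_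
    congr 2; ring
  have hsym : (hank c k (M + 1))ᵀ = hank c k (M + 1) := by
    ext i j; simp only [hank, transpose_apply, of_apply]; congr 1; ring
  have h3 : q ⬝ᵥ (hank c k (M + 1) *ᵥ w) = 0 := by
    rw [Matrix.dotProduct_mulVec, ← Matrix.mulVec_transpose, hsym, hq, zero_dotProduct]
  rw [dotProduct, Fin.sum_univ_succ] at h3
  simp only [hs, mul_zero, Finset.sum_const_zero, add_zero] at h3
  have h4 : (hank c k (M + 1) *ᵥ w) 0 = 0 := (mul_eq_zero.mp h3).resolve_left hq0'
  have hall : ∀ i, (hank c k (M + 1) *ᵥ w) i = 0 := fun i => Fin.cases h4 hs i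
  have hw0 := key w (fun i => hall _) rfl
  apply hv0
  funext i
  have := congrFun hw0 i.succ
  simpa [hw] using this

lemma isRat_of_hank (c : ℕ → ℚ) (M : ℕ) : ∀ k0 : ℕ, (∀ k, k0 ≤ k → (hank c k M).det = 0) →
    IsRat c := by
  induction M with
  | zero => intro k0 h; have := h k0 le_rfl; simp at this
  | succ M ih =>
    intro k0 h
    by_cases hA : ∃ k1, ∀ k, k1 ≤ k → (hank c k M).det = 0
    · obtain ⟨k1, hk1⟩ := hA
      exact ih k1 hk1
    push Not at hA
    obtain ⟨k1, hk1, hk1'⟩ := hA (k0 + 1)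
    have hne : ∀ n, (hank c (k1 + n) M).det ≠ 0 := by
      intro n
      induction n with
      | zero => exact hk1'
      | succ n ihn =>
        have := hank_step c (k1 + n - 1) M (h _ (by omega))
          (by rw [show k1 + n - 1 + 1 = k1 + n by omega]; exact ihn)
        rwa [show k1 + n - 1 + 2 = k1 + (n + 1) by omega] at this
    -- kernel vectors
    have hker : ∀ n, ∃ q : Fin (M + 1) → ℚ, q (Fin.last M) = 1 ∧
        hank c (k1 + n) (M + 1) *ᵥ q = 0 := by
      intro n
      obtain ⟨q, hq0, hq⟩ := Matrix.exists_mulVec_eq_zero_iff.mpr (h (k1 + n) (by omega))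
      have hl : q (Fin.last M) ≠ 0 := by
        intro hl
        apply hne n
        refine Matrix.exists_mulVec_eq_zero_iff.mp ⟨fun i => q i.castSucc, ?_, ?_⟩
        · intro h
          apply hq0
          funext i
          refine Fin.lastCases hl (fun i => ?_) i
          exact congrFun h i
        · funext i
          have := congrFun hq i.castSucc
          simpa [mulVec, dotProduct, hank, Fin.sum_univ_castSucc, hl] using this
      refine ⟨(q (Fin.last M))⁻¹ • q, by simp [hl], ?_⟩
      rw [Matrix.mulVec_smul, hq, smul_zero]
    choose q hq1 hq2 using hker
    have hqe : ∀ n, q (n + 1) = q n := by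
      intro n
      by_contra hcon
      apply hne (n + 1)
      refine Matrix.exists_mulVec_eq_zero_iff.mp
        ⟨fun i => q (n + 1) i.castSucc - q n i.castSucc, ?_, ?_⟩
      · intro h
        apply hcon
        funext i
        refine Fin.lastCases (by rw [hq1, hq1]) (fun i => ?_) i
        exact sub_eq_zero.mp (congrFun h i)
      · funext i
        have h1 := congrFun (hq2 (n + 1)) i.castSucc
        have h2 := congrFun (hq2 n) i.succ
        simp only [mulVec, dotProduct, hank, of_apply, Fin.sum_univ_castSucc, hq1,
          Fin.val_castSucc, Fin.val_succ, Pi.zero_apply, Fin.val_last, mul_one] at h1 h2 ⊢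
        simp only [mul_sub, Finset.sum_sub_distrib]
        have e : ∀ j : ℕ, k1 + n + (↑i + 1) + j = k1 + (n + 1) + ↑i + j := by intro j; ring
        simp only [e] at h2
        linear_combination h1 - h2
    have hq' : ∀ n, q n = q 0 := by
      intro n
      induction n with
      | zero => rfl
      | succ n ih => rw [hqe, ih]
    refine isRat_of_rec c M k1 (q 0) (hq1 0) ?_
    intro n hn
    obtain ⟨n, rfl⟩ := Nat.exists_eq_add_of_le hn
    have := congrFun (hq2 n) 0
    rw [hq'] at this
    simpa [mulVec, dotProduct, hank] using this

end PRat

namespace PRat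

lemma IsRat.zero : IsRat (fun _ => 0) :=
  ⟨0, 1, one_ne_zero, by ext n; simp⟩

lemma IsRat.add {c d : ℕ → ℚ} (hc : IsRat c) (hd : IsRat d) : IsRat (fun m => c m + d m) := by
  obtain ⟨a, b, hb, h⟩ := hc
  obtain ⟨a', b', hb', h'⟩ := hd
  refine ⟨b' * a + b * a', b * b', mul_ne_zero hb hb', ?_⟩
  have : PowerSeries.mk (fun m => c m + d m) = PowerSeries.mk c + PowerSeries.mk d := by
    ext n; simp
  rw [this]
  push_cast
  rw [← h, ← h']
  ring

lemma IsRat.const_mul {c : ℕ → ℚ} (hc : IsRat c) (r : ℚ) : IsRat (fun m => r * c m) := by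
  obtain ⟨a, b, hb, h⟩ := hc
  refine ⟨Polynomial.C r * a, b, hb, ?_⟩
  have : PowerSeries.mk (fun m => r * c m) = PowerSeries.C r * PowerSeries.mk c := by
    ext n; simp
  rw [this]
  push_cast
  rw [← h]
  ring

lemma IsRat.sum {ι : Type*} (s : Finset ι) (c : ι → ℕ → ℚ) (hc : ∀ i ∈ s, IsRat (c i)) :
    IsRat (fun m => ∑ i ∈ s, c i m) := by
  classical
  induction s using Finset.induction_on with
  | empty => simpa using IsRat.zero
  | insert i s hi ih =>
    simp only [Finset.sum_insert hi]
    exact (hc i (by simp)).add (ih fun j hj => hc j (by simp [hj]))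

lemma IsRat.congr {c d : ℕ → ℚ} (hc : IsRat c) (k : ℕ) (h : ∀ m, k ≤ m → d m = c m) :
    IsRat d := by
  have h1 : IsRat (fun m => d m - c m) := by
    obtain ⟨a, ha⟩ := eq_poly_of_coeff_zero (PowerSeries.mk (fun m => d m - c m)) k (by
      intro n hn; simp [h n hn])
    exact ⟨a, 1, one_ne_zero, by rw [← ha]; simp⟩
  have := hc.add h1
  simpa using this

lemma IsRat.rescale {c : ℕ → ℚ} (q : ℚ) (hq : q ≠ 0) (hc : IsRat (fun m => q ^ m * c m)) :
    IsRat c := by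
  obtain ⟨a, b, hb, h⟩ := hc
  have key : ∀ f : Polynomial ℚ, PowerSeries.rescale q⁻¹ (f : PowerSeries ℚ) =
      ((f.comp (Polynomial.C q⁻¹ * Polynomial.X) : Polynomial ℚ) : PowerSeries ℚ) := by
    intro f
    ext n
    rw [PowerSeries.coeff_rescale, Polynomial.coeff_coe, Polynomial.coeff_coe,
      Polynomial.comp_C_mul_X_coeff]
    ring
  refine ⟨a.comp (Polynomial.C q⁻¹ * Polynomial.X), b.comp (Polynomial.C q⁻¹ * Polynomial.X),
    ?_, ?_⟩
  · intro h0
    apply hb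
    ext n
    have := congrArg (fun f => Polynomial.coeff f n) h0
    simp only [Polynomial.comp_C_mul_X_coeff, Polynomial.coeff_zero] at this
    simpa [hq] using this
  · rw [← key, ← key, ← h, map_mul]
    congr 1
    ext n
    simp [PowerSeries.coeff_rescale, hq]

section Borel

variable {K : Type*} [NormedField K]

lemma norm_int_le_one {p : ℕ} [Fact p.Prime] [NormedAlgebra ℚ_[p] K] (n : ℤ) : ‖(n : K)‖ ≤ 1 := by
  rw [← map_intCast (algebraMap ℚ_[p] K), norm_algebraMap']
  exact Padic.norm_int_le_one n

lemma one_le_abs_mul_norm {p : ℕ} [Fact p.Prime] [NormedAlgebra ℚ_[p] K]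
    (n : ℤ) (hn : n ≠ 0) : 1 ≤ |(n : ℝ)| * ‖(n : K)‖ := by
  rw [← map_intCast (algebraMap ℚ_[p] K), norm_algebraMap']
  have h1 : ‖(n : ℚ_[p])‖ = (p : ℝ) ^ (-(padicValInt p n : ℤ)) := by
    rw [← Rat.cast_intCast, Padic.eq_padicNorm, padicNorm.eq_zpow_of_nonzero (by exact_mod_cast hn)]
    simp
  have hp : (0 : ℝ) < p := by exact_mod_cast (Fact.out : p.Prime).pos
  rw [h1, zpow_neg, ← div_eq_mul_inv, one_le_div (by positivity), zpow_natCast]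
  have h2 : p ^ padicValInt p n ∣ n.natAbs := pow_padicValNat_dvd
  have h3 := Nat.le_of_dvd (Int.natAbs_pos.mpr hn) h2
  have : ((p ^ padicValInt p n : ℕ) : ℝ) ≤ (n.natAbs : ℝ) := by exact_mod_cast h3
  rw [Nat.cast_natAbs] at this
  push_cast at this
  exact this

/-- approximability by exponential sums -/
def Approx (c : ℕ → K) : Prop :=
  ∀ θ : ℝ, 0 < θ → ∃ J : ℕ, ∀ N : ℕ, ∃ b β : Fin J → K, (∀ l, ‖b l‖ ≤ 1) ∧ (∀ l, ‖β l‖ ≤ 1) ∧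
    ∀ m, 1 ≤ m → m ≤ N → ‖c m - ∑ l, b l * β l ^ m‖ ≤ θ ^ m

open Matrix in
lemma norm_det_lowrank_le [IsUltrametricDist K] {J M : ℕ} (U : Matrix (Fin M) (Fin J) K) (V : Matrix (Fin J) (Fin M) K)
    (E : Matrix (Fin M) (Fin M) K) (hU : ∀ i j, ‖U i j‖ ≤ 1) (hV : ∀ i j, ‖V i j‖ ≤ 1) (ε : ℝ)
    (hε0 : 0 ≤ ε) (hε : ε ≤ 1) (hE : ∀ i j, ‖E i j‖ ≤ ε) : ‖(E + U * V).det‖ ≤ ε ^ (M - J) := by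
  have h1 : (E + U * V).det = (Matrix.fromBlocks 1 (-V) U E).det := by
    rw [Matrix.det_fromBlocks_one₁₁]; simp
  rw [h1, Matrix.det_apply]
  refine IsUltrametricDist.norm_sum_le_of_forall_le_of_nonneg (by positivity) ?_
  intro σ _
  have : ‖Equiv.Perm.sign σ • ∏ i, (Matrix.fromBlocks 1 (-V) U E) (σ i) i‖ =
      ‖∏ i, (Matrix.fromBlocks 1 (-V) U E) (σ i) i‖ := by
    rcases Int.units_eq_one_or (Equiv.Perm.sign σ) with h | h <;> simp [h]
  rw [this, norm_prod, Fintype.prod_sum_type]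
  have hb : ∀ x y, ‖(Matrix.fromBlocks 1 (-V) U E) x y‖ ≤ 1 := by
    rintro (x | x) (y | y)
    · simp only [Matrix.fromBlocks_apply₁₁, Matrix.one_apply]
      split_ifs <;> simp
    · simpa using hV x y
    · simpa using hU x y
    · simpa using (hE x y).trans hε
  classical
  set S : Finset (Fin M) := Finset.univ.filter fun i => (σ (Sum.inr i)).isRight with hS
  have hcard : M - J ≤ S.card := by
    have h3 : (Finset.univ.filter fun i : Fin M => ¬ (σ (Sum.inr i)).isRight).card ≤ J := by
      have : (Finset.univ.filter fun i : Fin M => ¬ (σ (Sum.inr i)).isRight).card ≤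
          (Finset.univ.image (Sum.inl : Fin J → Fin J ⊕ Fin M)).card := by
        refine Finset.card_le_card_of_injOn (fun i => σ (Sum.inr i)) ?_ ?_
        · intro i hi
          simp only [Finset.coe_filter, Set.mem_ofPred_eq] at hi
          rcases h : σ (Sum.inr i) with x | x
          · simp [h]
          · simp [h] at hi
        · intro i _ j _ h
          simpa using h
      refine this.trans (Finset.card_image_le.trans (by simp))
    have h4 := Finset.card_filter_add_card_filter_not (s := (Finset.univ : Finset (Fin M)))
      (fun i => ((σ (Sum.inr i)).isRight : Prop))
    simp only [Finset.card_univ, Fintype.card_fin] at h4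
    rw [← hS] at h4
    omega
  calc _ ≤ 1 * ∏ i : Fin M, (if i ∈ S then ε else 1) := by
        refine mul_le_mul (Finset.prod_le_one (fun _ _ => norm_nonneg _) fun _ _ => hb _ _) ?_
          (Finset.prod_nonneg fun _ _ => norm_nonneg _) zero_le_one
        refine Finset.prod_le_prod (fun _ _ => norm_nonneg _) fun i _ => ?_
        split_ifs with h
        · simp only [hS, Finset.mem_filter, Finset.mem_univ, true_and] at h
          obtain ⟨y, hy⟩ := Sum.isRight_iff.mp h
          rw [hy]
          simpa using hE y i
        · exact hb _ _
    _ = ε ^ S.card := by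
        rw [one_mul, Finset.prod_ite_mem, Finset.univ_inter, Finset.prod_const]
    _ ≤ ε ^ (M - J) := pow_le_pow_of_le_one hε0 hε hcard

theorem hank_zero_of_approx {p : ℕ} [Fact p.Prime] [NormedAlgebra ℚ_[p] K]
    [IsUltrametricDist K] (c : ℕ → ℤ) (A B : ℝ) (hA : 0 ≤ A) (hB : 1 ≤ B)
    (hc : ∀ m, |(c m : ℝ)| ≤ A * B ^ m) (happ : Approx (fun m => (c m : K))) :
    ∃ M k0, ∀ k, k0 ≤ k → (hank (fun m => (c m : ℚ)) k M).det = 0 := by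
  -- replace B by B+1 to have B>1
  set B' := B + 1 with hB'
  have hB1 : 1 < B' := by linarith
  have hc' : ∀ m, |(c m : ℝ)| ≤ A * B' ^ m := fun m =>
    (hc m).trans (mul_le_mul_of_nonneg_left (pow_le_pow_left₀ (by linarith) (by linarith) _) hA)
  set θ := (B' ^ 4)⁻¹ with hθ
  have hθ0 : 0 < θ := by positivity
  have hθ1 : θ ≤ 1 := inv_le_one_of_one_le₀ (one_le_pow₀ hB1.le)
  obtain ⟨J, hJ⟩ := happ θ hθ0
  set M := 2 * J + 1 with hM
  set C : ℝ := (M.factorial : ℝ) * (A * B' ^ (2 * M)) ^ M with hC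
  obtain ⟨k0, hk0⟩ : ∃ k0 : ℕ, C < B' ^ k0 := pow_unbounded_of_one_lt C hB1
  refine ⟨M, k0 + 1, fun k hk => ?_⟩
  have hcast : (hank (fun m => (c m : ℚ)) k M).det = (((hank c k M).det : ℤ) : ℚ) := by
    rw [Int.cast_det]; rfl
  rw [hcast, Int.cast_eq_zero]
  by_contra hne
  have h1 := one_le_abs_mul_norm (p := p) (K := K) _ hne
  -- archimedean bound
  have h2 : |(((hank c k M).det : ℤ) : ℝ)| ≤ C * B' ^ (k * M) := by
    rw [Int.cast_det, Matrix.det_apply]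
    refine (Finset.abs_sum_le_sum_abs _ _).trans ?_
    have : ∀ σ ∈ (Finset.univ : Finset (Equiv.Perm (Fin M))),
        |Equiv.Perm.sign σ • ∏ i, ((hank c k M).map (fun x : ℤ => (x : ℝ))) (σ i) i| ≤
        (A * B' ^ (2 * M) * B' ^ k) ^ M := by
      intro σ _
      have : |Equiv.Perm.sign σ • ∏ i, ((hank c k M).map (fun x : ℤ => (x : ℝ))) (σ i) i| =
          |∏ i, ((hank c k M).map (fun x : ℤ => (x : ℝ))) (σ i) i| := by
        rcases Int.units_eq_one_or (Equiv.Perm.sign σ) with h | h <;> simp [h]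
      rw [this, Finset.abs_prod]
      have hpr : (A * B' ^ (2 * M) * B' ^ k) ^ M =
          ∏ _i : Fin M, (A * B' ^ (2 * M) * B' ^ k) := by simp
      rw [hpr]
      refine Finset.prod_le_prod (fun _ _ => abs_nonneg _) ?_
      intro i _
      simp only [Matrix.map_apply, hank, Matrix.of_apply]
      refine (hc' _).trans ?_
      rw [mul_assoc, ← pow_add]
      refine mul_le_mul_of_nonneg_left (pow_le_pow_right₀ hB1.le ?_) hA
      have := i.2; have := (σ i).2; omega
    refine (Finset.sum_le_card_nsmul _ _ _ this).trans ?_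
    rw [Finset.card_univ, Fintype.card_perm, Fintype.card_fin, nsmul_eq_mul, hC, mul_pow _ (B' ^ k),
      ← pow_mul]
    apply le_of_eq; ring
  -- p-adic bound
  have h3 : ‖(((hank c k M).det : ℤ) : K)‖ ≤ (θ ^ k) ^ (M - J) := by
    obtain ⟨b, β, hb, hβ, hbβ⟩ := hJ (k + 2 * M)
    set U : Matrix (Fin M) (Fin J) K := Matrix.of fun i l => b l * β l ^ (k + i) with hU
    set V : Matrix (Fin J) (Fin M) K := Matrix.of fun l j => β l ^ (j : ℕ) with hV
    set E : Matrix (Fin M) (Fin M) K :=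
      Matrix.of fun i j => (c (k + i + j) : K) - ∑ l, b l * β l ^ (k + i + j : ℕ) with hE
    have hUV : (hank c k M).map (fun x : ℤ => (x : K)) = E + U * V := by
      ext i j
      simp only [hank, Matrix.map_apply, Matrix.of_apply, Matrix.add_apply, hE, Matrix.mul_apply, hU,
        hV]
      rw [sub_add_eq_add_sub, eq_sub_iff_add_eq, add_right_inj]
      exact Finset.sum_congr rfl fun l _ => by rw [pow_add _ (k + i : ℕ)]; ring
    rw [Int.cast_det]
    rw [hUV]
    refine norm_det_lowrank_le U V E ?_ ?_ _ (by positivity) (pow_le_one₀ hθ0.le hθ1) ?_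
    · intro i l
      simp only [hU, Matrix.of_apply, norm_mul, norm_pow]
      exact mul_le_one₀ (hb l) (by positivity) (pow_le_one₀ (norm_nonneg _) (hβ l))
    · intro l j
      simp only [hV, Matrix.of_apply, norm_pow]
      exact pow_le_one₀ (norm_nonneg _) (hβ l)
    · intro i j
      refine (hbβ _ (by omega) (by have := i.2; have := j.2; omega)).trans ?_
      exact pow_le_pow_of_le_one hθ0.le hθ1 (by omega)
  have h4 : C * B' ^ (k * M) * (θ ^ k) ^ (M - J) < 1 := by
    have e1 : (θ ^ k) ^ (M - J) = (B' ^ (4 * (k * (J + 1))))⁻¹ := by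
      rw [hθ, ← pow_mul, inv_pow, ← pow_mul]; congr 2
      rw [hM, show 2 * J + 1 - J = J + 1 by omega]
    rw [e1, ← div_eq_mul_inv, div_lt_one (by positivity)]
    calc C * B' ^ (k * M) < B' ^ k * B' ^ (k * M) := by
          refine mul_lt_mul_of_pos_right (hk0.trans_le ?_) (by positivity)
          exact pow_le_pow_right₀ hB1.le (by omega)
      _ = B' ^ (k * (M + 1)) := by rw [← pow_add]; ring_nf
      _ ≤ _ := pow_le_pow_right₀ hB1.le (by rw [hM]; nlinarith)
  have h5 : |(((hank c k M).det : ℤ) : ℝ)| * ‖(((hank c k M).det : ℤ) : K)‖ ≤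
      C * B' ^ (k * M) * (θ ^ k) ^ (M - J) :=
    mul_le_mul h2 h3 (norm_nonneg _) (by positivity)
  linarith

theorem isRat_of_approx {p : ℕ} [Fact p.Prime] [NormedAlgebra ℚ_[p] K]
    [IsUltrametricDist K] (c : ℕ → ℤ) (A B : ℝ) (hA : 0 ≤ A) (hB : 1 ≤ B)
    (hc : ∀ m, |(c m : ℝ)| ≤ A * B ^ m) (happ : Approx (fun m => (c m : K))) :
    IsRat (fun m => (c m : ℚ)) := by
  obtain ⟨M, k0, h⟩ := hank_zero_of_approx (p := p) (K := K) c A B hA hB hc happ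
  exact isRat_of_hank _ M k0 h

end Borel

end PRat

namespace PRat

section Closure

variable {K : Type*} [NormedField K] [IsUltrametricDist K]

lemma Approx.zero : Approx (fun _ => (0 : K)) := by
  intro θ hθ
  refine ⟨0, fun N => ⟨fun _ => 0, fun _ => 0, by simp, by simp, fun m _ _ => ?_⟩⟩
  simp; positivity

lemma Approx.congr {c d : ℕ → K} (hc : Approx c) (h : ∀ m, 1 ≤ m → d m = c m) : Approx d := by
  intro θ hθ
  obtain ⟨J, hJ⟩ := hc θ hθ
  refine ⟨J, fun N => ?_⟩
  obtain ⟨b, β, hb, hβ, hh⟩ := hJ N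
  exact ⟨b, β, hb, hβ, fun m h1 h2 => by rw [h m h1]; exact hh m h1 h2⟩

lemma Approx.add {c d : ℕ → K} (hc : Approx c) (hd : Approx d) : Approx (fun m => c m + d m) := by
  intro θ hθ
  obtain ⟨J, hJ⟩ := hc θ hθ
  obtain ⟨J', hJ'⟩ := hd θ hθ
  refine ⟨J + J', fun N => ?_⟩
  obtain ⟨b, β, hb, hβ, hh⟩ := hJ N
  obtain ⟨b', β', hb', hβ', hh'⟩ := hJ' N
  refine ⟨Fin.append b b', Fin.append β β', ?_, ?_, ?_⟩
  · intro l; refine Fin.addCases (fun i => ?_) (fun i => ?_) l <;> simp [hb, hb']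
  · intro l; refine Fin.addCases (fun i => ?_) (fun i => ?_) l <;> simp [hβ, hβ']
  · intro m h1 h2
    rw [Fin.sum_univ_add]
    simp only [Fin.append_left, Fin.append_right]
    rw [add_sub_add_comm]
    exact (IsUltrametricDist.norm_add_le_max _ _).trans (max_le (hh m h1 h2) (hh' m h1 h2))

lemma Approx.mul_pow {c : ℕ → K} (hc : Approx c) (a u : K) (ha : ‖a‖ ≤ 1) (hu : ‖u‖ ≤ 1) :
    Approx (fun m => a * u ^ m * c m) := by
  intro θ hθ
  obtain ⟨J, hJ⟩ := hc θ hθ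
  refine ⟨J, fun N => ?_⟩
  obtain ⟨b, β, hb, hβ, hh⟩ := hJ N
  refine ⟨fun l => a * b l, fun l => u * β l, ?_, ?_, ?_⟩
  · intro l; rw [norm_mul]; exact mul_le_one₀ ha (norm_nonneg _) (hb l)
  · intro l; rw [norm_mul]; exact mul_le_one₀ hu (norm_nonneg _) (hβ l)
  · intro m h1 h2
    have : a * u ^ m * c m - ∑ l, a * b l * (u * β l) ^ m =
        a * u ^ m * (c m - ∑ l, b l * β l ^ m) := by
      rw [mul_sub, Finset.mul_sum]
      congr 1
      exact Finset.sum_congr rfl fun l _ => by rw [_root_.mul_pow]; ring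
    rw [this, norm_mul, norm_mul, norm_pow]
    have h3 : ‖a‖ * ‖u‖ ^ m ≤ 1 := mul_le_one₀ ha (by positivity) (pow_le_one₀ (norm_nonneg _) hu)
    calc _ ≤ 1 * ‖c m - ∑ l, b l * β l ^ m‖ := mul_le_mul_of_nonneg_right h3 (norm_nonneg _)
      _ ≤ _ := by rw [one_mul]; exact hh m h1 h2

lemma Approx.sum {ι : Type*} (s : Finset ι) (c : ι → ℕ → K) (hc : ∀ i ∈ s, Approx (c i)) :
    Approx (fun m => ∑ i ∈ s, c i m) := by
  classical
  induction s using Finset.induction_on with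
  | empty => simpa using Approx.zero
  | insert i s hi ih =>
    simp only [Finset.sum_insert hi]
    exact (hc i (by simp)).add (ih fun j hj => hc j (by simp [hj]))

lemma Approx.comp_mul {c : ℕ → K} (hc : Approx c) (e : ℕ) (he : 1 ≤ e) :
    Approx (fun m => c (e * m)) := by
  intro θ hθ
  obtain ⟨J, hJ⟩ := hc (min θ 1) (by positivity)
  refine ⟨J, fun N => ?_⟩
  obtain ⟨b, β, hb, hβ, hh⟩ := hJ (e * N)
  refine ⟨b, fun l => β l ^ e, hb, fun l => ?_, fun m h1 h2 => ?_⟩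
  · rw [norm_pow]; exact pow_le_one₀ (norm_nonneg _) (hβ l)
  · have := hh (e * m) (Nat.mul_pos he h1) (Nat.mul_le_mul_left _ h2)
    simp only [pow_mul] at this
    refine this.trans (pow_le_pow_left₀ (by positivity) ?_ m)
    refine (pow_le_of_le_one (by positivity) (min_le_right _ _) (by omega)).trans (min_le_left _ _)

/-- multiplying by `(u^m - 1)^i` -/
lemma Approx.mul_sub_one_pow {c : ℕ → K} (hc : Approx c) (u : K) (hu : ‖u‖ ≤ 1) (i : ℕ) :
    Approx (fun m => (u ^ m - 1) ^ i * c m) := by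
  induction i with
  | zero => simpa using hc
  | succ i ih =>
    have h1 := ih.mul_pow 1 u (by simp) hu
    have h2 := ih.mul_pow (-1) 1 (by simp) (by simp)
    refine (h1.add h2).congr fun m _ => ?_
    rw [one_pow]; ring

end Closure

section Eigen

open Matrix

variable {K : Type*} [Field K] [IsAlgClosed K] {S : Type*} [Fintype S] [DecidableEq S]

lemma det_aeval (A : Matrix S S K) (n : ℕ) : ∀ f : Polynomial K, f.natDegree ≤ n →
    (Polynomial.aeval A f).det = (A.charpoly.roots.map fun α => f.eval α).prod := by
  have hcard : A.charpoly.roots.card = Fintype.card S := by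
    rw [← Matrix.charpoly_natDegree_eq_dim A]
    exact (IsAlgClosed.splits _).natDegree_eq_card_roots.symm
  have hlin : ∀ β : K, (Polynomial.aeval A (Polynomial.X - Polynomial.C β)).det =
      (A.charpoly.roots.map fun α => (Polynomial.X - Polynomial.C β).eval α).prod := by
    intro β
    have h1 := Matrix.eval_charpoly A β
    have h2 := (IsAlgClosed.splits A.charpoly).eq_prod_roots_of_monic (Matrix.charpoly_monic A)
    rw [h2, Polynomial.eval_multiset_prod, Multiset.map_map] at h1
    have h3 : Polynomial.aeval A (Polynomial.X - Polynomial.C β) = -(Matrix.scalar S β - A) := by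
      simp [Matrix.scalar_apply, Matrix.algebraMap_eq_diagonal]
    rw [h3, Matrix.det_neg, ← h1, ← hcard]
    rw [← Multiset.prod_replicate, ← Multiset.map_const', ← Multiset.prod_map_mul]
    simp
  induction n with
  | zero =>
    intro f hf
    rw [Polynomial.eq_C_of_natDegree_le_zero hf]
    simp [Matrix.algebraMap_eq_diagonal, hcard]
  | succ n ih =>
    intro f hf
    by_cases hd : f.natDegree = 0
    · exact ih f (by omega)
    obtain ⟨β, hβ⟩ := IsAlgClosed.exists_root f (by
      intro h; exact hd (Polynomial.natDegree_eq_of_degree_eq_some h))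
    obtain ⟨g, rfl⟩ := Polynomial.dvd_iff_isRoot.mpr hβ
    have hg : g ≠ 0 := by rintro rfl; simp at hd
    rw [Polynomial.natDegree_mul (Polynomial.X_sub_C_ne_zero β) hg,
      Polynomial.natDegree_X_sub_C] at hf
    rw [map_mul, Matrix.det_mul, hlin, ih g (by omega), ← Multiset.prod_map_mul]
    simp only [Polynomial.eval_mul]

lemma roots_charpoly_pow (A : Matrix S S K) (m : ℕ) :
    (A ^ m).charpoly.roots = A.charpoly.roots.map (fun α => α ^ m) := by
  have h : (A ^ m).charpoly = ((A.charpoly.roots.map (fun α => α ^ m)).map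
      (fun a => Polynomial.X - Polynomial.C a)).prod := by
    apply Polynomial.funext
    intro x
    have h1 := det_aeval A _ (Polynomial.C x - Polynomial.X ^ m) le_rfl
    rw [Matrix.eval_charpoly, Polynomial.eval_multiset_prod, Multiset.map_map, Multiset.map_map]
    have e1 : (Matrix.scalar S) x - A ^ m =
        Polynomial.aeval A (Polynomial.C x - Polynomial.X ^ m) := by
      simp [Matrix.scalar_apply, Matrix.algebraMap_eq_diagonal]
    rw [e1, h1]
    congr 1
    refine Multiset.map_congr rfl fun α _ => ?_
    simp
  rw [h, Polynomial.roots_multiset_prod_X_sub_C]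

lemma trace_pow_eq (A : Matrix S S K) (m : ℕ) :
    (A ^ m).trace = (A.charpoly.roots.map (fun α => α ^ m)).sum := by
  rw [Matrix.trace_eq_sum_roots_charpoly, roots_charpoly_pow]

end Eigen

section Count

open Matrix

variable {p : ℕ} [Fact p.Prime] {K : Type*} [NormedField K] [NormedAlgebra ℚ_[p] K]
  [IsUltrametricDist K] [IsAlgClosed K]

lemma norm_eigen_le_one {S : Type*} [Fintype S] [DecidableEq S] {K : Type*} [NormedField K]
    [IsUltrametricDist K] (A : Matrix S S K) (hA : ∀ i j, ‖A i j‖ ≤ 1)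
    (α : K) (hα : α ∈ A.charpoly.roots) : ‖α‖ ≤ 1 := by
  have hr : A.charpoly.IsRoot α := (Polynomial.mem_roots'.mp hα).2
  rw [Polynomial.IsRoot, Matrix.eval_charpoly] at hr
  obtain ⟨x, hx0, hx⟩ := Matrix.exists_mulVec_eq_zero_iff.mpr hr
  have hne : Nonempty S := by
    by_contra h
    rw [not_nonempty_iff] at h
    exact hx0 (Subsingleton.elim _ _)
  obtain ⟨i, hi⟩ := Finite.exists_max (fun i => ‖x i‖)
  have hxi : 0 < ‖x i‖ := by
    rw [norm_pos_iff]
    intro h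
    apply hx0
    funext j
    have := hi j
    rw [h, norm_zero] at this
    exact norm_le_zero_iff.mp this
  have h1 : α * x i = ∑ j, A i j * x j := by
    have := congrFun hx i
    rw [Matrix.sub_mulVec, Pi.sub_apply, Pi.zero_apply, sub_eq_zero, Matrix.scalar_apply,
      Matrix.mulVec_diagonal] at this
    exact this
  have h2 : ‖α‖ * ‖x i‖ ≤ ‖x i‖ := by
    rw [← norm_mul, h1]
    refine IsUltrametricDist.norm_sum_le_of_forall_le_of_nonneg (by positivity) fun j _ => ?_
    rw [norm_mul]
    calc _ ≤ 1 * ‖x j‖ := mul_le_mul_of_nonneg_right (hA i j) (norm_nonneg _)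
      _ ≤ _ := by rw [one_mul]; exact hi j
  by_contra h
  push Not at h
  nlinarith

/-- existence of an element of generic norm -/
lemma exists_generic (p : ℕ) [Fact p.Prime] {K : Type*} [NormedField K] [NormedAlgebra ℚ_[p] K]
    [IsAlgClosed K] (k : ℕ) (F : Finset ℝ) : ∃ t : K, (p : ℝ) ^ k ≤ ‖t‖ ∧
    ‖t‖ ≤ (p : ℝ) ^ (k + 1) ∧ ‖t‖ ∉ F := by
  have hp1 : (1 : ℝ) < p := by exact_mod_cast (Fact.out : p.Prime).one_lt
  have hpn : ‖(p : K)‖ = (p : ℝ)⁻¹ := by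
    rw [← map_natCast (algebraMap ℚ_[p] K), norm_algebraMap', Padic.norm_p]
  have hx : ∀ n : ℕ, ∃ x : K, x ^ (n + 1) = (p : K) := fun n =>
    IsAlgClosed.exists_pow_nat_eq _ (Nat.succ_pos n)
  choose x hx using hx
  have hxn : ∀ n, ‖x n‖ ^ (n + 1) = (p : ℝ)⁻¹ := fun n => by rw [← norm_pow, hx, hpn]
  have hinv1 : (p : ℝ)⁻¹ < 1 := inv_lt_one_of_one_lt₀ hp1
  have hinv0 : 0 < (p : ℝ)⁻¹ := by positivity
  have hlt : ∀ n, ‖x n‖ < 1 := fun n => by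
    by_contra h
    push Not at h
    have := one_le_pow₀ h (n := n + 1)
    rw [hxn] at this
    linarith
  have hpos : ∀ n, 0 < ‖x n‖ := fun n => by
    rcases (norm_nonneg (x n)).lt_or_eq with h | h
    · exact h
    · have := hxn n
      rw [← h, zero_pow (by omega)] at this
      linarith
  have hge : ∀ n, (p : ℝ)⁻¹ ≤ ‖x n‖ := fun n => by
    rw [← hxn n]; exact pow_le_of_le_one (hpos n).le (hlt n).le (by omega)
  set t : ℕ → K := fun n => x n * ((p : K)⁻¹) ^ (k + 1) with ht
  have htn : ∀ n, ‖t n‖ = ‖x n‖ * (p : ℝ) ^ (k + 1) := fun n => by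
    rw [ht]; simp only [norm_mul, norm_pow, norm_inv, hpn, inv_inv]
  have hinj : Function.Injective fun n => ‖t n‖ := by
    have key : ∀ a b, a < b → ‖x a‖ ≠ ‖x b‖ := by
      intro a b hab h
      have h1 := hxn b
      rw [← h] at h1
      have h2 : ‖x a‖ ^ (b + 1) < ‖x a‖ ^ (a + 1) :=
        pow_lt_pow_right_of_lt_one₀ (hpos a) (hlt a) (by omega)
      rw [h1, hxn] at h2
      exact lt_irrefl _ h2
    intro a b hab
    simp only [htn] at hab
    have hab' := mul_right_cancel₀ (by positivity) hab
    rcases lt_trichotomy a b with h | h | h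
    · exact absurd hab' (key a b h)
    · exact h
    · exact absurd hab'.symm (key b a h)
  obtain ⟨n, hn⟩ : ∃ n, ‖t n‖ ∉ F := by
    by_contra h
    push Not at h
    exact (Set.infinite_range_of_injective hinj) (F.finite_toSet.subset (by
      rintro _ ⟨n, rfl⟩; exact h n))
  refine ⟨t n, ?_, ?_, hn⟩
  · rw [htn]
    calc (p : ℝ) ^ k = (p : ℝ)⁻¹ * p ^ (k + 1) := by rw [pow_succ]; field_simp
      _ ≤ _ := mul_le_mul_of_nonneg_right (hge n) (by positivity)
  · rw [htn]
    calc _ ≤ 1 * (p : ℝ) ^ (k + 1) := mul_le_mul_of_nonneg_right (hlt n).le (by positivity)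
      _ = _ := one_mul _

end Count

end PRat

namespace PRat

open Matrix

lemma two_pow_le_norm_prod {K : Type*} [NormedField K] [IsUltrametricDist K] (θ : ℝ) (t : K)
    (ht : 2 ≤ θ * ‖t‖) (s : Multiset K) (hs : ∀ α ∈ s, ‖t‖ ≠ ‖α‖⁻¹) :
    (2 : ℝ) ^ (s.filter (fun α => θ ≤ ‖α‖)).card ≤ ‖(s.map fun α => 1 - t * α).prod‖ := by
  induction s using Multiset.induction_on with
  | empty => simp
  | cons a s ih =>
    have ih' := ih fun α hα => hs α (Multiset.mem_cons_of_mem hα)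
    have ha : ‖1 - t * a‖ = max 1 ‖t * a‖ := by
      have hne : ‖(1 : K)‖ ≠ ‖t * a‖ := by
        rw [norm_one, norm_mul]
        intro h
        have h1 := hs a (Multiset.mem_cons_self a s)
        have ha0 : ‖a‖ ≠ 0 := by intro h0; rw [h0, mul_zero] at h; exact one_ne_zero h
        exact h1 (eq_inv_of_mul_eq_one_left h.symm)
      rw [sub_eq_add_neg]
      rw [IsUltrametricDist.norm_add_eq_max_of_norm_ne_norm (by rwa [norm_neg]), norm_neg, norm_one]
    rw [Multiset.map_cons, Multiset.prod_cons, norm_mul, ha]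
    by_cases h : θ ≤ ‖a‖
    · rw [Multiset.filter_cons_of_pos (p := fun α : K => θ ≤ ‖α‖) s h, Multiset.card_cons, pow_succ']
      refine mul_le_mul ?_ ih' (by positivity) (by positivity)
      refine le_trans ?_ (le_max_right _ _)
      rw [norm_mul, mul_comm]
      exact ht.trans (mul_le_mul_of_nonneg_right h (norm_nonneg _))
    · rw [Multiset.filter_cons_of_neg (p := fun α : K => θ ≤ ‖α‖) s h]
      calc _ ≤ _ := ih'
        _ = 1 * _ := (one_mul _).symm
        _ ≤ _ := mul_le_mul_of_nonneg_right (le_max_left _ _) (norm_nonneg _)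

lemma norm_det_one_sub_le {K : Type*} [NormedField K] [IsUltrametricDist K]
    {S : Type*} [Fintype S] [DecidableEq S] (w : S → ℕ) (η : ℝ) (h0 : 0 < η)
    (Ψ : Matrix S S K) (hΨ : ∀ i j, ‖Ψ i j‖ * η ^ w j ≤ η ^ (2 * w i)) (t : K) (R : ℝ)
    (ht : ‖t‖ ≤ R) : ‖(1 - t • Ψ).det‖ ≤ ∏ v, max 1 (R * η ^ w v) := by
  rw [Matrix.det_apply]
  have hR : 0 ≤ R := (norm_nonneg t).trans ht
  refine IsUltrametricDist.norm_sum_le_of_forall_le_of_nonneg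
    (Finset.prod_nonneg fun _ _ => by positivity) ?_
  intro σ _
  have : ‖Equiv.Perm.sign σ • ∏ i, (1 - t • Ψ) (σ i) i‖ = ‖∏ i, (1 - t • Ψ) (σ i) i‖ := by
    rcases Int.units_eq_one_or (Equiv.Perm.sign σ) with h | h <;> simp [h]
  rw [this, norm_prod]
  have key : ∀ i, ‖(1 - t • Ψ) (σ i) i‖ * η ^ w i ≤ max 1 (R * η ^ w (σ i)) * η ^ w (σ i) := by
    intro i
    have hb : ‖t‖ * ‖Ψ (σ i) i‖ * η ^ w i ≤ (R * η ^ w (σ i)) * η ^ w (σ i) := by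
      calc _ = ‖t‖ * (‖Ψ (σ i) i‖ * η ^ w i) := by ring
        _ ≤ R * η ^ (2 * w (σ i)) := mul_le_mul ht (hΨ _ _) (by positivity) hR
        _ = _ := by rw [two_mul, pow_add]; ring
    by_cases h : σ i = i
    · rw [h] at hb ⊢
      refine mul_le_mul_of_nonneg_right ?_ (by positivity)
      have hb' := le_of_mul_le_mul_right hb (by positivity)
      rw [Matrix.sub_apply, Matrix.one_apply_eq, Matrix.smul_apply, smul_eq_mul, sub_eq_add_neg]
      refine (IsUltrametricDist.norm_add_le_max _ _).trans ?_
      rw [norm_neg, norm_one, norm_mul]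
      exact max_le_max le_rfl hb'
    · rw [Matrix.sub_apply, Matrix.one_apply_ne h, zero_sub, norm_neg, Matrix.smul_apply,
        smul_eq_mul, norm_mul]
      exact hb.trans (mul_le_mul_of_nonneg_right (le_max_right _ _) (by positivity))
  have h2 : (∏ i, ‖(1 - t • Ψ) (σ i) i‖) * ∏ i, η ^ w i ≤
      (∏ i, max 1 (R * η ^ w i)) * ∏ i, η ^ w i := by
    rw [← Equiv.prod_comp σ (fun i => max 1 (R * η ^ w i))]
    conv_rhs => rw [← Equiv.prod_comp σ (fun i => η ^ w i)]
    rw [← Finset.prod_mul_distrib, ← Finset.prod_mul_distrib]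
    exact Finset.prod_le_prod (fun _ _ => by positivity) fun i _ => key i
  exact le_of_mul_le_mul_right h2 (Finset.prod_pos fun _ _ => by positivity)

theorem exists_eigen_count (p : ℕ) [Fact p.Prime] (K : Type) [NormedField K]
    [NormedAlgebra ℚ_[p] K] [IsUltrametricDist K] [IsAlgClosed K] (η : ℝ) (h0 : 0 < η) (h1 : η < 1)
    (g : ℕ → ℕ) (θ : ℝ) (hθ : 0 < θ) : ∃ J : ℕ, ∀ (S : Type) [Fintype S] [DecidableEq S]
    (w : S → ℕ) (_ : ∀ n, (Finset.univ.filter fun v => w v ≤ n).card ≤ g n) (Ψ : Matrix S S K)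
    (_ : ∀ i j, ‖Ψ i j‖ * η ^ w j ≤ η ^ (2 * w i)),
    (Ψ.charpoly.roots.filter (fun α => θ ≤ ‖α‖)).card ≤ J := by
  have hp1 : (1 : ℝ) < p := by exact_mod_cast (Fact.out : p.Prime).one_lt
  obtain ⟨k, hk⟩ := pow_unbounded_of_one_lt (2 / θ) hp1
  set R : ℝ := (p : ℝ) ^ (k + 1) with hR
  have hR1 : 1 ≤ R := one_le_pow₀ hp1.le
  obtain ⟨n0, hn0⟩ := exists_pow_lt_of_lt_one (show 0 < R⁻¹ by positivity) h1
  obtain ⟨J, hJ⟩ := pow_unbounded_of_one_lt (R ^ g n0) (one_lt_two)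
  refine ⟨J, ?_⟩
  intro S _ _ w hw Ψ hΨ
  obtain ⟨t, ht1, ht2, ht3⟩ := exists_generic p (K := K) k
    (Ψ.charpoly.roots.map fun α => ‖α‖⁻¹).toFinset
  have hprod : (1 - t • Ψ).det = (Ψ.charpoly.roots.map fun α => 1 - t * α).prod := by
    have := det_aeval Ψ _ (1 - Polynomial.C t * Polynomial.X) le_rfl
    simp only [map_sub, map_one, map_mul, Polynomial.aeval_C, Polynomial.aeval_X,
      Polynomial.eval_sub, Polynomial.eval_one, Polynomial.eval_mul, Polynomial.eval_C,
      Polynomial.eval_X] at this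
    rw [← this, Algebra.smul_def]
  have hlow := two_pow_le_norm_prod θ t (by
      rw [div_lt_iff₀ hθ] at hk
      calc (2 : ℝ) ≤ (p : ℝ) ^ k * θ := hk.le
        _ ≤ ‖t‖ * θ := mul_le_mul_of_nonneg_right ht1 hθ.le
        _ = _ := mul_comm _ _) Ψ.charpoly.roots (by
      intro α hα h
      apply ht3
      rw [Multiset.mem_toFinset, Multiset.mem_map]
      exact ⟨α, hα, h.symm⟩)
  rw [← hprod] at hlow
  have hup := norm_det_one_sub_le w η h0 Ψ hΨ t R ht2
  have hup2 : ∏ v, max 1 (R * η ^ w v) ≤ R ^ g n0 := by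
    calc ∏ v, max 1 (R * η ^ w v) ≤ ∏ v, (if w v ≤ n0 then R else 1) := by
          refine Finset.prod_le_prod (fun _ _ => by positivity) fun v _ => ?_
          split_ifs with h
          · refine max_le hR1 ?_
            calc _ ≤ R * 1 := mul_le_mul_of_nonneg_left (pow_le_one₀ h0.le h1.le) (by positivity)
              _ = R := mul_one R
          · refine max_le le_rfl ?_
            have : η ^ w v ≤ η ^ n0 := pow_le_pow_of_le_one h0.le h1.le (by omega)
            calc R * η ^ w v ≤ R * R⁻¹ :=
                  mul_le_mul_of_nonneg_left (this.trans hn0.le) (by positivity)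
              _ = 1 := mul_inv_cancel₀ (by positivity)
      _ = R ^ (Finset.univ.filter fun v => w v ≤ n0).card := by
          rw [Finset.prod_ite]; simp
      _ ≤ _ := pow_le_pow_right₀ hR1 (hw n0)
  have : (2 : ℝ) ^ (Ψ.charpoly.roots.filter (fun α => θ ≤ ‖α‖)).card < 2 ^ J :=
    (hlow.trans (hup.trans hup2)).trans_lt hJ
  exact ((pow_lt_pow_iff_right₀ one_lt_two).mp this).le

lemma exists_fin_list {K : Type*} [Field K] (l : List K) : ∀ J, l.length ≤ J →
    ∃ β : Fin J → K, (∀ i, β i ∈ l ∨ β i = 0) ∧ ∀ m, 1 ≤ m →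
      ∑ i, β i ^ m = (l.map fun α => α ^ m).sum := by
  induction l with
  | nil =>
    intro J _
    refine ⟨fun _ => 0, by simp, fun m hm => ?_⟩
    simp [zero_pow (show m ≠ 0 by omega)]
  | cons a l ih =>
    intro J hJ
    obtain ⟨J, rfl⟩ : ∃ J', J = J' + 1 := ⟨J - 1, by simp at hJ; omega⟩
    obtain ⟨β, h1, h2⟩ := ih J (by simpa using hJ)
    refine ⟨Fin.cons a β, ?_, ?_⟩
    · intro i
      refine Fin.cases ?_ (fun i => ?_) i
      · simp
      · rcases h1 i with h | h
        · left; simp [h]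
        · right; simp [h]
    · intro m hm
      rw [Fin.sum_univ_succ]
      simp [h2 m hm]

theorem approx_of_matrices (p : ℕ) [Fact p.Prime] (K : Type) [NormedField K]
    [NormedAlgebra ℚ_[p] K] [IsUltrametricDist K] [IsAlgClosed K] (η : ℝ) (h0 : 0 < η) (h1 : η < 1)
    (g : ℕ → ℕ) (ρ : ℝ) (hρ1 : ρ < 1) (c : ℕ → K)
    (H : ∀ D : ℕ, ∃ (S : Type) (_ : Fintype S) (_ : DecidableEq S) (w : S → ℕ) (Ψ : Matrix S S K),
      (∀ n, (Finset.univ.filter fun v => w v ≤ n).card ≤ g n) ∧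
      (∀ i j, ‖Ψ i j‖ * η ^ w j ≤ η ^ (2 * w i)) ∧ (∀ i j, ‖Ψ i j‖ ≤ 1) ∧
      ∀ m, 1 ≤ m → ‖c m - (Ψ ^ m).trace‖ ≤ ρ ^ D) : Approx c := by
  intro θ hθ
  obtain ⟨J, hJ⟩ := exists_eigen_count p K η h0 h1 g θ hθ
  refine ⟨J, fun N => ?_⟩
  obtain ⟨D, hD⟩ := exists_pow_lt_of_lt_one (show 0 < (min θ 1) ^ N by positivity) hρ1
  obtain ⟨S, _, _, w, Ψ, hw, hΨ, hΨ1, hc⟩ := H D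
  have hcard := hJ S w hw Ψ hΨ
  set s := Ψ.charpoly.roots.filter (fun α => θ ≤ ‖α‖) with hs
  obtain ⟨β, hβ1, hβ2⟩ := exists_fin_list s.toList J (by simpa using hcard)
  refine ⟨fun _ => 1, β, by simp, ?_, ?_⟩
  · intro l
    rcases hβ1 l with h | h
    · rw [Multiset.mem_toList] at h
      exact norm_eigen_le_one Ψ hΨ1 _ (Multiset.mem_of_mem_filter h)
    · simp [h]
  · intro m hm1 hm2
    simp only [one_mul]
    rw [hβ2 m hm1]
    have e1 : (s.toList.map fun α => α ^ m).sum = (s.map fun α => α ^ m).sum := by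
      rw [← Multiset.sum_coe, ← Multiset.map_coe, Multiset.coe_toList]
    have e2 : (Ψ ^ m).trace = (s.map fun α => α ^ m).sum +
        ((Ψ.charpoly.roots.filter (fun α => ¬ θ ≤ ‖α‖)).map fun α => α ^ m).sum := by
      rw [trace_pow_eq, ← Multiset.sum_add, ← Multiset.map_add, hs, Multiset.filter_add_not]
    have e3 : ∀ u : Multiset K, (∀ α ∈ u, ‖α‖ ≤ θ) → ‖(u.map fun α => α ^ m).sum‖ ≤ θ ^ m := by
      intro u
      induction u using Multiset.induction_on with
      | empty => intro _; simp; positivity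
      | cons a u ih =>
        intro h
        rw [Multiset.map_cons, Multiset.sum_cons]
        refine (IsUltrametricDist.norm_add_le_max _ _).trans (max_le ?_ ?_)
        · rw [norm_pow]; exact pow_le_pow_left₀ (norm_nonneg _) (h a (by simp)) m
        · exact ih fun α hα => h α (by simp [hα])
    rw [e1]
    have e4 : c m - (s.map fun α => α ^ m).sum = (c m - (Ψ ^ m).trace) +
        ((Ψ.charpoly.roots.filter (fun α => ¬ θ ≤ ‖α‖)).map fun α => α ^ m).sum := by
      rw [e2]; ring
    rw [e4]
    refine (IsUltrametricDist.norm_add_le_max _ _).trans (max_le ?_ ?_)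
    · refine (hc m hm1).trans (hD.le.trans ?_)
      calc (min θ 1) ^ N ≤ (min θ 1) ^ m :=
            pow_le_pow_of_le_one (by positivity) (min_le_right _ _) hm2
        _ ≤ θ ^ m := pow_le_pow_left₀ (by positivity) (min_le_left _ _) m
    · refine e3 _ fun α hα => ?_
      exact (not_le.mp (Multiset.mem_filter.mp hα).2).le

end PRat

namespace PRat

open MvPolynomial

section Trace

variable {K : Type*} [Field K] {N : ℕ}

/-- box of exponents -/
noncomputable def box (N B : ℕ) : Finset (Fin N →₀ ℕ) :=
  Finset.Iic (Finsupp.equivFunOnFinite.symm fun _ => B)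

lemma mem_box {N B : ℕ} {v : Fin N →₀ ℕ} : v ∈ box N B ↔ ∀ i, v i ≤ B := by
  simp [box, Finsupp.le_def]

lemma coeff_mul_expand (p : ℕ) (hp : p ≠ 0) (s : Finset (Fin N →₀ ℕ)) (G F : MvPolynomial (Fin N) K)
    (hG : ∀ v, p • v ∈ G.support → v ∈ s) (u : Fin N →₀ ℕ) :
    coeff (p • u) (G * expand p F) =
      ∑ v ∈ s, coeff (p • v) G * coeff u (F * monomial v 1) := by
  classical
  have hinj : ∀ a b : Fin N →₀ ℕ, p • a = p • b → a = b := by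
    intro a b h; ext i
    have := DFunLike.congr_fun h i
    simpa [hp] using this
  induction F using MvPolynomial.induction_on' with
  | add f g hf hg =>
    rw [map_add, mul_add, coeff_add, hf, hg, ← Finset.sum_add_distrib]
    refine Finset.sum_congr rfl fun v _ => ?_
    rw [add_mul, coeff_add]; ring
  | monomial b β =>
    rw [expand_monomial, coeff_mul_monomial']
    simp only [monomial_mul, coeff_monomial, mul_one]
    by_cases hle : b ≤ u
    · have hle' : p • b ≤ p • u := by
        intro i; simpa using Nat.mul_le_mul_left p (hle i)
      rw [if_pos hle']
      have hsub : p • u - p • b = p • (u - b) := by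
        ext i; simp [Nat.mul_sub]
      rw [hsub]
      have hrew : ∀ v ∈ s, coeff (p • v) G * (if b + v = u then β else 0) =
          if v = u - b then coeff (p • (u - b)) G * β else 0 := by
        intro v _
        by_cases h : v = u - b
        · rw [if_pos h, if_pos (by rw [h]; exact add_tsub_cancel_of_le hle), h]
        · rw [if_neg h, if_neg, mul_zero]
          rintro rfl
          exact h (by simp)
      rw [Finset.sum_congr rfl hrew, Finset.sum_ite_eq']
      split_ifs with h
      · rfl
      · have : coeff (p • (u - b)) G = 0 := by
          by_contra hne
          exact h (hG _ (mem_support_iff.mpr hne))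
        rw [this, zero_mul]
    · rw [if_neg, Finset.sum_eq_zero]
      · intro v _
        rw [if_neg, mul_zero]
        rintro rfl
        exact hle (by simp)
      · intro h
        apply hle
        intro i
        have := h i
        simp only [Finsupp.smul_apply, smul_eq_mul] at this
        exact Nat.le_of_mul_le_mul_left this (Nat.pos_of_ne_zero hp)

/-- the iterated product `H(w) H(w^p) ... H(w^(p^(m-1)))` -/
noncomputable def iterProd (p : ℕ) (H : MvPolynomial (Fin N) K) : ℕ → MvPolynomial (Fin N) K
  | 0 => 1
  | m + 1 => H * expand p (iterProd p H m)

lemma eval_iterProd (p : ℕ) (H : MvPolynomial (Fin N) K) (m : ℕ) : ∀ w : Fin N → K,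
    eval w (iterProd p H m) = ∏ i ∈ Finset.range m, eval (fun j => w j ^ p ^ i) H := by
  induction m with
  | zero => intro w; simp [iterProd]
  | succ m ih =>
    intro w
    rw [iterProd, map_mul, Finset.prod_range_succ']
    rw [eval_expand, ih (w ^ p), mul_comm]
    congr 1
    · refine Finset.prod_congr rfl fun i _ => ?_
      congr 2; funext j
      simp only [Pi.pow_apply]
      rw [← pow_mul, pow_succ']
    · simp

lemma support_iterProd (p : ℕ) (hp : 2 ≤ p) (H : MvPolynomial (Fin N) K) (B : ℕ)
    (hB : ∀ a ∈ H.support, ∀ i, a i ≤ B * (p - 1)) (m : ℕ) :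
    ∀ a ∈ (iterProd p H m).support, ∀ i, a i ≤ B * (p ^ m - 1) := by
  classical
  induction m with
  | zero =>
    intro a ha i
    simp only [iterProd] at ha
    have : a = 0 := by simpa [MvPolynomial.coeff_one, eq_comm] using ha
    simp [this]
  | succ m ih =>
    intro a ha i
    rw [iterProd] at ha
    have h1 := support_mul _ _ ha
    obtain ⟨b, hb, c, hc, rfl⟩ := Finset.mem_add.mp h1
    have h2 : ∃ d ∈ (iterProd p H m).support, c = p • d := by
      have := support_expand_subset (p := p) (iterProd p H m) hc
      obtain ⟨d, hd, rfl⟩ := Finset.mem_image.mp this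
      exact ⟨d, hd, rfl⟩
    obtain ⟨d, hd, rfl⟩ := h2
    have h3 := hB b hb i
    have h4 := ih d hd i
    simp only [Finsupp.add_apply, Finsupp.smul_apply, smul_eq_mul]
    have h5 : 1 ≤ p ^ m := Nat.one_le_pow _ _ (by omega)
    calc b i + p * d i ≤ B * (p - 1) + p * (B * (p ^ m - 1)) := by gcongr
      _ = B * (p ^ (m + 1) - 1) := by
        zify [h5, (show 1 ≤ p by omega), Nat.one_le_pow (m + 1) p (by omega)]; ring

/-- the Dwork matrix -/
noncomputable def dworkMat (p : ℕ) (H : MvPolynomial (Fin N) K) (B : ℕ) :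
    Matrix (box N B) (box N B) K :=
  Matrix.of fun v v' => coeff (p • v.1) (H * monomial v'.1 1)

lemma dworkMat_pow (p : ℕ) (hp : 2 ≤ p) (H : MvPolynomial (Fin N) K) (B : ℕ)
    (hB : ∀ a ∈ H.support, ∀ i, a i ≤ B * (p - 1)) (m : ℕ) : ∀ v v' : box N B,
    (dworkMat p H B ^ m) v v' = coeff (p ^ m • v.1) (iterProd p H m * monomial v'.1 1) := by
  classical
  induction m with
  | zero =>
    intro v v'
    simp only [pow_zero, iterProd, one_mul, one_smul, coeff_monomial, Matrix.one_apply,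
      Subtype.ext_iff, eq_comm]
  | succ m ih =>
    intro v v'
    rw [pow_succ, Matrix.mul_apply, iterProd, pow_succ', mul_smul]
    have e : H * expand p (iterProd p H m) * monomial v'.1 1 =
        (H * monomial v'.1 1) * expand p (iterProd p H m) := by ring
    rw [e, coeff_mul_expand p (by omega) (box N B)]
    · rw [← Finset.sum_coe_sort (box N B) (fun x => coeff (p • x) (H * monomial v'.1 1) *
        coeff (p ^ m • v.1) (iterProd p H m * monomial x 1))]
      refine Finset.sum_congr rfl fun x _ => ?_
      rw [ih, mul_comm]; rfl
    · intro x hx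
      rw [mem_box]
      intro i
      have h1 := support_mul _ _ hx
      obtain ⟨b, hb, c, hc, hbc⟩ := Finset.mem_add.mp h1
      have hc' : c = v'.1 := by
        have := support_monomial_subset hc
        simpa using this
      have h2 := hB b hb i
      have h3 := mem_box.mp v'.2 i
      have h4 := DFunLike.congr_fun hbc i
      simp only [Finsupp.add_apply, Finsupp.smul_apply, smul_eq_mul, hc'] at h4
      have h5 : p * x i ≤ p * B := by
        rw [← h4]
        calc b i + v'.1 i ≤ B * (p - 1) + B := by gcongr
          _ = p * B := by zify [(show 1 ≤ p by omega)]; ring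
      exact Nat.le_of_mul_le_mul_left h5 (by omega)

lemma sum_eval_torus (q : ℕ) (T : Finset K)
    (hT : ∀ n : ℕ, ∑ τ ∈ T, τ ^ n = if q ∣ n then (q : K) else 0) (P : MvPolynomial (Fin N) K) :
    ∑ w ∈ Fintype.piFinset (fun _ : Fin N => T), eval w P =
      (q : K) ^ N * ∑ u ∈ P.support with ∀ i, q ∣ u i, coeff u P := by
  classical
  simp only [eval_eq']
  rw [Finset.sum_comm, Finset.sum_filter, Finset.mul_sum]
  refine Finset.sum_congr rfl fun u _ => ?_
  rw [← Finset.mul_sum]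
  rw [← Finset.prod_univ_sum (t := fun _ : Fin N => T) (f := fun i τ => τ ^ u i)]
  simp only [hT]
  split_ifs with h
  · simp only [h, if_true, Finset.prod_const, Finset.card_univ, Fintype.card_fin]; ring
  · push Not at h
    obtain ⟨i, hi⟩ := h
    rw [Finset.prod_eq_zero (Finset.mem_univ i) (by simp [hi])]; simp

theorem trace_formula (p : ℕ) (hp : 2 ≤ p) (H : MvPolynomial (Fin N) K) (B : ℕ)
    (hB : ∀ a ∈ H.support, ∀ i, a i ≤ B * (p - 1)) (m : ℕ) (hm : 1 ≤ m) (T : Finset K)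
    (hT : ∀ n : ℕ, ∑ τ ∈ T, τ ^ n = if (p ^ m - 1) ∣ n then ((p ^ m - 1 : ℕ) : K) else 0) :
    ∑ w ∈ Fintype.piFinset (fun _ : Fin N => T),
      ∏ i ∈ Finset.range m, eval (fun j => w j ^ p ^ i) H =
    ((p ^ m - 1 : ℕ) : K) ^ N * (dworkMat p H B ^ m).trace := by
  classical
  simp only [← eval_iterProd]
  rw [sum_eval_torus _ T hT]
  congr 1
  set q := p ^ m - 1 with hq
  have hq1 : p ^ m = q + 1 := by
    have := Nat.one_le_pow m p (by omega); omega
  have hq0 : 0 < q := by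
    have : 2 ^ 1 ≤ p ^ m := (Nat.pow_le_pow_left hp 1).trans (Nat.pow_le_pow_right (by omega) hm)
    omega
  have hdiag : ∀ v : box N B, (dworkMat p H B ^ m) v v = coeff (q • v.1) (iterProd p H m) := by
    intro v
    rw [dworkMat_pow p hp H B hB, hq1, add_smul, one_smul, coeff_mul_monomial, mul_one]
  simp only [Matrix.trace, Matrix.diag_apply, hdiag]
  rw [Finset.sum_coe_sort (box N B) (fun v => coeff (q • v) (iterProd p H m))]
  have hinj : Set.InjOn (fun v : Fin N →₀ ℕ => q • v) (box N B) := by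
    intro a _ b _ h
    ext i
    have := DFunLike.congr_fun h i
    simpa [hq0.ne'] using this
  rw [← Finset.sum_image (f := fun u => coeff u (iterProd p H m)) hinj]
  apply Finset.sum_subset_zero_on_sdiff
  · intro u hu
    rw [Finset.mem_filter] at hu
    choose v hv using hu.2
    rw [Finset.mem_image]
    refine ⟨Finsupp.equivFunOnFinite.symm v, ?_, ?_⟩
    · rw [mem_box]
      intro i
      have := support_iterProd p hp H B hB m u hu.1 i
      rw [hv i, ← hq, mul_comm] at this
      exact Nat.le_of_mul_le_mul_right this hq0
    · ext i; simp [hv i]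
  · intro u hu
    rw [Finset.mem_sdiff, Finset.mem_image] at hu
    obtain ⟨⟨v, _, rfl⟩, h2⟩ := hu
    by_contra hne
    apply h2
    rw [Finset.mem_filter]
    exact ⟨mem_support_iff.mpr hne, fun i => by simp⟩
  · intro _ _; rfl

end Trace

end PRat

namespace PRat

open PowerSeries in
/-- Euler operator `X d/dX`. -/
noncomputable def Dt (k : Type*) [CommRing k] : Derivation k (PowerSeries k) (PowerSeries k) :=
  (PowerSeries.X : PowerSeries k) • PowerSeries.derivative k

lemma coeff_Dt {k : Type*} [CommRing k] (f : PowerSeries k) (n : ℕ) :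
    PowerSeries.coeff n (Dt k f) = n * PowerSeries.coeff n f := by
  rw [Dt, Derivation.smul_apply, smul_eq_mul]
  cases n with
  | zero => simp
  | succ n =>
    rw [PowerSeries.coeff_succ_X_mul, PowerSeries.coeff_derivative]
    push_cast; ring

open Classical in
/-- `∑ X^(p^j)`. -/
noncomputable def Lp (p : ℕ) (k : Type*) [CommRing k] : PowerSeries k :=
  PowerSeries.mk fun n => if ∃ j, n = p ^ j then 1 else 0

lemma coeff_Lp_zero (p : ℕ) (hp : p ≠ 0) (k : Type*) [CommRing k] :
    PowerSeries.coeff 0 (Lp p k) = 0 := by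
  rw [Lp, PowerSeries.coeff_mk, if_neg]
  rintro ⟨j, hj⟩
  exact pow_ne_zero j hp hj.symm

/-- coefficients of the Artin-Hasse series -/
noncomputable def ahCoeff (p : ℕ) (k : Type*) [Field k] : ℕ → k
  | 0 => 1
  | n + 1 => ((n + 1 : ℕ) : k)⁻¹ *
      ∑ i : Fin (n + 1), PowerSeries.coeff (n + 1 - i) (Lp p k) * ahCoeff p k i

noncomputable def AH (p : ℕ) (k : Type*) [Field k] : PowerSeries k := PowerSeries.mk (ahCoeff p k)

/-- key recursion -/
lemma coeff_Lp_mul {k : Type*} [CommRing k] (p : ℕ) (hp : p ≠ 0) (P : PowerSeries k) (n : ℕ) :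
    PowerSeries.coeff (n + 1) (Lp p k * P) =
      ∑ i ∈ Finset.range (n + 1),
        PowerSeries.coeff (n + 1 - i) (Lp p k) * PowerSeries.coeff i P := by
  rw [mul_comm, PowerSeries.coeff_mul, Finset.Nat.sum_antidiagonal_eq_sum_range_succ_mk,
    Finset.sum_range_succ]
  simp only [le_refl, tsub_self, coeff_Lp_zero p hp, mul_zero, add_zero]
  exact Finset.sum_congr rfl fun i _ => mul_comm _ _

lemma Dt_AH (p : ℕ) (hp : p ≠ 0) (k : Type*) [Field k] [CharZero k] :
    Dt k (AH p k) = Lp p k * AH p k := by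
  ext n
  rw [coeff_Dt]
  cases n with
  | zero => simp [PowerSeries.coeff_mul, coeff_Lp_zero p hp]
  | succ n =>
    rw [coeff_Lp_mul p hp, AH, PowerSeries.coeff_mk, ahCoeff,
      mul_inv_cancel_left₀ (by exact_mod_cast n.succ_ne_zero), Fin.sum_univ_eq_sum_range
        (fun i => PowerSeries.coeff (n + 1 - i) (Lp p k) * ahCoeff p k i)]
    simp

/-- coefficients of solutions of `Dt P = s L P` are fixed polynomials in `s`. -/
lemma exists_poly_coeff {k : Type*} [Field k] [CharZero k] (p : ℕ) (hp : p ≠ 0) (n : ℕ) :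
    ∃ f : Polynomial k, ∀ (s : k) (P : PowerSeries k), PowerSeries.coeff 0 P = 1 →
      Dt k P = PowerSeries.C s * (Lp p k * P) → PowerSeries.coeff n P = f.eval s := by
  induction n using Nat.strong_induction_on with
  | _ n ih =>
    cases n with
    | zero => exact ⟨1, fun s P h _ => by simpa using h⟩
    | succ n =>
      choose f hf using ih
      refine ⟨Polynomial.C ((n + 1 : ℕ) : k)⁻¹ * Polynomial.X * ∑ i : Fin (n + 1),
        Polynomial.C (PowerSeries.coeff (n + 1 - i) (Lp p k)) * f i i.2, fun s P h0 h => ?_⟩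
      have h1 := congrArg (PowerSeries.coeff (n + 1)) h
      rw [coeff_Dt, PowerSeries.coeff_C_mul, coeff_Lp_mul p hp] at h1
      have hn : ((n + 1 : ℕ) : k) ≠ 0 := by exact_mod_cast n.succ_ne_zero
      rw [← mul_right_inj' hn, h1]
      simp only [Polynomial.eval_mul, Polynomial.eval_C, Polynomial.eval_X,
        Polynomial.eval_finsetSum]
      rw [mul_assoc _ s, mul_inv_cancel_left₀ hn, ← Fin.sum_univ_eq_sum_range
        (fun i => PowerSeries.coeff (n + 1 - i) (Lp p k) * PowerSeries.coeff i P)]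
      congr 1
      exact Finset.sum_congr rfl fun i _ => by rw [hf i i.2 s P h0 h]

lemma ode_unique {k : Type*} [Field k] [CharZero k] (p : ℕ) (hp : p ≠ 0) (s : k)
    (P P' : PowerSeries k) (h0 : PowerSeries.coeff 0 P = 1) (h0' : PowerSeries.coeff 0 P' = 1)
    (h : Dt k P = PowerSeries.C s * (Lp p k * P))
    (h' : Dt k P' = PowerSeries.C s * (Lp p k * P')) : P = P' := by
  ext n
  obtain ⟨f, hf⟩ := exists_poly_coeff (k := k) p hp n
  rw [hf s P h0 h, hf s P' h0' h']

lemma Dt_pow {k : Type*} [CommRing k] (P M : PowerSeries k) (h : Dt k P = M * P) (n : ℕ) :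
    Dt k (P ^ n) = (n : PowerSeries k) * M * P ^ n := by
  rw [Derivation.leibniz_pow, h]
  cases n with
  | zero => simp
  | succ n => simp only [smul_eq_mul, nsmul_eq_mul, Nat.add_sub_cancel]; ring

lemma Dt_expand {k : Type*} [CommRing k] (p : ℕ) (hp : p ≠ 0) (P : PowerSeries k) :
    Dt k (PowerSeries.expand p hp P) = (p : PowerSeries k) * PowerSeries.expand p hp (Dt k P) := by
  ext n
  rw [coeff_Dt, ← map_natCast (PowerSeries.C (R := k)), PowerSeries.coeff_C_mul,
    PowerSeries.coeff_expand, PowerSeries.coeff_expand]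
  split_ifs with h
  · obtain ⟨m, rfl⟩ := h
    rw [Nat.mul_div_cancel_left _ (Nat.pos_of_ne_zero hp), coeff_Dt]
    push_cast; ring
  · simp

lemma Lp_eq {k : Type*} [CommRing k] (p : ℕ) (hp : 2 ≤ p) :
    Lp p k = PowerSeries.expand p (by omega) (Lp p k) + PowerSeries.X := by
  ext n
  rw [map_add, PowerSeries.coeff_expand, PowerSeries.coeff_X]
  simp only [Lp, PowerSeries.coeff_mk]
  by_cases h1 : n = 1
  · subst h1
    have : ¬ p ∣ 1 := by
      intro h; have := Nat.le_of_dvd one_pos h; omega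
    simp only [this, if_false, if_true]
    rw [if_pos ⟨0, by simp⟩]; simp
  · simp only [h1, if_false, add_zero]
    split_ifs with ha hb hc hc hd hd
    · rfl
    · exfalso
      obtain ⟨j, rfl⟩ := ha
      cases j with
      | zero => simp at h1
      | succ j => exact hc ⟨j, by rw [pow_succ, Nat.mul_div_cancel _ (by omega)]⟩
    · exfalso
      obtain ⟨j, rfl⟩ := ha
      cases j with
      | zero => simp at h1
      | succ j => exact hb (dvd_pow_self _ (by omega))
    · exfalso
      obtain ⟨j, hj⟩ := hd
      exact ha ⟨j + 1, by rw [pow_succ, ← hj, Nat.div_mul_cancel hc]⟩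
    · rfl
    · rfl

lemma AH_pow {k : Type*} [Field k] [CharZero k] [Algebra ℚ k] (p : ℕ) (hp : 2 ≤ p) :
    AH p k ^ p = PowerSeries.expand p (by omega) (AH p k) *
      PowerSeries.rescale (p : k) (PowerSeries.exp k) := by
  have hp0 : p ≠ 0 := by omega
  have hU : Dt k (PowerSeries.rescale (p : k) (PowerSeries.exp k)) =
      (p : PowerSeries k) * PowerSeries.X * PowerSeries.rescale (p : k) (PowerSeries.exp k) := by
    ext n
    rw [coeff_Dt, mul_assoc, ← map_natCast (PowerSeries.C (R := k)), PowerSeries.coeff_C_mul]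
    cases n with
    | zero => simp
    | succ n =>
      rw [PowerSeries.coeff_succ_X_mul, PowerSeries.coeff_rescale, PowerSeries.coeff_rescale,
        PowerSeries.coeff_exp, PowerSeries.coeff_exp]
      have : ((n + 1 : ℕ) : k) ≠ 0 := by exact_mod_cast n.succ_ne_zero
      have h2 : ((n.factorial : ℕ) : k) ≠ 0 := by exact_mod_cast n.factorial_ne_zero
      simp only [map_div₀, map_one, map_natCast, Nat.factorial_succ, pow_succ]
      push_cast at this ⊢
      field_simp
  have h0 : PowerSeries.coeff 0 (AH p k) = 1 := by simp [AH, ahCoeff]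
  apply ode_unique p hp0 (p : k)
  · simp only [PowerSeries.coeff_zero_eq_constantCoeff, map_pow] at h0 ⊢
    rw [h0, one_pow]
  · simp only [PowerSeries.coeff_zero_eq_constantCoeff, map_mul,
      PowerSeries.constantCoeff_expand] at h0 ⊢
    rw [h0]; simp [← PowerSeries.coeff_zero_eq_constantCoeff]
  · rw [Dt_pow _ _ (Dt_AH p hp0 k) p, map_natCast, mul_assoc]
  · rw [Derivation.leibniz, hU, Dt_expand, Dt_AH p hp0, map_mul, smul_eq_mul, smul_eq_mul,
      map_natCast]
    conv_rhs => rw [Lp_eq (k := k) p hp]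
    ring

end PRat

namespace PRat

variable {p : ℕ} [hp : Fact p.Prime]

lemma norm_pow_div_factorial (n : ℕ) (hn : n ≠ 0) :
    ‖((p : ℚ_[p]) ^ n * ((n.factorial : ℕ) : ℚ_[p])⁻¹)‖ ≤ (p : ℝ)⁻¹ := by
  have h1 := padicValNat_factorial_lt_of_ne_zero p hn
  have hf : (n.factorial : ℚ_[p]) ≠ 0 := by exact_mod_cast n.factorial_ne_zero
  have hp1 : (1 : ℝ) < p := by exact_mod_cast hp.out.one_lt
  rw [norm_mul, norm_pow, Padic.norm_p, norm_inv, Padic.norm_eq_zpow_neg_valuation hf,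
    Padic.valuation_natCast, zpow_neg, inv_inv, zpow_natCast, inv_pow]
  obtain ⟨d, hd⟩ := Nat.exists_eq_add_of_lt h1
  have hd' : (p : ℝ) ^ n = (p : ℝ) ^ padicValNat p n.factorial * (p : ℝ) ^ d * p := by
    rw [← pow_add, ← pow_succ, ← hd]
  rw [hd', mul_inv, mul_inv]
  have h3 : (0 : ℝ) < (p : ℝ) ^ padicValNat p n.factorial := by positivity
  have h4 : (1 : ℝ) ≤ (p : ℝ) ^ d := one_le_pow₀ hp1.le
  have : ((p : ℝ) ^ padicValNat p n.factorial)⁻¹ * ((p : ℝ) ^ d)⁻¹ * (p : ℝ)⁻¹ *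
      (p : ℝ) ^ padicValNat p n.factorial = ((p : ℝ) ^ d)⁻¹ * (p : ℝ)⁻¹ := by
    field_simp
  rw [this]
  have := inv_le_one_of_one_le₀ h4
  have hp0 : 0 ≤ (p : ℝ)⁻¹ := by positivity
  nlinarith

lemma coeff_pow_congr (A : Polynomial ℤ_[p]) (n : ℕ) :
    ‖(A ^ p).coeff n - (Polynomial.expand ℤ_[p] p A).coeff n‖ ≤ (p : ℝ)⁻¹ := by
  have h : (A ^ p - Polynomial.expand ℤ_[p] p A).map (PadicInt.toZMod (p := p)) = 0 := by
    rw [Polynomial.map_sub, Polynomial.map_pow, Polynomial.map_expand, ZMod.expand_card, sub_self]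
  have h1 := congrArg (fun f => Polynomial.coeff f n) h
  simp only [Polynomial.coeff_map, Polynomial.coeff_zero, Polynomial.coeff_sub] at h1
  have h2 : (A ^ p).coeff n - (Polynomial.expand ℤ_[p] p A).coeff n ∈
      RingHom.ker (PadicInt.toZMod (p := p)) := h1
  rw [PadicInt.ker_toZMod, PadicInt.maximalIdeal_eq_span_p, Ideal.mem_span_singleton] at h2
  obtain ⟨c, hc⟩ := h2
  rw [hc, norm_mul, PadicInt.norm_p]
  have := PadicInt.norm_le_one c
  have hp0 : 0 ≤ (p : ℝ)⁻¹ := by positivity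
  nlinarith

lemma norm_sum_le_of {K : Type*} [SeminormedAddCommGroup K] [IsUltrametricDist K] {ι : Type*}
    (s : Finset ι) (f : ι → K) {C : ℝ} (hC : 0 ≤ C) (h : ∀ i ∈ s, ‖f i‖ ≤ C) :
    ‖∑ i ∈ s, f i‖ ≤ C :=
  IsUltrametricDist.norm_sum_le_of_forall_le_of_nonneg hC h

lemma norm_sub_le_of {K : Type*} [SeminormedAddCommGroup K] [IsUltrametricDist K]
    {a b : K} {C : ℝ} (ha : ‖a‖ ≤ C) (hb : ‖b‖ ≤ C) : ‖a - b‖ ≤ C :=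
  by
  rw [sub_eq_add_neg]
  exact (IsUltrametricDist.norm_add_le_max a (-b)).trans (max_le ha (by rwa [norm_neg]))

lemma norm_add_le_of {K : Type*} [SeminormedAddCommGroup K] [IsUltrametricDist K]
    {a b : K} {C : ℝ} (ha : ‖a‖ ≤ C) (hb : ‖b‖ ≤ C) : ‖a + b‖ ≤ C :=
  (IsUltrametricDist.norm_add_le_max a b).trans (max_le ha hb)

lemma ahCoeff_norm_le (n : ℕ) : ‖ahCoeff p ℚ_[p] n‖ ≤ 1 := by
  have hp2 := hp.out.two_le
  have hp0 : p ≠ 0 := by omega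
  have hpinv : 0 ≤ (p : ℝ)⁻¹ := by positivity
  induction n using Nat.strong_induction_on with
  | _ n ih =>
    rcases Nat.eq_zero_or_pos n with rfl | hn
    · simp [ahCoeff]
    -- polynomial over the p-adic integers
    obtain ⟨E, hE⟩ : ∃ E : ℕ → ℤ_[p], ∀ i < n, ((E i : ℤ_[p]) : ℚ_[p]) = ahCoeff p ℚ_[p] i := by
      have : ∀ i, ∃ x : ℤ_[p], i < n → (x : ℚ_[p]) = ahCoeff p ℚ_[p] i := by
        intro i
        by_cases h : i < n
        · exact ⟨⟨ahCoeff p ℚ_[p] i, ih i h⟩, fun _ => rfl⟩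
        · exact ⟨0, fun h' => absurd h' h⟩
      choose E hE using this
      exact ⟨E, hE⟩
    let A : Polynomial ℤ_[p] := ∑ i ∈ Finset.range n, Polynomial.monomial i (E i)
    have hA : ∀ i, ((A.coeff i : ℤ_[p]) : ℚ_[p]) = if i < n then ahCoeff p ℚ_[p] i else 0 := by
      intro i
      simp only [A, Polynomial.finsetSum_coeff, Polynomial.coeff_monomial, Finset.sum_ite_eq',
        Finset.mem_range]
      split_ifs with h
      · exact hE i h
      · rfl
    let A' : Polynomial ℚ_[p] := A.map (PadicInt.Coe.ringHom (p := p))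
    obtain ⟨B, hB⟩ : ∃ B : PowerSeries ℚ_[p], AH p ℚ_[p] = (A' : PowerSeries ℚ_[p]) +
        PowerSeries.X ^ n * B ∧ PowerSeries.coeff 0 B = ahCoeff p ℚ_[p] n := by
      refine ⟨PowerSeries.mk fun i => ahCoeff p ℚ_[p] (i + n), ?_, by simp⟩
      ext i
      rw [map_add, Polynomial.coeff_coe, Polynomial.coeff_map, PowerSeries.coeff_X_pow_mul']
      have := hA i
      rw [show PadicInt.Coe.ringHom (A.coeff i) = ((A.coeff i : ℤ_[p]) : ℚ_[p]) from rfl, this]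
      simp only [AH, PowerSeries.coeff_mk]
      split_ifs with h1 h2 h2
      · omega
      · simp
      · rw [Nat.sub_add_cancel h2, zero_add]
      · omega
    obtain ⟨hB, hB0⟩ := hB
    have hpow := AH_pow (k := ℚ_[p]) p hp2
    have hc := congrArg (PowerSeries.coeff n) hpow
    have hL : PowerSeries.coeff n (AH p ℚ_[p] ^ p) =
        (A' ^ p).coeff n + p * ahCoeff p ℚ_[p] n := by
      obtain ⟨z, hz⟩ := Polynomial.powAddExpansion (A' : PowerSeries ℚ_[p])
        (PowerSeries.X ^ n * B) p
      rw [hB, hz, map_add, map_add, ← Polynomial.coe_pow, Polynomial.coeff_coe]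
      have e1 : PowerSeries.coeff n ((p : PowerSeries ℚ_[p]) * (A' : PowerSeries ℚ_[p]) ^ (p - 1) *
          (PowerSeries.X ^ n * B)) = p * ahCoeff p ℚ_[p] n := by
        rw [show (p : PowerSeries ℚ_[p]) * (A' : PowerSeries ℚ_[p]) ^ (p - 1) *
          (PowerSeries.X ^ n * B) = PowerSeries.X ^ n * ((p : PowerSeries ℚ_[p]) *
            (A' : PowerSeries ℚ_[p]) ^ (p - 1) * B) by ring, PowerSeries.coeff_X_pow_mul',
          if_pos le_rfl, Nat.sub_self, PowerSeries.coeff_zero_eq_constantCoeff]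
        rw [PowerSeries.coeff_zero_eq_constantCoeff] at hB0
        have hA0 : PowerSeries.constantCoeff (A' : PowerSeries ℚ_[p]) = 1 := by
          rw [← PowerSeries.coeff_zero_eq_constantCoeff, Polynomial.coeff_coe,
            Polynomial.coeff_map]
          rw [show PadicInt.Coe.ringHom (A.coeff 0) = ((A.coeff 0 : ℤ_[p]) : ℚ_[p]) from rfl,
            hA 0, if_pos hn, ahCoeff]
        simp only [map_mul, map_pow, map_natCast, hA0, hB0]
        simp
      have e2 : PowerSeries.coeff n (z * (PowerSeries.X ^ n * B) ^ 2) = 0 := by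
        rw [show z * (PowerSeries.X ^ n * B) ^ 2 = PowerSeries.X ^ (n + n) * (z * B ^ 2) by ring,
          PowerSeries.coeff_X_pow_mul', if_neg (by omega)]
      rw [e1, e2, add_zero]
    have hR : ‖PowerSeries.coeff n (PowerSeries.expand p hp0 (AH p ℚ_[p]) *
      PowerSeries.rescale (p : ℚ_[p]) (PowerSeries.exp ℚ_[p])) -
        (Polynomial.expand ℚ_[p] p A').coeff n‖ ≤ (p : ℝ)⁻¹ := by
      rw [PowerSeries.coeff_mul, Finset.Nat.sum_antidiagonal_eq_sum_range_succ_mk,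
        Finset.sum_range_succ, add_sub_assoc]
      have hnp : n / p < n := Nat.div_lt_self hn hp2
      apply norm_add_le_of
      · apply norm_sum_le_of _ _ hpinv
        intro i hi
        have hi := Finset.mem_range.1 hi
        rw [norm_mul, PowerSeries.coeff_rescale, PowerSeries.coeff_exp]
        have h1 := norm_pow_div_factorial (p := p) (n - i) (by omega)
        have h2 : ‖PowerSeries.coeff i (PowerSeries.expand p hp0 (AH p ℚ_[p]))‖ ≤ 1 := by
          rw [PowerSeries.coeff_expand]
          split_ifs with h
          · simp only [AH, PowerSeries.coeff_mk]
            exact ih _ ((Nat.div_le_self _ _).trans_lt hi)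
          · simp
        have h3 : (algebraMap ℚ ℚ_[p]) (1 / ((n - i).factorial : ℚ)) =
          (((n - i).factorial : ℕ) : ℚ_[p])⁻¹ := by simp
        rw [h3]
        calc _ ≤ 1 * (p : ℝ)⁻¹ := mul_le_mul h2 h1 (norm_nonneg _) zero_le_one
          _ = _ := one_mul _
      · have : PowerSeries.coeff n (PowerSeries.expand p hp0 (AH p ℚ_[p])) =
          (Polynomial.expand ℚ_[p] p A').coeff n := by
          rw [PowerSeries.coeff_expand, Polynomial.coeff_expand (by omega)]
          split_ifs with h
          · rw [Polynomial.coeff_map]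
            rw [show PadicInt.Coe.ringHom (A.coeff (n / p)) =
              ((A.coeff (n / p) : ℤ_[p]) : ℚ_[p]) from rfl, hA, if_pos hnp]
            simp [AH]
          · rfl
        simp [this]
    have hAA : ‖(A' ^ p).coeff n - (Polynomial.expand ℚ_[p] p A').coeff n‖ ≤ (p : ℝ)⁻¹ := by
      have := coeff_pow_congr A n
      rw [← Polynomial.map_pow, ← Polynomial.map_expand, Polynomial.coeff_map,
        Polynomial.coeff_map, ← map_sub]
      exact this
    rw [← hc, hL] at hR
    have h5 : ‖(p : ℚ_[p]) * ahCoeff p ℚ_[p] n‖ ≤ (p : ℝ)⁻¹ := by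
      have := norm_sub_le_of hR hAA
      rwa [show (A' ^ p).coeff n + p * ahCoeff p ℚ_[p] n - (Polynomial.expand ℚ_[p] p A').coeff n -
        ((A' ^ p).coeff n - (Polynomial.expand ℚ_[p] p A').coeff n) =
          p * ahCoeff p ℚ_[p] n by ring] at this
    rw [norm_mul, Padic.norm_p] at h5
    have hpp : 0 < (p : ℝ)⁻¹ := by
      have : 0 < p := by omega
      positivity
    nlinarith

end PRat

namespace PRat

/-- closed unit ball -/
def OK (K : Type*) [NormedField K] [IsUltrametricDist K] : ValuationSubring K where
  carrier := {x | ‖x‖ ≤ 1}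
  mul_mem' {a b} ha hb := by
    have ha : ‖a‖ ≤ 1 := ha
    have hb : ‖b‖ ≤ 1 := hb
    change ‖a * b‖ ≤ 1
    rw [norm_mul]
    exact mul_le_one₀ ha (norm_nonneg _) hb
  one_mem' := by
    change ‖(1 : K)‖ ≤ 1
    simp
  add_mem' {a b} ha hb := norm_add_le_of ha hb
  zero_mem' := by
    change ‖(0 : K)‖ ≤ 1
    simp
  neg_mem' {a} ha := by
    change ‖-a‖ ≤ 1
    rw [norm_neg]; exact ha
  mem_or_inv_mem' a := by
    change ‖a‖ ≤ 1 ∨ ‖a⁻¹‖ ≤ 1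
    rw [norm_inv]
    rcases le_total ‖a‖ 1 with h | h
    · exact Or.inl h
    · exact Or.inr (inv_le_one_of_one_le₀ h)

lemma mem_OK {K : Type*} [NormedField K] [IsUltrametricDist K] {x : K} :
    x ∈ OK K ↔ ‖x‖ ≤ 1 := Iff.rfl

abbrev kap (K : Type*) [NormedField K] [IsUltrametricDist K] := IsLocalRing.ResidueField (OK K)

lemma residue_eq_zero {K : Type*} [NormedField K] [IsUltrametricDist K] (x : OK K) :
    IsLocalRing.residue (OK K) x = 0 ↔ ‖(x : K)‖ < 1 := by
  rw [IsLocalRing.residue_eq_zero_iff, IsLocalRing.mem_maximalIdeal, mem_nonunits_iff]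
  have hx : ‖(x : K)‖ ≤ 1 := x.2
  constructor
  · intro h
    refine lt_of_le_of_ne hx fun h1 => h ?_
    have h0 : (x : K) ≠ 0 := by
      intro h0; rw [h0] at h1; simp at h1
    have : (x : K)⁻¹ ∈ OK K := by
      rw [mem_OK, norm_inv, h1]; simp
    refine IsUnit.of_mul_eq_one ⟨(x : K)⁻¹, this⟩ ?_
    ext; simp [h0]
  · intro h hu
    obtain ⟨y, hy⟩ := hu.exists_right_inv
    have hy' : (x : K) * (y : K) = 1 := by exact_mod_cast congrArg Subtype.val hy
    have hy1 : ‖(y : K)‖ ≤ 1 := y.2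
    have := congrArg norm hy'
    rw [norm_mul, norm_one] at this
    nlinarith [norm_nonneg (x : K), norm_nonneg (y : K)]

lemma residue_eq {K : Type*} [NormedField K] [IsUltrametricDist K] (x y : OK K) :
    IsLocalRing.residue (OK K) x = IsLocalRing.residue (OK K) y ↔ ‖(x : K) - y‖ < 1 := by
  rw [← sub_eq_zero, ← map_sub, residue_eq_zero]; rfl

section
variable {p : ℕ} [hp : Fact p.Prime] {K : Type*} [NormedField K] [NormedAlgebra ℚ_[p] K]
  [IsUltrametricDist K]

lemma norm_p_K (p : ℕ) [hp : Fact p.Prime] (K : Type*) [NormedField K] [NormedAlgebra ℚ_[p] K] :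
    ‖(p : K)‖ = (p : ℝ)⁻¹ := by
  rw [← map_natCast (algebraMap ℚ_[p] K), norm_algebraMap', Padic.norm_p]

lemma norm_p_lt (p : ℕ) [hp : Fact p.Prime] (K : Type*) [NormedField K] [NormedAlgebra ℚ_[p] K] :
    ‖(p : K)‖ < 1 := by
  rw [norm_p_K]
  exact inv_lt_one_of_one_lt₀ (by exact_mod_cast hp.out.one_lt)

lemma charP_kap (p : ℕ) [hp : Fact p.Prime] (K : Type*) [NormedField K] [NormedAlgebra ℚ_[p] K]
    [IsUltrametricDist K] : CharP (kap K) p := by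
  have h : ((p : ℕ) : kap K) = 0 := by
    rw [← map_natCast (IsLocalRing.residue (OK K)), residue_eq_zero]
    simpa using norm_p_lt p K
  have hd := ringChar.dvd h
  rcases (Nat.dvd_prime hp.out).1 hd with h1 | h1
  · exact absurd h1 (by
      intro h1
      have := ringChar.spec (kap K) 1
      rw [h1] at this
      simp at this)
  · exact ringChar.of_eq h1

/-- Teichmuller uniqueness -/
lemma teich_unique (p : ℕ) [hp : Fact p.Prime] {K : Type*} [NormedField K] [NormedAlgebra ℚ_[p] K]
    [IsUltrametricDist K] {m : ℕ} (hm : m ≠ 0) (x y : K) (hx1 : ‖x‖ ≤ 1)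
    (hy1 : ‖y‖ ≤ 1) (hx : x ^ p ^ m = x) (hy : y ^ p ^ m = y) (h : ‖x - y‖ < 1) : x = y := by
  let d : OK K := ⟨x - y, h.le⟩
  let y' : OK K := ⟨y, hy1⟩
  obtain ⟨z, hz⟩ := Polynomial.powAddExpansion y' d (p ^ m)
  have hz' : (y + (x - y)) ^ p ^ m = y ^ p ^ m + (p ^ m : ℕ) * y ^ (p ^ m - 1) * (x - y) +
      z * (x - y) ^ 2 := by
    have := congrArg Subtype.val hz
    push_cast at this ⊢
    exact this
  rw [add_sub_cancel, hx, hy] at hz'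
  have h2 : (x - y) = ((p ^ m : ℕ) * y ^ (p ^ m - 1) + z * (x - y)) * (x - y) := by
    linear_combination hz'
  by_contra hne
  have h3 : (0 : ℝ) < ‖x - y‖ := norm_pos_iff.2 (sub_ne_zero.2 hne)
  have h4 := congrArg norm h2
  rw [norm_mul] at h4
  have h5 : ‖((p ^ m : ℕ) : K) * y ^ (p ^ m - 1) + z * (x - y)‖ < 1 := by
    refine (IsUltrametricDist.norm_add_le_max _ _).trans_lt (max_lt ?_ ?_)
    · rw [norm_mul, norm_pow]
      push_cast
      rw [norm_pow]
      have h6 := pow_lt_one₀ (norm_nonneg _) (norm_p_lt p K) hm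
      have h7 := pow_le_one₀ (n := p ^ m - 1) (norm_nonneg _) hy1
      calc _ ≤ ‖(p : K)‖ ^ m * 1 := by gcongr
        _ < 1 := by linarith
    · rw [norm_mul]
      have : ‖(z : K)‖ ≤ 1 := z.2
      nlinarith [norm_nonneg (z : K)]
  nlinarith

lemma norm_le_one_of_teich {K : Type*} [NormedField K] {Q : ℕ} (hQ : 2 ≤ Q) (x : K)
    (h : x ^ Q = x) : ‖x‖ ≤ 1 := by
  by_contra hc
  push Not at hc
  have := congrArg norm h
  rw [norm_pow] at this
  have h2 := lt_self_pow₀ hc (by omega : 1 < Q)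
  linarith

/-- Teichmuller map. -/
lemma exists_teich (p : ℕ) [hp : Fact p.Prime] (K : Type*) [NormedField K] [NormedAlgebra ℚ_[p] K]
    [IsUltrametricDist K] [IsAlgClosed K] {m : ℕ} (hm : m ≠ 0) :
    ∃ ω : GaloisField p m → K, (∀ x, ω x ^ p ^ m = ω x) ∧ Function.Injective ω ∧
      (∀ x y, ω (x * y) = ω x * ω y) ∧ ω 1 = 1 ∧ ω 0 = 0 ∧
      (∀ x y, ‖ω (x + y) - (ω x + ω y)‖ < 1) ∧
      (∀ τ : K, τ ^ p ^ m = τ → ∃ x, ω x = τ) := by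
  classical
  have hp2 := hp.out.two_le
  have hQ : 2 ≤ p ^ m := hp2.trans (Nat.le_self_pow hm p)
  have hQ1 : p ^ m - 1 ≠ 0 := by omega
  haveI : CharZero K := by
    have : CharZero ℚ_[p] := inferInstance
    exact charZero_of_injective_algebraMap (algebraMap ℚ_[p] K).injective
  haveI : CharP (kap K) p := charP_kap p K
  letI : Algebra (ZMod p) (kap K) := ZMod.algebra _ p
  haveI : NeZero (p ^ m - 1) := ⟨hQ1⟩
  haveI : NeZero ((p ^ m - 1 : ℕ) : K) := ⟨by exact_mod_cast hQ1⟩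
  obtain ⟨ε, hε⟩ := HasEnoughRootsOfUnity.exists_primitiveRoot K (p ^ m - 1)
  have hpow : ∀ {R : Type _} [CommRing R] (x : R), x ^ (p ^ m - 1) = 1 → x ^ p ^ m = x := by
    intro R _ x hx
    conv_lhs => rw [show p ^ m = (p ^ m - 1) + 1 by omega]
    rw [pow_succ, hx, one_mul]
  have hε1 : ‖ε‖ ≤ 1 := norm_le_one_of_teich hQ _ (hpow ε hε.pow_eq_one)
  let ε' : OK K := ⟨ε, hε1⟩
  have hε' : IsPrimitiveRoot (IsLocalRing.residue (OK K) ε') (p ^ m - 1) := by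
    refine ⟨?_, fun l hl => ?_⟩
    · rw [← map_pow, show ε' ^ (p ^ m - 1) = 1 from Subtype.ext hε.pow_eq_one, map_one]
    · rw [← map_pow, ← map_one (IsLocalRing.residue (OK K)), residue_eq] at hl
      apply hε.dvd_of_pow_eq_one
      have ha : (ε ^ l) ^ p ^ m = ε ^ l := by
        rw [← pow_mul, mul_comm, pow_mul, hpow ε hε.pow_eq_one]
      exact teich_unique p hm _ _ (norm_le_one_of_teich hQ _ ha) (by simp) ha (by simp)
        (by simpa [ε'] using hl)
  have hsplit : ((Polynomial.X ^ p ^ m - Polynomial.X : Polynomial (ZMod p)).map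
      (algebraMap (ZMod p) (kap K))).Splits := by
    have : (Polynomial.X ^ p ^ m - Polynomial.X : Polynomial (ZMod p)).map
      (algebraMap (ZMod p) (kap K)) = Polynomial.X * (Polynomial.X ^ (p ^ m - 1) - 1) := by
      simp only [Polynomial.map_sub, Polynomial.map_pow, Polynomial.map_X]
      rw [mul_sub, mul_one, ← pow_succ', Nat.sub_add_cancel (by omega)]
    rw [this]
    exact Polynomial.Splits.X.mul (Polynomial.X_pow_sub_one_splits hε')
  have hcard : Nat.card (GaloisField p m) = p ^ m := GaloisField.card p m hm
  have hisf : Polynomial.IsSplittingField (ZMod p) (GaloisField p m)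
      (Polynomial.X ^ p ^ m - Polynomial.X) := FiniteField.isSplittingField_of_nat_card_eq p m hcard
  let ι : GaloisField p m →ₐ[ZMod p] kap K :=
    Polynomial.IsSplittingField.lift (GaloisField p m) _ hsplit
  haveI : Fintype (GaloisField p m) := Fintype.ofFinite _
  have hfc : Fintype.card (GaloisField p m) = p ^ m := by rw [← Nat.card_eq_fintype_card, hcard]
  have hGF : ∀ x : GaloisField p m, x ^ p ^ m = x := fun x => by
    conv_lhs => rw [← hfc]
    exact FiniteField.pow_card x
  have hex : ∀ x : GaloisField p m, ∃ τ : OK K, (τ : K) ^ p ^ m = τ ∧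
      IsLocalRing.residue (OK K) τ = ι x := by
    intro x
    by_cases hx : x = 0
    · exact ⟨0, by simp [show p ≠ 0 by omega], by simp [hx]⟩
    · have h1 : (ι x) ^ (p ^ m - 1) = 1 := by
        rw [← map_pow, ← map_one ι, ← hfc, FiniteField.pow_card_sub_one_eq_one x hx]
      obtain ⟨i, -, hi⟩ := hε'.eq_pow_of_pow_eq_one h1
      refine ⟨ε' ^ i, ?_, by rw [map_pow, hi]⟩
      simp only [ε', SubmonoidClass.coe_pow]
      rw [← pow_mul, mul_comm, pow_mul, hpow ε hε.pow_eq_one]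
  choose τ hτ hres using hex
  have hn : ∀ x, ‖(τ x : K)‖ ≤ 1 := fun x => (τ x).2
  have hinj : Function.Injective (fun x => (τ x : K)) := by
    intro x y hxy
    have : τ x = τ y := Subtype.ext hxy
    have h2 : ι x = ι y := by rw [← hres, ← hres, this]
    exact RingHom.injective (ι : GaloisField p m →+* kap K) h2
  refine ⟨fun x => (τ x : K), hτ, hinj, ?_, ?_, ?_, ?_, ?_⟩
  · intro x y
    refine teich_unique p hm _ _ (hn _) (τ x * τ y).2 (hτ _) ?_ ?_
    · rw [mul_pow, hτ, hτ]
    · have := (residue_eq (τ (x * y)) (τ x * τ y)).1 (by rw [map_mul, hres, hres, hres, map_mul])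
      exact this
  · refine teich_unique p hm _ _ (hn _) (by simp) (hτ _) (by simp) ?_
    exact (residue_eq (τ 1) 1).1 (by rw [hres, map_one, map_one])
  · refine teich_unique p hm _ _ (hn _) (by simp) (hτ _) (by simp [show p ≠ 0 by omega]) ?_
    exact (residue_eq (τ 0) 0).1 (by rw [hres, map_zero, map_zero])
  · intro x y
    exact (residue_eq (τ (x + y)) (τ x + τ y)).1 (by rw [map_add, hres, hres, hres, map_add])
  · intro t ht
    let P : Polynomial K := Polynomial.X ^ p ^ m - Polynomial.X
    have hP : P ≠ 0 := FiniteField.X_pow_card_sub_X_ne_zero K (by omega)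
    have hPd : P.natDegree = p ^ m := FiniteField.X_pow_card_sub_X_natDegree_eq K (by omega)
    have hmem : ∀ z : K, z ^ p ^ m = z → z ∈ P.roots.toFinset := by
      intro z hz
      rw [Multiset.mem_toFinset, Polynomial.mem_roots hP]
      simp [P, hz]
    have hsub : Finset.univ.image (fun x => (τ x : K)) ⊆ P.roots.toFinset := by
      intro z hz
      obtain ⟨x, -, rfl⟩ := Finset.mem_image.1 hz
      exact hmem _ (hτ x)
    have heq := Finset.eq_of_subset_of_card_le hsub (by
      rw [Finset.card_image_of_injective _ hinj, Finset.card_univ, hfc, ← hPd]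
      exact (Multiset.toFinset_card_le _).trans (Polynomial.card_roots' _))
    have := hmem t ht
    rw [← heq] at this
    obtain ⟨x, -, hx⟩ := Finset.mem_image.1 this
    exact ⟨x, hx⟩

end

end PRat


namespace PRat

structure IsTeich (p : ℕ) [Fact p.Prime] {K : Type*} [NormedField K] (m : ℕ)
    (ω : GaloisField p m → K) : Prop where
  pow : ∀ x, ω x ^ p ^ m = ω x
  inj : Function.Injective ω
  mul : ∀ x y, ω (x * y) = ω x * ω y
  one : ω 1 = 1
  zero : ω 0 = 0
  add : ∀ x y, ‖ω (x + y) - (ω x + ω y)‖ < 1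
  surj : ∀ τ : K, τ ^ p ^ m = τ → ∃ x, ω x = τ

section
variable {p : ℕ} [hp : Fact p.Prime] {K : Type*} [NormedField K] [NormedAlgebra ℚ_[p] K]
  [IsUltrametricDist K] {m : ℕ} {ω : GaloisField p m → K}

lemma IsTeich.norm_le (h : IsTeich p m ω) (hm : m ≠ 0) (x) : ‖ω x‖ ≤ 1 :=
  norm_le_one_of_teich (hp.out.two_le.trans (Nat.le_self_pow hm p)) _ (h.pow x)

lemma IsTeich.map_pow (h : IsTeich p m ω) (x) (n : ℕ) : ω (x ^ n) = ω x ^ n := by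
  induction n with
  | zero => simp [h.one]
  | succ n ih => rw [pow_succ, h.mul, ih, pow_succ]

lemma norm_lt_add {a b : K} (ha : ‖a‖ < 1) (hb : ‖b‖ < 1) : ‖a + b‖ < 1 :=
  (IsUltrametricDist.norm_add_le_max a b).trans_lt (max_lt ha hb)

lemma IsTeich.sum (h : IsTeich p m ω) {ι : Type*} (s : Finset ι) (f : ι → GaloisField p m) :
    ‖ω (∑ i ∈ s, f i) - ∑ i ∈ s, ω (f i)‖ < 1 := by
  classical
  induction s using Finset.induction_on with
  | empty => simp [h.zero]
  | insert a s ha ih =>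
    rw [Finset.sum_insert ha, Finset.sum_insert ha]
    have := norm_lt_add (h.add (f a) (∑ i ∈ s, f i)) ih
    rwa [show ω (f a + ∑ i ∈ s, f i) - (ω (f a) + ω (∑ i ∈ s, f i)) +
      (ω (∑ i ∈ s, f i) - ∑ i ∈ s, ω (f i)) =
      ω (f a + ∑ i ∈ s, f i) - (ω (f a) + ∑ i ∈ s, ω (f i)) by ring] at this

lemma IsTeich.natCast (h : IsTeich p m ω) (n : ℕ) : ‖ω (n : GaloisField p m) - n‖ < 1 := by
  have := h.sum (Finset.range n) (fun _ => 1)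
  simpa [h.one] using this

end

lemma norm_gal {p : ℕ} [hp : Fact p.Prime] (g : Gal(PadicAlgCl p/ℚ_[p])) (x : PadicAlgCl p) :
    ‖g x‖ = ‖x‖ := (spectralNorm_eq_of_equiv g x).symm

lemma teich_gal {p : ℕ} [hp : Fact p.Prime] {m : ℕ} (hm : m ≠ 0)
    {ω : GaloisField p m → PadicAlgCl p} (h : IsTeich p m ω) (g : Gal(PadicAlgCl p/ℚ_[p])) :
    ∃ j, ∀ x, g (ω x) = ω x ^ p ^ j := by
  have hex : ∀ x, ∃ y, ω y = g (ω x) := fun x => h.surj _ (by rw [← map_pow, h.pow])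
  choose f hf using hex
  have key : ∀ x y, ‖ω x - ω y‖ < 1 → x = y := fun x y hxy => h.inj
    (teich_unique p hm _ _ (h.norm_le hm x) (h.norm_le hm y) (h.pow x) (h.pow y) hxy)
  let F : GaloisField p m →+* GaloisField p m :=
    { toFun := f
      map_one' := h.inj (by rw [hf, h.one, map_one])
      map_zero' := h.inj (by rw [hf, h.zero, map_zero])
      map_mul' := fun x y => h.inj (by rw [hf, h.mul, h.mul, map_mul, hf, hf])
      map_add' := fun x y => key _ _ (by
        have h1 := h.add x y
        rw [← norm_gal g, map_sub, map_add, ← hf, ← hf, ← hf] at h1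
        have h2 := h.add (f x) (f y)
        rw [← norm_neg] at h2
        have := norm_lt_add h1 h2
        rwa [show ω (f (x + y)) - (ω (f x) + ω (f y)) + -(ω (f x + f y) - (ω (f x) + ω (f y))) =
          ω (f (x + y)) - ω (f x + f y) by ring] at this) }
  have hcomm : ∀ r, F (algebraMap (ZMod p) (GaloisField p m) r) =
      algebraMap (ZMod p) (GaloisField p m) r := by
    intro r
    have : F.comp (algebraMap (ZMod p) (GaloisField p m)) =
      algebraMap (ZMod p) (GaloisField p m) := Subsingleton.elim _ _
    exact congrArg (fun f : ZMod p →+* GaloisField p m => f r) this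
  let F' : GaloisField p m →ₐ[ZMod p] GaloisField p m := AlgHom.mk F hcomm
  obtain ⟨j, hj⟩ := (FiniteField.bijective_frobeniusAlgHom_pow (ZMod p) (GaloisField p m)).2 F'
  refine ⟨j, fun x => ?_⟩
  have : f x = x ^ p ^ (j : ℕ) := by
    have h1 : F' x = f x := rfl
    rw [← h1, ← hj]
    simp [FiniteField.coe_frobeniusAlgHom, AlgHom.coe_pow, ZMod.card, pow_iterate]
  rw [← hf, this, h.map_pow]

lemma sum_cyclic {K : Type*} [Field K] {p m : ℕ} {t : K} (ht : t ^ p ^ m = t) (j : ℕ) :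
    ∑ i ∈ Finset.range m, t ^ p ^ (i + j) = ∑ i ∈ Finset.range m, t ^ p ^ i := by
  induction j with
  | zero => rfl
  | succ j ih =>
    rw [← ih]
    have h1 := Finset.sum_range_succ (fun i => t ^ p ^ (i + j)) m
    have h2 := Finset.sum_range_succ' (fun i => t ^ p ^ (i + j)) m
    have h3 : t ^ p ^ (m + j) = t ^ p ^ (0 + j) := by
      rw [zero_add, pow_add, pow_mul, ht]
    rw [h1, h3] at h2
    have := add_right_cancel h2
    rw [this]
    refine Finset.sum_congr rfl fun i _ => ?_
    rw [add_right_comm, add_assoc]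

lemma teich_trace {p : ℕ} [hp : Fact p.Prime] {m : ℕ} (hm : m ≠ 0)
    {ω : GaloisField p m → PadicAlgCl p} (h : IsTeich p m ω) (x : GaloisField p m) :
    ∃ σ : ℤ_[p], algebraMap ℚ_[p] (PadicAlgCl p) (σ : ℚ_[p]) =
      ∑ i ∈ Finset.range m, ω x ^ p ^ i ∧
      ‖σ - ((Algebra.trace (ZMod p) (GaloisField p m) x).val : ℕ)‖ < 1 := by
  set s := ∑ i ∈ Finset.range m, ω x ^ p ^ i with hs
  have hfix : ∀ g : Gal(PadicAlgCl p/ℚ_[p]), g s = s := by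
    intro g
    obtain ⟨j, hj⟩ := teich_gal hm h g
    rw [hs, map_sum, ← sum_cyclic (h.pow x) j]
    refine Finset.sum_congr rfl fun i _ => ?_
    rw [map_pow, hj, ← pow_mul, ← pow_add, add_comm]
  obtain ⟨σ, hσ⟩ := (InfiniteGalois.mem_range_algebraMap_iff_fixed s).2 hfix
  have hsn : ‖s‖ ≤ 1 := by
    refine norm_sum_le_of _ _ zero_le_one fun i _ => ?_
    rw [norm_pow]
    exact pow_le_one₀ (norm_nonneg _) (h.norm_le hm x)
  have hσn : ‖σ‖ ≤ 1 := by
    rw [← hσ, norm_algebraMap'] at hsn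
    exact hsn
  refine ⟨⟨σ, hσn⟩, hσ, ?_⟩
  set t := Algebra.trace (ZMod p) (GaloisField p m) x with ht
  have h1 : ((t.val : ℕ) : GaloisField p m) = ∑ i ∈ Finset.range m, x ^ p ^ i := by
    have h2 := FiniteField.algebraMap_trace_eq_sum_pow (ZMod p) (GaloisField p m) x
    rw [Nat.card_zmod, GaloisField.finrank p hm] at h2
    rw [← h2, ← ht, ← map_natCast (algebraMap (ZMod p) (GaloisField p m)), ZMod.natCast_zmod_val]
  have h3 := h.sum (Finset.range m) (fun i => x ^ p ^ i)
  simp only [h.map_pow] at h3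
  rw [← h1, ← hs] at h3
  have h4 := h.natCast t.val
  rw [← norm_neg] at h3
  have h5 := norm_lt_add h3 h4
  rw [show -(ω ((t.val : ℕ) : GaloisField p m) - s) +
    (ω ((t.val : ℕ) : GaloisField p m) - ((t.val : ℕ) : PadicAlgCl p)) =
    s - ((t.val : ℕ) : PadicAlgCl p) by ring] at h5
  rw [← hσ, ← map_natCast (algebraMap ℚ_[p] (PadicAlgCl p)), ← map_sub, norm_algebraMap'] at h5
  rw [PadicInt.norm_def]
  push_cast
  exact h5

end PRat

namespace PRat

section
variable {K : Type*} [NormedField K] [IsUltrametricDist K]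

noncomputable def ev (D : ℕ) (γ : K) (A : PowerSeries K) : K := (PowerSeries.trunc D A).eval γ

lemma ev_eq (D : ℕ) (γ : K) (A : PowerSeries K) :
    ev D γ A = ∑ n ∈ Finset.range D, PowerSeries.coeff n A * γ ^ n := by
  rw [ev, ← Polynomial.eval₂_id, PowerSeries.eval₂_trunc_eq_sum_range]
  rfl

def PSInt (A : PowerSeries K) : Prop := ∀ n, ‖PowerSeries.coeff n A‖ ≤ 1

lemma PSInt.mul {A B : PowerSeries K} (hA : PSInt A) (hB : PSInt B) : PSInt (A * B) := by
  intro n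
  rw [PowerSeries.coeff_mul]
  refine norm_sum_le_of _ _ zero_le_one fun i _ => ?_
  rw [norm_mul]
  exact mul_le_one₀ (hA _) (norm_nonneg _) (hB _)

lemma PSInt.one : PSInt (1 : PowerSeries K) := by
  intro n
  rw [PowerSeries.coeff_one]
  split_ifs <;> simp

lemma PSInt.prod {ι : Type*} (s : Finset ι) (F : ι → PowerSeries K) (h : ∀ i ∈ s, PSInt (F i)) :
    PSInt (∏ i ∈ s, F i) := by
  classical
  induction s using Finset.induction_on with
  | empty => simpa using PSInt.one
  | insert a s ha ih =>
    rw [Finset.prod_insert ha]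
    exact (h a (Finset.mem_insert_self _ _)).mul
      (ih fun i hi => h i (Finset.mem_insert_of_mem hi))

lemma PSInt.ev_norm {A : PowerSeries K} (hA : PSInt A) {γ : K} (hγ : ‖γ‖ ≤ 1) (D : ℕ) :
    ‖ev D γ A‖ ≤ 1 := by
  rw [ev_eq]
  refine norm_sum_le_of _ _ zero_le_one fun i _ => ?_
  rw [norm_mul, norm_pow]
  exact mul_le_one₀ (hA _) (by positivity) (pow_le_one₀ (norm_nonneg _) hγ)

lemma ev_mul {A B : PowerSeries K} (hA : PSInt A) (hB : PSInt B) {γ : K} {ρ : ℝ} (hγ : ‖γ‖ ≤ ρ)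
    (hρ : ρ ≤ 1) (D : ℕ) : ‖ev D γ (A * B) - ev D γ A * ev D γ B‖ ≤ ρ ^ D := by
  have hρ0 : 0 ≤ ρ := (norm_nonneg _).trans hγ
  have key : ∀ R : Polynomial K, (∀ n < D, R.coeff n = 0) → (∀ n, ‖R.coeff n‖ ≤ 1) →
      ‖R.eval γ‖ ≤ ρ ^ D := by
    intro R h0 h1
    rw [Polynomial.eval_eq_sum, Polynomial.sum]
    refine norm_sum_le_of _ _ (by positivity) fun n hn => ?_
    by_cases hD : n < D
    · rw [h0 n hD]; simp; positivity
    · rw [norm_mul, norm_pow]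
      calc _ ≤ 1 * ρ ^ n := by
            gcongr
            exact h1 n
        _ ≤ ρ ^ D := by
            rw [one_mul]; exact pow_le_pow_of_le_one hρ0 hρ (by omega)
  rw [ev, ev, ev, ← Polynomial.eval_mul, ← Polynomial.eval_sub]
  have hT : ∀ {C : PowerSeries K}, PSInt C → ∀ n, ‖(PowerSeries.trunc D C).coeff n‖ ≤ 1 := by
    intro C hC n
    rw [PowerSeries.coeff_trunc]
    split_ifs
    · exact hC n
    · simp
  apply key
  · intro n hn
    rw [Polynomial.coeff_sub, PowerSeries.coeff_trunc, if_pos hn, sub_eq_zero,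
      PowerSeries.coeff_mul, Polynomial.coeff_mul]
    refine Finset.sum_congr rfl fun ij hij => ?_
    have := Finset.HasAntidiagonal.mem_antidiagonal.1 hij
    rw [PowerSeries.coeff_trunc, PowerSeries.coeff_trunc, if_pos (by omega), if_pos (by omega)]
  · intro n
    rw [Polynomial.coeff_sub]
    apply norm_sub_le_of (hT (hA.mul hB) n)
    rw [Polynomial.coeff_mul]
    refine norm_sum_le_of _ _ zero_le_one fun i _ => ?_
    rw [norm_mul]
    exact mul_le_one₀ (hT hA _) (norm_nonneg _) (hT hB _)

lemma norm_mul_sub_mul {a b a' b' : K} {C : ℝ} (ha : ‖a - a'‖ ≤ C) (hb : ‖b - b'‖ ≤ C)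
    (ha1 : ‖a‖ ≤ 1) (hb1 : ‖b'‖ ≤ 1) : ‖a * b - a' * b'‖ ≤ C := by
  have hC : 0 ≤ C := (norm_nonneg _).trans ha
  rw [show a * b - a' * b' = a * (b - b') + (a - a') * b' by ring]
  apply norm_add_le_of
  · rw [norm_mul]
    calc _ ≤ 1 * C := by gcongr
      _ = C := one_mul C
  · rw [norm_mul]
    calc _ ≤ C * 1 := by gcongr
      _ = C := mul_one C

lemma norm_prod_sub_prod {ι : Type*} (s : Finset ι) (f g : ι → K) {C : ℝ} (hC : 0 ≤ C)
    (h : ∀ i ∈ s, ‖f i - g i‖ ≤ C) (hf : ∀ i ∈ s, ‖f i‖ ≤ 1) (hg : ∀ i ∈ s, ‖g i‖ ≤ 1) :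
    ‖∏ i ∈ s, f i - ∏ i ∈ s, g i‖ ≤ C := by
  classical
  induction s using Finset.induction_on with
  | empty => simpa using hC
  | insert a s ha ih =>
    rw [Finset.prod_insert ha, Finset.prod_insert ha]
    refine norm_mul_sub_mul (h a (Finset.mem_insert_self _ _))
      (ih (fun i hi => h i (Finset.mem_insert_of_mem hi))
        (fun i hi => hf i (Finset.mem_insert_of_mem hi))
        (fun i hi => hg i (Finset.mem_insert_of_mem hi))) (hf a (Finset.mem_insert_self _ _)) ?_
    rw [norm_prod]
    exact Finset.prod_le_one (fun i _ => norm_nonneg _)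
      fun i hi => hg i (Finset.mem_insert_of_mem hi)

lemma ev_prod {ι : Type*} (s : Finset ι) (F : ι → PowerSeries K) (h : ∀ i ∈ s, PSInt (F i))
    {γ : K} {ρ : ℝ} (hγ : ‖γ‖ ≤ ρ) (hρ : ρ ≤ 1) (D : ℕ) (hD : D ≠ 0) :
    ‖ev D γ (∏ i ∈ s, F i) - ∏ i ∈ s, ev D γ (F i)‖ ≤ ρ ^ D := by
  classical
  have hρ0 : 0 ≤ ρ := (norm_nonneg _).trans hγ
  induction s using Finset.induction_on with
  | empty =>
    obtain ⟨D, rfl⟩ := Nat.exists_eq_succ_of_ne_zero hD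
    simp [ev, PowerSeries.trunc_one]; positivity
  | insert a s ha ih =>
    have ih := ih fun i hi => h i (Finset.mem_insert_of_mem hi)
    have ha' := h a (Finset.mem_insert_self _ _)
    have hs := PSInt.prod s F fun i hi => h i (Finset.mem_insert_of_mem hi)
    rw [Finset.prod_insert ha, Finset.prod_insert ha]
    have h1 := ev_mul ha' hs hγ hρ D
    have h2 : ‖ev D γ (F a) * (ev D γ (∏ i ∈ s, F i) - ∏ i ∈ s, ev D γ (F i))‖ ≤ ρ ^ D := by
      rw [norm_mul]
      calc _ ≤ 1 * ρ ^ D := by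
            gcongr
            exact ha'.ev_norm (hγ.trans hρ) D
        _ = _ := one_mul _
    have := norm_add_le_of h1 h2
    rwa [mul_sub, sub_add_sub_cancel] at this

/-- iteration producing `γ` with `E(γ) ≈ ζ`. -/
lemma exists_gamma {E : PowerSeries K} (hE : PSInt E) (h0 : PowerSeries.coeff 0 E = 1)
    (h1 : PowerSeries.coeff 1 E = 1) {ζ : K} {ρ : ℝ} (hρ : ρ ≤ 1) (hζ : ‖ζ - 1‖ ≤ ρ)
    (D : ℕ) (j : ℕ) : ∃ γ : K, ‖γ‖ ≤ ρ ∧ ‖ev (D + 2) γ E - ζ‖ ≤ ρ ^ (j + 1) := by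
  have hρ0 : 0 ≤ ρ := (norm_nonneg _).trans hζ
  have hev : ∀ γ : K, ev (D + 2) γ E = 1 + γ +
      ∑ n ∈ Finset.range D, PowerSeries.coeff (n + 2) E * γ ^ (n + 2) := by
    intro γ
    rw [ev_eq, Finset.sum_range_succ', Finset.sum_range_succ', h0, h1]
    simp; ring
  induction j with
  | zero =>
    refine ⟨0, by simpa using hρ0, ?_⟩
    rw [hev, norm_sub_rev]
    simpa using hζ
  | succ j ih =>
    obtain ⟨γ, hγ, h⟩ := ih
    set δ := ev (D + 2) γ E - ζ with hδ
    have hδρ : ‖δ‖ ≤ ρ := h.trans (by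
      rw [pow_succ]
      exact mul_le_of_le_one_left hρ0 (pow_le_one₀ hρ0 hρ))
    have hγ' : ‖γ - δ‖ ≤ ρ := norm_sub_le_of hγ hδρ
    refine ⟨γ - δ, hγ', ?_⟩
    have e1 : ev (D + 2) (γ - δ) E - ζ = ∑ n ∈ Finset.range D, PowerSeries.coeff (n + 2) E *
        ((γ - δ) ^ (n + 2) - γ ^ (n + 2)) := by
      have : ev (D + 2) (γ - δ) E - ζ = (ev (D + 2) (γ - δ) E - ev (D + 2) γ E) + δ := by
        rw [hδ]; ring
      rw [this, hev, hev]
      simp only [mul_sub, Finset.sum_sub_distrib]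
      ring
    rw [e1]
    refine norm_sum_le_of _ _ (by positivity) fun n _ => ?_
    have e2 : ‖(γ - δ) ^ (n + 2) - γ ^ (n + 2)‖ ≤ ρ ^ (j + 1 + 1) := by
      have := (Commute.all (γ - δ) γ).geom_sum₂_mul (n + 2)
      rw [← this, norm_mul, pow_succ, mul_comm]
      refine mul_le_mul (by simpa using h) ?_ (norm_nonneg _) (by positivity)
      refine norm_sum_le_of _ _ hρ0 fun i hi => ?_
      have hi := Finset.mem_range.1 hi
      rw [norm_mul, norm_pow, norm_pow]
      calc _ ≤ ρ ^ i * ρ ^ (n + 2 - 1 - i) := by gcongr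
        _ = ρ ^ (n + 1) := by rw [← pow_add]; congr 1; omega
        _ ≤ ρ := by
            rw [pow_succ]
            exact mul_le_of_le_one_left hρ0 (pow_le_one₀ hρ0 hρ)
    rw [norm_mul]
    calc _ ≤ 1 * ρ ^ (j + 1 + 1) := by
          gcongr
          exact hE _
      _ = _ := one_mul _

end

lemma ahCoeff_map (p : ℕ) {k K : Type*} [Field k] [Field K] (f : k →+* K) (n : ℕ) :
    f (ahCoeff p k n) = ahCoeff p K n := by
  classical
  induction n using Nat.strong_induction_on with
  | _ n ih =>
    cases n with
    | zero => simp [ahCoeff]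
    | succ n =>
      rw [ahCoeff, ahCoeff, map_mul, map_inv₀, map_natCast, map_sum]
      congr 1
      refine Finset.sum_congr rfl fun i _ => ?_
      rw [map_mul, ih i i.2]
      simp only [Lp, PowerSeries.coeff_mk]
      split_ifs <;> simp

lemma AH_PSInt (p : ℕ) [hp : Fact p.Prime] (K : Type*) [NormedField K] [NormedAlgebra ℚ_[p] K] :
    ∀ n, ‖PowerSeries.coeff n (AH p K)‖ ≤ 1 := by
  intro n
  rw [AH, PowerSeries.coeff_mk, ← ahCoeff_map p (algebraMap ℚ_[p] K), norm_algebraMap']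
  exact ahCoeff_norm_le n

lemma AH_zero (p : ℕ) (K : Type*) [Field K] : PowerSeries.coeff 0 (AH p K) = 1 := by
  simp [AH, ahCoeff]

lemma AH_one (p : ℕ) (K : Type*) [Field K] : PowerSeries.coeff 1 (AH p K) = 1 := by
  rw [AH, PowerSeries.coeff_mk, ahCoeff]
  simp [ahCoeff, Lp]
  exact ⟨0, by simp⟩

lemma Dt_prod_rescale {K : Type*} [Field K] [CharZero K] (p : ℕ) (hp : p ≠ 0) {m : ℕ} {t : K}
    (ht : t ^ p ^ m = t) :
    Dt K (∏ i ∈ Finset.range m, PowerSeries.rescale (t ^ p ^ i) (AH p K)) =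
      PowerSeries.C (∑ i ∈ Finset.range m, t ^ p ^ i) * (Lp p K *
        ∏ i ∈ Finset.range m, PowerSeries.rescale (t ^ p ^ i) (AH p K)) := by
  have hDr : ∀ c : K, Dt K (PowerSeries.rescale c (AH p K)) =
      PowerSeries.rescale c (Lp p K) * PowerSeries.rescale c (AH p K) := by
    intro c
    rw [← map_mul, ← Dt_AH p hp]
    ext n
    simp only [coeff_Dt, PowerSeries.coeff_rescale]
    ring
  have hprod : ∀ M : ℕ, Dt K (∏ i ∈ Finset.range M, PowerSeries.rescale (t ^ p ^ i) (AH p K)) =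
      (∑ i ∈ Finset.range M, PowerSeries.rescale (t ^ p ^ i) (Lp p K)) *
        ∏ i ∈ Finset.range M, PowerSeries.rescale (t ^ p ^ i) (AH p K) := by
    intro M
    induction M with
    | zero => simp
    | succ M ih =>
      rw [Finset.prod_range_succ, Derivation.leibniz, ih, hDr, Finset.sum_range_succ]
      simp only [smul_eq_mul]
      ring
  rw [hprod, ← mul_assoc]
  congr 1
  ext n
  simp only [map_sum, PowerSeries.coeff_rescale, PowerSeries.coeff_C_mul, Lp, PowerSeries.coeff_mk]
  rw [← map_sum, PowerSeries.coeff_C_mul, PowerSeries.coeff_mk, ← Finset.sum_mul]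
  split_ifs with h
  · obtain ⟨j, rfl⟩ := h
    rw [mul_one, mul_one, ← sum_cyclic ht j]
    refine Finset.sum_congr rfl fun i _ => ?_
    rw [← pow_mul, ← pow_add]
  · simp

end PRat

namespace PRat

lemma exists_zeta (p : ℕ) [hp : Fact p.Prime] :
    ∃ (ζ : PadicAlgCl p), IsPrimitiveRoot ζ p ∧ 0 < ‖ζ - 1‖ ∧ ‖ζ - 1‖ < 1 := by
  haveI : NeZero (p : PadicAlgCl p) := ⟨by exact_mod_cast hp.out.ne_zero⟩
  haveI : NeZero p := ⟨hp.out.ne_zero⟩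
  obtain ⟨ζ, hζ⟩ := HasEnoughRootsOfUnity.exists_primitiveRoot (PadicAlgCl p) p
  refine ⟨ζ, hζ, norm_pos_iff.2 (sub_ne_zero.2 (hζ.ne_one hp.out.one_lt)), ?_⟩
  haveI : CharP (kap (PadicAlgCl p)) p := charP_kap p _
  have h1 : ‖ζ‖ ≤ 1 := by
    have := congrArg norm hζ.pow_eq_one
    rw [norm_pow, norm_one] at this
    exact ((pow_eq_one_iff_of_nonneg (norm_nonneg _) hp.out.ne_zero).1 this).le
  let z : OK (PadicAlgCl p) := ⟨ζ, h1⟩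
  have h2 : IsLocalRing.residue _ z = IsLocalRing.residue _ 1 := by
    rw [← sub_eq_zero]
    have : (IsLocalRing.residue _ z - IsLocalRing.residue _ (1 : OK (PadicAlgCl p))) ^ p = 0 := by
      rw [sub_pow_char, ← map_pow, show z ^ p = 1 from Subtype.ext hζ.pow_eq_one]
      simp
    exact pow_eq_zero_iff hp.out.ne_zero |>.1 this
  exact (residue_eq z 1).1 h2

theorem exists_splitting (p : ℕ) [hp : Fact p.Prime] :
    ∃ (ρ : ℝ) (ζ : PadicAlgCl p), 0 < ρ ∧ ρ < 1 ∧ IsPrimitiveRoot ζ p ∧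
      ∀ D : ℕ, ∃ Θ : Polynomial (PadicAlgCl p), (∀ i, ‖Θ.coeff i‖ ≤ ρ ^ i) ∧
        ∀ m : ℕ, m ≠ 0 → ∀ ω : GaloisField p m → PadicAlgCl p, IsTeich p m ω → ∀ x,
          ‖∏ i ∈ Finset.range m, Θ.eval (ω x ^ p ^ i) -
            ζ ^ (Algebra.trace (ZMod p) (GaloisField p m) x).val‖ ≤ ρ ^ D := by
  obtain ⟨ζ, hζ, hρ0, hρ1⟩ := exists_zeta p
  set ρ := ‖ζ - 1‖ with hρ
  have hp0 : p ≠ 0 := hp.out.ne_zero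
  refine ⟨ρ, ζ, hρ0, hρ1, hζ, fun D => ?_⟩
  set E := AH p (PadicAlgCl p) with hEdef
  have hE : PSInt E := AH_PSInt p (PadicAlgCl p)
  obtain ⟨γ, hγ, hγζ⟩ := exists_gamma hE (AH_zero p _) (AH_one p _) hρ1.le hρ.ge D (D + 1)
  have hγ1 : ‖γ‖ ≤ 1 := hγ.trans hρ1.le
  set D' := D + 2 with hD'
  have hζ1 : ‖ζ‖ ≤ 1 := by
    have := congrArg norm hζ.pow_eq_one
    rw [norm_pow, norm_one] at this
    exact ((pow_eq_one_iff_of_nonneg (norm_nonneg _) hp0).1 this).le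
  refine ⟨∑ n ∈ Finset.range D', Polynomial.monomial n (PowerSeries.coeff n E * γ ^ n),
    fun i => ?_, fun m hm ω hω x => ?_⟩
  · simp only [Polynomial.finsetSum_coeff, Polynomial.coeff_monomial, Finset.sum_ite_eq']
    split_ifs
    · rw [norm_mul, norm_pow]
      calc _ ≤ 1 * ρ ^ i := by
            gcongr
            exact hE i
        _ = _ := one_mul _
    · simp; positivity
  · have hΘ : ∀ T : PadicAlgCl p, (∑ n ∈ Finset.range D',
        Polynomial.monomial n (PowerSeries.coeff n E * γ ^ n)).eval T =
        ev D' γ (PowerSeries.rescale T E) := by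
      intro T
      rw [ev_eq, Polynomial.eval_finsetSum]
      refine Finset.sum_congr rfl fun n _ => ?_
      rw [Polynomial.eval_monomial, PowerSeries.coeff_rescale]
      ring
    simp only [hΘ]
    set P := ∏ i ∈ Finset.range m, PowerSeries.rescale (ω x ^ p ^ i) E with hP
    obtain ⟨σ, hσ, hσt⟩ := teich_trace hm hω x
    set t := (Algebra.trace (ZMod p) (GaloisField p m) x).val with ht
    -- the product
    have hωi : ∀ i, PSInt (PowerSeries.rescale (ω x ^ p ^ i) E) := by
      intro i n
      rw [PowerSeries.coeff_rescale, norm_mul, norm_pow, norm_pow]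
      exact mul_le_one₀ (pow_le_one₀ (by positivity) (pow_le_one₀ (norm_nonneg _)
        (hω.norm_le hm x))) (norm_nonneg _) (hE n)
    have hA := ev_prod (Finset.range m) _ (fun i _ => hωi i) hγ hρ1.le D' (by omega)
    rw [← hP] at hA
    -- polynomials
    have hpoly := fun n => exists_poly_coeff (k := PadicAlgCl p) p hp0 n
    choose f hf using hpoly
    have hP0 : PowerSeries.coeff 0 P = 1 := by
      have h0 := AH_zero p (PadicAlgCl p)
      rw [PowerSeries.coeff_zero_eq_constantCoeff] at h0 ⊢
      rw [hP, map_prod]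
      refine Finset.prod_eq_one fun i _ => ?_
      rw [← PowerSeries.coeff_zero_eq_constantCoeff, PowerSeries.coeff_rescale, pow_zero, one_mul,
        PowerSeries.coeff_zero_eq_constantCoeff, h0]
    have hPn : ∀ n, PowerSeries.coeff n P =
        (f n).eval (algebraMap ℚ_[p] (PadicAlgCl p) (σ : ℚ_[p])) := fun n =>
      hf n _ P hP0 (by rw [hσ]; exact Dt_prod_rescale p hp0 (hω.pow x))
    have hEn : ∀ (s n : ℕ), PowerSeries.coeff n (E ^ s) = (f n).eval (s : PadicAlgCl p) := by
      intro s n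
      refine hf n _ _ ?_ ?_
      · have h0 := AH_zero p (PadicAlgCl p)
        rw [PowerSeries.coeff_zero_eq_constantCoeff] at h0 ⊢
        rw [map_pow, h0, one_pow]
      · rw [Dt_pow _ _ (Dt_AH p hp0 _) s, map_natCast, mul_assoc]
    -- approximate σ by a natural number
    have hcont : ∀ n, Continuous (fun z : ℤ_[p] =>
        (f n).eval (algebraMap ℚ_[p] (PadicAlgCl p) (z : ℚ_[p]))) := by
      intro n
      exact (f n).continuous.comp ((algebraMapCLM ℚ_[p] (PadicAlgCl p)).continuous.comp
        continuous_subtype_val)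
    have hopen : IsOpen {z : ℤ_[p] | (∀ n ∈ Finset.range D',
        ‖(f n).eval (algebraMap ℚ_[p] (PadicAlgCl p) (σ : ℚ_[p])) -
          (f n).eval (algebraMap ℚ_[p] (PadicAlgCl p) (z : ℚ_[p]))‖ < ρ ^ D) ∧ ‖z - σ‖ < 1} := by
      apply IsOpen.and
      · have : {z : ℤ_[p] | ∀ n ∈ Finset.range D',
          ‖(f n).eval (algebraMap ℚ_[p] (PadicAlgCl p) (σ : ℚ_[p])) -
          (f n).eval (algebraMap ℚ_[p] (PadicAlgCl p) (z : ℚ_[p]))‖ < ρ ^ D} =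
          ⋂ n ∈ Finset.range D', {z : ℤ_[p] |
          ‖(f n).eval (algebraMap ℚ_[p] (PadicAlgCl p) (σ : ℚ_[p])) -
          (f n).eval (algebraMap ℚ_[p] (PadicAlgCl p) (z : ℚ_[p]))‖ < ρ ^ D} := by
            ext z; simp
        rw [this]
        refine isOpen_biInter_finset fun n _ => ?_
        exact isOpen_lt (continuous_const.sub (hcont n)).norm continuous_const
      · exact isOpen_lt (continuous_id.sub continuous_const).norm continuous_const
    obtain ⟨s, hs⟩ := PadicInt.denseRange_natCast.exists_mem_open hopen
      ⟨σ, fun n _ => by simp; positivity, by simp⟩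
    obtain ⟨hs1, hs2⟩ := hs
    have hB : ‖ev D' γ P - ev D' γ (E ^ s)‖ ≤ ρ ^ D := by
      rw [ev_eq, ev_eq, ← Finset.sum_sub_distrib]
      refine norm_sum_le_of _ _ (by positivity) fun n hn => ?_
      rw [hPn, hEn, ← sub_mul, norm_mul, norm_pow]
      have h1 := hs1 n hn
      rw [PadicInt.coe_natCast, map_natCast] at h1
      calc _ ≤ ρ ^ D * 1 := by
            gcongr
            exact pow_le_one₀ (norm_nonneg _) hγ1
        _ = _ := mul_one _
    have hC := ev_prod (Finset.range s) (fun _ => E) (fun i _ => hE) hγ hρ1.le D' (by omega)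
    rw [Finset.prod_const, Finset.prod_const, Finset.card_range] at hC
    have hρD : ρ ^ D' ≤ ρ ^ D := pow_le_pow_of_le_one hρ0.le hρ1.le (by omega)
    have hF : ‖ev D' γ E ^ s - ζ ^ s‖ ≤ ρ ^ D := by
      have := norm_prod_sub_prod (Finset.range s) (fun _ => ev D' γ E) (fun _ => ζ)
        (C := ρ ^ D) (by positivity) (fun _ _ => hγζ.trans hρD)
        (fun _ _ => hE.ev_norm hγ1 D') (fun _ _ => hζ1)
      simpa using this
    have hst : ζ ^ s = ζ ^ t := by
      have h1 : ‖((s : ℕ) : ℤ_[p]) - (t : ℕ)‖ < 1 := by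
        have := norm_add_le_of (C := max ‖((s : ℕ) : ℤ_[p]) - σ‖ ‖σ - (t : ℕ)‖)
          (le_max_left _ _) (le_max_right _ _)
        rw [sub_add_sub_cancel] at this
        exact this.trans_lt (max_lt hs2 hσt)
      have h2 : (((s : ℤ) - t : ℤ) : ℤ_[p]) = ((s : ℕ) : ℤ_[p]) - (t : ℕ) := by push_cast; rfl
      rw [← h2, PadicInt.norm_intCast_lt_one_iff] at h1
      have h3 : ζ ^ (s : ℤ) = ζ ^ (t : ℤ) := by
        obtain ⟨c, hc⟩ := h1
        rw [show (s : ℤ) = t + p * c by linarith, zpow_add₀ (hζ.ne_zero hp0), zpow_mul,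
          zpow_natCast ζ p, hζ.pow_eq_one, one_zpow, mul_one]
      exact_mod_cast h3
    rw [← hst]
    have hA' := hA.trans hρD
    rw [norm_sub_rev] at hA'
    have := norm_add_le_of hA' (norm_add_le_of hB (norm_add_le_of (hC.trans hρD) hF))
    simpa only [sub_add_sub_cancel] using this

end PRat

namespace PRat
open MvPolynomial

section Torus
variable {p : ℕ} [hp : Fact p.Prime]

lemma card_gf {m : ℕ} (hm : m ≠ 0) [Fintype (GaloisField p m)] :
    Fintype.card (GaloisField p m) = p ^ m := by
  rw [← Nat.card_eq_fintype_card, GaloisField.card p m hm]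

/-- the set of nonzero Teichmüller representatives -/
noncomputable def teichSet {K : Type*} {m : ℕ} (ω : GaloisField p m → K) : Finset K := by
  classical
  letI := Fintype.ofFinite (GaloisField p m)
  exact (Finset.univ.filter (fun x => x ≠ 0)).image ω

lemma sum_teichSet {K : Type*} [NormedField K] [NormedAlgebra ℚ_[p] K]
    [IsUltrametricDist K] {m : ℕ} (hm : m ≠ 0) {ω : GaloisField p m → K}
    (h : IsTeich p m ω) (n : ℕ) :
    ∑ τ ∈ teichSet ω, τ ^ n = if (p ^ m - 1) ∣ n then ((p ^ m - 1 : ℕ) : K) else 0 := by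
  classical
  letI := Fintype.ofFinite (GaloisField p m)
  unfold teichSet
  rw [Finset.sum_image (fun x _ y _ hxy => h.inj hxy)]
  let f : (GaloisField p m)ˣ →* K :=
    { toFun := fun u => ω u ^ n
      map_one' := by simp [h.one]
      map_mul' := fun x y => by simp [h.mul, mul_pow] }
  have h1 : ∑ x ∈ Finset.univ.filter (fun x : GaloisField p m => x ≠ 0), ω x ^ n = ∑ u, f u := by
    symm
    refine Finset.sum_bij (fun u _ => (u : GaloisField p m)) ?_ ?_ ?_ ?_
    · intro u _; simp
    · intro u _ v _ huv; exact Units.ext huv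
    · intro x hx; exact ⟨Units.mk0 x (by simpa using hx), by simp, rfl⟩
    · intro u _; rfl
  have h2 := sum_hom_units f
  have h3 : f = 1 ↔ (p ^ m - 1) ∣ n := by
    rw [← card_gf (p := p) hm, ← FiniteField.forall_pow_eq_one_iff]
    constructor
    · intro hf u
      have := DFunLike.congr_fun hf u
      have h4 : ω ((u : GaloisField p m) ^ n) = ω 1 := by
        rw [h.map_pow, h.one]; exact this
      exact Units.ext (by simpa using h.inj h4)
    · intro hf
      ext u
      change ω u ^ n = 1
      rw [← h.map_pow, ← Units.val_pow_eq_pow_val, hf u]; simp [h.one]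
  rw [Finset.sum_congr (s₂ := Finset.univ.filter (fun x : GaloisField p m => x ≠ 0)) _ (fun _ _ => rfl)]
  · rw [h1, h2, Fintype.card_units, card_gf hm]
    simp [h3]
  · ext x; simp

/-- additive character -/
noncomputable def psi {K : Type*} [Field K] (ζ : K) (m : ℕ) (x : GaloisField p m) : K :=
  ζ ^ (Algebra.trace (ZMod p) (GaloisField p m) x).val

lemma psi_eq {K : Type*} [Field K] {ζ : K} (hζ : ζ ^ p = 1) {m : ℕ} (x : GaloisField p m) :
    psi ζ m x = ((AddChar.zmodChar p hζ).compAddMonoidHom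
      (Algebra.trace (ZMod p) (GaloisField p m)).toAddMonoidHom) x := by
  simp [psi, AddChar.zmodChar_apply]

lemma psi_add {K : Type*} [Field K] {ζ : K} (hζ : ζ ^ p = 1) {m : ℕ} (x y : GaloisField p m) :
    psi ζ m (x + y) = psi ζ m x * psi ζ m y := by
  simp only [psi_eq hζ, AddChar.map_add_eq_mul]

lemma psi_zero {K : Type*} [Field K] {ζ : K} (hζ : ζ ^ p = 1) {m : ℕ} :
    psi ζ m (0 : GaloisField p m) = 1 := by
  simp only [psi_eq hζ, AddChar.map_zero_eq_one]

lemma psi_nsmul {K : Type*} [Field K] {ζ : K} (hζ : ζ ^ p = 1) {m : ℕ} (n : ℕ)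
    (x : GaloisField p m) : psi ζ m (n • x) = psi ζ m x ^ n := by
  simp only [psi_eq hζ, AddChar.map_nsmul_eq_pow]

lemma psi_sum {K : Type*} [Field K] {ζ : K} (hζ : ζ ^ p = 1) {m : ℕ} {ι : Type*} (s : Finset ι)
    (f : ι → GaloisField p m) : psi ζ m (∑ i ∈ s, f i) = ∏ i ∈ s, psi ζ m (f i) := by
  classical
  induction s using Finset.induction_on with
  | empty => simp [psi_zero hζ]
  | insert i s hi ih => rw [Finset.sum_insert hi, Finset.prod_insert hi, psi_add hζ, ih]

lemma sum_psi_mul {K : Type*} [Field K] {ζ : K} (hζ : IsPrimitiveRoot ζ p) {m : ℕ} (hm : m ≠ 0)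
    [Fintype (GaloisField p m)] [DecidableEq (GaloisField p m)]
    (b : GaloisField p m) : ∑ x, psi ζ m (x * b) = if b = 0 then ((p ^ m : ℕ) : K) else 0 := by
  have hpr : (AddChar.zmodChar p hζ.pow_eq_one).IsPrimitive :=
    AddChar.zmodChar_primitive_of_primitive_root p hζ
  have : NeZero p := ⟨hp.out.ne_zero⟩
  have hprim : ((AddChar.zmodChar p hζ.pow_eq_one).compAddMonoidHom
      (Algebra.trace (ZMod p) (GaloisField p m)).toAddMonoidHom).IsPrimitive := by
    apply AddChar.IsPrimitive.of_ne_one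
    intro hcon
    obtain ⟨a, ha⟩ := Algebra.trace_surjective (ZMod p) (GaloisField p m) 1
    have h1 := DFunLike.congr_fun hcon a
    have h2 : AddChar.zmodChar p hζ.pow_eq_one (1 : ZMod p) = 1 := by
      have : ((AddChar.zmodChar p hζ.pow_eq_one).compAddMonoidHom
        (Algebra.trace (ZMod p) (GaloisField p m)).toAddMonoidHom) a =
        AddChar.zmodChar p hζ.pow_eq_one (1 : ZMod p) := by simp [ha]
      rw [← this, h1]; simp
    rw [hpr.zmod_char_eq_one_iff] at h2
    exact one_ne_zero h2
  have := AddChar.sum_mulShift b hprim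
  simp only [psi_eq hζ.pow_eq_one]
  rw [this, card_gf hm]
  split_ifs <;> simp

end Torus

section Weighted
variable {K : Type*} [NormedField K] [IsUltrametricDist K] {N : ℕ}

/-- coefficients decay like `η^|a|` -/
def Decay (η : ℝ) (H : MvPolynomial (Fin N) K) : Prop := ∀ a, ‖coeff a H‖ ≤ η ^ a.degree

lemma Decay.one {η : ℝ} (h0 : 0 < η) : Decay η (1 : MvPolynomial (Fin N) K) := by
  classical
  intro a
  rw [coeff_one]
  split_ifs with h
  · subst h; simp
  · simp; positivity

lemma Decay.mul {η : ℝ} (h0 : 0 < η) {F G : MvPolynomial (Fin N) K} (hF : Decay η F)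
    (hG : Decay η G) : Decay η (F * G) := by
  classical
  intro a
  rw [coeff_mul]
  refine norm_sum_le_of _ _ (by positivity) fun x hx => ?_
  rw [Finset.HasAntidiagonal.mem_antidiagonal] at hx
  rw [norm_mul, ← hx, map_add, pow_add]
  exact mul_le_mul (hF _) (hG _) (norm_nonneg _) (by positivity)

lemma Decay.pow {η : ℝ} (h0 : 0 < η) {F : MvPolynomial (Fin N) K} (hF : Decay η F) (n : ℕ) :
    Decay η (F ^ n) := by
  induction n with
  | zero => simpa using Decay.one h0
  | succ n ih => rw [pow_succ]; exact ih.mul h0 hF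

lemma Decay.prod {η : ℝ} (h0 : 0 < η) {ι : Type*} (s : Finset ι) (F : ι → MvPolynomial (Fin N) K)
    (hF : ∀ i ∈ s, Decay η (F i)) : Decay η (∏ i ∈ s, F i) := by
  classical
  induction s using Finset.induction_on with
  | empty => simpa using Decay.one h0
  | insert i s hi ih =>
    rw [Finset.prod_insert hi]
    exact (hF i (by simp)).mul h0 (ih fun j hj => hF j (by simp [hj]))

lemma decay_aeval {η ρ : ℝ} (h0 : 0 < η) (h1 : η < 1) {d : ℕ} (hη : η ^ d = ρ) (Θ : Polynomial K)
    (hΘ : ∀ i, ‖Θ.coeff i‖ ≤ ρ ^ i) (u : Fin N →₀ ℕ) (hu : u.degree ≤ d) :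
    Decay η (Polynomial.aeval (monomial u (1 : K)) Θ) := by
  classical
  intro a
  rw [Polynomial.aeval_eq_sum_range, coeff_sum]
  refine norm_sum_le_of _ _ (by positivity) fun i _ => ?_
  rw [monomial_pow, one_pow, coeff_smul, coeff_monomial, smul_eq_mul]
  split_ifs with h
  · rw [mul_one, ← h]
    refine (hΘ i).trans ?_
    rw [← hη, ← pow_mul, map_nsmul, smul_eq_mul]
    apply pow_le_pow_of_le_one h0.le h1.le
    rw [mul_comm]; exact Nat.mul_le_mul_right _ hu
  · simp; positivity

lemma decay_dworkMat {η : ℝ} (h0 : 0 < η) (h1 : η < 1) {p : ℕ} (hp : 2 ≤ p) {B : ℕ}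
    {H : MvPolynomial (Fin N) K} (hH : Decay η H) (i j : box N B) :
    ‖dworkMat p H B i j‖ * η ^ (j : Fin N →₀ ℕ).degree ≤ η ^ (2 * (i : Fin N →₀ ℕ).degree) ∧
    ‖dworkMat p H B i j‖ ≤ 1 := by
  classical
  simp only [dworkMat, Matrix.of_apply]
  rw [coeff_mul_monomial']
  split_ifs with h
  · rw [mul_one]
    constructor
    · calc _ ≤ η ^ (p • (i : Fin N →₀ ℕ) - j : Fin N →₀ ℕ).degree * η ^ (j : Fin N →₀ ℕ).degree := by
            gcongr; exact hH _
        _ = η ^ (p • (i : Fin N →₀ ℕ)).degree := by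
            rw [← pow_add, ← map_add, tsub_add_cancel_of_le h]
        _ ≤ _ := by
            rw [map_nsmul, smul_eq_mul]
            exact pow_le_pow_of_le_one h0.le h1.le (Nat.mul_le_mul_right _ hp)
    · exact (hH _).trans (pow_le_one₀ h0.le h1.le)
  · simp; positivity
end Weighted

end PRat

namespace PRat
open MvPolynomial

section TorusApprox
variable {p : ℕ} [hp : Fact p.Prime]

/-- the splitting property -/
def Splits (p : ℕ) [hp : Fact p.Prime] (ρ : ℝ) (ζ : PadicAlgCl p) : Prop :=
  ∀ D, ∃ Θ : Polynomial (PadicAlgCl p), (∀ i, ‖Θ.coeff i‖ ≤ ρ ^ i) ∧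
    ∀ m, m ≠ 0 → ∀ ω : GaloisField p m → PadicAlgCl p, IsTeich p m ω →
    ∀ x, ‖∏ i ∈ Finset.range m, Θ.eval (ω x ^ p ^ i) - psi ζ m x‖ ≤ ρ ^ D

lemma norm_q_sub_one (m : ℕ) (hm : m ≠ 0) : ‖((p ^ m - 1 : ℕ) : PadicAlgCl p)‖ = 1 := by
  rw [Nat.cast_sub (Nat.one_le_pow _ _ hp.out.pos)]
  push_cast
  have h1 : ‖((p : PadicAlgCl p)) ^ m‖ < 1 := by
    rw [norm_pow]; exact pow_lt_one₀ (norm_nonneg _) (norm_p_lt p _) hm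
  rw [sub_eq_add_neg, IsUltrametricDist.norm_add_eq_max_of_norm_ne_norm]
  · simpa using h1.le
  · simpa using h1.ne

variable {N : ℕ}

/-- evaluation of a polynomial given by natural number coefficients -/
def pval {R : Type*} [CommSemiring R] (s : Finset (Fin N →₀ ℕ)) (c : (Fin N →₀ ℕ) → ℕ)
    (x : Fin N → R) : R := ∑ a ∈ s, c a • ∏ i, x i ^ a i

open Classical in
/-- sum over the torus -/
noncomputable def torusSum (ζ : PadicAlgCl p) (s : Finset (Fin N →₀ ℕ)) (c : (Fin N →₀ ℕ) → ℕ)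
    (m : ℕ) : PadicAlgCl p :=
  letI := Fintype.ofFinite (GaloisField p m)
  ∑ x ∈ Fintype.piFinset (fun _ : Fin N => Finset.univ.filter (fun y : GaloisField p m => y ≠ 0)),
    psi ζ m (pval s c x)

lemma norm_psi {ζ : PadicAlgCl p} (hζ : ζ ^ p = 1) {m : ℕ} (x : GaloisField p m) :
    ‖psi ζ m x‖ = 1 := by
  have : ‖ζ‖ = 1 := by
    have h := congrArg norm hζ
    rw [norm_pow, norm_one] at h
    exact (pow_eq_one_iff_of_nonneg (norm_nonneg _) hp.out.ne_zero).mp h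
  rw [psi, norm_pow, this, one_pow]

theorem torus_approx {ρ : ℝ} (hρ0 : 0 < ρ) (hρ1 : ρ < 1) {ζ : PadicAlgCl p}
    (hζ : IsPrimitiveRoot ζ p) (hsp : Splits p ρ ζ)
    (s : Finset (Fin N →₀ ℕ)) (c : (Fin N →₀ ℕ) → ℕ) :
    Approx (fun m => torusSum ζ s c m / ((p ^ m - 1 : ℕ) : PadicAlgCl p) ^ N) := by
  classical
  set d := (s.sup fun a => a.degree) + 1 with hd
  have hζ1 := hζ.pow_eq_one
  set η : ℝ := ρ ^ ((d : ℝ)⁻¹) with hη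
  have hη0 : 0 < η := Real.rpow_pos_of_pos hρ0 _
  have hη1 : η < 1 := Real.rpow_lt_one hρ0.le hρ1 (by positivity)
  have hηd : η ^ d = ρ := Real.rpow_inv_natCast_pow hρ0.le (by omega)
  refine approx_of_matrices p (PadicAlgCl p) η hη0 hη1 (fun n => (box N n).card) ρ hρ1 _ ?_
  intro D
  obtain ⟨Θ, hΘ, hΘ'⟩ := hsp D
  set H : MvPolynomial (Fin N) (PadicAlgCl p) :=
    ∏ a ∈ s, (Polynomial.aeval (monomial a (1 : PadicAlgCl p)) Θ) ^ c a with hH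
  have hdec : Decay η H := Decay.prod hη0 _ _ fun a ha => Decay.pow hη0 (decay_aeval hη0 hη1 hηd Θ hΘ a
    ((Finset.le_sup (f := fun a => Finsupp.degree a) ha).trans (Nat.le_succ _))) _
  set B := H.support.sup fun a => a.degree with hB
  refine ⟨box N B, inferInstance, inferInstance, fun v => (v : Fin N →₀ ℕ).degree, dworkMat p H B,
    ?_, fun i j => (decay_dworkMat hη0 hη1 hp.out.two_le hdec i j).1,
    fun i j => (decay_dworkMat hη0 hη1 hp.out.two_le hdec i j).2, ?_⟩
  · intro n
    refine Finset.card_le_card_of_injOn (fun v => (v : Fin N →₀ ℕ)) ?_ ?_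
    · intro v hv
      simp only [Finset.coe_filter, Finset.mem_univ, true_and] at hv
      exact mem_box.mpr fun i => (Finsupp.le_degree i _).trans hv
    · intro v _ w _ h; exact Subtype.ext h
  · intro m hm
    have hm0 : m ≠ 0 := by omega
    letI := Fintype.ofFinite (GaloisField p m)
    obtain ⟨ω, hω⟩ := exists_teich p (PadicAlgCl p) hm0
    obtain ⟨w1, w2, w3, w4, w5, w6, w7⟩ := hω
    have hω : IsTeich p m ω := ⟨w1, w2, w3, w4, w5, w6, w7⟩
    have htr := trace_formula p hp.out.two_le H B (fun a ha i => (Finsupp.le_degree i a).trans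
      ((Finset.le_sup (f := fun a => Finsupp.degree a) ha).trans
      (Nat.le_mul_of_pos_right _ (by have := hp.out.two_le; omega)))) m hm (teichSet ω)
      (sum_teichSet hm0 hω)
    have hne : ((p ^ m - 1 : ℕ) : PadicAlgCl p) ≠ 0 := by
      rw [← norm_ne_zero_iff, norm_q_sub_one m hm0]; exact one_ne_zero
    have hreidx : ∑ w ∈ Fintype.piFinset (fun _ : Fin N => teichSet ω),
        ∏ i ∈ Finset.range m, eval (fun j => w j ^ p ^ i) H =
        ∑ x ∈ Fintype.piFinset (fun _ : Fin N =>
          Finset.univ.filter (fun y : GaloisField p m => y ≠ 0)),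
        ∏ i ∈ Finset.range m, eval (fun j => ω (x j) ^ p ^ i) H := by
      symm
      refine Finset.sum_bij (fun x _ => fun j => ω (x j)) ?_ ?_ ?_ ?_
      · intro x hx
        rw [Fintype.mem_piFinset] at hx ⊢
        intro j
        have := hx j
        simp only [teichSet, Finset.mem_image]
        exact ⟨x j, by simpa using this, rfl⟩
      · intro x _ y _ h
        funext j
        exact hω.inj (congrFun h j)
      · intro w hw
        rw [Fintype.mem_piFinset] at hw
        have : ∀ j, ∃ y : GaloisField p m, y ≠ 0 ∧ ω y = w j := by
          intro j
          have := hw j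
          simp only [teichSet, Finset.mem_image] at this
          obtain ⟨y, hy, h⟩ := this
          exact ⟨y, by simpa using hy, h⟩
        choose y hy1 hy2 using this
        exact ⟨y, by rw [Fintype.mem_piFinset]; intro j; simpa using hy1 j, funext hy2⟩
      · intro x _; rfl
    have hterm : ∀ x : Fin N → GaloisField p m,
        ‖psi ζ m (pval s c x) - ∏ i ∈ Finset.range m, eval (fun j => ω (x j) ^ p ^ i) H‖ ≤ ρ ^ D := by
      intro x
      have hρD : ρ ^ D ≤ 1 := pow_le_one₀ hρ0.le hρ1.le
      have e1 : ∏ i ∈ Finset.range m, eval (fun j => ω (x j) ^ p ^ i) H =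
          ∏ a ∈ s, ∏ _k ∈ Finset.range (c a), (∏ i ∈ Finset.range m,
            Θ.eval (ω (∏ j, x j ^ a j) ^ p ^ i)) := by
        simp only [hH, map_prod, map_pow]
        rw [Finset.prod_comm]
        refine Finset.prod_congr rfl fun a _ => ?_
        rw [Finset.prod_const, Finset.card_range, ← Finset.prod_pow]
        refine Finset.prod_congr rfl fun i _ => ?_
        congr 1
        rw [← Polynomial.eval_map_algebraMap, Polynomial.eval_map, Polynomial.hom_eval₂,
          ← Polynomial.eval_map]
        have : (eval fun j => ω (x j) ^ p ^ i).comp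
          (algebraMap (PadicAlgCl p) (MvPolynomial (Fin N) (PadicAlgCl p))) = RingHom.id _ := by
          ext y; simp [MvPolynomial.algebraMap_eq]
        rw [this, Polynomial.map_id, eval_monomial, one_mul]
        congr 1
        rw [Finsupp.prod_fintype _ _ (by simp)]
        have : ∀ t : Finset (Fin N), ω (∏ j ∈ t, x j ^ a j) = ∏ j ∈ t, ω (x j) ^ a j := by
          intro t
          induction t using Finset.induction_on with
          | empty => simp [hω.one]
          | insert j t hj ih => rw [Finset.prod_insert hj, Finset.prod_insert hj, hω.mul,
              hω.map_pow, ih]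
        rw [this, ← Finset.prod_pow]
        exact Finset.prod_congr rfl fun j _ => by rw [← pow_mul, ← pow_mul, mul_comm]
      have e2 : psi ζ m (pval s c x) =
          ∏ a ∈ s, ∏ _k ∈ Finset.range (c a), psi ζ m (∏ j, x j ^ a j) := by
        rw [pval, psi_sum hζ1]
        refine Finset.prod_congr rfl fun a _ => ?_
        rw [psi_nsmul hζ1, Finset.prod_const, Finset.card_range]
      have hle : ∀ y : GaloisField p m, ‖∏ i ∈ Finset.range m, Θ.eval (ω y ^ p ^ i)‖ ≤ 1 := by
        intro y
        have h1 := hΘ' m hm0 ω hω y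
        have := norm_add_le_of (h1.trans hρD) (norm_psi hζ1 y).le
        simpa using this
      rw [e1, e2]
      have hD0 : 0 ≤ ρ ^ D := by positivity
      refine norm_prod_sub_prod s _ _ hD0 (fun a _ => ?_) (fun a _ => ?_) (fun a _ => ?_)
      · refine norm_prod_sub_prod _ _ _ hD0 (fun k _ => ?_) (fun k _ => ?_) (fun k _ => ?_)
        · rw [norm_sub_rev]; exact hΘ' m hm0 ω hω _
        · exact (norm_psi hζ1 _).le
        · exact hle _
      · rw [norm_prod]; exact Finset.prod_le_one (fun _ _ => norm_nonneg _) fun _ _ => (norm_psi hζ1 _).le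
      · rw [norm_prod]; exact Finset.prod_le_one (fun _ _ => norm_nonneg _) fun _ _ => hle _
    rw [hreidx] at htr
    have : (dworkMat p H B ^ m).trace = (∑ x ∈ Fintype.piFinset (fun _ : Fin N =>
          Finset.univ.filter (fun y : GaloisField p m => y ≠ 0)),
        ∏ i ∈ Finset.range m, eval (fun j => ω (x j) ^ p ^ i) H) / ((p ^ m - 1 : ℕ) : PadicAlgCl p) ^ N := by
      rw [htr]; field_simp
    rw [this, torusSum, ← sub_div, norm_div, norm_pow, norm_q_sub_one m hm0, one_pow, div_one,
      ← Finset.sum_sub_distrib]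
    exact norm_sum_le_of _ _ (by positivity) fun x _ => hterm x

end TorusApprox
end PRat

namespace PRat
open MvPolynomial

section Full
variable {p : ℕ} [hp : Fact p.Prime] {N : ℕ}

lemma pval_restrict {R : Type*} [CommRing R] (s : Finset (Fin N →₀ ℕ)) (c : (Fin N →₀ ℕ) → ℕ)
    (I : Finset (Fin N)) (w : Fin N → R) :
    pval (s.filter fun a => a.support ⊆ I) c w = pval s c (fun i => if i ∈ I then w i else 0) := by
  classical
  unfold pval
  rw [Finset.sum_filter]
  refine Finset.sum_congr rfl fun a _ => ?_
  split_ifs with h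
  · congr 1
    refine Finset.prod_congr rfl fun i _ => ?_
    by_cases hi : i ∈ I
    · simp only [if_pos hi]
    · have : a i = 0 := by
        by_contra h0
        exact hi (h (Finsupp.mem_support_iff.mpr h0))
      rw [this, pow_zero, pow_zero]
  · rw [Finset.not_subset] at h
    obtain ⟨i, hi, hiI⟩ := h
    rw [Finset.prod_eq_zero (Finset.mem_univ i), smul_zero]
    simp only [if_neg hiI]
    rw [zero_pow (Finsupp.mem_support_iff.mp hi)]

open Classical in
lemma torusSum_restrict (ζ : PadicAlgCl p) (s : Finset (Fin N →₀ ℕ)) (c : (Fin N →₀ ℕ) → ℕ)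
    {m : ℕ} (hm : m ≠ 0) [Fintype (GaloisField p m)] (I : Finset (Fin N)) :
    torusSum ζ (s.filter fun a => a.support ⊆ I) c m =
      ((p ^ m - 1 : ℕ) : PadicAlgCl p) ^ (N - I.card) *
      ∑ x ∈ Finset.univ.filter (fun x : Fin N → GaloisField p m =>
        Finset.univ.filter (fun i => x i ≠ 0) = I), psi ζ m (pval s c x) := by
  set T : Finset (GaloisField p m) := Finset.univ.filter (fun y => y ≠ 0) with hT
  have hTc : T.card = p ^ m - 1 := by
    have : T = Finset.univ.erase 0 := by ext y; simp [hT]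
    rw [this, Finset.card_erase_of_mem (Finset.mem_univ _), Finset.card_univ, card_gf hm]
  have h0 : torusSum ζ (s.filter fun a => a.support ⊆ I) c m =
    ∑ w ∈ Fintype.piFinset (fun _ : Fin N => T),
      psi ζ m (pval s c (fun i => if i ∈ I then w i else 0)) := by
    unfold torusSum
    simp only [pval_restrict]
    refine Finset.sum_congr ?_ fun _ _ => rfl
    ext w; simp [hT]
  rw [h0, ← Finset.sum_fiberwise_of_maps_to (s := Fintype.piFinset (fun _ : Fin N => T))
    (t := Finset.univ.filter (fun x : Fin N → GaloisField p m =>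
        Finset.univ.filter (fun i => x i ≠ 0) = I)) (g := fun w => fun i => if i ∈ I then w i else 0),
    Finset.mul_sum]
  · refine Finset.sum_congr rfl fun x hx => ?_
    simp only [Finset.mem_filter, Finset.mem_univ, true_and] at hx
    rw [Finset.sum_congr rfl (g := fun _ => psi ζ m (pval s c x))]
    · rw [Finset.sum_const, nsmul_eq_mul]
      congr 1
      have : (Fintype.piFinset (fun _ : Fin N => T)).filter
          (fun w => (fun i => if i ∈ I then w i else 0) = x) =
          Fintype.piFinset (fun i => if i ∈ I then {x i} else T) := by
        ext w
        simp only [Finset.mem_filter, Fintype.mem_piFinset, funext_iff]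
        constructor
        · rintro ⟨h1, h2⟩ i
          have := h2 i
          split_ifs with hi
          · simpa [hi] using this
          · exact h1 i
        · intro h
          refine ⟨fun i => ?_, fun i => ?_⟩
          · have := h i
            split_ifs at this with hi
            · rw [Finset.mem_singleton] at this
              rw [this]
              rw [← hx] at hi
              simpa [hT] using hi
            · exact this
          · have := h i
            split_ifs at this ⊢ with hi
            · simpa using this
            · rw [← hx] at hi
              simp at hi
              exact hi.symm
      rw [this, Fintype.card_piFinset]
      have h3 : ∀ i, (if i ∈ I then ({x i} : Finset (GaloisField p m)) else T).card =
        if i ∈ I then 1 else p ^ m - 1 := by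
        intro i; split_ifs <;> simp [hTc]
      simp only [h3]
      rw [Finset.prod_ite]
      simp only [Finset.prod_const_one, Finset.prod_const, one_mul]
      have h4 : (Finset.univ.filter fun i => i ∉ I).card = N - I.card := by
        have : (Finset.univ.filter fun i => i ∉ I) = Iᶜ := by ext i; simp
        rw [this, Finset.card_compl, Fintype.card_fin]
      rw [h4]; push_cast; rfl
    · intro w hw
      simp only [Finset.mem_filter] at hw
      rw [hw.2]
  · intro w hw
    rw [Fintype.mem_piFinset] at hw
    simp only [Finset.mem_filter, Finset.mem_univ, true_and]
    ext i
    have := hw i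
    simp [hT] at this
    simp [this]

open Classical in
/-- full exponential sum -/
noncomputable def fullSum (ζ : PadicAlgCl p) (s : Finset (Fin N →₀ ℕ)) (c : (Fin N →₀ ℕ) → ℕ)
    (m : ℕ) : PadicAlgCl p :=
  letI := Fintype.ofFinite (GaloisField p m)
  ∑ x : Fin N → GaloisField p m, psi ζ m (pval s c x)

theorem fullSum_approx {ρ : ℝ} (hρ0 : 0 < ρ) (hρ1 : ρ < 1) {ζ : PadicAlgCl p}
    (hζ : IsPrimitiveRoot ζ p) (hsp : Splits p ρ ζ)
    (s : Finset (Fin N →₀ ℕ)) (c : (Fin N →₀ ℕ) → ℕ) : Approx (fullSum ζ s c) := by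
  classical
  have h1 := Approx.sum (Finset.univ : Finset (Finset (Fin N))) _ (fun I _ =>
    (torus_approx hρ0 hρ1 hζ hsp (s.filter fun a => a.support ⊆ I) c).mul_sub_one_pow
      (p : PadicAlgCl p) (norm_p_lt p _).le I.card)
  refine h1.congr fun m hm => ?_
  have hm0 : m ≠ 0 := by omega
  letI := Fintype.ofFinite (GaloisField p m)
  have hne : ((p ^ m - 1 : ℕ) : PadicAlgCl p) ≠ 0 := by
    rw [← norm_ne_zero_iff, norm_q_sub_one m hm0]; exact one_ne_zero
  have hcast : (p : PadicAlgCl p) ^ m - 1 = ((p ^ m - 1 : ℕ) : PadicAlgCl p) := by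
    rw [Nat.cast_sub (Nat.one_le_pow _ _ hp.out.pos)]; simp
  unfold fullSum
  rw [← Finset.sum_fiberwise_of_maps_to (s := (Finset.univ : Finset (Fin N → GaloisField p m)))
    (t := Finset.univ) (g := fun x => Finset.univ.filter (fun i => x i ≠ 0)) (fun _ _ => Finset.mem_univ _)]
  refine Finset.sum_congr rfl fun I _ => ?_
  rw [torusSum_restrict ζ s c hm0 I, hcast]
  have hI : I.card ≤ N := by simpa using Finset.card_le_univ I
  rw [mul_div_assoc', ← mul_assoc, ← pow_add, Nat.add_sub_cancel' hI,
    mul_div_cancel_left₀ _ (pow_ne_zero _ hne)]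

/-- the affine point count -/
noncomputable def zeroCount (p : ℕ) [Fact p.Prime] {n r : ℕ} (h : Fin r → MvPolynomial (Fin n) ℤ)
    (m : ℕ) : ℕ := Nat.card {z : Fin n → GaloisField p m // ∀ j, aeval z (h j) = 0}

lemma exists_pval (p : ℕ) [hp : Fact p.Prime] (G : MvPolynomial (Fin N) ℤ) :
    ∃ (s : Finset (Fin N →₀ ℕ)) (c : (Fin N →₀ ℕ) → ℕ), ∀ m : ℕ, ∀ x : Fin N → GaloisField p m,
      aeval x G = pval s c x := by
  refine ⟨G.support, fun a => ((coeff a G : ℤ) : ZMod p).val, fun m x => ?_⟩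
  rw [aeval_def, eval₂_eq]
  unfold pval
  refine Finset.sum_congr rfl fun a _ => ?_
  rw [nsmul_eq_mul]
  congr 1
  · have : (algebraMap ℤ (GaloisField p m)) (coeff a G) =
      algebraMap (ZMod p) (GaloisField p m) ((coeff a G : ℤ) : ZMod p) := by simp
    rw [this]
    conv_lhs => rw [← ZMod.natCast_zmod_val (((coeff a G : ℤ) : ZMod p))]
    rw [map_natCast]
  · exact Finset.prod_subset (Finset.subset_univ _) fun i _ hi => by
      rw [Finsupp.notMem_support_iff.mp hi, pow_zero]

theorem zeroCount_isRat (p : ℕ) [hp : Fact p.Prime] {n r : ℕ} (h : Fin r → MvPolynomial (Fin n) ℤ)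
    (e : ℕ) (he : 1 ≤ e) : IsRat (fun m => (zeroCount p h (e * m) : ℚ)) := by
  classical
  obtain ⟨ρ, ζ, hρ0, hρ1, hζ, hsp⟩ := exists_splitting p
  have hsp : Splits p ρ ζ := hsp
  set G : MvPolynomial (Fin (n + r)) ℤ :=
    ∑ j, X (Fin.natAdd n j) * rename (Fin.castAdd r) (h j) with hG
  obtain ⟨s, c, hsc⟩ := exists_pval p G
  have happ := fullSum_approx hρ0 hρ1 hζ hsp s c
  have key : ∀ m : ℕ, m ≠ 0 →
      fullSum ζ s c m = ((p ^ (m * r) * zeroCount p h m : ℕ) : PadicAlgCl p) := by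
    intro m hm
    letI := Fintype.ofFinite (GaloisField p m)
    unfold fullSum
    simp only [← hsc]
    rw [← (Fin.appendEquiv n r).sum_comp, Fintype.sum_prod_type]
    have hin : ∀ z : Fin n → GaloisField p m,
        ∑ y : Fin r → GaloisField p m, psi ζ m (aeval (Fin.appendEquiv n r (z, y)) G) =
        if ∀ j, aeval z (h j) = 0 then ((p ^ (m * r) : ℕ) : PadicAlgCl p) else 0 := by
      intro z
      have h1 : ∀ y : Fin r → GaloisField p m, psi ζ m (aeval (Fin.appendEquiv n r (z, y)) G) =
        ∏ j, psi ζ m (y j * aeval z (h j)) := by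
        intro y
        rw [← psi_sum hζ.pow_eq_one]
        congr 1
        rw [hG, map_sum]
        refine Finset.sum_congr rfl fun j _ => ?_
        rw [map_mul, aeval_X, aeval_rename]
        congr 1
        · simp [Fin.appendEquiv]
        · congr 2
          funext i
          simp [Fin.appendEquiv]
      simp only [h1]
      have h2 := Finset.prod_univ_sum (fun _ : Fin r => (Finset.univ : Finset (GaloisField p m)))
        (fun j y => psi ζ m (y * aeval z (h j)))
      rw [Fintype.piFinset_univ] at h2
      rw [← h2]
      simp only [sum_psi_mul hζ hm]
      split_ifs with hz
      · simp only [hz, if_true, Finset.prod_const, Finset.card_univ, Fintype.card_fin]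
        rw [pow_mul]; push_cast; rfl
      · push Not at hz
        obtain ⟨j, hj⟩ := hz
        exact Finset.prod_eq_zero (Finset.mem_univ j) (if_neg hj)
    simp only [hin]
    rw [← Finset.sum_filter, Finset.sum_const, nsmul_eq_mul, mul_comm]
    push_cast
    congr 2
    rw [zeroCount, Nat.card_eq_fintype_card, Fintype.card_subtype]
  have hbound : ∀ m : ℕ, m ≠ 0 → zeroCount p h m ≤ (p ^ n) ^ m := by
    intro m hm
    letI := Fintype.ofFinite (GaloisField p m)
    rw [zeroCount, Nat.card_eq_fintype_card]
    refine (Fintype.card_subtype_le _).trans ?_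
    rw [Fintype.card_fun, card_gf hm, Fintype.card_fin, ← pow_mul, ← pow_mul, mul_comm]
  have hrat := isRat_of_approx (p := p) (K := PadicAlgCl p)
    (fun m => if m = 0 then 0 else ((p ^ (e * m * r) * zeroCount p h (e * m) : ℕ) : ℤ)) 1
    ((p : ℝ) ^ (e * r) * (p : ℝ) ^ (n * e)) zero_le_one
    (one_le_mul_of_one_le_of_one_le (one_le_pow₀ (by exact_mod_cast hp.out.one_le))
      (one_le_pow₀ (by exact_mod_cast hp.out.one_le))) ?_ ?_
  · apply IsRat.rescale ((p : ℚ) ^ (e * r)) (pow_ne_zero _ (by exact_mod_cast hp.out.ne_zero))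
    refine hrat.congr 1 fun m hm => ?_
    rw [if_neg (by omega)]
    push_cast
    rw [← pow_mul, show e * r * m = e * m * r by ring]
  · intro m
    split_ifs with hm
    · simp; positivity
    · have := hbound (e * m) (by positivity)
      rw [one_mul]
      push_cast
      rw [abs_of_nonneg (by positivity), mul_pow, ← pow_mul, show e * r * m = e * m * r by ring]
      gcongr
      rw [← pow_mul, show n * e * m = n * (e * m) by ring, pow_mul]
      exact_mod_cast this
  · refine (happ.comp_mul e he).congr fun m hm => ?_
    rw [if_neg (by omega), key _ (by positivity)]
    push_cast
    rfl

end Full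
end PRat

namespace PRat
open Polynomial

section Wt
variable {k : Type*} [Field k]

/-- weighted degree at most `n`, where `Y` has weight one and `T` has weight `δ` -/
def Wt (δ n : ℕ) (f : k[X][X]) : Prop := ∀ j i, n < i + δ * j → (f.coeff j).coeff i = 0

variable {δ n m : ℕ} {f g : k[X][X]}

lemma Wt.mono (hf : Wt δ n f) (h : n ≤ m) : Wt δ m f := fun j i hij => hf j i (h.trans_lt hij)

lemma Wt.zero : Wt δ n (0 : k[X][X]) := fun j i _ => by simp

lemma Wt.add (hf : Wt δ n f) (hg : Wt δ n g) : Wt δ n (f + g) := fun j i h => by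
  simp [hf j i h, hg j i h]

lemma Wt.sub (hf : Wt δ n f) (hg : Wt δ n g) : Wt δ n (f - g) := fun j i h => by
  simp [hf j i h, hg j i h]

lemma Wt.mul (hf : Wt δ n f) (hg : Wt δ m g) : Wt δ (n + m) (f * g) := by
  intro j i h
  rw [coeff_mul, finsetSum_coeff]
  refine Finset.sum_eq_zero fun x hx => ?_
  rw [coeff_mul]
  refine Finset.sum_eq_zero fun y hy => ?_
  rw [Finset.HasAntidiagonal.mem_antidiagonal] at hx hy
  by_cases h1 : n < y.1 + δ * x.1
  · rw [hf _ _ h1, zero_mul]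
  · rw [hg x.2 y.2, mul_zero]
    have : δ * j = δ * x.1 + δ * x.2 := by rw [← hx]; ring
    omega

lemma Wt.one : Wt δ n (1 : k[X][X]) := by
  intro j i h
  rw [coeff_one]
  split_ifs with hj
  · subst hj
    rw [coeff_one, if_neg (by omega)]
  · simp

lemma Wt.pow (hf : Wt δ n f) (e : ℕ) : Wt δ (n * e) (f ^ e) := by
  induction e with
  | zero => simpa using Wt.one
  | succ e ih => rw [pow_succ, Nat.mul_succ]; exact ih.mul hf

lemma Wt.sum {ι : Type*} (s : Finset ι) (F : ι → k[X][X]) (h : ∀ i ∈ s, Wt δ n (F i)) :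
    Wt δ n (∑ i ∈ s, F i) := by
  classical
  induction s using Finset.induction_on with
  | empty => simpa using Wt.zero
  | insert i s hi ih =>
    rw [Finset.sum_insert hi]
    exact (h i (by simp)).add (ih fun j hj => h j (by simp [hj]))

lemma Wt.monomial {j i : ℕ} (h : i + δ * j ≤ n) (c : k) :
    Wt δ n (monomial j (monomial i c) : k[X][X]) := by
  intro j' i' h'
  rw [coeff_monomial]
  split_ifs with hj
  · subst hj
    rw [coeff_monomial, if_neg]
    rintro rfl; omega
  · simp

lemma Wt.C {d : k[X]} (h : d.natDegree ≤ n) : Wt δ n (C d) := by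
  intro j i h'
  rw [coeff_C]
  split_ifs with hj
  · subst hj; exact coeff_eq_zero_of_natDegree_lt (by omega)
  · simp

lemma Wt.smul (hf : Wt δ n f) (c : k) : Wt δ n (c • f) := by
  intro j i h
  rw [coeff_smul, coeff_smul, hf j i h, smul_zero]

/-- exponents `(j, i)` of the monomials `T^j Y^i` -/
def Ix (D δ n : ℕ) : Finset (ℕ × ℕ) :=
  (Finset.range D ×ˢ Finset.range (n + 1)).filter fun x => x.2 + δ * x.1 ≤ n

lemma mem_Ix {D δ n : ℕ} {x : ℕ × ℕ} : x ∈ Ix D δ n ↔ x.1 < D ∧ x.2 + δ * x.1 ≤ n := by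
  simp only [Ix, Finset.mem_filter, Finset.mem_product, Finset.mem_range]
  constructor
  · rintro ⟨⟨h1, _⟩, h2⟩; exact ⟨h1, h2⟩
  · rintro ⟨h1, h2⟩; exact ⟨⟨h1, by omega⟩, h2⟩

lemma card_Ix_le (D δ n : ℕ) : (Ix D δ n).card ≤ D * (n + 1) := by
  refine (Finset.card_filter_le _ _).trans ?_
  simp

lemma le_card_Ix (D δ n : ℕ) : D * (n + 1 - δ * D) ≤ (Ix D δ n).card := by
  have : (Finset.range D ×ˢ Finset.range (n + 1 - δ * D)) ⊆ Ix D δ n := by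
    intro x hx
    simp only [Finset.mem_product, Finset.mem_range] at hx
    rw [mem_Ix]
    have := Nat.mul_le_mul_left δ hx.1.le
    exact ⟨hx.1, by omega⟩
  simpa using Finset.card_le_card this

/-- the basis element -/
noncomputable def mon (k : Type*) [Field k] (x : ℕ × ℕ) : k[X][X] := monomial x.1 (monomial x.2 1)

lemma eq_sum_mon {D : ℕ} (hf : Wt δ n f) (hd : f.degree < D) :
    f = ∑ x ∈ Ix D δ n, ((f.coeff x.1).coeff x.2) • mon k x := by
  ext j i
  simp only [finsetSum_coeff, coeff_smul, mon, coeff_monomial]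
  have : ∀ x : ℕ × ℕ, ((if x.1 = j then (monomial x.2 (1 : k)) else 0 : k[X])).coeff i =
      if x = (j, i) then 1 else 0 := by
    rintro ⟨a, b⟩
    simp only [Prod.mk.injEq]
    by_cases h1 : a = j
    · simp [h1, coeff_monomial]
    · simp [h1]
  simp only [this, smul_eq_mul, mul_ite, mul_one, mul_zero, Finset.sum_ite_eq']
  split_ifs with h
  · rfl
  · rw [mem_Ix, not_and_or] at h
    rcases h with h | h
    · rw [coeff_eq_zero_of_degree_lt (hd.trans_le (by exact_mod_cast not_lt.mp h)), coeff_zero]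
    · exact hf _ _ (by simpa using h)

variable {h : k[X][X]} {D : ℕ}

lemma exists_reduced (hm : h.Monic) (hD : h.natDegree = D) (hδ : Wt δ (δ * D) h) :
    ∀ N : ℕ, ∀ f : k[X][X], f.natDegree < N → Wt δ n f →
      ∃ g : k[X][X], Wt δ n g ∧ g.degree < D ∧ AdjoinRoot.mk h g = AdjoinRoot.mk h f := by
  intro N
  induction N with
  | zero => intro f hf; omega
  | succ N ih =>
    intro f hf hw
    by_cases hlt : f.natDegree < D
    · exact ⟨f, hw, degree_le_natDegree.trans_lt (by exact_mod_cast hlt), rfl⟩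
    push Not at hlt
    by_cases hf0 : f = 0
    · subst hf0; exact ⟨0, Wt.zero, by simp [bot_lt_iff_ne_bot], rfl⟩
    by_cases hD0 : D = 0
    · refine ⟨0, Wt.zero, by simp [bot_lt_iff_ne_bot], ?_⟩
      have h1 : h = 1 := hm.natDegree_eq_zero.mp (by omega)
      rw [map_zero, eq_comm, AdjoinRoot.mk_eq_zero, h1]; exact one_dvd f
    set e := f.natDegree - D with he
    set q : k[X][X] := Polynomial.C f.leadingCoeff * X ^ e with hq
    have hwq : Wt δ (n - δ * D) q ∧ δ * D ≤ n := by
      have hlc : f.leadingCoeff ≠ 0 := leadingCoeff_ne_zero.mpr hf0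
      have hcoe : (f.coeff f.natDegree).coeff f.leadingCoeff.natDegree ≠ 0 := by
        change f.leadingCoeff.leadingCoeff ≠ 0
        exact leadingCoeff_ne_zero.mpr hlc
      have h1 : f.leadingCoeff.natDegree + δ * f.natDegree ≤ n := by
        by_contra hcon
        exact hcoe (hw _ _ (by omega))
      have h2 : δ * f.natDegree = δ * e + δ * D := by rw [← mul_add]; congr 1; omega
      refine ⟨?_, by omega⟩
      intro j i hij
      rw [hq, coeff_C_mul_X_pow]
      split_ifs with hj
      · subst hj
        exact coeff_eq_zero_of_natDegree_lt (by omega)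
      · simp
    have hw' : Wt δ n (f - q * h) := by
      refine hw.sub ?_
      have := hwq.1.mul hδ
      rwa [Nat.sub_add_cancel hwq.2] at this
    have hdeg : (f - q * h).natDegree < N := by
      have hlt' : (f - q * h).degree < f.degree := by
        apply degree_sub_lt_left _ hf0
        · rw [hq, leadingCoeff_mul_monic hm]; simp
        · rw [hq, degree_mul, degree_C_mul_X_pow _ (leadingCoeff_ne_zero.mpr hf0),
            degree_eq_natDegree hm.ne_zero, degree_eq_natDegree hf0, hD]
          norm_cast; omega
      by_cases h0 : f - q * h = 0
      · rw [h0, natDegree_zero]; omega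
      · have := (natDegree_lt_natDegree_iff h0).mpr hlt'
        omega
    obtain ⟨g, hg1, hg2, hg3⟩ := ih _ hdeg hw'
    refine ⟨g, hg1, hg2, ?_⟩
    rw [hg3, map_sub, map_mul, AdjoinRoot.mk_self, mul_zero, sub_zero]

lemma mk_eq_sum (hm : h.Monic) (hD : h.natDegree = D) (hδ : Wt δ (δ * D) h) (hf : Wt δ n f) :
    ∃ c : ℕ × ℕ → k, AdjoinRoot.mk h f = ∑ x ∈ Ix D δ n, c x • AdjoinRoot.mk h (mon k x) := by
  obtain ⟨g, hg1, hg2, hg3⟩ := exists_reduced hm hD hδ _ f (Nat.lt_succ_self _) hf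
  refine ⟨fun x => (g.coeff x.1).coeff x.2, ?_⟩
  rw [← hg3]
  conv_lhs => rw [eq_sum_mon hg1 hg2]
  rw [map_sum]
  refine Finset.sum_congr rfl fun x _ => ?_
  rw [← AdjoinRoot.smul_mk]

lemma mon_indep (hm : h.Monic) (hD : h.natDegree = D) (c : ℕ × ℕ → k)
    (hc : ∑ x ∈ Ix D δ n, c x • AdjoinRoot.mk h (mon k x) = 0) : ∀ x ∈ Ix D δ n, c x = 0 := by
  classical
  set f : k[X][X] := ∑ x ∈ Ix D δ n, c x • mon k x with hf
  have h1 : AdjoinRoot.mk h f = 0 := by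
    rw [hf, map_sum, ← hc]
    exact Finset.sum_congr rfl fun x _ => by rw [← AdjoinRoot.smul_mk]
  rw [AdjoinRoot.mk_eq_zero] at h1
  have h2 : f = 0 := by
    by_contra hf0
    refine hm.not_dvd_of_degree_lt hf0 ?_ h1
    rw [degree_eq_natDegree hm.ne_zero, hD, hf]
    refine (degree_sum_le _ _).trans_lt ((Finset.sup_lt_iff (by simp [bot_lt_iff_ne_bot])).mpr ?_)
    intro x hx
    refine (degree_smul_le _ _).trans_lt ((degree_monomial_le _ _).trans_lt ?_)
    exact_mod_cast (mem_Ix.mp hx).1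
  intro y hy
  have h3 : (f.coeff y.1).coeff y.2 = c y := by
    simp only [hf, finsetSum_coeff, coeff_smul, mon, coeff_monomial]
    have : ∀ x : ℕ × ℕ, ((if x.1 = y.1 then (monomial x.2 (1 : k)) else 0 : k[X])).coeff y.2 =
        if x = y then 1 else 0 := by
      rintro ⟨a, b⟩
      obtain ⟨j, i⟩ := y
      simp only [Prod.mk.injEq]
      by_cases h1 : a = j
      · simp [h1, coeff_monomial]
      · simp [h1]
    simp only [this, smul_eq_mul, mul_ite, mul_one, mul_zero, Finset.sum_ite_eq', if_pos hy]
  rw [← h3, h2]; simp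

lemma natDegree_det_le {D : ℕ} (M : Matrix (Fin D) (Fin D) k[X])
    (hM : ∀ i j : Fin D, ∀ e, n + δ * j < e + δ * i → (M i j).coeff e = 0) :
    M.det.natDegree ≤ D * n := by
  rw [Matrix.det_apply]
  refine natDegree_sum_le_of_forall_le _ _ fun σ _ => ?_
  have : ((Equiv.Perm.sign σ : ℤˣ) • ∏ i, M (σ i) i).natDegree ≤ (∏ i, M (σ i) i).natDegree := by
    rcases Int.units_eq_one_or (Equiv.Perm.sign σ) with h | h <;> rw [h]
    · simp
    · rw [Units.neg_smul, one_smul, natDegree_neg]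
  refine this.trans ?_
  by_cases h0 : ∏ i, M (σ i) i = 0
  · rw [h0]; simp
  have hne : ∀ i, M (σ i) i ≠ 0 := fun i hi => h0 (Finset.prod_eq_zero (Finset.mem_univ i) hi)
  rw [natDegree_prod _ _ fun i _ => hne i]
  have h1 : ∀ i, (M (σ i) i).natDegree + δ * (σ i : ℕ) ≤ n + δ * (i : ℕ) := by
    intro i
    by_contra hcon
    exact leadingCoeff_ne_zero.mpr (hne i) (hM _ _ _ (by omega))
  have h2 := Finset.sum_le_sum fun i (_ : i ∈ Finset.univ) => h1 i
  rw [Finset.sum_add_distrib, Finset.sum_add_distrib,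
    Equiv.sum_comp σ (fun i : Fin D => δ * (i : ℕ))] at h2
  simpa using h2

lemma natDegree_norm_le (hm : h.Monic) (hD : h.natDegree = D) (hδ : Wt δ (δ * D) h)
    (hf : Wt δ n f) : (Algebra.norm k[X] (AdjoinRoot.mk h f)).natDegree ≤ D * n := by
  subst hD
  rw [Algebra.norm_eq_matrix_det (AdjoinRoot.powerBasisAux' hm)]
  apply natDegree_det_le (δ := δ)
  intro i j e he
  rw [Algebra.leftMulMatrix_eq_repr_mul]
  have h1 : Wt δ (n + δ * j) (f * X ^ (j : ℕ)) := by
    refine hf.mul ?_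
    have := Wt.monomial (k := k) (δ := δ) (n := δ * j) (j := j) (i := 0) (by simp) 1
    rwa [show (monomial (j : ℕ) (monomial 0 (1 : k)) : k[X][X]) = X ^ (j : ℕ) by
      rw [monomial_zero_left, map_one, X_pow_eq_monomial]] at this
  obtain ⟨g, hg1, hg2, hg3⟩ := exists_reduced hm rfl hδ _ _ (Nat.lt_succ_self _) h1
  have h2 : (AdjoinRoot.powerBasisAux' hm) j = AdjoinRoot.mk h (X ^ (j : ℕ)) := by
    have := (AdjoinRoot.powerBasis' hm).basis_eq_pow j
    rw [map_pow, AdjoinRoot.mk_X]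
    exact this
  rw [h2, ← map_mul, ← hg3, AdjoinRoot.powerBasisAux'_repr_apply_to_fun]
  rw [AdjoinRoot.modByMonicHom_mk, (modByMonic_eq_self_iff hm).mpr (by
    rw [degree_eq_natDegree hm.ne_zero]; exact hg2)]
  exact hg1 _ _ he

end Wt
end PRat

namespace PRat
open Polynomial

section Hensel
variable {k : Type*} [Field k]

lemma dvd_algebraMap_norm {A R : Type*} [CommRing A] [CommRing R] [Algebra A R]
    [Module.Free A R] [Module.Finite A R] (u : R) : u ∣ algebraMap A R (Algebra.norm A u) := by
  set f := Algebra.lmul A R u with hf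
  have h1 : aeval u f.charpoly = 0 := by
    have h := LinearMap.aeval_self_charpoly f
    have h2 : aeval f f.charpoly = Algebra.lmul A R (aeval u f.charpoly) := by
      rw [hf, aeval_algHom_apply]
    rw [h2] at h
    have h3 := LinearMap.congr_fun h 1
    simpa using h3
  have h2 : u ∣ algebraMap A R (f.charpoly.coeff 0) := by
    obtain ⟨g, hg⟩ := X_dvd_sub_C (p := f.charpoly)
    have h3 := congrArg (aeval u) hg
    rw [map_sub, h1, map_mul, aeval_X, aeval_C] at h3
    exact ⟨-aeval u g, by linear_combination -h3⟩
  rw [Algebra.norm_apply]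
  change u ∣ algebraMap A R (LinearMap.det f)
  rw [LinearMap.det_eq_sign_charpoly_coeff, map_mul]
  exact h2.mul_left _

variable {h : k[X][X]}

/-- expansion at the point `y0` -/
noncomputable def expand0 (y0 : k) : k[X] →ₐ[k] PowerSeries k :=
  aeval (PowerSeries.X + PowerSeries.C y0)

lemma constantCoeff_expand0 (y0 : k) (d : k[X]) :
    PowerSeries.constantCoeff (expand0 y0 d) = d.eval y0 := by
  have : ((PowerSeries.constantCoeff (R := k)).comp (expand0 y0).toRingHom) = evalRingHom y0 := by
    apply Polynomial.ringHom_ext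
    · intro a
      simp [expand0]
    · simp [expand0]
  exact RingHom.congr_fun this d

lemma expand0_X_pow_dvd (y0 : k) (d : k[X]) (r : ℕ) (hd : d ≠ 0) (hr : d.natDegree < r) :
    ¬ PowerSeries.X ^ r ∣ expand0 y0 d := by
  intro hdvd
  have h1 : expand0 y0 d = ((d.comp (X + C y0) : k[X]) : PowerSeries k) := by
    have : (expand0 y0) = (Polynomial.coeToPowerSeries.algHom (R := k) k).comp
        (aeval (X + C y0)) := by
      ext1
      simp [expand0, Polynomial.coeToPowerSeries.algHom_apply]
    rw [this]
    simp [Polynomial.coeToPowerSeries.algHom_apply, Polynomial.comp, aeval_def]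
  rw [h1, PowerSeries.X_pow_dvd_iff] at hdvd
  have hne : d.comp (X + C y0) ≠ 0 := by
    intro h0
    rw [comp_eq_zero_iff] at h0
    rcases h0 with h0 | ⟨_, h0⟩
    · exact hd h0
    · have := congrArg natDegree h0
      rw [natDegree_X_add_C, natDegree_C] at this
      omega
  have h2 : (d.comp (X + C y0)).natDegree = d.natDegree := by
    rw [natDegree_comp, natDegree_X_add_C, mul_one]
  have := hdvd (d.comp (X + C y0)).natDegree (by rw [h2]; exact hr)
  rw [coeff_coe] at this
  exact leadingCoeff_ne_zero.mpr hne this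

lemma exists_hensel (hm : h.Monic) (y0 t0 : k) (h0 : h.evalEval y0 t0 = 0)
    (h1 : h.derivative.evalEval y0 t0 ≠ 0) :
    ∃ ψ : AdjoinRoot h →+* PowerSeries k, ∀ d : k[X],
      ψ (AdjoinRoot.of h d) = expand0 y0 d := by
  set ψ0 : k[X] →+* PowerSeries k := (expand0 y0).toRingHom with hψ0
  have key : ∀ f : k[X][X], PowerSeries.constantCoeff ((f.map ψ0).eval (PowerSeries.C t0)) =
      f.evalEval y0 t0 := by
    intro f
    rw [eval_map, hom_eval₂, PowerSeries.constantCoeff_C]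
    have : (PowerSeries.constantCoeff (R := k)).comp ψ0 = evalRingHom y0 := by
      ext1
      · ext a; exact constantCoeff_expand0 y0 _
      · exact constantCoeff_expand0 y0 _
    rw [this, eval₂_evalRingHom]
  have hen : HenselianRing (PowerSeries k) (Ideal.span {PowerSeries.X}) := inferInstance
  obtain ⟨a, ha, _⟩ := hen.is_henselian (h.map ψ0) (hm.map ψ0) (PowerSeries.C t0)
    (by rw [Ideal.mem_span_singleton, PowerSeries.X_dvd_iff, key, h0])
    (by
      apply IsUnit.map
      rw [PowerSeries.isUnit_iff_constantCoeff, derivative_map, key]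
      exact isUnit_iff_ne_zero.mpr h1)
  refine ⟨AdjoinRoot.lift ψ0 a (by rw [← eval_map]; exact ha), fun d => ?_⟩
  rw [AdjoinRoot.lift_of]
  rfl

variable {δ n D r : ℕ} {f : k[X][X]}

lemma hensel_dvd (hm : h.Monic) (hirr : Irreducible h) (hD : h.natDegree = D)
    (hδ : Wt δ (δ * D) h) {y0 : k}
    (ψ : AdjoinRoot h →+* PowerSeries k) (hψ : ∀ d : k[X], ψ (AdjoinRoot.of h d) = expand0 y0 d)
    (hf : Wt δ n f) (hr : D * n < r) (hdvd : PowerSeries.X ^ r ∣ ψ (AdjoinRoot.mk h f)) :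
    AdjoinRoot.mk h f = 0 := by
  by_contra hne
  have : Fact (Irreducible h) := ⟨hirr⟩
  have hpr : Prime h := hirr.prime
  haveI : IsDomain (AdjoinRoot h) := AdjoinRoot.isDomain_of_prime hpr
  haveI := Module.Free.of_basis (AdjoinRoot.powerBasisAux' hm)
  haveI := Module.Finite.of_basis (AdjoinRoot.powerBasisAux' hm)
  have h1 := dvd_algebraMap_norm (A := k[X]) (AdjoinRoot.mk h f)
  have h2 := map_dvd ψ h1
  rw [AdjoinRoot.algebraMap_eq, hψ] at h2
  refine expand0_X_pow_dvd y0 _ r ?_ ?_ (hdvd.trans h2)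
  · exact (Algebra.norm_ne_zero_iff_of_basis (AdjoinRoot.powerBasisAux' hm)).mpr hne
  · exact (natDegree_norm_le hm hD hδ hf).trans_lt hr

lemma indep_pow (p : ℕ) [Fact p.Prime] [CharP k p] {ι : Type*} (s : Finset ι)
    (v : ι → PowerSeries k) (u : ℕ)
    (hv : ∀ c : ι → k, PowerSeries.X ^ (p ^ u) ∣ ∑ i ∈ s, PowerSeries.C (c i) * v i →
      ∀ i ∈ s, c i = 0)
    (e : ι → PowerSeries k) (he : ∑ i ∈ s, e i ^ (p ^ u) * v i = 0) : ∀ i ∈ s, e i = 0 := by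
  have : CharP (PowerSeries k) p := charP_of_injective_ringHom
    (f := (PowerSeries.C (R := k))) PowerSeries.C_injective p
  have key : ∀ n, ∀ e : ι → PowerSeries k, ∑ i ∈ s, e i ^ (p ^ u) * v i = 0 →
      ∀ i ∈ s, PowerSeries.X ^ n ∣ e i := by
    intro n
    induction n with
    | zero => intro e he i hi; simp
    | succ n ih =>
      intro e he
      have h1 := fun i => PowerSeries.eq_X_mul_shift_add_const (e i)
      set c : ι → k := fun i => PowerSeries.constantCoeff (e i) with hc
      set e' : ι → PowerSeries k := fun i => PowerSeries.mk fun q => PowerSeries.coeff (q + 1) (e i)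
        with he'
      have h2 : ∀ i, e i ^ (p ^ u) = PowerSeries.X ^ (p ^ u) * e' i ^ (p ^ u) +
          PowerSeries.C (c i ^ (p ^ u)) := by
        intro i
        rw [h1 i, add_pow_char_pow, mul_pow, map_pow]
      have h3 : PowerSeries.X ^ (p ^ u) * ∑ i ∈ s, e' i ^ (p ^ u) * v i +
          ∑ i ∈ s, PowerSeries.C (c i ^ (p ^ u)) * v i = 0 := by
        rw [Finset.mul_sum, ← Finset.sum_add_distrib, ← he]
        refine Finset.sum_congr rfl fun i _ => ?_
        rw [h2]; ring
      have h4 : ∀ i ∈ s, c i = 0 := by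
        intro i hi
        have := hv (fun i => c i ^ (p ^ u)) (Dvd.intro (-∑ i ∈ s, e' i ^ (p ^ u) * v i)
          (by linear_combination -h3)) i hi
        exact eq_zero_of_pow_eq_zero this
      have h5 : ∑ i ∈ s, PowerSeries.C (c i ^ (p ^ u)) * v i = 0 := by
        refine Finset.sum_eq_zero fun i hi => ?_
        rw [h4 i hi, zero_pow (pow_ne_zero _ (Fact.out : p.Prime).ne_zero)]; simp
      rw [h5, add_zero] at h3
      have h6 : ∑ i ∈ s, e' i ^ (p ^ u) * v i = 0 := by
        rcases mul_eq_zero.mp h3 with h | h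
        · exact absurd h (pow_ne_zero _ PowerSeries.X_ne_zero)
        · exact h
      intro i hi
      have h7 : e i = PowerSeries.X * e' i := by
        have : PowerSeries.constantCoeff (e i) = 0 := h4 i hi
        rw [h1 i, this]; simp [he']
      rw [h7, pow_succ']
      exact mul_dvd_mul_left _ (ih e' h6 i hi)
  intro i hi
  ext n
  have := key (n + 1) e he i hi
  rw [PowerSeries.X_pow_dvd_iff] at this
  simpa using this n (by omega)

end Hensel
end PRat

namespace PRat
open Polynomial

section Stepanov
variable {k : Type*} [Field k] [IsAlgClosed k]
variable {h : k[X][X]} {δ D : ℕ}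

lemma card_points_le (hm : h.Monic) (hirr : Irreducible h) (hD : h.natDegree = D)
    (hδ : Wt δ (δ * D) h) {n : ℕ} {G : k[X][X]} (hG : Wt δ n G) (hG0 : AdjoinRoot.mk h G ≠ 0)
    (P : Finset (k × k)) (hP : ∀ x ∈ P, h.evalEval x.1 x.2 = 0 ∧ G.evalEval x.1 x.2 = 0) :
    P.card ≤ D * n := by
  haveI : IsDomain (AdjoinRoot h) := AdjoinRoot.isDomain_of_prime hirr.prime
  set b := AdjoinRoot.powerBasisAux' hm
  have hI : Ideal.span {AdjoinRoot.mk h G} ≠ ⊥ := Ideal.span_singleton_eq_bot.not.2 hG0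
  haveI : Module.Finite k (AdjoinRoot h ⧸ Ideal.span {AdjoinRoot.mk h G}) :=
    Module.Finite.equiv (Ideal.quotientEquivDirectSum k b hI).symm
  have h1 := finrank_quotient_span_eq_natDegree_norm (F := k) b hG0
  have h2 := card_algHom_le_finrank k (AdjoinRoot h ⧸ Ideal.span {AdjoinRoot.mk h G}) k
  refine le_trans ?_ (h2.trans (h1.le.trans (natDegree_norm_le hm hD hδ hG)))
  have hev : ∀ (x : k × k) (f : k[X][X]),
      eval₂ ((aeval x.1 : k[X] →ₐ[k] k) : k[X] →+* k) x.2 f = f.evalEval x.1 x.2 := by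
    intro x f
    rw [← eval₂_evalRingHom]
    rfl
  let φ : P → (AdjoinRoot h →ₐ[k] k) := fun x => AdjoinRoot.liftAlgHom h (aeval x.1.1) x.1.2
    (by rw [hev]; exact (hP x.1 x.2).1)
  have hφ : ∀ (x : P) (f : k[X][X]), φ x (AdjoinRoot.mk h f) = f.evalEval x.1.1 x.1.2 := by
    intro x f
    rw [← hev]
    exact AdjoinRoot.liftAlgHom_mk ..
  let φ' : P → (AdjoinRoot h ⧸ Ideal.span {AdjoinRoot.mk h G} →ₐ[k] k) := fun x =>
    Ideal.Quotient.liftₐ _ (φ x) (by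
      intro a ha
      rw [Ideal.mem_span_singleton] at ha
      obtain ⟨c, rfl⟩ := ha
      rw [map_mul, hφ, (hP x.1 x.2).2, zero_mul])
  have hφ' : ∀ (x : P) (f : k[X][X]), φ' x (Ideal.Quotient.mk _ (AdjoinRoot.mk h f)) =
      f.evalEval x.1.1 x.1.2 := by
    intro x f
    rw [← hφ]
    rfl
  have hinj : Function.Injective φ' := by
    intro x x' hxx
    have e1 := hφ' x (C X)
    have e2 := hφ' x X
    rw [hxx, hφ'] at e1 e2
    simp only [evalEval_C, eval_X, evalEval_X] at e1 e2
    exact Subtype.ext (Prod.ext e1.symm e2.symm)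
  rw [← Nat.card_eq_finsetCard]
  exact Nat.card_le_card_of_injective φ' hinj

lemma stepanov (p : ℕ) [Fact p.Prime] [CharP k p]
    (hm : h.Monic) (hirr : Irreducible h) (hD : h.natDegree = D)
    (hδ : Wt δ (δ * D) h) (Δ : k[X]) (hΔ : Δ ≠ 0) {c0 : ℕ} (hΔC : Δ.natDegree ≤ c0)
    (hsep : ∀ y t, Δ.eval y ≠ 0 → h.evalEval y t = 0 → h.derivative.evalEval y t ≠ 0)
    (ρ : k[X][X]) (hρ : Wt δ c0 ρ) (a b u v : ℕ) (ha : D * a < p ^ u)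
    (hcard : (Ix D δ (a * p ^ v + b + c0 * D)).card < (Ix D δ a).card * (Ix D δ b).card)
    (P : Finset (k × k)) (hP : ∀ x ∈ P, h.evalEval x.1 x.2 = 0 ∧ Δ.eval x.1 ≠ 0 ∧
      x.1 ^ (p ^ u * p ^ v) = x.1 ∧ Δ.eval x.1 * x.2 ^ (p ^ u * p ^ v) = ρ.evalEval x.1 x.2) :
    P.card ≤ D * (a + b * p ^ u) := by
  classical
  have hpp : p.Prime := Fact.out
  haveI : IsDomain (AdjoinRoot h) := AdjoinRoot.isDomain_of_prime hirr.prime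
  haveI : ExpChar k p := ExpChar.prime hpp
  haveI : ExpChar (AdjoinRoot h) p := expChar_of_injective_ringHom
    (f := algebraMap k (AdjoinRoot h)) (FaithfulSMul.algebraMap_injective k _) p
  haveI : ExpChar k[X][X] p := expChar_of_injective_ringHom
    (f := algebraMap k k[X][X]) (FaithfulSMul.algebraMap_injective k _) p
  -- the elements e_l
  set e : ℕ × ℕ → k[X][X] := fun l => C (X ^ l.2) * ρ ^ l.1 * C Δ ^ (D - 1 - l.1) with he
  have heW : ∀ l ∈ Ix D δ b, Wt δ (b + c0 * D) (e l) := by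
    intro l hl
    rw [mem_Ix] at hl
    have h1 : Wt δ l.2 (C (X ^ l.2) : k[X][X]) := Wt.C (by simp)
    have h2 := (h1.mul (hρ.pow l.1)).mul ((Wt.C (δ := δ) hΔC).pow (D - 1 - l.1))
    refine h2.mono ?_
    have : c0 * l.1 + c0 * (D - 1 - l.1) ≤ c0 * D := by
      rw [← mul_add]; exact Nat.mul_le_mul_left _ (by omega)
    have : l.2 ≤ b := by omega
    omega
  have hmonW : ∀ n, ∀ l ∈ Ix D δ n, Wt δ n (mon k l) := by
    intro n l hl
    exact Wt.monomial (mem_Ix.mp hl).2 1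
  have hcoord : ∀ x : (ℕ × ℕ) × (ℕ × ℕ), ∃ c : ℕ × ℕ → k, x ∈ Ix D δ a ×ˢ Ix D δ b →
      AdjoinRoot.mk h (mon k x.1 ^ (p ^ v) * e x.2) =
        ∑ z ∈ Ix D δ (a * p ^ v + b + c0 * D), c z • AdjoinRoot.mk h (mon k z) := by
    intro x
    by_cases hx : x ∈ Ix D δ a ×ˢ Ix D δ b
    · rw [Finset.mem_product] at hx
      obtain ⟨c, hc⟩ := mk_eq_sum hm hD hδ (((hmonW a _ hx.1).pow (p ^ v)).mul (heW _ hx.2))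
      rw [← add_assoc] at hc
      exact ⟨c, fun _ => hc⟩
    · exact ⟨0, fun h => absurd h hx⟩
  choose c hc using hcoord
  -- nonzero solution
  obtain ⟨x, hxne, hx0⟩ : ∃ x : (ℕ × ℕ) × (ℕ × ℕ) → k, (∃ z ∈ Ix D δ a ×ˢ Ix D δ b, x z ≠ 0) ∧
      ∀ z ∈ Ix D δ (a * p ^ v + b + c0 * D), ∑ y ∈ Ix D δ a ×ˢ Ix D δ b, x y * c y z = 0 := by
    let L : ((Ix D δ a ×ˢ Ix D δ b : Finset _) → k) →ₗ[k] 
        ((Ix D δ (a * p ^ v + b + c0 * D) : Finset _) → k) :=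
      (Matrix.of fun z y => c y.1 z.1).mulVecLin
    have hL : L.ker ≠ ⊥ := LinearMap.ker_ne_bot_of_finrank_lt (by
      rw [Module.finrank_fintype_fun_eq_card, Module.finrank_fintype_fun_eq_card,
        Fintype.card_coe, Fintype.card_coe, Finset.card_product]
      exact hcard)
    obtain ⟨w, hw, hw0⟩ := Submodule.exists_mem_ne_zero_of_ne_bot hL
    refine ⟨fun y => if hy : y ∈ Ix D δ a ×ˢ Ix D δ b then w ⟨y, hy⟩ else 0, ?_, ?_⟩
    · obtain ⟨y, hy⟩ := Function.ne_iff.mp hw0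
      exact ⟨y.1, y.2, by simpa using hy⟩
    · intro z hz
      have := congrFun (LinearMap.mem_ker.mp hw) ⟨z, hz⟩
      simp only [L, Matrix.mulVecLin_apply, Matrix.mulVec, dotProduct, Matrix.of_apply,
        Pi.zero_apply] at this
      refine Eq.trans ?_ this
      rw [← Finset.sum_coe_sort (Ix D δ a ×ˢ Ix D δ b)]
      refine Finset.sum_congr rfl fun y _ => ?_
      simp only [dif_pos y.2]
      rw [mul_comm]
  have hE1 : ∑ y ∈ Ix D δ a ×ˢ Ix D δ b, x y • AdjoinRoot.mk h (mon k y.1 ^ (p ^ v) * e y.2) = 0 := by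
    rw [Finset.sum_congr rfl fun y hy => by rw [hc y hy, Finset.smul_sum], Finset.sum_comm]
    refine Finset.sum_eq_zero fun z hz => ?_
    simp_rw [smul_smul]
    rw [← Finset.sum_smul, hx0 z hz, zero_smul]
  have hpos : 0 < p ^ u * p ^ v := Nat.mul_pos (pow_pos hpp.pos _) (pow_pos hpp.pos _)
  choose w hw using fun y => IsAlgClosed.exists_pow_nat_eq (x y) hpos
  set z : (ℕ × ℕ) × (ℕ × ℕ) → k := fun y => w y ^ p ^ u with hz
  have hzx : ∀ y, z y ^ p ^ v = x y := fun y => by rw [hz, ← hw y, pow_mul]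
  set G : k[X][X] := ∑ y ∈ Ix D δ a ×ˢ Ix D δ b, z y • (mon k y.1 * mon k y.2 ^ (p ^ u)) with hG
  have hGW : Wt δ (a + b * p ^ u) G := by
    refine Wt.sum _ _ fun y hy => ?_
    rw [Finset.mem_product] at hy
    exact Wt.smul ((hmonW a _ hy.1).mul ((hmonW b _ hy.2).pow _)) _
  refine card_points_le hm hirr hD hδ hGW ?_ P ?_
  · -- nonvanishing
    intro hG0
    have hDpos : 0 < D := by
      rw [← hD]
      rcases Nat.eq_zero_or_pos h.natDegree with h0 | h0
      · exact absurd (by rw [hm.natDegree_eq_zero.mp h0]; exact isUnit_one) hirr.not_isUnit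
      · exact h0
    obtain ⟨y0, hy0⟩ : ∃ y0, Δ.eval y0 ≠ 0 := by
      by_contra hcon
      push Not at hcon
      exact hΔ (Polynomial.funext fun y => by simp [hcon y])
    obtain ⟨t0, ht0⟩ : ∃ t0, h.evalEval y0 t0 = 0 := by
      have h1 : (h.map (evalRingHom y0)).degree ≠ 0 := by
        rw [hm.degree_map, degree_eq_natDegree hm.ne_zero, hD]
        exact_mod_cast hDpos.ne'
      obtain ⟨t, ht⟩ := IsAlgClosed.exists_root _ h1
      exact ⟨t, by rw [← map_evalRingHom_eval]; exact ht⟩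
    obtain ⟨ψ, hψ⟩ := exists_hensel hm y0 t0 ht0 (hsep _ _ hy0 ht0)
    have hψs : ∀ (c : k) (f : AdjoinRoot h), ψ (c • f) = PowerSeries.C c * ψ f := by
      intro c f
      have : c • f = AdjoinRoot.of h (C c) * f := by
        rw [Algebra.smul_def]; rfl
      rw [this, map_mul, hψ]
      simp [expand0, PowerSeries.algebraMap_eq]
    have hsum : ∑ κ ∈ Ix D δ a, (ψ (∑ l ∈ Ix D δ b, w (κ, l) • AdjoinRoot.mk h (mon k l))) ^ (p ^ u) *
        ψ (AdjoinRoot.mk h (mon k κ)) = 0 := by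
      rw [← map_zero ψ, ← hG0, hG, map_sum, map_sum, Finset.sum_product]
      refine Finset.sum_congr rfl fun κ _ => ?_
      rw [← map_pow, sum_pow_char_pow, ← map_mul, Finset.sum_mul, map_sum]
      refine Finset.sum_congr rfl fun l _ => ?_
      congr 1
      rw [← AdjoinRoot.smul_mk, map_mul, map_pow, _root_.smul_pow, hz]
      simp only [smul_mul_assoc]
      rw [mul_comm]
    have hall := indep_pow p (Ix D δ a) (fun κ => ψ (AdjoinRoot.mk h (mon k κ))) u ?_ _ hsum
    · obtain ⟨y, hy, hxy⟩ := hxne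
      rw [Finset.mem_product] at hy
      have h1 := hall y.1 hy.1
      have h2 : ∑ l ∈ Ix D δ b, w (y.1, l) • AdjoinRoot.mk h (mon k l) = 0 := by
        have h3 : ∑ l ∈ Ix D δ b, w (y.1, l) • AdjoinRoot.mk h (mon k l) =
            AdjoinRoot.mk h (∑ l ∈ Ix D δ b, w (y.1, l) • mon k l) := by
          rw [map_sum]
          exact Finset.sum_congr rfl fun x _ => by rw [← AdjoinRoot.smul_mk]
        rw [h3] at h1 ⊢
        refine hensel_dvd (r := D * b + 1) hm hirr hD hδ ψ hψ (n := b) ?_ (Nat.lt_succ_self _)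
          (by rw [h1]; exact dvd_zero _)
        exact Wt.sum _ _ fun l hl => Wt.smul (hmonW b l hl) _
      have h3 := mon_indep hm hD _ h2 y.2 hy.2
      apply hxy
      rw [← hw y]
      simp only [Prod.mk.eta] at h3
      rw [h3, zero_pow hpos.ne']
    · intro c' hc'
      apply mon_indep hm hD
      have h3 : ∑ l ∈ Ix D δ a, c' l • AdjoinRoot.mk h (mon k l) =
            AdjoinRoot.mk h (∑ l ∈ Ix D δ a, c' l • mon k l) := by
          rw [map_sum]
          exact Finset.sum_congr rfl fun x _ => by rw [← AdjoinRoot.smul_mk]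
      rw [h3]
      refine hensel_dvd (r := p ^ u) hm hirr hD hδ ψ hψ (n := a) ?_ ha ?_
      · exact Wt.sum _ _ fun l hl => Wt.smul (hmonW a l hl) _
      · rw [← h3, map_sum]
        simp_rw [hψs]
        exact hc'
  · intro q hq
    obtain ⟨q1, q2, q3, q4⟩ := hP q hq
    refine ⟨q1, ?_⟩
    have hE2 : h ∣ ∑ y ∈ Ix D δ a ×ˢ Ix D δ b, x y • (mon k y.1 ^ (p ^ v) * e y.2) := by
      rw [← AdjoinRoot.mk_eq_zero, map_sum, ← hE1]
      exact Finset.sum_congr rfl fun y _ => by rw [← AdjoinRoot.smul_mk]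
    have hE3 : (∑ y ∈ Ix D δ a ×ˢ Ix D δ b, x y • (mon k y.1 ^ (p ^ v) * e y.2)).evalEval q.1 q.2
        = 0 := by
      obtain ⟨g, hg⟩ := hE2
      rw [hg, evalEval_mul, q1, zero_mul]
    have hmon : ∀ l : ℕ × ℕ, (mon k l).evalEval q.1 q.2 = q.1 ^ l.2 * q.2 ^ l.1 := by
      intro l
      simp [mon, evalEval]
    have key : Δ.eval q.1 ^ (D - 1) * (G.evalEval q.1 q.2) ^ (p ^ v) = 0 := by
      rw [← hE3, hG, evalEval_finsetSum, evalEval_finsetSum, sum_pow_char_pow, Finset.mul_sum]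
      refine Finset.sum_congr rfl fun y hy => ?_
      rw [Finset.mem_product, mem_Ix, mem_Ix] at hy
      rw [evalEval_smul, evalEval_smul, evalEval_mul, evalEval_pow, evalEval_mul, evalEval_pow,
        hmon, hmon, smul_eq_mul, smul_eq_mul, mul_pow, hzx]
      simp only [he, evalEval_mul, evalEval_pow, evalEval_C, eval_pow, eval_X]
      rw [← q4, mul_pow (q.1 ^ y.1.2 * _), ← pow_mul, mul_pow (q.1 ^ y.2.2), ← pow_mul, ← pow_mul]
      have e1 : q.1 ^ (y.2.2 * (p ^ u * p ^ v)) = q.1 ^ y.2.2 := by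
        rw [mul_comm, pow_mul, q3]
      have e2 : Δ.eval q.1 ^ (D - 1) = Δ.eval q.1 ^ y.2.1 * Δ.eval q.1 ^ (D - 1 - y.2.1) := by
        rw [← pow_add]; congr 1; omega
      rw [e1, e2, mul_pow]
      ring
    rcases mul_eq_zero.mp key with h1 | h1
    · exact absurd (eq_zero_of_pow_eq_zero h1) q2
    · exact eq_zero_of_pow_eq_zero h1

end Stepanov
end PRat

namespace PRat
open Polynomial

/-- size threshold for the existence of points -/
def thrC (D δ c0 : ℕ) : ℕ :=
  (δ * D + 3 + 1 + δ * D + c0 * D + (D + δ * D * D) * (δ * D + 3)) + D * (1 + δ * D) +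
    D * c0 + D * (1 + D * (δ * D + 3 + δ * D)) + 2 * D + 5

section ThmC

/-- arithmetic of the parameters in Stepanov's method -/
lemma params {D δ c0 r s : ℕ} (hD : 0 < D) (hrs : s ≤ r) (hs : thrC D δ c0 ≤ s) :
    ∃ a b : ℕ, D * a < r ∧
      (Ix D δ (a * s + b + c0 * D)).card < (Ix D δ a).card * (Ix D δ b).card ∧
      D * (a + b * r) ≤ r * s + (1 + D * (δ * D + 3 + δ * D)) * r := by
  unfold thrC at hs
  set M := δ * D + 3 with hM
  obtain ⟨x, hx⟩ : ∃ x, x = r / D := ⟨_, rfl⟩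
  obtain ⟨y, hy⟩ : ∃ y, y = s / D := ⟨_, rfl⟩
  have hx1 : D * x ≤ r := by rw [hx]; exact Nat.mul_div_le r D
  have hx2 : r < D * x + D := by
    rw [hx]; exact Nat.lt_mul_div_succ r hD |>.trans_eq (by ring)
  have hy1 : D * y ≤ s := by rw [hy]; exact Nat.mul_div_le s D
  have hy2 : s < D * y + D := by
    rw [hy]; exact Nat.lt_mul_div_succ s hD |>.trans_eq (by ring)
  have hxbig : δ * D + 1 ≤ x := by
    rw [hx, Nat.le_div_iff_mul_le hD]
    have : (δ * D + 1) * D = D * (1 + δ * D) := by ring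
    omega
  obtain ⟨A, hA⟩ : ∃ A, x = A + δ * D := ⟨x - δ * D, by omega⟩
  have hA1 : 1 ≤ A := by omega
  set B := y + M + 1 with hB
  refine ⟨x - 1, y + M + δ * D, ?_, ?_, ?_⟩
  · obtain ⟨x', rfl⟩ : ∃ x', x = x' + 1 := ⟨x - 1, by omega⟩
    simp only [Nat.add_sub_cancel]
    have : D * (x' + 1) = D * x' + D := by ring
    omega
  · refine (card_Ix_le _ _ _).trans_lt (lt_of_lt_of_le ?_
      (Nat.mul_le_mul (le_card_Ix D δ (x - 1)) (le_card_Ix D δ _)))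
    have e1 : x - 1 + 1 - δ * D = A := by omega
    have e2 : y + M + δ * D + 1 - δ * D = B := by omega
    rw [e1, e2]
    have key : (x - 1) * s + (y + M + δ * D) + c0 * D + 1 < A * (D * B) := by
      have hDB : s + D * M ≤ D * B := by
        have : D * B = D * y + D * M + D := by rw [hB]; ring
        omega
      have h2 : A * (s + D * M) ≤ A * (D * B) := Nat.mul_le_mul_left _ hDB
      refine lt_of_lt_of_le ?_ h2
      -- A * s = x * s - δ D s ; A * D * M ≥ (r - D - δ D D) M
      have h3 : r < D * A + δ * D * D + D := by
        have : D * x = D * A + δ * D * D := by rw [hA]; ring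
        omega
      have h4 : (x - 1) * s ≤ A * s + δ * D * s := by
        have : (x - 1) * s ≤ x * s := Nat.mul_le_mul_right _ (by omega)
        have e : x * s = A * s + δ * D * s := by rw [hA]; ring
        omega
      have h5 : r * M ≤ (D * A) * M + (D + δ * D * D) * M := by
        rw [← add_mul]; exact Nat.mul_le_mul_right _ (by omega)
      have h6 : r * M = r * (δ * D) + 3 * r := by rw [hM]; ring
      have h7 : δ * D * s ≤ r * (δ * D) := by
        rw [mul_comm r]; exact Nat.mul_le_mul_left _ hrs
      have h8 : A * (s + D * M) = A * s + (D * A) * M := by ring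
      have hys : y ≤ s := by rw [hy]; exact Nat.div_le_self _ _
      rw [h8]
      omega
    calc D * ((x - 1) * s + (y + M + δ * D) + c0 * D + 1) < D * (A * (D * B)) :=
          Nat.mul_lt_mul_of_pos_left key hD
      _ = D * A * (D * B) := by ring
  · have h1 : D * (x - 1) ≤ r := (Nat.mul_le_mul_left _ (by omega)).trans hx1
    calc D * (x - 1 + (y + M + δ * D) * r) = D * (x - 1) + (D * y) * r + D * (M + δ * D) * r := by ring
      _ ≤ r + s * r + D * (M + δ * D) * r := by gcongr
      _ = _ := by ring

variable {k : Type*} [Field k] [IsAlgClosed k]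
variable {h : k[X][X]} {δ D : ℕ}

theorem thmC (p : ℕ) [Fact p.Prime] [CharP k p] {m : ℕ} {c0 : ℕ} (hmm : 2 * thrC D δ c0 ≤ m)
    (hm : h.Monic) (hirr : Irreducible h) (hD : h.natDegree = D)
    (hδ : Wt δ (δ * D) h) (Δ : k[X]) (hΔ : Δ ≠ 0) (hΔC : Δ.natDegree ≤ c0)
    (hsep : ∀ y t, Δ.eval y ≠ 0 → h.evalEval y t = 0 → h.derivative.evalEval y t ≠ 0)
    (ρ : Fin D → k[X][X]) (hρ : ∀ l, Wt δ c0 (ρ l))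
    (hprod : ∀ y t, y ^ p ^ m = y → h.evalEval y t = 0 →
      ∏ l, (Δ.eval y * t ^ p ^ m - (ρ l).evalEval y t) = 0) (l0 : Fin D) :
    ∃ y t, y ^ p ^ m = y ∧ Δ.eval y ≠ 0 ∧ h.evalEval y t = 0 ∧
      Δ.eval y * t ^ p ^ m = (ρ l0).evalEval y t := by
  classical
  have hpp : p.Prime := Fact.out
  have hDpos : 0 < D := l0.pos
  by_contra hcon
  push Not at hcon
  set v := m / 2 with hv
  set u := m - m / 2 with hu
  set s := p ^ v with hs
  set r := p ^ u with hr
  have hQ : p ^ m = r * s := by rw [hr, hs, ← pow_add]; congr 1; omega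
  have hsr : s ≤ r := Nat.pow_le_pow_right hpp.pos (by omega)
  have hsbig : thrC D δ c0 ≤ s := by
    have h1 : thrC D δ c0 ≤ v := by omega
    exact h1.trans (Nat.lt_pow_self hpp.one_lt).le
  obtain ⟨a, b, ha, hcard, hbound⟩ := params hDpos hsr hsbig
  -- rational points
  set Qp : k[X] := X ^ p ^ m - X with hQp
  have hm0 : m ≠ 0 := by
    intro h0
    unfold thrC at hmm
    omega
  have h1Q : 1 < p ^ m := Nat.one_lt_pow hm0 hpp.one_lt
  have hQdeg : Qp.natDegree = p ^ m := FiniteField.X_pow_card_sub_X_natDegree_eq k h1Q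
  have hQ0 : Qp ≠ 0 := FiniteField.X_pow_card_sub_X_ne_zero k h1Q
  have hQnd : Qp.roots.Nodup := nodup_roots (galois_poly_separable p _ (dvd_pow_self p hm0))
  set Y0 := Qp.roots.toFinset with hY0
  have hY0card : Y0.card = p ^ m := by
    rw [hY0, Multiset.toFinset_card_of_nodup hQnd, ← hQdeg]
    exact (IsAlgClosed.splits Qp).natDegree_eq_card_roots.symm
  set Y := Y0.filter fun y => Δ.eval y ≠ 0 with hY
  have hYmem : ∀ y, y ∈ Y ↔ y ^ p ^ m = y ∧ Δ.eval y ≠ 0 := by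
    intro y
    rw [hY, Finset.mem_filter, hY0, Multiset.mem_toFinset, mem_roots hQ0, IsRoot, hQp]
    simp [sub_eq_zero]
  have hYcard : p ^ m ≤ Y.card + c0 := by
    have h1 := Finset.card_filter_add_card_filter_not (s := Y0) (fun y => Δ.eval y ≠ 0)
    have h2 : (Y0.filter fun y => ¬ Δ.eval y ≠ 0).card ≤ c0 := by
      refine le_trans (Finset.card_le_card (t := Δ.roots.toFinset) ?_) 
        ((Multiset.toFinset_card_le _).trans ((card_roots' _).trans hΔC))
      intro y hy
      rw [Finset.mem_filter, not_not] at hy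
      rw [Multiset.mem_toFinset, mem_roots hΔ]
      exact hy.2
    rw [← hY] at h1
    omega
  -- roots over a point
  set T : k → Finset k := fun y => (h.map (evalRingHom y)).roots.toFinset with hT
  have hTmem : ∀ y t, t ∈ T y ↔ h.evalEval y t = 0 := by
    intro y t
    rw [hT, Multiset.mem_toFinset, mem_roots (hm.map _).ne_zero, IsRoot, map_evalRingHom_eval]
  have hTcard : ∀ y ∈ Y, (T y).card = D := by
    intro y hy
    have hnd : (h.map (evalRingHom y)).roots.Nodup := by
      rw [Multiset.nodup_iff_count_le_one]
      intro t
      rw [count_roots]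
      by_contra hlt
      push Not at hlt
      rw [one_lt_rootMultiplicity_iff_isRoot (hm.map _).ne_zero] at hlt
      rw [IsRoot, IsRoot, derivative_map, map_evalRingHom_eval, map_evalRingHom_eval] at hlt
      exact hsep y t ((hYmem y).mp hy).2 hlt.1 hlt.2
    change (h.map (evalRingHom y)).roots.toFinset.card = D
    rw [Multiset.toFinset_card_of_nodup hnd,
      ← (IsAlgClosed.splits (h.map (evalRingHom y))).natDegree_eq_card_roots, hm.natDegree_map, hD]
  set S : Finset (k × k) := (Y.sigma T).map (Equiv.sigmaEquivProd k k).toEmbedding with hS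
  have hSmem : ∀ x : k × k, x ∈ S ↔ x.1 ∈ Y ∧ x.2 ∈ T x.1 := by
    rintro ⟨y, t⟩
    rw [hS, Finset.mem_map_equiv]
    simp
  have hScard : S.card = Y.card * D := by
    rw [hS, Finset.card_map, Finset.card_sigma, Finset.sum_congr rfl hTcard, Finset.sum_const,
      smul_eq_mul]
  have hcover : S ⊆ (Finset.univ.erase l0).biUnion fun l =>
      S.filter fun x => Δ.eval x.1 * x.2 ^ p ^ m = (ρ l).evalEval x.1 x.2 := by
    intro x hx
    have hx' := (hSmem x).mp hx
    rw [hYmem, hTmem] at hx'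
    have h1 := hprod x.1 x.2 hx'.1.1 hx'.2
    rw [Finset.prod_eq_zero_iff] at h1
    obtain ⟨l, _, hl⟩ := h1
    rw [Finset.mem_biUnion]
    refine ⟨l, ?_, Finset.mem_filter.mpr ⟨hx, sub_eq_zero.mp hl⟩⟩
    rw [Finset.mem_erase]
    refine ⟨?_, Finset.mem_univ _⟩
    rintro rfl
    exact hcon x.1 x.2 hx'.1.1 hx'.1.2 hx'.2 (sub_eq_zero.mp hl)
  have hN : ∀ l, (S.filter fun x => Δ.eval x.1 * x.2 ^ p ^ m = (ρ l).evalEval x.1 x.2).card ≤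
      r * s + (1 + D * (δ * D + 3 + δ * D)) * r := by
    intro l
    refine le_trans (stepanov p hm hirr hD hδ Δ hΔ hΔC hsep (ρ l) (hρ l) a b u v ha hcard _ ?_) hbound
    intro x hx
    rw [Finset.mem_filter, hSmem, hYmem, hTmem] at hx
    rw [← hr, ← hs, ← hQ]
    exact ⟨hx.1.2, hx.1.1.2, hx.1.1.1, hx.2⟩
  have hle : S.card ≤ (D - 1) * (r * s + (1 + D * (δ * D + 3 + δ * D)) * r) := by
    refine (Finset.card_le_card hcover).trans (Finset.card_biUnion_le.trans ?_)
    refine (Finset.sum_le_sum fun l _ => hN l).trans ?_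
    rw [Finset.sum_const, Finset.card_erase_of_mem (Finset.mem_univ _), Finset.card_univ,
      Fintype.card_fin, smul_eq_mul]
  rw [hScard] at hle
  rw [hQ] at hYcard
  obtain ⟨D', hD'⟩ : ∃ D', D = D' + 1 := ⟨D - 1, by omega⟩
  set K := 1 + D * (δ * D + 3 + δ * D) with hK
  have hthr : D * c0 + D * K < s := by
    unfold thrC at hsbig
    rw [← hK] at hsbig
    omega
  have hD1 : D - 1 = D' := by omega
  rw [hD1] at hle
  have h1 : (r * s) * D ≤ Y.card * D + c0 * D := by
    rw [← add_mul]; exact Nat.mul_le_mul_right _ hYcard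
  have h2 : (r * s) * D = D' * (r * s) + r * s := by rw [hD']; ring
  have h3 : r * s ≤ D' * (K * r) + c0 * D := by
    have : D' * (r * s + K * r) = D' * (r * s) + D' * (K * r) := by ring
    omega
  have hr1 : 1 ≤ r := Nat.one_le_pow _ _ hpp.pos
  have h4 : D' * (K * r) + c0 * D ≤ r * (D * c0 + D * K) := by
    have e1 : D' * (K * r) ≤ D * (K * r) := Nat.mul_le_mul_right _ (by omega)
    have e2 : c0 * D ≤ r * (D * c0) := by
      rw [mul_comm c0]; exact Nat.le_mul_of_pos_left _ hr1
    calc _ ≤ D * (K * r) + r * (D * c0) := add_le_add e1 e2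
      _ = _ := by ring
  have h5 : r * (D * c0 + D * K) < r * s := Nat.mul_lt_mul_of_pos_left hthr hr1
  omega

end ThmC
end PRat

namespace PRat
open Polynomial IntermediateField

section Step0
variable {A K L : Type*} [Field A] [Field K] [Field L] [Algebra A K] [Algebra A L]

lemma ext_hom [IsAlgClosed L] {F1 F2 : Type*} [Field F1] [Field F2] [Algebra A F1] [Algebra A F2]
    [Algebra.IsAlgebraic A F2] (i : F1 →ₐ[A] F2) (f : F1 →ₐ[A] L) :
    ∃ g : F2 →ₐ[A] L, ∀ x, g (i x) = f x := by
  letI := i.toRingHom.toAlgebra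
  letI := f.toRingHom.toAlgebra
  haveI : IsScalarTower A F1 F2 := .of_algebraMap_eq fun x => (i.commutes x).symm
  haveI : IsScalarTower A F1 L := .of_algebraMap_eq fun x => (f.commutes x).symm
  haveI : Algebra.IsAlgebraic F1 F2 := Algebra.IsAlgebraic.tower_top (K := A) F1
  let g : F2 →ₐ[F1] L := IsAlgClosed.lift
  exact ⟨g.restrictScalars A, fun x => g.commutes x⟩

lemma exists_normal [IsAlgClosed K] (Z : Finset K) (hZ : ∀ z ∈ Z, IsAlgebraic A z) :
    ∃ M : IntermediateField A K, FiniteDimensional A M ∧ Normal A M ∧ (∀ z ∈ Z, z ∈ M) ∧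
      ((∀ z ∈ Z, IsSeparable A z) → Algebra.IsSeparable A M) := by
  set q : A[X] := ∏ z ∈ Z, minpoly A z with hq
  have hq0 : q ≠ 0 := Finset.prod_ne_zero_iff.mpr fun z hz =>
    minpoly.ne_zero (hZ z hz).isIntegral
  haveI : IsSplittingField A (adjoin A (q.rootSet K)) q :=
    adjoin_rootSet_isSplittingField (IsAlgClosed.splits _)
  refine ⟨adjoin A (q.rootSet K), IsSplittingField.finiteDimensional _ q,
    Normal.of_isSplittingField q, ?_, ?_⟩
  · intro z hz
    refine subset_adjoin _ _ ?_
    rw [mem_rootSet]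
    refine ⟨hq0, ?_⟩
    rw [hq, map_prod]
    exact Finset.prod_eq_zero hz (minpoly.aeval A z)
  · intro hsep
    rw [isSeparable_adjoin_iff_isSeparable]
    intro x hx
    rw [mem_rootSet, hq, map_prod, Finset.prod_eq_zero_iff] at hx
    obtain ⟨_, z, hz, hxz⟩ := hx
    exact (hsep z hz : (minpoly A z).Separable).of_dvd (minpoly.dvd A x hxz)

lemma coprime_adjust {n N w : ℕ} (hn : 0 < n) (hN : 0 < N) (h : n.Coprime w) :
    ∃ w', w'.Coprime N ∧ w' ≡ w [MOD n] := by
  haveI : NeZero (n * N) := ⟨(Nat.mul_pos hn hN).ne'⟩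
  haveI : NeZero n := ⟨hn.ne'⟩
  obtain ⟨u, hu⟩ := ZMod.unitsMap_surjective (Dvd.intro N rfl : n ∣ n * N)
    (ZMod.unitOfCoprime w h.symm)
  refine ⟨(u : ZMod (n * N)).val, ?_, ?_⟩
  · exact Nat.Coprime.coprime_mul_left_right (ZMod.val_coe_unit_coprime u)
  · have h1 := congrArg Units.val hu
    rw [ZMod.unitsMap_val, ZMod.coe_unitOfCoprime] at h1
    rw [← ZMod.natCast_eq_natCast_iff, ← h1, ZMod.natCast_val]

theorem step0 [IsAlgClosed K] [IsAlgClosed L] (σ : K ≃ₐ[A] K) (τ : L ≃ₐ[A] L)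
    (hKL : ∀ E : IntermediateField A K, FiniteDimensional A E → (∀ x ∈ E, σ x = x) →
      ∃ f : E →ₐ[A] L, ∀ x, τ (f x) = f x)
    (hLK : ∀ E : IntermediateField A L, FiniteDimensional A E → (∀ x ∈ E, τ x = x) →
      ∃ f : E →ₐ[A] K, ∀ x, σ (f x) = f x)
    (Z : Finset K) (hZ : ∀ z ∈ Z, IsAlgebraic A z) (N : ℕ) (hN : 0 < N) :
    ∃ w, w.Coprime N ∧ ∃ j : algebraicClosure A K →ₐ[A] L,
      ∀ z z' : algebraicClosure A K, (z : K) ∈ Z → (z' : K) = (σ ^ w) z → j z' = τ (j z) := by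
  obtain ⟨M, hfin, hnorm, hZM, _⟩ := exists_normal Z hZ
  set s : M ≃ₐ[A] M := σ.restrictNormal M with hs
  have hsc : ∀ x : M, ((s x : M) : K) = σ x := fun x => σ.restrictNormal_commutes M x
  have hspow : ∀ (n : ℕ) (x : M), (((s ^ n) x : M) : K) = (σ ^ n) (x : K) := by
    intro n
    induction n with
    | zero => intro x; simp
    | succ n ih =>
      intro x
      rw [pow_succ', pow_succ', AlgEquiv.mul_apply, AlgEquiv.mul_apply, hsc, ih]
  set E := fixedField (Subgroup.zpowers s) with hE
  -- embedding of E
  have hElift : ∀ x ∈ lift E, σ x = x := by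
    intro x hx
    have hxM : x ∈ M := lift_le E hx
    have h1 : (⟨x, hxM⟩ : M) ∈ E := (mem_lift ⟨x, hxM⟩).mp hx
    rw [hE, mem_fixedField_iff] at h1
    have h2 := h1 s (Subgroup.mem_zpowers s)
    rw [← hsc ⟨x, hxM⟩, h2]
  haveI : FiniteDimensional A (lift E) := LinearEquiv.finiteDimensional (liftAlgEquiv E).toLinearEquiv
  obtain ⟨f, hf⟩ := hKL (lift E) inferInstance hElift
  have hMle : M ≤ algebraicClosure A K := by
    intro x hx
    rw [mem_algebraicClosure_iff]
    exact (isAlgebraic_iff (x := (⟨x, hx⟩ : M))).mp (Algebra.IsAlgebraic.isAlgebraic _)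
  obtain ⟨j, hj⟩ := ext_hom (A := A) ((inclusion hMle).comp E.val)
    (f.comp (liftAlgEquiv E).toAlgHom)
  set jM : M →ₐ[A] L := j.comp (inclusion hMle) with hjM
  have hjE : ∀ x : E, τ (jM x) = jM x := by
    intro x
    have : jM x = f (liftAlgEquiv E x) := hj x
    rw [this, hf]
  letI := jM.toRingHom.toAlgebra
  haveI : IsScalarTower A M L := .of_algebraMap_eq fun x => (jM.commutes x).symm
  set t : M ≃ₐ[A] M := τ.restrictNormal M with ht
  have htc : ∀ x : M, jM (t x) = τ (jM x) := fun x => τ.restrictNormal_commutes M x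
  have hjinj : Function.Injective jM := jM.toRingHom.injective
  have htE : t ∈ Subgroup.zpowers s := by
    rw [← fixingSubgroup_fixedField (Subgroup.zpowers s), IntermediateField.mem_fixingSubgroup_iff]
    intro x hx
    apply hjinj
    rw [htc]
    exact hjE ⟨x, hx⟩
  obtain ⟨w, hw⟩ : ∃ w : ℕ, s ^ w = t := by
    rw [← mem_powers_iff_mem_zpowers] at htE
    exact htE
  set E' := fixedField (Subgroup.zpowers t) with hE'
  have hEE' : E ≤ E' := by
    rw [hE, hE']
    exact fixedField_antitone (Subgroup.zpowers_le.mpr htE)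
  have hfr : Module.finrank A E' ≤ Module.finrank A E := by
    obtain ⟨f', hf'⟩ := hLK (E'.map jM) (by
        exact LinearEquiv.finiteDimensional (E'.equivMap jM).toLinearEquiv) (by
      rintro x ⟨y, hy, rfl⟩
      have := (mem_fixedField_iff _ _).mp hy t (Subgroup.mem_zpowers t)
      change τ (jM y) = jM y
      rw [← htc, this])
    obtain ⟨G, hG⟩ := ext_hom (A := A) (F2 := M) E'.val (f'.comp (E'.equivMap jM).toAlgHom)
    have hGM : ∀ x, G x ∈ M := by
      intro x
      have h := AlgHom.fieldRange_of_normal G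
      exact h.le ⟨x, rfl⟩
    have hGE : ∀ x : E', (⟨G x, hGM x⟩ : M) ∈ E := by
      intro x
      rw [hE, mem_fixedField_iff]
      have h1 : s ∈ MulAction.stabilizer (M ≃ₐ[A] M) (⟨G x, hGM x⟩ : M) := by
        rw [MulAction.mem_stabilizer_iff, AlgEquiv.smul_def]
        apply Subtype.ext
        rw [hsc]
        change σ (G (E'.val x)) = G (E'.val x)
        rw [hG]
        exact hf' _
      intro g hg
      exact (Subgroup.zpowers_le.mpr h1) hg
    let Φ : E' →ₗ[A] E :=
      { toFun := fun x => ⟨⟨G x, hGM x⟩, hGE x⟩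
        map_add' := fun x y => by apply Subtype.ext; apply Subtype.ext; simp
        map_smul' := fun c x => by apply Subtype.ext; apply Subtype.ext; simp }
    refine LinearMap.finrank_le_finrank_of_injective (f := Φ) ?_
    intro x y hxy
    have h1 : G x = G y := congrArg (fun z : E => ((z : M) : K)) hxy
    exact Subtype.ext (G.toRingHom.injective h1)
  have hEeq : E = E' := eq_of_le_of_finrank_le hEE' hfr
  have hzp : Subgroup.zpowers s = Subgroup.zpowers t := by
    rw [← fixingSubgroup_fixedField (Subgroup.zpowers s), ← hE, hEeq, hE', fixingSubgroup_fixedField]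
  have hord : orderOf s = orderOf t := by
    rw [← Nat.card_zpowers, ← Nat.card_zpowers, hzp]
  have hcop : (orderOf s).Coprime w := by
    rw [← hw, orderOf_pow] at hord
    have h0 := orderOf_pos s
    have hd := Nat.gcd_dvd_left (orderOf s) w
    have h1 := Nat.div_mul_cancel hd
    rw [← hord] at h1
    exact Nat.eq_of_mul_eq_mul_left h0 (by rw [h1, mul_one])
  obtain ⟨w', hw'N, hw'⟩ := coprime_adjust (orderOf_pos s) hN hcop
  have hsw : s ^ w' = t := by
    rw [← hw]; exact pow_eq_pow_iff_modEq.mpr hw'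
  refine ⟨w', hw'N, j, ?_⟩
  intro z z' hz hz'
  have hzM := hZM _ hz
  have h1 := htc ⟨z, hzM⟩
  have h2 : z' = inclusion hMle (t ⟨z, hzM⟩) := by
    apply Subtype.ext
    rw [hz', ← hsw]
    exact (hspow w' ⟨z, hzM⟩).symm
  rw [h2]
  exact h1

end Step0
end PRat

namespace PRat
open Polynomial

section Irr

lemma exists_point {k B : Type*} [Field k] [IsAlgClosed k] [CommRing B] [Nontrivial B] [Algebra k B]
    [Algebra.FiniteType k B] : ∃ π : B →+* k, ∀ a, π (algebraMap k B a) = a := by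
  obtain ⟨𝔪, hm⟩ := Ideal.exists_maximal B
  letI : Field (B ⧸ 𝔪) := Ideal.Quotient.field 𝔪
  haveI : Module.Finite k (B ⧸ 𝔪) := finite_of_finite_type_of_isJacobsonRing k (B ⧸ 𝔪)
  have hb : Function.Bijective (algebraMap k (B ⧸ 𝔪)) :=
    IsAlgClosed.algebraMap_bijective_of_isIntegral
  let e := RingEquiv.ofBijective _ hb
  refine ⟨e.symm.toRingHom.comp (Ideal.Quotient.mk 𝔪), fun a => ?_⟩
  change e.symm (algebraMap k (B ⧸ 𝔪) a) = a
  exact e.symm_apply_apply a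

theorem irreducible_map_bi {k L : Type*} [Field k] [IsAlgClosed k] [Field L] (j : k →+* L)
    {h : k[X][X]} (hm : h.Monic) (hirr : Irreducible h) :
    Irreducible (h.map (mapRingHom j)) := by
  classical
  letI := j.toAlgebra
  have hmL : (h.map (mapRingHom j)).Monic := hm.map _
  have hdeg : (h.map (mapRingHom j)).natDegree = h.natDegree := hm.natDegree_map _
  rw [hmL.irreducible_iff_natDegree']
  have hirr' := (hm.irreducible_iff_natDegree').mp hirr
  constructor
  · intro h1
    apply hirr'.1
    rw [h1, natDegree_one] at hdeg
    exact hm.natDegree_eq_zero.mp hdeg.symm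
  · intro f g hf hg hfg hgm
    rw [hdeg] at hgm
    set s : Finset L := (f.support.biUnion fun n => (f.coeff n).support.image fun i => (f.coeff n).coeff i) ∪
      (g.support.biUnion fun n => (g.coeff n).support.image fun i => (g.coeff n).coeff i) with hs
    set B : Subalgebra k L := Algebra.adjoin k (s : Set L) with hB
    haveI : Algebra.FiniteType k B := (Subalgebra.fg_iff_finiteType B).mp ⟨s, rfl⟩
    have hlift : ∀ q : L[X][X], (∀ n i, (q.coeff n).coeff i ∈ B) → q.Monic →
        ∃ Q : B[X][X], Q.map (mapRingHom B.val.toRingHom) = q ∧ Q.natDegree = q.natDegree ∧ Q.Monic := by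
      intro q hq hqm
      refine lifts_and_natDegree_eq_and_monic ?_ hqm
      rw [lifts_iff_coeff_lifts]
      intro n
      have : q.coeff n ∈ lifts B.val.toRingHom := by
        rw [lifts_iff_coeff_lifts]
        intro i
        exact ⟨⟨_, hq n i⟩, rfl⟩
      obtain ⟨Q, hQ⟩ := (mem_lifts _).mp this
      exact ⟨Q, hQ⟩
    have hmemf : ∀ n i, (f.coeff n).coeff i ∈ B := by
      intro n i
      by_cases h0 : (f.coeff n).coeff i = 0
      · rw [h0]; exact B.zero_mem
      · refine Algebra.subset_adjoin ?_
        rw [hs, Finset.mem_coe, Finset.mem_union]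
        left
        rw [Finset.mem_biUnion]
        refine ⟨n, ?_, ?_⟩
        · rw [mem_support_iff]; intro h1; rw [h1] at h0; simp at h0
        · exact Finset.mem_image_of_mem _ (mem_support_iff.mpr h0)
    have hmemg : ∀ n i, (g.coeff n).coeff i ∈ B := by
      intro n i
      by_cases h0 : (g.coeff n).coeff i = 0
      · rw [h0]; exact B.zero_mem
      · refine Algebra.subset_adjoin ?_
        rw [hs, Finset.mem_coe, Finset.mem_union]
        right
        rw [Finset.mem_biUnion]
        refine ⟨n, ?_, ?_⟩
        · rw [mem_support_iff]; intro h1; rw [h1] at h0; simp at h0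
        · exact Finset.mem_image_of_mem _ (mem_support_iff.mpr h0)
    obtain ⟨F, hF, hFd, hFm⟩ := hlift f hmemf hf
    obtain ⟨G, hG, hGd, hGm⟩ := hlift g hmemg hg
    obtain ⟨π, hπ⟩ := exists_point (k := k) (B := B)
    have hinj : Function.Injective (Polynomial.map (mapRingHom B.val.toRingHom)) := by
      apply map_injective
      rw [coe_mapRingHom]
      exact map_injective _ Subtype.val_injective
    have hFG : F * G = h.map (mapRingHom (algebraMap k B)) := by
      apply hinj
      rw [Polynomial.map_mul, hF, hG, hfg, Polynomial.map_map, mapRingHom_comp]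
      rfl
    have hπh : F.map (mapRingHom π) * G.map (mapRingHom π) = h := by
      rw [← Polynomial.map_mul, hFG, Polynomial.map_map, mapRingHom_comp]
      have : π.comp (algebraMap k B) = RingHom.id k := RingHom.ext hπ
      rw [this, mapRingHom_id, Polynomial.map_id]
    refine hirr'.2 _ _ (hFm.map _) (hGm.map _) hπh ?_
    rw [hGm.natDegree_map, hGd]
    exact hgm
end Irr
end PRat

namespace PRat
open Polynomial

section Graph
variable {S K L : Type*} [CommRing S] [Field K] [Field L]

/-- A subring of `K × L` which is the graph of a partial map. -/
def Func (Γ : Subring (K × L)) : Prop := ∀ x : L, ((0 : K), x) ∈ Γ → x = 0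

lemma Func.eq {Γ : Subring (K × L)} (hΓ : Func Γ) {x : K} {a b : L} (h1 : (x, a) ∈ Γ)
    (h2 : (x, b) ∈ Γ) : a = b := by
  have := Γ.sub_mem h1 h2
  rw [Prod.mk_sub_mk, sub_self] at this
  exact sub_eq_zero.mp (hΓ _ this)

lemma Func.ne_zero {Γ : Subring (K × L)} (hΓ : Func Γ) {x : K} (hx : x ≠ 0) {a b : L} (h1 : (x, a) ∈ Γ)
    (h2 : (x⁻¹, b) ∈ Γ) : a ≠ 0 := by
  rintro rfl
  have := Γ.mul_mem h1 h2
  rw [Prod.mk_mul_mk, mul_inv_cancel₀ hx, zero_mul] at this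
  exact one_ne_zero (hΓ.eq Γ.one_mem this)

/-- the graph subring of a specialization -/
def graphRing (ev : S →+* K) (P0 : S →+* L) (hk : ∀ s, ev s = 0 → P0 s = 0) : Subring (K × L) where
  carrier := {x | ∃ s d : S, P0 d ≠ 0 ∧ x = (ev s / ev d, P0 s / P0 d)}
  mul_mem' := by
    rintro _ _ ⟨s, d, hd, rfl⟩ ⟨s', d', hd', rfl⟩
    refine ⟨s * s', d * d', ?_, ?_⟩
    · rw [map_mul]; exact mul_ne_zero hd hd'
    · simp only [map_mul, Prod.mk_mul_mk, div_mul_div_comm]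
  one_mem' := ⟨1, 1, by simp, by simp; rfl⟩
  add_mem' := by
    rintro _ _ ⟨s, d, hd, rfl⟩ ⟨s', d', hd', rfl⟩
    have h1 : ev d ≠ 0 := fun h => hd (hk _ h)
    have h2 : ev d' ≠ 0 := fun h => hd' (hk _ h)
    refine ⟨s * d' + d * s', d * d', ?_, ?_⟩
    · rw [map_mul]; exact mul_ne_zero hd hd'
    · simp only [map_mul, map_add, Prod.mk_add_mk]
      rw [div_add_div _ _ h1 h2, div_add_div _ _ hd hd']
  zero_mem' := ⟨0, 1, by simp, by simp; rfl⟩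
  neg_mem' := by
    rintro _ ⟨s, d, hd, rfl⟩
    refine ⟨-s, d, hd, ?_⟩
    simp [neg_div]

lemma graphRing_func (ev : S →+* K) (P0 : S →+* L) (hk : ∀ s, ev s = 0 → P0 s = 0) :
    Func (graphRing ev P0 hk) := by
  rintro x ⟨s, d, hd, h⟩
  rw [Prod.mk.injEq] at h
  have h1 : ev d ≠ 0 := fun h => hd (hk _ h)
  have h2 : ev s = 0 := (div_eq_zero_iff.mp h.1.symm).resolve_right h1
  rw [h.2, hk s h2, zero_div]

lemma mem_graphRing (ev : S →+* K) (P0 : S →+* L) (hk : ∀ s, ev s = 0 → P0 s = 0) (s d : S)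
    (hd : P0 d ≠ 0) : (ev s / ev d, P0 s / P0 d) ∈ graphRing ev P0 hk := ⟨s, d, hd, rfl⟩

lemma mem_graphRing' (ev : S →+* K) (P0 : S →+* L) (hk : ∀ s, ev s = 0 → P0 s = 0) (s : S) :
    (ev s, P0 s) ∈ graphRing ev P0 hk := ⟨s, 1, by simp, by simp⟩

end Graph

section Biev
variable {R S T : Type*} [CommRing R] [CommRing S] [CommRing T]

/-- evaluation of bivariate polynomials along a ring hom. -/
noncomputable def biev (j : R →+* S) (y t : S) : R[X][X] →+* S :=
  (evalEvalRingHom y t).comp (mapRingHom (mapRingHom j))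

lemma biev_apply (j : R →+* S) (y t : S) (f : R[X][X]) :
    biev j y t f = (f.map (mapRingHom j)).evalEval y t := rfl

@[simp] lemma biev_X (j : R →+* S) (y t : S) : biev j y t X = t := by simp [biev_apply]

@[simp] lemma biev_C (j : R →+* S) (y t : S) (g : R[X]) : biev j y t (C g) = g.eval₂ j y := by
  simp [biev_apply, evalEval_C, eval_map]

lemma biev_eq_eval (j : R →+* S) (y t : S) (f : R[X][X]) :
    biev j y t f = (f.map (eval₂RingHom j y)).eval t := by
  have : biev j y t = (evalRingHom t).comp (mapRingHom (eval₂RingHom j y)) := by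
    apply Polynomial.ringHom_ext
    · intro g; simp
    · simp
  rw [this]; rfl

lemma map_biev (j : R →+* S) (y t : S) (φ : S →+* T) (f : R[X][X]) :
    φ (biev j y t f) = biev (φ.comp j) (φ y) (φ t) f := by
  have : φ.comp (biev j y t) = biev (φ.comp j) (φ y) (φ t) := by
    apply Polynomial.ringHom_ext
    · intro g; simp [Polynomial.hom_eval₂]
    · simp
  rw [← this]; rfl

lemma biev_map (j : R →+* S) (i : S →+* T) (y t : T) (f : R[X][X]) :
    biev i y t (f.map (mapRingHom j)) = biev (i.comp j) y t f := by
  rw [biev_apply, biev_apply, Polynomial.map_map, mapRingHom_comp]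

lemma biev_congr (j j' : R →+* S) (y t : S) (f : R[X][X])
    (h : ∀ n i, j ((f.coeff n).coeff i) = j' ((f.coeff n).coeff i)) : biev j y t f = biev j' y t f := by
  rw [biev_apply, biev_apply]
  congr 1
  ext n i
  simp [h]

end Biev

section Core
variable {K L : Type*} [Field K] [Field L]

/-- the pseudo-algebraically-closed type property of a field with automorphism, for plane curves. -/
def PAC (τ : L → L) : Prop := ∀ (D : ℕ) (h : L[X][X]) (Δ : L[X]) (ρ : Fin D → L[X][X]),
  h.Monic → Irreducible h → h.natDegree = D → Δ ≠ 0 →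
  (∀ y t, Δ.eval y ≠ 0 → h.evalEval y t = 0 → h.derivative.evalEval y t ≠ 0) →
  (∀ y t, τ y = y → h.evalEval y t = 0 → ∏ l, (Δ.eval y * τ t - (ρ l).evalEval y t) = 0) →
  ∀ l0, ∃ y t, τ y = y ∧ Δ.eval y ≠ 0 ∧ h.evalEval y t = 0 ∧ Δ.eval y * τ t = (ρ l0).evalEval y t

theorem pac_core {k0 : Type*} [Field k0] [IsAlgClosed k0] (α : k0 →+* K) (σ : K ≃+* K) (τ : L ≃+* L)
    (hPAC : PAC τ) (j : k0 →+* L) (σ0 : k0 →+* k0) (hσ0 : ∀ a, α (σ0 a) = σ (α a))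
    (c θ : K) (hσc : σ c = c) (h : k0[X][X]) (hm : h.Monic) (hirr : Irreducible h)
    {D : ℕ} (hD : h.natDegree = D) (hθ : ∀ f, biev α c θ f = 0 ↔ h ∣ f)
    (θs : Fin D → K) (hsplit : h.map (eval₂RingHom α c) = ∏ l, (X - C (θs l)))
    (hder : biev α c θ h.derivative ≠ 0) (Δ0 : k0[X]) (hΔ0 : Δ0 ≠ 0)
    (ρ : Fin D → k0[X][X]) (hρ : ∀ l, Δ0.eval₂ α c * σ (θs l) = biev α c θ (ρ l))
    (l0 : Fin D) (hl0 : θs l0 = θ)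
    (hj : ∀ n i, j (σ0 ((h.coeff n).coeff i)) = τ (j ((h.coeff n).coeff i))) :
    ∃ y t : L, τ y = y ∧ Δ0.eval₂ j y ≠ 0 ∧ ∃ hk : ∀ f, biev α c θ f = 0 → biev j y t f = 0,
      (σ θ, τ t) ∈ graphRing (biev α c θ) (biev j y t) hk := by
  haveI : Fact (Irreducible h) := ⟨hirr⟩
  -- denominators for the derivative
  obtain ⟨r, hr0, b, hb⟩ : ∃ r : k0[X], r ≠ 0 ∧ ∃ b : k0[X][X], h ∣ C r - h.derivative * b := by
    haveI : IsDomain (AdjoinRoot h) := AdjoinRoot.isDomain_of_prime hirr.prime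
    haveI := hm.finite_adjoinRoot
    have h1 : AdjoinRoot.mk h h.derivative ≠ 0 := by
      rw [Ne, AdjoinRoot.mk_eq_zero, ← hθ]; exact hder
    have h2 : IsAlgebraic k0[X] (AdjoinRoot.mk h h.derivative) :=
      (Algebra.IsIntegral.isIntegral (R := k0[X]) _).isAlgebraic
    obtain ⟨r, hr, b, hb⟩ := h2.exists_nonzero_dvd (mem_nonZeroDivisors_of_ne_zero h1)
    obtain ⟨b, rfl⟩ := AdjoinRoot.mk_surjective b
    refine ⟨r, hr, b, ?_⟩
    rw [← AdjoinRoot.mk_eq_zero, map_sub, map_mul, ← hb, sub_eq_zero]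
    rfl
  have hk : ∀ y t, biev j y t h = 0 → ∀ f, biev α c θ f = 0 → biev j y t f = 0 := by
    intro y t hyt f hf
    obtain ⟨g, rfl⟩ := (hθ f).mp hf
    rw [map_mul, hyt, zero_mul]
  -- the norm identity
  set Q : k0[X][X][X] := ∏ l, (C (C Δ0) * X - C (ρ l)) -
    C (C (Δ0 ^ D)) * (h.map (mapRingHom σ0)).map C with hQ
  have hQ0 : Q.map (biev α c θ) = 0 := by
    have h1 : (((h.map (mapRingHom σ0)).map C).map (biev α c θ)) = ∏ l, (X - C (σ (θs l))) := by
      have : (h.map (eval₂RingHom α c)).map (σ : K →+* K) = ∏ l, (X - C (σ (θs l))) := by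
        rw [hsplit, Polynomial.map_prod]
        simp
      rw [← this, Polynomial.map_map, Polynomial.map_map, Polynomial.map_map]
      congr 1
      apply Polynomial.ringHom_ext
      · intro a; simp [hσ0]
      · simp [hσc]
    rw [hQ, Polynomial.map_sub, Polynomial.map_mul, h1, Polynomial.map_prod]
    simp only [Polynomial.map_sub, Polynomial.map_mul, map_C, map_X, ← hρ, biev_C, Polynomial.map_pow, C_mul,
      C_pow, ← mul_sub, Finset.prod_mul_distrib, Finset.prod_const, Finset.card_univ, Fintype.card_fin,
      sub_self]
  have hident : ∀ y t T, biev j y t h = 0 → ∏ l, (Δ0.eval₂ j y * T - biev j y t (ρ l)) =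
      (Δ0.eval₂ j y) ^ D * biev (j.comp σ0) y T h := by
    intro y t T hyt
    have h1 : Q.map (biev j y t) = 0 := by
      ext n
      rw [coeff_map, coeff_zero]
      apply hk y t hyt
      rw [← coeff_map, hQ0, coeff_zero]
    have h2 : ((Q.map (biev j y t)).eval T) = 0 := by rw [h1, eval_zero]
    rw [hQ, Polynomial.map_sub, eval_sub, sub_eq_zero, Polynomial.map_prod, eval_prod] at h2
    simp only [Polynomial.map_sub, Polynomial.map_mul, map_C, map_X, biev_C, eval_sub, eval_mul, eval_C,
      eval_X, eval₂_pow] at h2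
    rw [h2, ← biev_map, biev_eq_eval j y T]
    congr 2
    rw [Polynomial.map_map]
    congr 1
    apply Polynomial.ringHom_ext
    · intro a; simp
    · simp
  have hev : ∀ (y : L) (g : k0[X]), (g.map j).eval y = g.eval₂ j y := fun y g => eval_map _ _
  obtain ⟨y, t, hy, hΔ, hyt, ht⟩ := hPAC D (h.map (mapRingHom j)) ((Δ0 * r).map j)
    (fun l => (C r * ρ l).map (mapRingHom j)) (hm.map _) (irreducible_map_bi j hm hirr)
    ((hm.natDegree_map _).trans hD)
    ((Polynomial.map_ne_zero_iff j.injective).mpr (mul_ne_zero hΔ0 hr0)) (by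
      intro y t hy hyt
      rw [derivative_map, ← biev_apply]
      rw [← biev_apply] at hyt
      obtain ⟨g, hg⟩ := hb
      have := congrArg (biev j y t) hg
      rw [map_sub, map_mul, map_mul, hyt, zero_mul, sub_eq_zero, biev_C] at this
      rw [hev, eval₂_mul, this] at hy
      exact left_ne_zero_of_mul (right_ne_zero_of_mul hy)) (by
      intro y t hy hyt
      rw [← biev_apply] at hyt
      have h1 := hident y t (τ t) hyt
      have h2 : biev (j.comp σ0) y (τ t) h = 0 := by
        have := map_biev j y t (τ : L →+* L) h
        rw [hyt, map_zero] at this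
        rw [this]
        simp only [RingEquiv.coe_toRingHom, hy]
        apply biev_congr
        intro n i
        exact hj n i
      rw [h2, mul_zero] at h1
      simp only [hev, ← biev_apply, map_mul, biev_C, eval₂_mul]
      obtain ⟨l, _, hl⟩ := Finset.prod_eq_zero_iff.mp h1
      refine Finset.prod_eq_zero (Finset.mem_univ l) ?_
      linear_combination (r.eval₂ j y) * hl) l0
  rw [← biev_apply] at hyt
  rw [hev, eval₂_mul] at hΔ
  have hΔ1 := left_ne_zero_of_mul hΔ
  have hr1 := right_ne_zero_of_mul hΔ
  refine ⟨y, t, hy, hΔ1, hk y t hyt, ?_⟩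
  rw [hev, ← biev_apply, map_mul, biev_C, eval₂_mul] at ht
  have h3 := mem_graphRing (biev α c θ) (biev j y t) (hk y t hyt) (ρ l0) (C Δ0) (by rwa [biev_C])
  have h4 : Δ0.eval₂ α c ≠ 0 := by
    intro h0
    apply hΔ1
    have := hk y t hyt (C Δ0) (by rwa [biev_C])
    rwa [biev_C] at this
  rw [← hρ, hl0, biev_C, biev_C, mul_div_cancel_left₀ _ h4] at h3
  have h5 : biev j y t (ρ l0) / Δ0.eval₂ j y = τ t := by
    rw [div_eq_iff hΔ1]
    apply mul_left_cancel₀ hr1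
    linear_combination -ht
  rwa [h5] at h3

end Core
end PRat

namespace PRat
open Polynomial IntermediateField

section SpecPrep

lemma minpoly_data {k0 K : Type*} [Field k0] [Field K] (α : k0 →+* K) (c θ : K)
    (hc : ∀ f : k0[X], f.eval₂ α c = 0 → f = 0) (hθ : (eval₂RingHom α c).IsIntegralElem θ) :
    ∃ h : k0[X][X], h.Monic ∧ Irreducible h ∧ ∀ f, biev α c θ f = 0 ↔ h ∣ f := by
  letI : Algebra k0[X] K := (eval₂RingHom α c).toAlgebra
  have hinj : Function.Injective (algebraMap k0[X] K) := by
    rw [injective_iff_map_eq_zero]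
    exact hc
  haveI : FaithfulSMul k0[X] K := (faithfulSMul_iff_algebraMap_injective _ _).mpr hinj
  haveI : Module.IsTorsionFree k0[X] K := inferInstance
  have hintg : IsIntegral k0[X] θ := hθ
  refine ⟨minpoly k0[X] θ, minpoly.monic hintg, minpoly.irreducible hintg, fun f => ?_⟩
  rw [← minpoly.isIntegrallyClosed_dvd_iff hintg, biev_eq_eval, aeval_def, eval₂_eq_eval_map]
  rfl

lemma integral_multiple {A K : Type*} [Field A] [Field K] (α : A →+* K) (c θ : K)
    (G : A[X][X]) (hG : G ≠ 0) (hGθ : biev α c θ G = 0) :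
    ∃ d : A[X], d ≠ 0 ∧ (eval₂RingHom α c).IsIntegralElem (d.eval₂ α c * θ) := by
  letI : Algebra A[X] K := (eval₂RingHom α c).toAlgebra
  have h1 : IsAlgebraic A[X] θ := ⟨G, hG, by
    rw [biev_eq_eval] at hGθ
    rw [aeval_def, eval₂_eq_eval_map]
    exact hGθ⟩
  obtain ⟨d, hd, h2⟩ := h1.exists_integral_multiple
  refine ⟨d, hd, ?_⟩
  rw [Algebra.smul_def] at h2
  exact h2

variable {A K : Type*} [Field A] [Field K] [Algebra A K]

lemma clear_poly (c : K) (μ : (A⟮c⟯)[X]) : ∃ d : A[X], aeval c d ≠ 0 ∧ ∃ G : A[X][X],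
    G.map (eval₂RingHom (algebraMap A K) c) = C (aeval c d) * μ.map (algebraMap A⟮c⟯ K) := by
  induction μ using Polynomial.induction_on' with
  | add p q hp hq =>
    obtain ⟨d, hd, G, hG⟩ := hp
    obtain ⟨d', hd', G', hG'⟩ := hq
    refine ⟨d * d', by rw [map_mul]; exact mul_ne_zero hd hd', C d' * G + C d * G', ?_⟩
    rw [Polynomial.map_add, Polynomial.map_mul, Polynomial.map_mul, hG, hG', map_C, map_C, map_mul,
      Polynomial.map_add, C_mul]
    simp only [coe_eval₂RingHom, aeval_def]
    ring
  | monomial n a =>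
    obtain ⟨r, s, hrs⟩ := (mem_adjoin_simple_iff A (a : K)).mp a.2
    by_cases hs : aeval c s = 0
    · refine ⟨1, by simp, 0, ?_⟩
      rw [hs, div_zero] at hrs
      rw [map_monomial]
      have : algebraMap A⟮c⟯ K a = 0 := hrs
      rw [this]
      simp
    · refine ⟨s, hs, monomial n r, ?_⟩
      rw [map_monomial, map_monomial, C_mul_monomial]
      congr 1
      have : algebraMap A⟮c⟯ K a = aeval c r / aeval c s := hrs
      rw [this, mul_div_cancel₀ _ hs]
      rfl

lemma clear_elt (c θ : K) (hθ : IsAlgebraic A⟮c⟯ θ) (x : K) (hx : x ∈ (A⟮c⟯)⟮θ⟯) :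
    ∃ d : A[X], aeval c d ≠ 0 ∧ ∃ G : A[X][X], aeval c d * x = biev (algebraMap A K) c θ G := by
  rw [← mem_toSubalgebra, adjoin_simple_toSubalgebra_of_isAlgebraic hθ,
    Algebra.adjoin_singleton_eq_range_aeval] at hx
  obtain ⟨μ, hμ⟩ := hx
  obtain ⟨d, hd, G, hG⟩ := clear_poly c μ
  refine ⟨d, hd, G, ?_⟩
  rw [biev_eq_eval, hG, eval_mul, eval_C, eval_map, ← hμ]
  rfl

lemma clear_finset (c θ : K) (hθ : IsAlgebraic A⟮c⟯ θ) (W : Finset K) (hW : ∀ x ∈ W, x ∈ (A⟮c⟯)⟮θ⟯) :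
    ∃ d : A[X], aeval c d ≠ 0 ∧ ∀ x ∈ W, ∃ G : A[X][X], aeval c d * x = biev (algebraMap A K) c θ G := by
  classical
  induction W using Finset.induction_on with
  | empty => exact ⟨1, by simp, by simp⟩
  | insert x W hx ih =>
    obtain ⟨d, hd, h1⟩ := ih fun y hy => hW y (Finset.mem_insert_of_mem hy)
    obtain ⟨d', hd', G', hG'⟩ := clear_elt c θ hθ x (hW x (Finset.mem_insert_self _ _))
    refine ⟨d * d', by rw [map_mul]; exact mul_ne_zero hd hd', ?_⟩
    intro y hy
    rcases Finset.mem_insert.mp hy with rfl | hy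
    · refine ⟨C d * G', ?_⟩
      rw [map_mul, map_mul, ← hG', biev_C, mul_assoc, aeval_def]
    · obtain ⟨G, hG⟩ := h1 y hy
      refine ⟨C d' * G, ?_⟩
      rw [map_mul, map_mul, ← hG, biev_C, ← aeval_def]
      ring

lemma biev_mem {R S : Type*} [CommRing R] [CommRing S] (Γ : Subring S) (j : R →+* S) (y t : S)
    (hj : ∀ a, j a ∈ Γ) (hy : y ∈ Γ) (ht : t ∈ Γ) (f : R[X][X]) : biev j y t f ∈ Γ := by
  induction f using Polynomial.induction_on' with
  | add p q hp hq => rw [map_add]; exact Γ.add_mem hp hq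
  | monomial n a =>
    rw [← C_mul_X_pow_eq_monomial, map_mul, map_pow, biev_X, biev_C]
    refine Γ.mul_mem ?_ (Γ.pow_mem ht n)
    rw [eval₂_eq_sum_range]
    exact Γ.sum_mem fun i _ => Γ.mul_mem (hj _) (Γ.pow_mem hy i)

/-- A primitive element of a normal separable closure, integral over `A[c]`. -/
lemma exists_theta [IsAlgClosed K] (c : K) (hc : Transcendental A c) (Z : Finset K)
    (hZ : ∀ z ∈ Z, IsSeparable A⟮c⟯ z) :
    ∃ θ : K, IsIntegral A⟮c⟯ θ ∧ (minpoly A⟮c⟯ θ).Separable ∧ (∀ z ∈ Z, z ∈ (A⟮c⟯)⟮θ⟯) ∧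
      Normal A⟮c⟯ (A⟮c⟯)⟮θ⟯ ∧
      (eval₂RingHom (algebraMap A K) c).IsIntegralElem θ := by
  obtain ⟨M, hfin, hnorm, hZM, hsep⟩ := exists_normal (A := A⟮c⟯) Z fun z hz => (hZ z hz).isIntegral.isAlgebraic
  haveI := hsep hZ
  obtain ⟨β, hβ⟩ := Field.exists_primitive_element A⟮c⟯ M
  have hβi : IsIntegral A⟮c⟯ (β : K) := by
    have := (Algebra.IsIntegral.isIntegral (R := A⟮c⟯) β)
    exact this.map M.val
  obtain ⟨d, hd, G, hG⟩ := clear_poly c (minpoly A⟮c⟯ (β : K))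
  have hinj : Function.Injective (eval₂RingHom (algebraMap A K) c) := by
    rw [injective_iff_map_eq_zero]
    exact transcendental_iff.mp hc
  have hG0 : G ≠ 0 := by
    rintro rfl
    rw [Polynomial.map_zero, eq_comm, mul_eq_zero, C_eq_zero] at hG
    exact (hG.resolve_left hd) |> fun h => (Polynomial.map_ne_zero (minpoly.ne_zero hβi)) h
  obtain ⟨d1, hd1, hintg⟩ := integral_multiple (algebraMap A K) c (β : K) G hG0 (by
    rw [biev_eq_eval, hG, eval_mul, eval_map]
    have := minpoly.aeval A⟮c⟯ (β : K)
    rw [aeval_def] at this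
    rw [this, mul_zero])
  have hd1c : aeval c d1 ≠ 0 := fun h => hd1 (transcendental_iff.mp hc _ h)
  set u : A⟮c⟯ := ⟨aeval c d1, by
    exact (mem_adjoin_simple_iff A _).mpr ⟨d1, 1, by simp⟩⟩ with hu
  have hu0 : u ≠ 0 := fun h => hd1c (congrArg Subtype.val h)
  have huβ : ((u • β : M) : K) = d1.eval₂ (algebraMap A K) c * β := by
    rw [IntermediateField.coe_smul, Algebra.smul_def]; rfl
  have hadj : (A⟮c⟯)⟮((u • β : M) : K)⟯ = M := by
    apply le_antisymm
    · rw [adjoin_simple_le_iff]; exact (u • β : M).2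
    · intro x hx
      have h1 : (⟨x, hx⟩ : M) ∈ (A⟮c⟯)⟮β⟯ := by rw [hβ]; trivial
      have h2 : (⟨x, hx⟩ : M) ∈ (A⟮c⟯)⟮u • β⟯ := by
        refine (adjoin_simple_le_iff.mpr ?_ : (A⟮c⟯)⟮β⟯ ≤ (A⟮c⟯)⟮u • β⟯) h1
        have := (A⟮c⟯)⟮u • β⟯.smul_mem (mem_adjoin_simple_self A⟮c⟯ (u • β)) (x := u⁻¹)
        rwa [smul_smul, inv_mul_cancel₀ hu0, one_smul] at this
      have h3 : x ∈ ((A⟮c⟯)⟮u • β⟯).map M.val := ⟨_, h2, rfl⟩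
      rw [adjoin_map, Set.image_singleton] at h3
      exact h3
  refine ⟨((u • β : M) : K), ?_, ?_, ?_, ?_, ?_⟩
  · exact (Algebra.IsIntegral.isIntegral (R := A⟮c⟯) (u • β)).map M.val
  · have := Algebra.IsSeparable.isSeparable A⟮c⟯ (u • β)
    have h2 : minpoly A⟮c⟯ ((u • β : M) : K) = minpoly A⟮c⟯ (u • β) :=
      minpoly.algHom_eq M.val M.val.injective (u • β)
    rw [h2]; exact this
  · rw [hadj]; exact hZM
  · rw [hadj]; exact hnorm
  · rw [huβ]; exact hintg

end SpecPrep
end PRat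

namespace PRat
open Polynomial IntermediateField

section Spec

lemma exists_fin_roots {K : Type*} [Field K] [IsAlgClosed K] (q : K[X]) (hq : q.Monic) {D : ℕ}
    (hD : q.natDegree = D) : ∃ θs : Fin D → K, q = ∏ l, (X - C (θs l)) := by
  have h1 := (IsAlgClosed.splits q).eq_prod_roots
  have h2 := (IsAlgClosed.splits q).natDegree_eq_card_roots
  obtain ⟨l, hl⟩ := Quot.exists_rep q.roots
  have hl' : (l : Multiset K) = q.roots := hl
  rw [← hl', Multiset.coe_card, hD] at h2
  subst h2
  refine ⟨l.get, ?_⟩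
  rw [hq.leadingCoeff, C_1, one_mul, ← hl', Multiset.map_coe, Multiset.prod_coe] at h1
  rw [← List.prod_ofFn]
  conv_lhs => rw [h1]
  congr 1
  conv_lhs => rw [← List.ofFn_get l]
  rw [List.map_ofFn]
  rfl

variable {A K L : Type*} [Field A] [Field K] [Field L] [Algebra A K] [Algebra A L]

/-- existence of a good specialization -/
def Spec (σ : K ≃ₐ[A] K) (τ : L ≃ₐ[A] L) (Z : Finset K) (N : ℕ) : Prop :=
  ∃ w : ℕ, w.Coprime N ∧ ∃ Γ : Subring (K × L), Func Γ ∧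
    (∀ a : A, (algebraMap A K a, algebraMap A L a) ∈ Γ) ∧
    ∃ P : K → L, ∀ z ∈ Z, (z, P z) ∈ Γ ∧ ((σ ^ w) z, τ (P z)) ∈ Γ

theorem spec_sep [IsAlgClosed K] [IsAlgClosed L] (σ : K ≃ₐ[A] K) (τ : L ≃ₐ[A] L)
    (hKL : ∀ E : IntermediateField A K, FiniteDimensional A E → (∀ x ∈ E, σ x = x) →
      ∃ f : E →ₐ[A] L, ∀ x, τ (f x) = f x)
    (hLK : ∀ E : IntermediateField A L, FiniteDimensional A E → (∀ x ∈ E, τ x = x) →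
      ∃ f : E →ₐ[A] K, ∀ x, σ (f x) = f x) (hPAC : PAC τ)
    (c : K) (hσc : σ c = c) (hc : Transcendental A c)
    (Z : Finset K) (hZ : ∀ z ∈ Z, IsSeparable A⟮c⟯ z) (N : ℕ) (hN : 0 < N) : Spec σ τ Z N := by
  classical
  obtain ⟨θ, hθi, hθs, hZθ, hnorm, hθint⟩ := exists_theta c hc Z hZ
  set k0 := algebraicClosure A K with hk0
  haveI : IsAlgClosed k0 := IsAlgClosure.isAlgClosed A
  set α : k0 →+* K := algebraMap k0 K with hα
  set β : A →+* k0 := algebraMap A k0 with hβ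
  have hαβ : α.comp β = algebraMap A K := rfl
  have hc0 : ∀ f : k0[X], f.eval₂ α c = 0 → f = 0 := transcendental_iff.mp hc.algebraicClosure
  have hθ0 : (eval₂RingHom α c).IsIntegralElem θ := by
    obtain ⟨q, hq, hq'⟩ := hθint
    refine ⟨q.map (mapRingHom β), hq.map _, ?_⟩
    rw [eval₂_map]
    rw [← hq']
    congr 1
    apply Polynomial.ringHom_ext
    · intro a; simp [← hαβ]
    · simp
  obtain ⟨h, hm, hirr, hdvd⟩ := minpoly_data α c θ hc0 hθ0
  obtain ⟨d, hd, G, hG⟩ := clear_poly c (minpoly A⟮c⟯ θ)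
  set μ := (minpoly A⟮c⟯ θ).map (algebraMap A⟮c⟯ K) with hμ
  have hGev : ∀ x, biev (algebraMap A K) c x G = aeval c d * μ.eval x := by
    intro x
    rw [biev_eq_eval, hG, eval_mul, eval_C]
  have hμθ : μ.eval θ = 0 := by
    rw [hμ, eval_map]; exact minpoly.aeval A⟮c⟯ θ
  have hdvdμ : h.map (eval₂RingHom α c) ∣ μ := by
    have h1 : h ∣ G.map (mapRingHom β) := by
      rw [← hdvd, biev_map, hαβ, hGev, hμθ, mul_zero]
    have h2 := map_dvd (mapRingHom (eval₂RingHom α c)) h1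
    rw [coe_mapRingHom, Polynomial.map_map] at h2
    have h3 : (eval₂RingHom α c).comp (mapRingHom β) = eval₂RingHom (algebraMap A K) c := by
      apply Polynomial.ringHom_ext
      · intro a; simp [← hαβ]
      · simp
    rw [h3, hG] at h2
    exact (IsUnit.dvd_mul_left (isUnit_C.mpr (isUnit_iff_ne_zero.mpr hd))).mp h2
  have hμsep : μ.Separable := hθs.map
  have hsep := hμsep.of_dvd hdvdμ
  have hroot : ∀ x, μ.eval x = 0 → x ∈ (A⟮c⟯)⟮θ⟯ := by
    intro x hx
    have h1 := hnorm.splits (⟨θ, mem_adjoin_simple_self _ θ⟩ : (A⟮c⟯)⟮θ⟯)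
    have h0 : minpoly A⟮c⟯ (⟨θ, mem_adjoin_simple_self _ θ⟩ : (A⟮c⟯)⟮θ⟯) = minpoly A⟮c⟯ θ :=
      (minpoly.algHom_eq (A⟮c⟯)⟮θ⟯.val (A⟮c⟯)⟮θ⟯.val.injective _).symm
    rw [h0] at h1
    refine (splits_iff_mem (IsAlgClosed.splits _)).mp h1 x ?_
    rw [mem_rootSet]
    refine ⟨minpoly.ne_zero hθi, ?_⟩
    rw [aeval_def, ← eval_map]; exact hx
  obtain ⟨D, hD⟩ : ∃ D, h.natDegree = D := ⟨_, rfl⟩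
  obtain ⟨θs, hsplit⟩ := exists_fin_roots (h.map (eval₂RingHom α c)) (hm.map _)
    ((hm.natDegree_map _).trans hD)
  have hθsroot : ∀ l, μ.eval (θs l) = 0 := by
    intro l
    obtain ⟨g, hg⟩ := hdvdμ
    rw [hg, hsplit, eval_mul, eval_prod, Finset.prod_eq_zero (Finset.mem_univ l) (by simp), zero_mul]
  have hhθ : (h.map (eval₂RingHom α c)).eval θ = 0 := by
    rw [← biev_eq_eval, hdvd]
  obtain ⟨l0, hl0⟩ : ∃ l0, θs l0 = θ := by
    rw [hsplit, eval_prod, Finset.prod_eq_zero_iff] at hhθ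
    obtain ⟨l, _, hl⟩ := hhθ
    rw [eval_sub, eval_X, eval_C, sub_eq_zero] at hl
    exact ⟨l, hl.symm⟩
  have hder : biev α c θ h.derivative ≠ 0 := by
    rw [biev_eq_eval, ← derivative_map]
    have := hsep.aeval_derivative_ne_zero (x := θ) (by rw [coe_aeval_eq_eval]; exact hhθ)
    rwa [coe_aeval_eq_eval] at this
  -- apply step0
  set Z0 : Finset K := h.support.biUnion fun n => (h.coeff n).support.image fun i => α ((h.coeff n).coeff i)
    with hZ0
  have hZ0mem : ∀ n i, (h.coeff n).coeff i ≠ 0 → α ((h.coeff n).coeff i) ∈ Z0 := by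
    intro n i h0
    rw [hZ0, Finset.mem_biUnion]
    refine ⟨n, ?_, ?_⟩
    · rw [mem_support_iff]; intro h1; rw [h1] at h0; simp at h0
    · exact Finset.mem_image_of_mem _ (mem_support_iff.mpr h0)
  obtain ⟨w, hwN, j, hj⟩ := step0 σ τ hKL hLK Z0 (by
    intro z hz
    rw [hZ0, Finset.mem_biUnion] at hz
    obtain ⟨n, _, hz⟩ := hz
    rw [Finset.mem_image] at hz
    obtain ⟨i, _, rfl⟩ := hz
    exact mem_algebraicClosure_iff.mp ((h.coeff n).coeff i).2) N hN
  set s : K ≃ₐ[A] K := σ ^ w with hs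
  have hsc : s c = c := by
    have : σ ∈ MulAction.stabilizer (K ≃ₐ[A] K) c := hσc
    exact Subgroup.pow_mem _ this w
  have hsA : (s : K →+* K).comp (algebraMap A K) = algebraMap A K := by
    ext a; exact s.commutes a
  let σ0 : k0 →+* k0 :=
    { toFun := fun x => ⟨s x, (map_mem_algebraicClosure_iff (s : K →ₐ[A] K)).mpr x.2⟩
      map_one' := by apply Subtype.ext; simp
      map_mul' := fun x y => by apply Subtype.ext; simp
      map_zero' := by apply Subtype.ext; simp
      map_add' := fun x y => by apply Subtype.ext; simp }
  have hsroot : ∀ x, μ.eval x = 0 → μ.eval (s x) = 0 := by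
    intro x hx
    have h1 := hGev (s x)
    have h2 := map_biev (algebraMap A K) c x (s : K →+* K) G
    rw [hGev x, hx, mul_zero, map_zero, hsA] at h2
    change 0 = biev (algebraMap A K) (s c) (s x) G at h2
    rw [hsc, h1] at h2
    exact (mul_eq_zero.mp h2.symm).resolve_left hd
  obtain ⟨e, he, hW⟩ := clear_finset c θ hθi.isAlgebraic (Z ∪ Finset.univ.image fun l => s (θs l)) (by
    intro x hx
    rcases Finset.mem_union.mp hx with hx | hx
    · exact hZθ x hx
    · obtain ⟨l, _, rfl⟩ := Finset.mem_image.mp hx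
      exact hroot _ (hsroot _ (hθsroot l)))
  choose! U hU using hW
  have hlift : ∀ f, biev α c θ (f.map (mapRingHom β)) = biev (algebraMap A K) c θ f := by
    intro f; rw [biev_map, hαβ]
  have hliftj : ∀ y t f, biev (j : k0 →+* L) y t (f.map (mapRingHom β)) = biev (algebraMap A L) y t f := by
    intro y t f; rw [biev_map]
    congr 2
    ext a; exact j.commutes a
  have heα : (e.map β).eval₂ α c = aeval c e := by rw [eval₂_map, hαβ]; rfl
  obtain ⟨y, t, hy, hΔ, hk, hst⟩ := pac_core α (s : K ≃+* K) (τ : L ≃+* L) hPAC (j : k0 →+* L) σ0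
    (fun a => rfl) c θ hsc h hm hirr hD hdvd θs hsplit hder (e.map β)
    (by intro h0; apply he; rw [← heα, h0, eval₂_zero])
    (fun l => (U (s (θs l))).map (mapRingHom β))
    (by
      intro l
      rw [hlift, ← hU _ (Finset.mem_union_right _ (Finset.mem_image_of_mem _ (Finset.mem_univ l))), heα]
      rfl) l0 hl0 (by
      intro n i
      by_cases h0 : (h.coeff n).coeff i = 0
      · rw [h0]; simp
      · exact hj _ _ (hZ0mem n i h0) rfl)
  set Γ := graphRing (biev α c θ) (biev (j : k0 →+* L) y t) hk with hΓ
  have hAΓ : ∀ a : A, (algebraMap A K a, algebraMap A L a) ∈ Γ := by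
    intro a
    have := mem_graphRing' (biev α c θ) (biev (j : k0 →+* L) y t) hk (C (C (β a)))
    rw [biev_C, biev_C, eval₂_C, eval₂_C] at this
    have h2 : (j : k0 →+* L) (β a) = algebraMap A L a := j.commutes a
    rwa [h2] at this
  have hcΓ : (c, y) ∈ Γ := by
    have := mem_graphRing' (biev α c θ) (biev (j : k0 →+* L) y t) hk (C X)
    rwa [biev_C, biev_C, eval₂_X, eval₂_X] at this
  have heL : (e.map β).eval₂ (j : k0 →+* L) y = aeval y e := by
    rw [eval₂_map]
    have : (j : k0 →+* L).comp β = algebraMap A L := by ext a; exact j.commutes a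
    rw [this]; rfl
  rw [heL] at hΔ
  have heΓ : ((aeval c e)⁻¹, (aeval y e)⁻¹) ∈ Γ := by
    have := mem_graphRing (biev α c θ) (biev (j : k0 →+* L) y t) hk 1 (C (e.map β))
      (by rw [biev_C, heL]; exact hΔ)
    rwa [map_one, map_one, biev_C, biev_C, heL, heα, one_div, one_div] at this
  have hpair : ∀ (x : K) (x' : L) (f : A[X][X]), (x, x') ∈ Γ →
      (biev (algebraMap A K) c x f, biev (algebraMap A L) y x' f) ∈ Γ := by
    intro x x' f hx
    have h1 := biev_mem Γ (algebraMap A (K × L)) (c, y) (x, x') hAΓ hcΓ hx f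
    have h2 := map_biev (algebraMap A (K × L)) (c, y) (x, x') (RingHom.fst K L) f
    have h3 := map_biev (algebraMap A (K × L)) (c, y) (x, x') (RingHom.snd K L) f
    have h4 : biev (algebraMap A (K × L)) (c, y) (x, x') f =
      (biev (algebraMap A K) c x f, biev (algebraMap A L) y x' f) := Prod.ext h2 h3
    rwa [← h4]
  have hθΓ : (θ, t) ∈ Γ := by
    have := mem_graphRing' (biev α c θ) (biev (j : k0 →+* L) y t) hk X
    rwa [biev_X, biev_X] at this
  refine ⟨w, hwN, Γ, graphRing_func _ _ _, hAΓ, fun z => biev (algebraMap A L) y t (U z) * (aeval y e)⁻¹, ?_⟩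
  intro z hz
  have hz1 := hU z (Finset.mem_union_left _ hz)
  have hz2 : z = biev (algebraMap A K) c θ (U z) * (aeval c e)⁻¹ := by
    rw [← hz1]; field_simp
  constructor
  · have := Γ.mul_mem (hpair θ t (U z) hθΓ) heΓ
    rwa [Prod.mk_mul_mk, ← hz2] at this
  · have := Γ.mul_mem (hpair (s θ) (τ t) (U z) hst) heΓ
    rw [Prod.mk_mul_mk] at this
    have h5 : s z = biev (algebraMap A K) c (s θ) (U z) * (aeval c e)⁻¹ := by
      conv_lhs => rw [hz2]
      rw [map_mul, map_inv₀, ← aeval_algHom_apply, hsc]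
      congr 1
      have h2 := map_biev (algebraMap A K) c θ (s : K →+* K) (U z)
      rw [hsA] at h2
      change s _ = biev (algebraMap A K) (s c) (s θ) (U z) at h2
      rw [h2, hsc]
    have hy' : τ y = y := hy
    have h6 : τ (biev (algebraMap A L) y t (U z) * (aeval y e)⁻¹) =
        biev (algebraMap A L) y (τ t) (U z) * (aeval y e)⁻¹ := by
      rw [map_mul, map_inv₀, ← aeval_algHom_apply, hy']
      congr 1
      have h2 := map_biev (algebraMap A L) y t (τ : L →+* L) (U z)
      have h3 : (τ : L →+* L).comp (algebraMap A L) = algebraMap A L := by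
        ext a; exact τ.commutes a
      rw [h3] at h2
      change τ _ = biev (algebraMap A L) (τ y) (τ t) (U z) at h2
      rw [h2, hy']
    rw [h5, h6]
    exact this

end Spec
end PRat

namespace PRat
open Polynomial IntermediateField

section Spec2

lemma exists_sep_pow {F K : Type*} [Field F] [Field K] [Algebra F K] (p : ℕ) [Fact p.Prime] [CharP F p]
    (Z : Finset K) (hZ : ∀ z ∈ Z, IsAlgebraic F z) : ∃ e : ℕ, ∀ z ∈ Z, IsSeparable F (z ^ p ^ e) := by
  have h1 : ∀ z ∈ Z, ∃ e : ℕ, IsSeparable F (z ^ p ^ e) := by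
    intro z hz
    have hi := (hZ z hz).isIntegral
    obtain ⟨n, g, hg, hgz⟩ := exists_separable_of_irreducible p (minpoly.irreducible hi)
      (Fact.out : p.Prime).ne_zero
    refine ⟨n, hg.of_dvd (minpoly.dvd _ _ ?_)⟩
    rw [← expand_aeval, hgz, minpoly.aeval]
  choose! e he using h1
  refine ⟨Z.sup e, fun z hz => ?_⟩
  have h2 := Finset.le_sup (f := e) hz
  have h3 : z ^ p ^ e z ∈ separableClosure F K := mem_separableClosure_iff.mpr (he z hz)
  have h4 := pow_mem h3 (p ^ (Z.sup e - e z))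
  rw [← pow_mul, ← pow_add, Nat.add_sub_cancel' h2] at h4
  exact mem_separableClosure_iff.mp h4

variable {A K L : Type*} [Field A] [Field K] [Field L] [Algebra A K] [Algebra A L]

theorem spec_all [IsAlgClosed K] [IsAlgClosed L] (p : ℕ) [Fact p.Prime] [CharP K p] [CharP L p]
    (σ : K ≃ₐ[A] K) (τ : L ≃ₐ[A] L)
    (hKL : ∀ E : IntermediateField A K, FiniteDimensional A E → (∀ x ∈ E, σ x = x) →
      ∃ f : E →ₐ[A] L, ∀ x, τ (f x) = f x)
    (hLK : ∀ E : IntermediateField A L, FiniteDimensional A E → (∀ x ∈ E, τ x = x) →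
      ∃ f : E →ₐ[A] K, ∀ x, σ (f x) = f x) (hPAC : PAC τ)
    (c : K) (hσc : σ c = c)
    (Z : Finset K) (hZ : ∀ z ∈ Z, IsAlgebraic A⟮c⟯ z) (N : ℕ) (hN : 0 < N) : Spec σ τ Z N := by
  classical
  by_cases hc : IsAlgebraic A c
  · have hZA : ∀ z ∈ Z, IsAlgebraic A z := by
      intro z hz
      haveI : Algebra.IsAlgebraic A A⟮c⟯ := isAlgebraic_adjoin_simple hc.isIntegral
      exact (hZ z hz).restrictScalars A
    obtain ⟨w, hw, j, hj⟩ := step0 σ τ hKL hLK Z hZA N hN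
    set α : algebraicClosure A K →+* K := algebraMap (algebraicClosure A K) K with hα
    have hk : ∀ x, α x = 0 → (j : algebraicClosure A K →+* L) x = 0 := by
      intro x hx
      have : x = 0 := α.injective (by rw [hx, map_zero])
      rw [this, map_zero]
    refine ⟨w, hw, graphRing α (j : algebraicClosure A K →+* L) hk, graphRing_func _ _ _, ?_,
      fun z => if h : z ∈ algebraicClosure A K then j ⟨z, h⟩ else 0, ?_⟩
    · intro a
      have := mem_graphRing' α (j : algebraicClosure A K →+* L) hk (algebraMap A _ a)
      have h2 : (j : algebraicClosure A K →+* L) (algebraMap A _ a) = algebraMap A L a := j.commutes a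
      rw [h2] at this
      exact this
    · intro z hz
      have hz' : z ∈ algebraicClosure A K := mem_algebraicClosure_iff.mpr (hZA z hz)
      simp only [dif_pos hz']
      constructor
      · exact mem_graphRing' α (j : algebraicClosure A K →+* L) hk ⟨z, hz'⟩
      · have hz2 : (σ ^ w) z ∈ algebraicClosure A K :=
          (map_mem_algebraicClosure_iff ((σ ^ w : K ≃ₐ[A] K) : K →ₐ[A] K)).mpr hz'
        have h1 := mem_graphRing' α (j : algebraicClosure A K →+* L) hk ⟨(σ ^ w) z, hz2⟩
        have h2 := hj ⟨z, hz'⟩ ⟨(σ ^ w) z, hz2⟩ hz rfl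
        rw [← h2]
        exact h1
  · haveI : CharP A p := ((algebraMap A K).charP_iff (algebraMap A K).injective p).mpr inferInstance
    haveI : CharP A⟮c⟯ p := ((algebraMap A⟮c⟯ K).charP_iff (algebraMap A⟮c⟯ K).injective p).mpr inferInstance
    obtain ⟨e, he⟩ := exists_sep_pow p Z hZ
    obtain ⟨w, hw, Γ, hΓ, hA, P, hP⟩ := spec_sep σ τ hKL hLK hPAC c hσc hc (Z.image fun z => z ^ p ^ e) (by
      intro z hz
      obtain ⟨x, hx, rfl⟩ := Finset.mem_image.mp hz
      exact he x hx) N hN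
    let Φ : K × L →+* K × L := RingHom.prodMap (iterateFrobenius K p e) (iterateFrobenius L p e)
    have hΦ : ∀ x y, Φ (x, y) = (x ^ p ^ e, y ^ p ^ e) := fun x y => rfl
    have hpe : 0 < p ^ e := pow_pos (Fact.out : p.Prime).pos e
    have hroot : ∀ u : L, ∃ v, v ^ p ^ e = u := fun u => IsAlgClosed.exists_pow_nat_eq u hpe
    choose V hV using hroot
    refine ⟨w, hw, Γ.comap Φ, ?_, ?_, fun z => V (P (z ^ p ^ e)), ?_⟩
    · intro x hx
      rw [Subring.mem_comap, hΦ, zero_pow hpe.ne'] at hx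
      exact eq_zero_of_pow_eq_zero (hΓ _ hx)
    · intro a
      rw [Subring.mem_comap, hΦ, ← map_pow, ← map_pow]
      exact hA _
    · intro z hz
      have h1 := hP _ (Finset.mem_image_of_mem _ hz)
      rw [Subring.mem_comap, Subring.mem_comap, hΦ, hΦ, ← map_pow, ← map_pow, hV]
      exact h1

end Spec2
end PRat

namespace PRat
open Polynomial

section Mev
variable {s R S : Type*} [CommRing R] [CommRing S]

/-- evaluation of integer polynomials -/
noncomputable def mev (x : s → R) : MvPolynomial s ℤ →+* R := (MvPolynomial.aeval x).toRingHom

@[simp] lemma mev_X (x : s → R) (i : s) : mev x (MvPolynomial.X i) = x i := by simp [mev]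

lemma mev_apply (x : s → R) (q : MvPolynomial s ℤ) : mev x q = MvPolynomial.aeval x q := rfl

lemma map_mev (φ : R →+* S) (x : s → R) (q : MvPolynomial s ℤ) : φ (mev x q) = mev (fun i => φ (x i)) q := by
  have : φ.comp (mev x) = mev (fun i => φ (x i)) := by
    apply MvPolynomial.ringHom_ext
    · intro n; simp
    · intro i; simp
  rw [← this]; rfl

lemma comp_mev (φ : R →+* S) (x : s → R) : φ.comp (mev x) = mev (fun i => φ (x i)) :=
  RingHom.ext (map_mev φ x)

lemma mev_mem (Γ : Subring R) (x : s → R) (hx : ∀ i, x i ∈ Γ) (q : MvPolynomial s ℤ) : mev x q ∈ Γ := by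
  have := map_mev Γ.subtype (fun i => (⟨x i, hx i⟩ : Γ)) q
  simp only [Subring.subtype_apply] at this
  rw [← this]
  exact Subtype.property _

end Mev

/-- The data of a basic (Ax-type) formula. -/
structure OmD (k : ℕ) where
  /-- number of algebraic witnesses -/
  r : ℕ
  /-- polynomials whose roots are the witnesses -/
  g : Fin r → Polynomial (MvPolynomial (Fin k) ℤ)
  /-- equations -/
  f : Finset (MvPolynomial (Fin k ⊕ Fin r) ℤ)

/-- truth of a basic formula in the fixed field of `σ`. -/
def OmD.Holds {k : ℕ} (ω : OmD k) {K : Type*} [CommRing K] (σ : K → K) (x : Fin k → K) : Prop :=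
  (∀ i, (ω.g i).map (mev x) ≠ 0) ∧ ∃ t : Fin ω.r → K, (∀ i, σ (t i) = t i) ∧
    (∀ i, ((ω.g i).map (mev x)).eval (t i) = 0) ∧ ∀ q ∈ ω.f, mev (Sum.elim x t) q = 0

section Transfer
variable {K L : Type*} [Field K] [Field L]

lemma exists_period (σ : K ≃+* K) (R : Finset K) (hR : ∀ z ∈ R, σ z ∈ R) :
    ∃ N : ℕ, 0 < N ∧ ∀ z ∈ R, ∀ w : ℕ, w.Coprime N → (σ ^ w) z = z → σ z = z := by
  let f : R → R := fun z => ⟨σ z, hR z z.2⟩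
  have hf : Function.Bijective f := by
    rw [← Finite.injective_iff_bijective]
    intro x y hxy
    exact Subtype.ext (σ.injective (congrArg Subtype.val hxy))
  let s : Equiv.Perm R := Equiv.ofBijective f hf
  have hs : ∀ (n : ℕ) (z : R), (((s ^ n) z : R) : K) = (σ ^ n) (z : K) := by
    intro n
    induction n with
    | zero => intro z; rfl
    | succ n ih =>
      intro z
      rw [pow_succ', pow_succ', Equiv.Perm.mul_apply, RingAut.mul_apply, ← ih]
      rfl
  refine ⟨orderOf s, orderOf_pos s, ?_⟩
  intro z hz w hw hwz
  have h1 : (s ^ w) • (⟨z, hz⟩ : R) = ⟨z, hz⟩ := by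
    apply Subtype.ext
    exact (hs w ⟨z, hz⟩).trans hwz
  have h2 : (s ^ orderOf s) • (⟨z, hz⟩ : R) = ⟨z, hz⟩ := by
    rw [pow_orderOf_eq_one, one_smul]
  rw [MulAction.pow_smul_eq_iff_period_dvd] at h1 h2
  have h3 := Nat.dvd_gcd h1 h2
  rw [hw.gcd_eq_one] at h3
  have h4 : s ^ 1 • (⟨z, hz⟩ : R) = ⟨z, hz⟩ := MulAction.pow_smul_eq_iff_period_dvd.mpr h3
  rw [pow_one] at h4
  exact congrArg Subtype.val h4

theorem holds_iff [IsAlgClosed K] {F : Type*} [Field F] [Algebra F K] {k : ℕ} (ω : OmD k) (σ : K ≃+* K)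
    (τ : L ≃+* L) (a0 : Fin k → F) (a : Fin k → K) (haa : ∀ i, algebraMap F K (a0 i) = a i)
    (hσa : ∀ i, σ (a i) = a i) :
    ∃ (Z : Finset K) (N : ℕ), 0 < N ∧ (∀ z ∈ Z, IsAlgebraic F z) ∧
      ∀ (w : ℕ) (Γ : Subring (K × L)) (P : K → L) (b : Fin k → L), w.Coprime N → Func Γ →
      (∀ i, (a i, b i) ∈ Γ) → (∀ z ∈ Z, (z, P z) ∈ Γ ∧ ((σ ^ w) z, τ (P z)) ∈ Γ) →
      (ω.Holds σ a ↔ ω.Holds τ b) := by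
  classical
  set q : Fin ω.r → K[X] := fun i => (ω.g i).map (mev a) with hq
  set R : Finset K := Finset.univ.biUnion fun i => (q i).roots.toFinset with hR
  have hRroot : ∀ i z, z ∈ (q i).roots → z ∈ R := by
    intro i z hz
    rw [hR, Finset.mem_biUnion]
    exact ⟨i, Finset.mem_univ i, Multiset.mem_toFinset.mpr hz⟩
  have hσq : ∀ (s : K ≃+* K), (∀ i, s (a i) = a i) → ∀ i z, (q i).eval z = 0 → (q i).eval (s z) = 0 := by
    intro s hs i z hz
    have h1 : (q i).map (s : K →+* K) = q i := by
      rw [hq]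
      simp only
      rw [Polynomial.map_map, comp_mev]
      congr 2
      funext i
      exact hs i
    rw [← h1, eval_map]
    have := Polynomial.hom_eval₂ (q i) (RingHom.id K) (s : K →+* K) z
    rw [RingHom.comp_id, eval₂_id, hz, map_zero] at this
    exact this.symm
  have hRσ : ∀ z ∈ R, σ z ∈ R := by
    intro z hz
    rw [hR, Finset.mem_biUnion] at hz
    obtain ⟨i, _, hz⟩ := hz
    rw [Multiset.mem_toFinset, mem_roots'] at hz
    exact hRroot i _ (mem_roots'.mpr ⟨hz.1, hσq σ hσa i z hz.2⟩)
  obtain ⟨N, hN, hper⟩ := exists_period σ R hRσ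
  set Z : Finset K := R ∪ (Finset.univ.image fun i => ((q i).leadingCoeff)⁻¹) ∪
    ((R ×ˢ R).image fun z => (z.1 - z.2)⁻¹) ∪
    (ω.f ×ˢ (Fintype.piFinset fun _ : Fin ω.r => R)).image (fun u => (mev (Sum.elim a u.2) u.1)⁻¹) with hZ
  have hZ1 : ∀ z ∈ R, z ∈ Z := by
    intro z hz; simp only [hZ, Finset.mem_union]; exact Or.inl (Or.inl (Or.inl hz))
  have hZ2 : ∀ i, ((q i).leadingCoeff)⁻¹ ∈ Z := by
    intro i; simp only [hZ, Finset.mem_union]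
    exact Or.inl (Or.inl (Or.inr (Finset.mem_image_of_mem _ (Finset.mem_univ i))))
  have hZ3 : ∀ z ∈ R, ∀ z' ∈ R, (z - z')⁻¹ ∈ Z := by
    intro z hz z' hz'; simp only [hZ, Finset.mem_union]
    exact Or.inl (Or.inr (Finset.mem_image.mpr ⟨(z, z'), Finset.mk_mem_product hz hz', rfl⟩))
  have hZ4 : ∀ f ∈ ω.f, ∀ t : Fin ω.r → K, (∀ i, t i ∈ R) → (mev (Sum.elim a t) f)⁻¹ ∈ Z := by
    intro f hf t ht; simp only [hZ, Finset.mem_union]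
    exact Or.inr (Finset.mem_image.mpr ⟨(f, t), Finset.mk_mem_product hf (Fintype.mem_piFinset.mpr ht), rfl⟩)
  refine ⟨Z, N, hN, ?_, ?_⟩
  · -- algebraicity
    have hacl : ∀ i, a i ∈ algebraicClosure F K := by
      intro i; rw [← haa]; exact IntermediateField.algebraMap_mem _ _
    have hRa : ∀ z ∈ R, z ∈ algebraicClosure F K := by
      intro z hz
      rw [hR, Finset.mem_biUnion] at hz
      obtain ⟨i, _, hz⟩ := hz
      rw [Multiset.mem_toFinset, mem_roots'] at hz
      rw [mem_algebraicClosure_iff]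
      have h1 : q i = ((ω.g i).map (mev a0)).map (algebraMap F K) := by
        rw [Polynomial.map_map, comp_mev, funext haa]
      refine ⟨(ω.g i).map (mev a0), ?_, ?_⟩
      · intro h0; apply hz.1; rw [h1, h0, Polynomial.map_zero]
      · rw [aeval_def, ← eval_map, ← h1]; exact hz.2
    have hev : ∀ (x : Fin k ⊕ Fin ω.r → K) f, (∀ i, x i ∈ algebraicClosure F K) →
        mev x f ∈ algebraicClosure F K := fun x f hx =>
      mev_mem (algebraicClosure F K).toSubring x hx f
    intro z hz
    rw [← mem_algebraicClosure_iff]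
    simp only [hZ, Finset.mem_union] at hz
    rcases hz with ((hz | hz) | hz) | hz
    · exact hRa z hz
    · obtain ⟨i, _, rfl⟩ := Finset.mem_image.mp hz
      refine inv_mem ?_
      rw [Polynomial.leadingCoeff, hq]
      simp only
      rw [coeff_map]
      exact mev_mem (algebraicClosure F K).toSubring a hacl _
    · obtain ⟨u, hu, rfl⟩ := Finset.mem_image.mp hz
      rw [Finset.mem_product] at hu
      exact inv_mem (sub_mem (hRa _ hu.1) (hRa _ hu.2))
    · obtain ⟨u, hu, rfl⟩ := Finset.mem_image.mp hz
      rw [Finset.mem_product, Fintype.mem_piFinset] at hu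
      refine inv_mem (hev _ _ ?_)
      rintro (i | i)
      · exact hacl i
      · exact hRa _ (hu.2 i)
  · intro w Γ P b hw hΓ hab hP
    set P1 : Γ →+* K := (RingHom.fst K L).comp Γ.subtype with hP1
    set P2 : Γ →+* L := (RingHom.snd K L).comp Γ.subtype with hP2
    have hinj : Function.Injective P1 := by
      rw [injective_iff_map_eq_zero]
      rintro ⟨⟨x, y⟩, hxy⟩ h0
      have h0' : x = 0 := h0
      subst h0'
      exact Subtype.ext (Prod.ext rfl (hΓ y hxy))
    set ah : Fin k → Γ := fun i => ⟨(a i, b i), hab i⟩ with hah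
    set zh : K → Γ := fun z => if h : (z, P z) ∈ Γ then ⟨(z, P z), h⟩ else 0 with hzh
    have hzR : ∀ z ∈ Z, P1 (zh z) = z ∧ P2 (zh z) = P z := by
      intro z hz
      have := (hP z hz).1
      simp only [hzh, dif_pos this]
      exact ⟨rfl, rfl⟩
    have hga : ∀ i, ((ω.g i).map (mev ah)).map P1 = q i := by
      intro i; rw [Polynomial.map_map, comp_mev]; rfl
    have hgb : ∀ i, ((ω.g i).map (mev ah)).map P2 = (ω.g i).map (mev b) := by
      intro i; rw [Polynomial.map_map, comp_mev]; rfl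
    -- nonvanishing detection
    have hnz : ∀ x : Γ, P1 x ≠ 0 → (P1 x)⁻¹ ∈ Z → P2 x ≠ 0 := by
      rintro ⟨⟨x, y⟩, hxy⟩ h0 h1
      exact hΓ.ne_zero h0 hxy (hP _ h1).1
    have hzero : ∀ x : Γ, P1 x = 0 → P2 x = 0 := by
      intro x hx
      have : x = 0 := hinj (by rw [hx, map_zero])
      rw [this, map_zero]
    have hgnz : ∀ i, q i ≠ 0 ↔ (ω.g i).map (mev b) ≠ 0 := by
      intro i
      constructor
      · intro h0 h1
        have h2 : P1 (((ω.g i).map (mev ah)).coeff (q i).natDegree) = (q i).leadingCoeff := by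
          rw [← coeff_map, hga]; rfl
        refine hnz (((ω.g i).map (mev ah)).coeff (q i).natDegree) ?_ ?_ ?_
        · rw [h2]; exact leadingCoeff_ne_zero.mpr h0
        · rw [h2]; exact hZ2 i
        · rw [← coeff_map, hgb, h1, coeff_zero]
      · intro h0 h1
        apply h0
        have : (ω.g i).map (mev ah) = 0 := by
          apply Polynomial.map_injective P1 hinj
          rw [hga, h1, Polynomial.map_zero]
        rw [← hgb, this, Polynomial.map_zero]
    have helim1 : ∀ t : Fin ω.r → K, (∀ i, t i ∈ R) → (fun i => P1 ((Sum.elim ah fun i => zh (t i)) i)) = Sum.elim a t := by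
      intro t ht
      funext i
      rcases i with i | i
      · rfl
      · exact (hzR _ (hZ1 _ (ht i))).1
    have helim2 : ∀ t : Fin ω.r → K, (∀ i, t i ∈ R) → (fun i => P2 ((Sum.elim ah fun i => zh (t i)) i)) =
        Sum.elim b (fun i => P (t i)) := by
      intro t ht
      funext i
      rcases i with i | i
      · rfl
      · exact (hzR _ (hZ1 _ (ht i))).2
    constructor
    · rintro ⟨h1, t, h2, h3, h4⟩
      have htR : ∀ i, t i ∈ R := fun i => hRroot i _ (mem_roots'.mpr ⟨h1 i, h3 i⟩)
      refine ⟨fun i => (hgnz i).mp (h1 i), fun i => P (t i), ?_, ?_, ?_⟩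
      · intro i
        have h5 := hP _ (hZ1 _ (htR i))
        have h6 : (σ ^ w) (t i) = t i := by
          have : σ ∈ MulAction.stabilizer (K ≃+* K) (t i) := h2 i
          exact Subgroup.pow_mem _ this w
        rw [h6] at h5
        exact (hΓ.eq h5.2 h5.1)
      · intro i
        have h5 := hzR _ (hZ1 _ (htR i))
        beta_reduce
        rw [← hgb, ← h5.2, eval_map_apply]
        apply hzero
        rw [← eval_map_apply, hga, h5.1]
        exact h3 i
      · intro f hf
        rw [← helim2 t htR, ← map_mev]
        apply hzero
        rw [map_mev, helim1 t htR]
        exact h4 f hf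
    · rintro ⟨h1, t, h2, h3, h4⟩
      have hq0 : ∀ i, q i ≠ 0 := fun i => (hgnz i).mpr (h1 i)
      have hfac : ∀ i, (ω.g i).map (mev ah) = C (((ω.g i).map (mev ah)).coeff (q i).natDegree) *
          ((q i).roots.map fun z => X - C (zh z)).prod := by
        intro i
        apply Polynomial.map_injective P1 hinj
        rw [hga, Polynomial.map_mul, map_C, ← coeff_map, hga, Polynomial.map_multiset_prod, Multiset.map_map]
        have e1 := (IsAlgClosed.splits (q i)).eq_prod_roots
        conv_lhs => rw [e1]
        congr 2
        apply Multiset.map_congr rfl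
        intro z hz
        simp only [Function.comp, Polynomial.map_sub, map_X, map_C, (hzR z (hZ1 _ (hRroot i z hz))).1]
      have hex : ∀ i, ∃ z ∈ (q i).roots, t i = P z := by
        intro i
        have e1 := h3 i
        rw [← hgb, hfac, Polynomial.map_mul, map_C, ← coeff_map, hgb, Polynomial.map_multiset_prod, Multiset.map_map,
          eval_mul, eval_C, eval_multiset_prod, Multiset.map_map, mul_eq_zero] at e1
        have e2 : ((ω.g i).map (mev b)).coeff (q i).natDegree ≠ 0 := by
          have h2 : P1 (((ω.g i).map (mev ah)).coeff (q i).natDegree) = (q i).leadingCoeff := by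
            rw [← coeff_map, hga]; rfl
          rw [← hgb, coeff_map]
          refine hnz _ ?_ ?_
          · rw [h2]; exact leadingCoeff_ne_zero.mpr (hq0 i)
          · rw [h2]; exact hZ2 i
        have e3 := e1.resolve_left e2
        rw [Multiset.prod_eq_zero_iff, Multiset.mem_map] at e3
        obtain ⟨z, hz, e4⟩ := e3
        refine ⟨z, hz, ?_⟩
        simp only [Function.comp, Polynomial.map_sub, map_X, map_C, (hzR z (hZ1 _ (hRroot i z hz))).2, eval_sub,
          eval_X, eval_C] at e4
        exact sub_eq_zero.mp e4
      choose u hu hut using hex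
      have huR : ∀ i, u i ∈ R := fun i => hRroot i _ (hu i)
      refine ⟨hq0, u, ?_, ?_, ?_⟩
      · intro i
        apply hper _ (huR i) w hw
        by_contra hne
        have h5 := hP _ (hZ1 _ (huR i))
        have h6 : (σ ^ w) (u i) ∈ R := by
          refine hRroot i _ (mem_roots'.mpr ⟨hq0 i, ?_⟩)
          refine hσq (σ ^ w) ?_ i (u i) (mem_roots'.mp (hu i)).2
          intro l
          have : σ ∈ MulAction.stabilizer (K ≃+* K) (a l) := hσa l
          exact Subgroup.pow_mem _ this w
        have h7 := hΓ.ne_zero (sub_ne_zero.mpr hne) (Γ.sub_mem h5.2 h5.1) (hP _ (hZ3 _ h6 _ (huR i))).1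
        apply h7
        change τ (P (u i)) - P (u i) = 0
        rw [← hut, h2, sub_self]
      · intro i
        exact (mem_roots'.mp (hu i)).2
      · intro f hf
        by_contra hne
        have h5 := hnz (mev (Sum.elim ah fun i => zh (u i)) f) (by rw [map_mev, helim1 u huR]; exact hne)
          (by rw [map_mev, helim1 u huR]; exact hZ4 f hf u huR)
        apply h5
        rw [map_mev, helim2 u huR]
        have : (fun i => P (u i)) = t := by funext i; exact (hut i).symm
        rw [this]
        exact h4 f hf

end Transfer
end PRat

namespace PRat
open Polynomial

section Types
universe u

variable {A : Type*} [Field A] {k : ℕ} (a0 : Fin k → A)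

lemma clear_uv (hgen : ∀ x : A, ∃ q d : MvPolynomial (Fin k) ℤ, mev a0 d ≠ 0 ∧ x = mev a0 q / mev a0 d)
    (g : A[X]) : ∃ d : MvPolynomial (Fin k) ℤ, mev a0 d ≠ 0 ∧ ∃ f : (MvPolynomial (Fin k) ℤ)[X],
      f.map (mev a0) = C (mev a0 d) * g := by
  induction g using Polynomial.induction_on' with
  | add p q hp hq =>
    obtain ⟨d, hd, G, hG⟩ := hp
    obtain ⟨d', hd', G', hG'⟩ := hq
    refine ⟨d * d', by rw [map_mul]; exact mul_ne_zero hd hd', C d' * G + C d * G', ?_⟩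
    rw [Polynomial.map_add, Polynomial.map_mul, Polynomial.map_mul, hG, hG', map_C, map_C, map_mul, C_mul]
    ring
  | monomial n x =>
    obtain ⟨q, d, hd, rfl⟩ := hgen x
    refine ⟨d, hd, monomial n q, ?_⟩
    rw [map_monomial, C_mul_monomial, mul_div_cancel₀ _ hd]

lemma clear_mv (hgen : ∀ x : A, ∃ q d : MvPolynomial (Fin k) ℤ, mev a0 d ≠ 0 ∧ x = mev a0 q / mev a0 d)
    {r : ℕ} (g : MvPolynomial (Fin r) A) : ∃ d : MvPolynomial (Fin k) ℤ, mev a0 d ≠ 0 ∧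
      ∃ f : MvPolynomial (Fin k ⊕ Fin r) ℤ,
      mev (Sum.elim (fun i => MvPolynomial.C (a0 i)) MvPolynomial.X) f = MvPolynomial.C (mev a0 d) * g := by
  set Φ : MvPolynomial (Fin k ⊕ Fin r) ℤ →+* MvPolynomial (Fin r) A :=
    mev (Sum.elim (fun i => MvPolynomial.C (a0 i)) MvPolynomial.X) with hΦ
  have hren : ∀ q : MvPolynomial (Fin k) ℤ, Φ (MvPolynomial.rename Sum.inl q) = MvPolynomial.C (mev a0 q) := by
    intro q
    rw [hΦ, mev_apply, MvPolynomial.aeval_rename, map_mev]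
    rfl
  induction g using MvPolynomial.induction_on with
  | C x =>
    obtain ⟨q, d, hd, rfl⟩ := hgen x
    refine ⟨d, hd, MvPolynomial.rename Sum.inl q, ?_⟩
    rw [hren, ← MvPolynomial.C_mul, mul_div_cancel₀ _ hd]
  | add p q hp hq =>
    obtain ⟨d, hd, G, hG⟩ := hp
    obtain ⟨d', hd', G', hG'⟩ := hq
    refine ⟨d * d', by rw [map_mul]; exact mul_ne_zero hd hd',
      MvPolynomial.rename Sum.inl d' * G + MvPolynomial.rename Sum.inl d * G', ?_⟩
    rw [map_add, map_mul, map_mul, hG, hG', hren, hren, map_mul, MvPolynomial.C_mul]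
    ring
  | mul_X p i hp =>
    obtain ⟨d, hd, G, hG⟩ := hp
    refine ⟨d, hd, G * MvPolynomial.X (Sum.inr i), ?_⟩
    rw [map_mul, hG, hΦ, mev_X]
    simp only [Sum.elim_inr]
    ring

theorem types_embed {K L : Type u} [Field K] [Field L] [Algebra A K] [Algebra A L]
    (hgen : ∀ x : A, ∃ q d : MvPolynomial (Fin k) ℤ, mev a0 d ≠ 0 ∧ x = mev a0 q / mev a0 d)
    (σ : K ≃ₐ[A] K) (τ : L ≃ₐ[A] L)
    (htype : ∀ ω : OmD k, ω.Holds σ (fun i => algebraMap A K (a0 i)) →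
      ω.Holds τ (fun i => algebraMap A L (a0 i)))
    (E : IntermediateField A K) (hE : FiniteDimensional A E) (hσ : ∀ x ∈ E, σ x = x) :
    ∃ f : E →ₐ[A] L, ∀ x, τ (f x) = f x := by
  classical
  set r := Module.finrank A E with hr
  set b := Module.finBasis A E with hb
  set φ : MvPolynomial (Fin r) A →ₐ[A] E := MvPolynomial.aeval (fun i => b i) with hφ
  have hφs : Function.Surjective φ := by
    intro x
    refine ⟨∑ i, MvPolynomial.C (b.repr x i) * MvPolynomial.X i, ?_⟩
    rw [map_sum]
    conv_rhs => rw [← b.sum_repr x]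
    refine Finset.sum_congr rfl fun i _ => ?_
    rw [map_mul, hφ, MvPolynomial.aeval_X, MvPolynomial.aeval_C, Algebra.smul_def]
  obtain ⟨G, hG⟩ := (isNoetherianRing_iff_ideal_fg (MvPolynomial (Fin r) A)).mp inferInstance
    (RingHom.ker φ)
  choose du hdu fu hfu using clear_uv a0 hgen
  choose dm hdm fm hfm using clear_mv (r := r) a0 hgen
  let ω : OmD k := ⟨r, fun i => fu (minpoly A (b i)), G.image fm⟩
  have hmapg : ∀ {B : Type u} [Field B] [Algebra A B] (i : Fin r),
      (ω.g i).map (mev fun i => algebraMap A B (a0 i)) =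
        C (algebraMap A B (mev a0 (du (minpoly A (b i))))) * (minpoly A (b i)).map (algebraMap A B) := by
    intro B _ _ i
    rw [← comp_mev, ← Polynomial.map_map]
    change ((fu (minpoly A (b i))).map _).map _ = _
    rw [hfu, Polynomial.map_mul, map_C]
  have hmapf : ∀ {B : Type u} [Field B] [Algebra A B] (t : Fin r → B) (g : MvPolynomial (Fin r) A),
      mev (Sum.elim (fun i => algebraMap A B (a0 i)) t) (fm g) =
        algebraMap A B (mev a0 (dm g)) * MvPolynomial.aeval t g := by
    intro B _ _ t g
    have h1 := congrArg (MvPolynomial.aeval t : MvPolynomial (Fin r) A →ₐ[A] B) (hfm g)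
    rw [map_mul, MvPolynomial.aeval_C] at h1
    rw [← h1]
    have h2 := map_mev (MvPolynomial.aeval t : MvPolynomial (Fin r) A →ₐ[A] B).toRingHom
      (Sum.elim (fun i => MvPolynomial.C (a0 i)) MvPolynomial.X) (fm g)
    refine Eq.trans ?_ h2.symm
    congr 2
    funext i
    rcases i with i | i
    · simp
    · simp
  have hmin0 : ∀ i, minpoly A (b i) ≠ 0 := fun i =>
    minpoly.ne_zero (Algebra.IsIntegral.isIntegral (b i))
  have hK : ω.Holds σ (fun i => algebraMap A K (a0 i)) := by
    refine ⟨fun i => ?_, fun i => (b i : K), fun i => hσ _ (b i).2, fun i => ?_, ?_⟩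
    · rw [hmapg]
      exact mul_ne_zero (C_ne_zero.mpr ((_root_.map_ne_zero _).mpr (hdu _))) (Polynomial.map_ne_zero (hmin0 i))
    · rw [hmapg, eval_mul, eval_map]
      have h1 := minpoly.aeval A (b i)
      have h2 := congrArg E.val h1
      rw [← aeval_algHom_apply, map_zero] at h2
      change eval₂ (algebraMap A K) (b i : K) _ = 0 at h2
      exact mul_eq_zero_of_right _ h2
    · intro q hq
      obtain ⟨g, hg, rfl⟩ := Finset.mem_image.mp hq
      have h1 := hmapf (fun i => (b i : K)) g
      refine h1.trans (mul_eq_zero_of_right _ ?_)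
      have h2 : φ g = 0 := by
        have : g ∈ RingHom.ker φ := by rw [← hG]; exact Ideal.subset_span hg
        exact this
      have h3 := congrArg E.val h2
      rw [hφ, map_zero, MvPolynomial.comp_aeval_apply] at h3
      exact h3
  obtain ⟨hg0, t, hτt, hgt, hft⟩ := htype ω hK
  set ψ : MvPolynomial (Fin r) A →ₐ[A] L := MvPolynomial.aeval t with hψ
  have hker : ∀ x ∈ RingHom.ker φ, ψ x = 0 := by
    have : RingHom.ker φ ≤ RingHom.ker ψ := by
      rw [← hG, Ideal.span_le]
      intro g hg
      have h1 := hft (fm g) (Finset.mem_image_of_mem _ hg)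
      have h2 := hmapf t g
      rw [h2] at h1
      exact (mul_eq_zero.mp h1).resolve_left ((_root_.map_ne_zero _).mpr (hdm g))
    exact fun x hx => this hx
  let f : E →ₐ[A] L := (Ideal.Quotient.liftₐ (RingHom.ker φ) ψ hker).comp
    (Ideal.quotientKerAlgEquivOfSurjective hφs).symm.toAlgHom
  have hf : ∀ q, f (φ q) = ψ q := by
    intro q
    have h1 : (Ideal.quotientKerAlgEquivOfSurjective hφs).symm (φ q) = Ideal.Quotient.mk _ q := by
      rw [AlgEquiv.symm_apply_eq]; rfl
    change Ideal.Quotient.liftₐ (RingHom.ker φ) ψ hker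
      ((Ideal.quotientKerAlgEquivOfSurjective hφs).symm (φ q)) = ψ q
    rw [h1]
    rfl
  refine ⟨f, fun x => ?_⟩
  obtain ⟨q, rfl⟩ := hφs x
  rw [hf]
  have : (τ : L →ₐ[A] L).comp ψ = ψ := by
    apply MvPolynomial.algHom_ext
    intro i
    simp [hψ, hτt]
  exact DFunLike.congr_fun this q

end Types

section TransferOne
universe u
variable {K L : Type u} [Field K] [Field L]

lemma ker_of_types {k : ℕ} (σ : K → K) (τ : L → L) (a : Fin k → K) (b : Fin k → L)
    (htype : ∀ ω : OmD k, ω.Holds σ a → ω.Holds τ b) (q : MvPolynomial (Fin k) ℤ) (hq : mev a q = 0) :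
    mev b q = 0 := by
  have hren : ∀ {B : Type u} [Field B] (x : Fin k → B) (t : Fin 0 → B),
      mev (Sum.elim x t) (MvPolynomial.rename Sum.inl q) = mev x q := by
    intro B _ x t
    rw [mev_apply, MvPolynomial.aeval_rename]; rfl
  have hren' : ∀ {B : Type u} [Field B] (x : Fin k → B) (t : Fin 0 → B),
      mev (Sum.elim x t) (MvPolynomial.rename Sum.inl q) = mev x q := by
    intro B _ x t
    rw [mev_apply, MvPolynomial.aeval_rename]; rfl
  obtain ⟨_, t, _, _, h⟩ := htype ⟨0, fun i => i.elim0, {MvPolynomial.rename Sum.inl q}⟩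
    ⟨fun i => i.elim0, fun i => i.elim0, fun i => i.elim0, fun i => i.elim0, by
      intro q' hq'
      rw [Finset.mem_singleton.mp hq']
      exact (hren a _).trans hq⟩
  have h2 := h _ (Finset.mem_singleton_self _)
  exact (hren' b t).symm.trans h2

theorem transfer_one [IsAlgClosed K] [IsAlgClosed L] (p : ℕ) [Fact p.Prime] [CharP K p] [CharP L p]
    (σ : K ≃+* K) (τ : L ≃+* L) (hPAC : PAC τ) {k : ℕ} (a : Fin k → K) (b : Fin k → L)
    (hσa : ∀ i, σ (a i) = a i) (hτb : ∀ i, τ (b i) = b i)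
    (htype : ∀ ω : OmD k, ω.Holds σ a ↔ ω.Holds τ b) (c : K) (hc : σ c = c)
    {n : ℕ} (Ω : Fin n → OmD (k + 1)) :
    ∃ c' : L, τ c' = c' ∧ ∀ i, (Ω i).Holds σ (Fin.snoc a c : Fin (k + 1) → K) ↔
      (Ω i).Holds τ (Fin.snoc b c' : Fin (k + 1) → L) := by
  classical
  -- the common base field
  set I := RingHom.ker (mev a) with hI
  haveI : I.IsPrime := RingHom.ker_isPrime _
  set A0 := MvPolynomial (Fin k) ℤ ⧸ I with hA0
  let iK : A0 →+* K := Ideal.Quotient.lift I (mev a) fun q hq => hq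
  let iL : A0 →+* L := Ideal.Quotient.lift I (mev b) fun q hq =>
    ker_of_types σ τ a b (fun ω => (htype ω).mp) q hq
  have hiK : Function.Injective iK := by
    rw [injective_iff_map_eq_zero]
    intro x hx
    obtain ⟨q, rfl⟩ := Ideal.Quotient.mk_surjective x
    rw [Ideal.Quotient.eq_zero_iff_mem]
    exact hx
  have hiL : Function.Injective iL := by
    rw [injective_iff_map_eq_zero]
    intro x hx
    obtain ⟨q, rfl⟩ := Ideal.Quotient.mk_surjective x
    rw [Ideal.Quotient.eq_zero_iff_mem]
    exact ker_of_types τ σ b a (fun ω => (htype ω).mpr) q hx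
  let A := FractionRing A0
  let jK : A →+* K := IsFractionRing.lift hiK
  let jL : A →+* L := IsFractionRing.lift hiL
  letI : Algebra A K := jK.toAlgebra
  letI : Algebra A L := jL.toAlgebra
  let a0 : Fin k → A := fun i => algebraMap A0 A (Ideal.Quotient.mk I (MvPolynomial.X i))
  have hmeva : ∀ q, mev a0 q = algebraMap A0 A (Ideal.Quotient.mk I q) := by
    intro q
    have := map_mev ((algebraMap A0 A).comp (Ideal.Quotient.mk I)) MvPolynomial.X q
    have h2 : mev MvPolynomial.X q = q := by
      rw [mev_apply]; exact MvPolynomial.aeval_X_left_apply q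
    rw [h2] at this
    exact this.symm
  have hKa : ∀ i, algebraMap A K (a0 i) = a i := by
    intro i
    have : jK (algebraMap A0 A (Ideal.Quotient.mk I (MvPolynomial.X i))) = iK (Ideal.Quotient.mk I (MvPolynomial.X i)) :=
      IsFractionRing.lift_algebraMap hiK _
    refine this.trans ?_
    exact mev_X a i
  have hLb : ∀ i, algebraMap A L (a0 i) = b i := by
    intro i
    have : jL (algebraMap A0 A (Ideal.Quotient.mk I (MvPolynomial.X i))) = iL (Ideal.Quotient.mk I (MvPolynomial.X i)) :=
      IsFractionRing.lift_algebraMap hiL _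
    refine this.trans ?_
    exact mev_X b i
  have hgen : ∀ x : A, ∃ q d : MvPolynomial (Fin k) ℤ, mev a0 d ≠ 0 ∧ x = mev a0 q / mev a0 d := by
    intro x
    obtain ⟨u, v, hv, rfl⟩ := IsFractionRing.div_surjective (A := A0) x
    obtain ⟨q, rfl⟩ := Ideal.Quotient.mk_surjective u
    obtain ⟨d, rfl⟩ := Ideal.Quotient.mk_surjective v
    refine ⟨q, d, ?_, ?_⟩
    · rw [hmeva]
      exact IsFractionRing.to_map_ne_zero_of_mem_nonZeroDivisors hv
    · rw [hmeva, hmeva]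
  have hfix : ∀ {B : Type u} [Field B] [Algebra A B] (s : B ≃+* B), (∀ i, s (algebraMap A B (a0 i)) = algebraMap A B (a0 i)) →
      ∀ x : A, s (algebraMap A B x) = algebraMap A B x := by
    intro B _ _ s hs x
    have h1 : ∀ q, s (algebraMap A B (mev a0 q)) = algebraMap A B (mev a0 q) := by
      intro q
      rw [map_mev]
      have := map_mev (s : B →+* B) (fun i => algebraMap A B (a0 i)) q
      refine this.trans ?_
      congr 2
      funext i
      exact hs i
    obtain ⟨q, d, hd, rfl⟩ := hgen x
    rw [map_div₀, map_div₀, h1, h1]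
  let σA : K ≃ₐ[A] K := AlgEquiv.ofRingEquiv (f := σ) (hfix σ fun i => by rw [hKa]; exact hσa i)
  let τA : L ≃ₐ[A] L := AlgEquiv.ofRingEquiv (f := τ) (fun x => by
    have h1 : ∀ q, τ (algebraMap A L (mev a0 q)) = algebraMap A L (mev a0 q) := by
      intro q
      rw [map_mev]
      have := map_mev (τ : L →+* L) (fun i => algebraMap A L (a0 i)) q
      refine this.trans ?_
      congr 2
      funext i
      change τ (algebraMap A L (a0 i)) = algebraMap A L (a0 i)
      rw [hLb]; exact hτb i
    obtain ⟨q, d, hd, rfl⟩ := hgen x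
    rw [map_div₀, map_div₀, h1, h1])
  have hKL := types_embed a0 hgen σA τA (by
    intro ω hω
    rw [funext hKa] at hω
    rw [funext hLb]
    exact (htype ω).mp hω)
  have hLK := types_embed a0 hgen τA σA (by
    intro ω hω
    rw [funext hLb] at hω
    rw [funext hKa]
    exact (htype ω).mpr hω)
  -- apply holds_iff over A(c)
  let F := IntermediateField.adjoin A {c}
  have hH := fun i => holds_iff (L := L) (Ω i) σ τ
    (Fin.snoc (fun i => algebraMap A F (a0 i)) ⟨c, IntermediateField.mem_adjoin_simple_self A c⟩ : Fin (k + 1) → F)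
    (Fin.snoc a c : Fin (k + 1) → K) (by
      intro i
      refine Fin.lastCases ?_ (fun i => ?_) i
      · rw [Fin.snoc_last, Fin.snoc_last]; rfl
      · rw [Fin.snoc_castSucc, Fin.snoc_castSucc]; exact hKa i) (by
      intro i
      refine Fin.lastCases ?_ (fun i => ?_) i
      · rw [Fin.snoc_last]; exact hc
      · rw [Fin.snoc_castSucc]; exact hσa i)
  choose Z N hN hZalg hZ using hH
  obtain ⟨w, hw, Γ, hΓ, hAΓ, P, hP⟩ := spec_all p σA τA hKL hLK hPAC c hc
    (insert c (Finset.univ.biUnion Z)) (by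
      intro z hz
      rcases Finset.mem_insert.mp hz with rfl | hz
      · exact isAlgebraic_algebraMap (⟨z, IntermediateField.mem_adjoin_simple_self A z⟩ : IntermediateField.adjoin A {z})
      · obtain ⟨i, _, hi⟩ := Finset.mem_biUnion.mp hz
        exact hZalg i z hi) (∏ i, N i) (Finset.prod_pos fun i _ => hN i)
  have hpow : ∀ (w : ℕ) z, (σA ^ w) z = (σ ^ w) z := by
    intro w
    induction w with
    | zero => intro z; rfl
    | succ w ih =>
      intro z
      rw [pow_succ', pow_succ', AlgEquiv.mul_apply, RingAut.mul_apply, ih]; rfl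
  have hcP := hP c (Finset.mem_insert_self _ _)
  have hcw : (σA ^ w) c = c := by
    have : σA ∈ MulAction.stabilizer (K ≃ₐ[A] K) c := hc
    exact Subgroup.pow_mem _ this w
  rw [hcw] at hcP
  refine ⟨P c, hΓ.eq hcP.2 hcP.1, fun i => ?_⟩
  refine hZ i w Γ P _ (Nat.Coprime.coprime_dvd_right (Finset.dvd_prod_of_mem N (Finset.mem_univ i)) hw) hΓ ?_ ?_
  · intro l
    refine Fin.lastCases ?_ (fun l => ?_) l
    · rw [Fin.snoc_last, Fin.snoc_last]; exact hcP.1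
    · rw [Fin.snoc_castSucc, Fin.snoc_castSucc, ← hKa, ← hLb]; exact hAΓ _
  · intro z hz
    have := hP z (Finset.mem_insert_of_mem (Finset.mem_biUnion.mpr ⟨i, Finset.mem_univ i, hz⟩))
    rw [hpow] at this
    exact this

end TransferOne
end PRat

namespace PRat
open Polynomial

section Lf
variable {R S : Type*} [Semiring R] [Semiring S]

/-- coefficientwise application of a function -/
noncomputable def lf (f : R → S) (P : R[X]) : S[X] := ∑ j ∈ P.support, monomial j (f (P.coeff j))

lemma lf_coeff (f : R → S) (h0 : f 0 = 0) (P : R[X]) (j : ℕ) : (lf f P).coeff j = f (P.coeff j) := by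
  classical
  rw [lf, finsetSum_coeff]
  simp only [coeff_monomial]
  rw [Finset.sum_ite_eq']
  split_ifs with h
  · rfl
  · rw [notMem_support_iff.mp h, h0]

lemma lf_zero (f : R → S) : lf f 0 = 0 := by simp [lf]

lemma lf_one (f : R → S) (h0 : f 0 = 0) (h1 : f 1 = 1) : lf f 1 = 1 := by
  ext j
  rw [lf_coeff f h0, coeff_one, coeff_one]
  split_ifs <;> assumption

lemma lf_monic (f : R → S) (h0 : f 0 = 0) (h1 : f 1 = 1) {P : R[X]} (hP : P.Monic) : (lf f P).Monic := by
  refine monic_of_natDegree_le_of_coeff_eq_one P.natDegree ?_ ?_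
  · rw [natDegree_le_iff_coeff_eq_zero]
    intro j hj
    rw [lf_coeff f h0, coeff_eq_zero_of_natDegree_lt hj, h0]
  · rw [lf_coeff f h0]
    have : P.coeff P.natDegree = 1 := hP
    rw [this, h1]

lemma lf_natDegree_le (f : R → S) (h0 : f 0 = 0) (P : R[X]) : (lf f P).natDegree ≤ P.natDegree := by
  rw [natDegree_le_iff_coeff_eq_zero]
  intro j hj
  rw [lf_coeff f h0, coeff_eq_zero_of_natDegree_lt hj, h0]

lemma lf_natDegree [Nontrivial S] (f : R → S) (h0 : f 0 = 0) (h1 : f 1 = 1) {P : R[X]} (hP : P.Monic) :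
    (lf f P).natDegree = P.natDegree := by
  refine le_antisymm (lf_natDegree_le f h0 P) (le_natDegree_of_ne_zero ?_)
  rw [lf_coeff f h0]
  have : P.coeff P.natDegree = 1 := hP
  rw [this, h1]
  exact one_ne_zero

end Lf

lemma swap_coeff {R : Type*} [CommRing R] (P : R[X][X]) (i j : ℕ) :
    ((Bivariate.swap P).coeff i).coeff j = (P.coeff j).coeff i := by
  induction P using Polynomial.induction_on' with
  | add p q hp hq => rw [map_add]; simp only [coeff_add, hp, hq]
  | monomial n f =>
    induction f using Polynomial.induction_on' with
    | add p q hp hq => rw [map_add, map_add]; simp only [coeff_add, hp, hq]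
    | monomial m r =>
      rw [Bivariate.swap_monomial_monomial]
      simp only [coeff_monomial]
      split_ifs <;> simp_all [coeff_monomial]

lemma factor_bound {R : Type*} [CommRing R] [IsDomain R] {P Q T : R[X][X]} (h : P * Q = T) (hT : T ≠ 0) {M : ℕ}
    (hM : ∀ j i, M < i → (T.coeff j).coeff i = 0) : ∀ j i, M < i → (P.coeff j).coeff i = 0 := by
  intro j i hi
  have h1 : (Bivariate.swap P * Bivariate.swap Q) = Bivariate.swap T := by rw [← h, map_mul]
  have h2 : (Bivariate.swap T).natDegree ≤ M := by
    rw [natDegree_le_iff_coeff_eq_zero]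
    intro i hi
    ext j
    rw [swap_coeff, hM j i hi, coeff_zero]
  have h3 : (Bivariate.swap P).natDegree ≤ M := by
    have hne : Bivariate.swap P * Bivariate.swap Q ≠ 0 := by
      rw [h1]; exact (map_ne_zero_iff _ Bivariate.swap.injective).mpr hT
    have := natDegree_mul (left_ne_zero_of_mul hne) (right_ne_zero_of_mul hne)
    rw [h1] at this
    omega
  rw [← swap_coeff, coeff_eq_zero_of_natDegree_lt (h3.trans_lt hi), coeff_zero]

lemma exists_wt {k : Type*} [Field k] {h : k[X][X]} (hm : h.Monic) : ∃ δ, Wt δ (δ * h.natDegree) h := by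
  refine ⟨h.support.sup fun j => (h.coeff j).natDegree, fun j i hij => ?_⟩
  set δ := h.support.sup fun j => (h.coeff j).natDegree with hδ
  have hle : ∀ j, (h.coeff j).natDegree ≤ δ := by
    intro j
    by_cases hj : j ∈ h.support
    · exact Finset.le_sup (f := fun j => (h.coeff j).natDegree) hj
    · rw [notMem_support_iff.mp hj]; simp
  rcases lt_trichotomy j h.natDegree with hlt | heq | hgt
  · refine coeff_eq_zero_of_natDegree_lt ((hle j).trans_lt ?_)
    have : δ * (j + 1) ≤ δ * h.natDegree := Nat.mul_le_mul_left _ hlt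
    rw [mul_add] at this
    omega
  · have : h.coeff h.natDegree = 1 := hm
    rw [heq, this, coeff_one, if_neg]
    rw [heq] at hij; omega
  · rw [coeff_eq_zero_of_natDegree_lt hgt, coeff_zero]

lemma exists_wt_bound {k : Type*} [Field k] (δ : ℕ) (h : k[X][X]) : ∃ c, Wt δ c h := by
  set M := h.support.sup fun j => (h.coeff j).natDegree with hδ
  have hle : ∀ j, (h.coeff j).natDegree ≤ M := by
    intro j
    by_cases hj : j ∈ h.support
    · exact Finset.le_sup (f := fun j => (h.coeff j).natDegree) hj
    · rw [notMem_support_iff.mp hj]; simp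
  refine ⟨M + δ * h.natDegree, fun j i hij => ?_⟩
  by_cases hj : j ≤ h.natDegree
  · refine coeff_eq_zero_of_natDegree_lt ((hle j).trans_lt ?_)
    have : δ * j ≤ δ * h.natDegree := Nat.mul_le_mul_left _ hj
    omega
  · rw [coeff_eq_zero_of_natDegree_lt (not_le.mp hj), coeff_zero]

section UP
variable {ι : Type} (𝒰 : Ultrafilter ι) {F : Type} [Field F]

/-- the quotient map to the ultrapower -/
noncomputable def uq : (ι → F) →+* Filter.Germ (𝒰 : Filter ι) F := Filter.Germ.coeRingHom _

lemma uq_surj : Function.Surjective (uq (F := F) 𝒰) := fun x => by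
  induction x using Filter.Germ.inductionOn with
  | h f => exact ⟨f, rfl⟩

lemma uq_eq_iff (a b : ι → F) : uq 𝒰 a = uq 𝒰 b ↔ ∀ᶠ i in (𝒰 : Filter ι), a i = b i :=
  Filter.Germ.coe_eq

lemma uq_eq_zero_iff (a : ι → F) : uq 𝒰 a = 0 ↔ ∀ᶠ i in (𝒰 : Filter ι), a i = 0 := by
  rw [← map_zero (uq (F := F) 𝒰), uq_eq_iff]; rfl

lemma uq_ne_zero_iff (a : ι → F) : uq 𝒰 a ≠ 0 ↔ ∀ᶠ i in (𝒰 : Filter ι), a i ≠ 0 := by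
  rw [Ne, uq_eq_zero_iff, ← Ultrafilter.eventually_not]

lemma exists_rep : ∃ rep : Filter.Germ (𝒰 : Filter ι) F → (ι → F), (∀ x, uq 𝒰 (rep x) = x) ∧ rep 0 = 0 ∧ rep 1 = 1 := by
  classical
  refine ⟨fun x => if x = 0 then 0 else if x = 1 then 1 else Function.surjInv (uq_surj 𝒰) x, fun x => ?_, ?_, ?_⟩
  · dsimp only
    split_ifs with h0 h1
    · rw [h0, map_zero]
    · rw [h1, map_one]
    · exact Function.surjInv_eq _ _
  · simp
  · simp

/-- evaluation at an index -/
abbrev uev (F : Type) [Field F] (i : ι) : (ι → F) →+* F := Pi.evalRingHom (fun _ => F) i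

lemma los_poly (P : (ι → F)[X]) : P.map (uq 𝒰) = 0 ↔ ∀ᶠ i in (𝒰 : Filter ι), P.map (uev F i) = 0 := by
  constructor
  · intro h
    have h1 : ∀ᶠ i in (𝒰 : Filter ι), ∀ j ∈ P.support, P.coeff j i = 0 := by
      rw [Filter.eventually_all_finset]
      intro j _
      rw [← uq_eq_zero_iff, ← coeff_map, h, coeff_zero]
    filter_upwards [h1] with i hi
    ext j
    rw [coeff_map, coeff_zero]
    by_cases hj : j ∈ P.support
    · exact hi j hj
    · rw [notMem_support_iff.mp hj, map_zero]
  · intro h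
    ext j
    rw [coeff_map, coeff_zero, uq_eq_zero_iff]
    filter_upwards [h] with i hi
    have := congrArg (fun Q => Q.coeff j) hi
    simpa using this

lemma los_poly2 (P Q : (ι → F)[X][X])
    (h : ∀ᶠ i in (𝒰 : Filter ι), P.map (mapRingHom (uev F i)) = Q.map (mapRingHom (uev F i))) :
    P.map (mapRingHom (uq 𝒰)) = Q.map (mapRingHom (uq 𝒰)) := by
  ext j l
  rw [coeff_map, coe_mapRingHom, coeff_map, coeff_map, coe_mapRingHom, coeff_map, uq_eq_iff]
  filter_upwards [h] with i hi
  have := congrArg (fun Q => (Q.coeff j).coeff l) hi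
  simpa using this

variable [IsAlgClosed F]

instance up_algClosed : IsAlgClosed (Filter.Germ (𝒰 : Filter ι) F) := by
  apply IsAlgClosed.of_exists_root
  intro P hP hirr
  obtain ⟨rep, hrep, h0, h1⟩ := exists_rep (F := F) 𝒰
  set Q := lf rep P with hQ
  have hQP : Q.map (uq 𝒰) = P := by
    ext j
    rw [coeff_map, hQ, lf_coeff rep h0, hrep]
  have hQm : Q.Monic := lf_monic rep h0 h1 hP
  haveI : Nonempty ι := by
    obtain ⟨i, _⟩ := 𝒰.nonempty_of_mem Filter.univ_mem
    exact ⟨i⟩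
  have hQd : Q.natDegree = P.natDegree := lf_natDegree rep h0 h1 hP
  have hroot : ∀ i, ∃ x : F, (Q.map (uev F i)).eval x = 0 := by
    intro i
    apply IsAlgClosed.exists_root
    have h2 : (Q.map (uev F i)).natDegree = Q.natDegree := hQm.natDegree_map _
    intro h3
    have := natDegree_eq_of_degree_eq_some h3
    rw [h2, hQd] at this
    exact hirr.natDegree_pos.ne' this
  choose x hx using hroot
  refine ⟨uq 𝒰 x, ?_⟩
  rw [← hQP, eval_map_apply]
  rw [uq_eq_zero_iff]
  refine Filter.Eventually.of_forall fun i => ?_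
  have := hx i
  have h4 : (Q.map (uev F i)).eval (uev F i x) = uev F i (Q.eval x) := eval_map_apply _ _
  exact h4.symm.trans this

lemma up_charP (p : ℕ) [CharP F p] : CharP (Filter.Germ (𝒰 : Filter ι) F) p :=
  charP_of_injective_ringHom (f := (uq (F := F) 𝒰).comp (Pi.constRingHom ι F)) (RingHom.injective _) p

variable (p : ℕ) [Fact p.Prime] [CharP F p] (m : ι → ℕ)

/-- coordinatewise Frobenius powers -/
noncomputable def frobPi : (ι → F) →+* (ι → F) :=
  RingHom.pi fun i => (iterateFrobenius F p (m i)).comp (uev F i)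

lemma frobPi_apply (x : ι → F) (i : ι) : frobPi p m x i = x i ^ p ^ m i := rfl

/-- Frobenius on the ultraproduct -/
noncomputable def upFrobHom : Filter.Germ (𝒰 : Filter ι) F →+* Filter.Germ (𝒰 : Filter ι) F :=
  (uq 𝒰).liftOfSurjective (uq_surj 𝒰) ⟨(uq 𝒰).comp (frobPi p m), by
    intro x hx
    rw [RingHom.mem_ker] at hx ⊢
    rw [uq_eq_zero_iff] at hx
    rw [RingHom.comp_apply, uq_eq_zero_iff]
    filter_upwards [hx] with i hi
    rw [frobPi_apply, hi, zero_pow (pow_ne_zero _ (Fact.out : p.Prime).ne_zero)]⟩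

lemma upFrobHom_uq (x : ι → F) : upFrobHom 𝒰 p m (uq 𝒰 x) = uq 𝒰 (frobPi p m x) :=
  RingHom.liftOfRightInverse_comp_apply _ _ _ _ _

/-- Frobenius automorphism on the ultraproduct -/
noncomputable def upFrob : Filter.Germ (𝒰 : Filter ι) F ≃+* Filter.Germ (𝒰 : Filter ι) F :=
  RingEquiv.ofBijective (upFrobHom 𝒰 p m) ⟨RingHom.injective _, by
    intro y
    obtain ⟨b, rfl⟩ := uq_surj 𝒰 y
    have : ∀ i, ∃ x : F, x ^ p ^ m i = b i := fun i =>
      IsAlgClosed.exists_pow_nat_eq (b i) (pow_pos (Fact.out : p.Prime).pos _)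
    choose x hx using this
    refine ⟨uq 𝒰 x, ?_⟩
    rw [upFrobHom_uq]
    congr 1
    funext i
    exact hx i⟩

lemma upFrob_uq (x : ι → F) : upFrob 𝒰 p m (uq 𝒰 x) = uq 𝒰 (frobPi p m x) := upFrobHom_uq 𝒰 p m x

lemma upFrob_fix (x : ι → F) : upFrob 𝒰 p m (uq 𝒰 x) = uq 𝒰 x ↔ ∀ᶠ i in (𝒰 : Filter ι), x i ^ p ^ m i = x i := by
  rw [upFrob_uq, uq_eq_iff]; rfl

lemma mev_uev {s : Type*} (x : s → ι → F) (q : MvPolynomial s ℤ) (i : ι) :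
    mev x q i = mev (fun j => x j i) q := map_mev (uev F i) x q

theorem los_om {k : ℕ} (ω : OmD k) (x : Fin k → ι → F) :
    ω.Holds (upFrob 𝒰 p m) (fun j => uq 𝒰 (x j)) ↔
      ∀ᶠ i in (𝒰 : Filter ι), ω.Holds (fun y : F => y ^ p ^ m i) (fun j => x j i) := by
  have hg : ∀ l, ((ω.g l).map (mev fun j => uq 𝒰 (x j))) = ((ω.g l).map (mev x)).map (uq 𝒰) := by
    intro l; rw [Polynomial.map_map, comp_mev]
  have hgi : ∀ l i, ((ω.g l).map (mev fun j => x j i)) = ((ω.g l).map (mev x)).map (uev F i) := by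
    intro l i; rw [Polynomial.map_map, comp_mev]; rfl
  have hge : ∀ l (t : ι → F), ((ω.g l).map (mev fun j => uq 𝒰 (x j))).eval (uq 𝒰 t) = 0 ↔
      ∀ᶠ i in (𝒰 : Filter ι), ((ω.g l).map (mev fun j => x j i)).eval (t i) = 0 := by
    intro l t
    rw [hg, eval_map_apply, uq_eq_zero_iff]
    refine Filter.eventually_congr (Filter.Eventually.of_forall fun i => ?_)
    rw [hgi]
    have : (((ω.g l).map (mev x)).map (uev F i)).eval (uev F i t) = uev F i (((ω.g l).map (mev x)).eval t) :=
      eval_map_apply _ _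
    exact Eq.congr_left this.symm
  have hgn : ∀ l, ((ω.g l).map (mev fun j => uq 𝒰 (x j))) ≠ 0 ↔
      ∀ᶠ i in (𝒰 : Filter ι), ((ω.g l).map (mev fun j => x j i)) ≠ 0 := by
    intro l
    rw [Ultrafilter.eventually_not, hg, Ne, los_poly]
    simp only [hgi]
  have hf : ∀ q (t : Fin ω.r → ι → F), mev (Sum.elim (fun j => uq 𝒰 (x j)) (fun l => uq 𝒰 (t l))) q = 0 ↔
      ∀ᶠ i in (𝒰 : Filter ι), mev (Sum.elim (fun j => x j i) (fun l => t l i)) q = 0 := by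
    intro q t
    have h1 : (Sum.elim (fun j => uq 𝒰 (x j)) (fun l => uq 𝒰 (t l))) = fun s => uq 𝒰 (Sum.elim x t s) := by
      funext s; rcases s with s | s <;> rfl
    rw [h1, ← map_mev, uq_eq_zero_iff]
    refine Filter.eventually_congr (Filter.Eventually.of_forall fun i => ?_)
    rw [mev_uev]
    have h2 : (Sum.elim (fun j => x j i) (fun l => t l i)) = fun s => Sum.elim x t s i := by
      funext s; rcases s with s | s <;> rfl
    rw [h2]
  constructor
  · rintro ⟨h1, t, h2, h3, h4⟩
    choose t' ht' using fun l => uq_surj 𝒰 (t l)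
    obtain rfl : (fun l => uq 𝒰 (t' l)) = t := funext ht'
    have e1 := Filter.eventually_all.mpr fun l => (hgn l).mp (h1 l)
    have e2 := Filter.eventually_all.mpr fun l => (upFrob_fix 𝒰 p m (t' l)).mp (h2 l)
    have e3 := Filter.eventually_all.mpr fun l => (hge l (t' l)).mp (h3 l)
    have e4 := (Filter.eventually_all_finset ω.f).mpr fun q hq => (hf q t').mp (h4 q hq)
    filter_upwards [e1, e2, e3, e4] with i h1 h2 h3 h4
    exact ⟨h1, fun l => t' l i, h2, h3, h4⟩
  · intro h
    have h' : ∃ t : ι → Fin ω.r → F, ∀ i, ω.Holds (fun y : F => y ^ p ^ m i) (fun j => x j i) →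
      (∀ l, (t i l) ^ p ^ m i = t i l) ∧ (∀ l, ((ω.g l).map (mev fun j => x j i)).eval (t i l) = 0) ∧
      ∀ q ∈ ω.f, mev (Sum.elim (fun j => x j i) (t i)) q = 0 := by
      classical
      refine ⟨fun i => if h : ω.Holds (fun y : F => y ^ p ^ m i) (fun j => x j i) then h.2.choose else 0, fun i hi => ?_⟩
      simp only [dif_pos hi]
      exact hi.2.choose_spec
    obtain ⟨t, ht⟩ := h'
    refine ⟨fun l => (hgn l).mpr (h.mono fun i hi => hi.1 l), fun l => uq 𝒰 fun i => t i l, fun l => ?_, fun l => ?_, fun q hq => ?_⟩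
    · exact (upFrob_fix 𝒰 p m _).mpr (h.mono fun i hi => (ht i hi).1 l)
    · exact (hge l _).mpr (h.mono fun i hi => (ht i hi).2.1 l)
    · exact (hf q fun l i => t i l).mpr (h.mono fun i hi => (ht i hi).2.2 q hq)

end UP
end PRat

namespace PRat
open Polynomial

section UP
variable {ι : Type} (𝒰 : Ultrafilter ι) {F : Type} [Field F]

lemma los_irr {H : (ι → F)[X][X]} (hH : H.Monic) (hirr : Irreducible (H.map (mapRingHom (uq 𝒰)))) :
    ∀ᶠ i in (𝒰 : Filter ι), Irreducible (H.map (mapRingHom (uev F i))) := by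
  classical
  by_contra hcon
  rw [← Ultrafilter.eventually_not] at hcon
  set q2 : (ι → F)[X][X] →+* _ := mapRingHom (mapRingHom (uq (F := F) 𝒰)) with hq2
  haveI : Nonempty ι := by
    obtain ⟨i, _⟩ := 𝒰.nonempty_of_mem Filter.univ_mem
    exact ⟨i⟩
  set D := H.natDegree with hD
  have hDq : (H.map (mapRingHom (uq 𝒰))).natDegree = D := hH.natDegree_map _
  have hDi : ∀ i, (H.map (mapRingHom (uev F i))).natDegree = D := fun i => hH.natDegree_map _
  have hqm : (H.map (mapRingHom (uq 𝒰))).Monic := hH.map _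
  have hDpos : 0 < D := by
    rcases Nat.eq_zero_or_pos D with h0 | h0
    · rw [← hDq] at h0
      have := hqm.natDegree_eq_zero.mp h0
      exact absurd (this ▸ hirr) not_irreducible_one
    · exact h0
  set M := H.support.sup fun j => (H.coeff j).natDegree with hM
  have hMle : ∀ j, (H.coeff j).natDegree ≤ M := by
    intro j
    by_cases hj : j ∈ H.support
    · exact Finset.le_sup (f := fun j => (H.coeff j).natDegree) hj
    · rw [notMem_support_iff.mp hj]; simp
  have hMi : ∀ i j l, M < l → ((H.map (mapRingHom (uev F i))).coeff j).coeff l = 0 := by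
    intro i j l hl
    rw [coeff_map, coe_mapRingHom, coeff_map, coeff_eq_zero_of_natDegree_lt ((hMle j).trans_lt hl), map_zero]
  have hfac : ∀ i, ∃ f g : F[X][X], ¬ Irreducible (H.map (mapRingHom (uev F i))) →
      f * g = H.map (mapRingHom (uev F i)) ∧ f.natDegree < D ∧ g.natDegree < D := by
    intro i
    by_cases hi : Irreducible (H.map (mapRingHom (uev F i)))
    · exact ⟨0, 0, fun h => absurd hi h⟩
    · have hmi : (H.map (mapRingHom (uev F i))).Monic := hH.map _
      have hi' := hi
      rw [hmi.irreducible_iff_natDegree] at hi'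
      push Not at hi'
      obtain ⟨f, g, hf, hg, hfg, hf0, hg0⟩ := hi' (by
        intro h1
        have := hDi i
        rw [h1, natDegree_one] at this
        omega)
      refine ⟨f, g, fun _ => ⟨hfg, ?_⟩⟩
      have := hf.natDegree_mul hg
      rw [hfg, hDi] at this
      omega
  choose f g hfg using hfac
  let lift : (ι → F[X][X]) → (ι → F)[X][X] := fun f =>
    ∑ j ∈ Finset.range D, ∑ l ∈ Finset.range (M + 1), monomial j (monomial l (fun i => ((f i).coeff j).coeff l))
  have hliftc : ∀ f j l, ((lift f).coeff j).coeff l = if j < D ∧ l < M + 1 then (fun i => ((f i).coeff j).coeff l) else 0 := by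
    intro f j l
    simp only [lift, finsetSum_coeff, coeff_monomial]
    rw [Finset.sum_congr rfl (fun j' _ => Finset.sum_congr rfl fun l' _ => apply_ite (fun P : (ι → F)[X] => P.coeff l) _ _ _)]
    simp only [coeff_monomial, coeff_zero]
    by_cases hj : j < D
    · rw [Finset.sum_eq_single j]
      · simp only [if_true]
        rw [Finset.sum_ite_eq']
        simp only [Finset.mem_range, hj, true_and]
      · intro b _ hb; simp [hb]
      · intro h; simp [hj] at h
    · rw [if_neg (by tauto)]
      refine Finset.sum_eq_zero fun j' hj' => Finset.sum_eq_zero fun l' _ => ?_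
      rw [if_neg]
      rw [Finset.mem_range] at hj'
      omega
  have hliftd : ∀ f, (lift f).natDegree < D := by
    intro f
    have : (lift f).natDegree ≤ D - 1 := by
      rw [natDegree_le_iff_coeff_eq_zero]
      intro j hj
      ext l
      rw [hliftc, if_neg (by omega)]
      rfl
    omega
  have hlifti : ∀ f i, (f i).natDegree < D → (∀ j l, M < l → ((f i).coeff j).coeff l = 0) →
      (lift f).map (mapRingHom (uev F i)) = f i := by
    intro f i h1 h2
    ext j l
    rw [coeff_map, coe_mapRingHom, coeff_map, hliftc]
    split_ifs with h
    · rfl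
    · rw [map_zero]
      by_cases hj : j < D
      · rw [h2 j l (by omega)]
      · rw [coeff_eq_zero_of_natDegree_lt (h1.trans_le (not_lt.mp hj)), coeff_zero]
  have hprod : (lift f * lift g).map (mapRingHom (uq 𝒰)) = H.map (mapRingHom (uq 𝒰)) := by
    apply los_poly2
    filter_upwards [hcon] with i hi
    obtain ⟨h1, h2, h3⟩ := hfg i hi
    have hne : H.map (mapRingHom (uev F i)) ≠ 0 := (hH.map _).ne_zero
    rw [Polynomial.map_mul, hlifti f i h2 (factor_bound h1 hne (hMi i)),
      hlifti g i h3 (factor_bound ((mul_comm _ _).trans h1) hne (hMi i)), h1]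
  rw [Polynomial.map_mul] at hprod
  have hlt : ∀ f, ((lift f).map (mapRingHom (uq 𝒰))).natDegree < D := fun f =>
    natDegree_map_le.trans_lt (hliftd f)
  have hnd : ∀ P Q : (Filter.Germ (𝒰 : Filter ι) F)[X][X], IsUnit P → P * Q = H.map (mapRingHom (uq 𝒰)) → Q.natDegree < D → False := by
    intro P Q hP hPQ hQ
    have hne : P * Q ≠ 0 := by rw [hPQ]; exact hqm.ne_zero
    have := natDegree_mul (left_ne_zero_of_mul hne) (right_ne_zero_of_mul hne)
    rw [hPQ, hDq, natDegree_eq_zero_of_isUnit hP] at this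
    omega
  rcases hirr.isUnit_or_isUnit hprod.symm with h | h
  · exact hnd _ _ h hprod (hlt g)
  · exact hnd _ _ h (by rw [← Polynomial.map_mul, mul_comm (lift g), Polynomial.map_mul, hprod]) (hlt f)

variable [IsAlgClosed F] (p : ℕ) [Fact p.Prime] [CharP F p] (m : ι → ℕ)

theorem up_PAC (hm : Filter.Tendsto m (𝒰 : Filter ι) Filter.atTop) : PAC (upFrob (F := F) 𝒰 p m) := by
  classical
  intro D h Δ ρ hmon hirr hD hΔ hsep hprod l0
  obtain ⟨rep, hrep, h0, h1⟩ := exists_rep (F := F) 𝒰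
  have hl0 : lf rep 0 = 0 := lf_zero rep
  have hl1 : lf rep 1 = 1 := lf_one rep h0 h1
  haveI : Nonempty ι := by
    obtain ⟨i, _⟩ := 𝒰.nonempty_of_mem Filter.univ_mem
    exact ⟨i⟩
  set H := lf (lf rep) h with hH
  set Δ' := lf rep Δ with hΔ'
  let ρ' : Fin D → (ι → F)[X][X] := fun l => lf (lf rep) (ρ l)
  have hq1 : ∀ P, (lf rep P).map (uq 𝒰) = P := by
    intro P; ext j; rw [coeff_map, lf_coeff rep h0, hrep]
  have hq2 : ∀ P, (lf (lf rep) P).map (mapRingHom (uq 𝒰)) = P := by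
    intro P
    ext j l
    rw [coeff_map, coe_mapRingHom, lf_coeff _ hl0, hq1]
  have hHm : H.Monic := lf_monic _ hl0 hl1 hmon
  have hHd : H.natDegree = D := (lf_natDegree _ hl0 hl1 hmon).trans hD
  obtain ⟨δ, hδ⟩ := exists_wt hmon
  choose c hc using fun l => exists_wt_bound δ (ρ l)
  set c0 := Δ.natDegree + ∑ l, c l with hc0
  have hρc : ∀ l, Wt δ c0 (ρ l) := fun l => (hc l).mono ((Finset.single_le_sum (fun _ _ => Nat.zero_le _) (Finset.mem_univ l)).trans (Nat.le_add_left _ _))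
  have hWt : ∀ n (P : (Filter.Germ (𝒰 : Filter ι) F)[X][X]) i, Wt δ n P → Wt δ n ((lf (lf rep) P).map (mapRingHom (uev F i))) := by
    intro n P i hP j l hjl
    rw [coeff_map, coe_mapRingHom, coeff_map, lf_coeff _ hl0, lf_coeff _ h0, hP j l hjl, h0, map_zero]
  -- evaluation lemmas
  have ev2q : ∀ (P : (ι → F)[X][X]) y t, (P.map (mapRingHom (uq 𝒰))).evalEval (uq 𝒰 y) (uq 𝒰 t) = uq 𝒰 (P.evalEval y t) :=
    fun P y t => map_mapRingHom_evalEval _ _ _ _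
  have ev2i : ∀ (P : (ι → F)[X][X]) y t i, (P.map (mapRingHom (uev F i))).evalEval (y i) (t i) = P.evalEval y t i :=
    fun P y t i => map_mapRingHom_evalEval (uev F i) P y t
  have ev1q : ∀ (P : (ι → F)[X]) y, (P.map (uq 𝒰)).eval (uq 𝒰 y) = uq 𝒰 (P.eval y) :=
    fun P y => eval_map_apply _ _
  have ev1i : ∀ (P : (ι → F)[X]) y i, (P.map (uev F i)).eval (y i) = P.eval y i :=
    fun P y i => eval_map_apply (uev F i) y
  -- eventual facts
  have e1 : ∀ᶠ i in (𝒰 : Filter ι), Irreducible (H.map (mapRingHom (uev F i))) := by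
    apply los_irr 𝒰 hHm
    rw [hH, hq2]; exact hirr
  have e2 : ∀ᶠ i in (𝒰 : Filter ι), Δ'.map (uev F i) ≠ 0 := by
    rw [Ultrafilter.eventually_not, ← los_poly, hΔ', hq1]; exact hΔ
  have e3 : ∀ᶠ i in (𝒰 : Filter ι), ∀ y t, (Δ'.map (uev F i)).eval y ≠ 0 →
      (H.map (mapRingHom (uev F i))).evalEval y t = 0 → (H.map (mapRingHom (uev F i))).derivative.evalEval y t ≠ 0 := by
    by_contra hcon
    rw [← Ultrafilter.eventually_not] at hcon
    have : ∀ i, ∃ y t, ¬ (∀ y t, (Δ'.map (uev F i)).eval y ≠ 0 →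
      (H.map (mapRingHom (uev F i))).evalEval y t = 0 → (H.map (mapRingHom (uev F i))).derivative.evalEval y t ≠ 0) →
        (Δ'.map (uev F i)).eval y ≠ 0 ∧
      (H.map (mapRingHom (uev F i))).evalEval y t = 0 ∧ (H.map (mapRingHom (uev F i))).derivative.evalEval y t = 0 := by
      intro i
      by_cases hi : (∀ y t, (Δ'.map (uev F i)).eval y ≠ 0 →
      (H.map (mapRingHom (uev F i))).evalEval y t = 0 → (H.map (mapRingHom (uev F i))).derivative.evalEval y t ≠ 0)
      · exact ⟨0, 0, fun h => absurd hi h⟩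
      · have hi' := hi
        push Not at hi'
        obtain ⟨y, t, h⟩ := hi'
        exact ⟨y, t, fun _ => h⟩
    choose y t hyt using this
    refine hsep (uq 𝒰 y) (uq 𝒰 t) ?_ ?_ ?_
    · rw [← hq1 Δ, ev1q, uq_ne_zero_iff]
      filter_upwards [hcon] with i hi
      rw [← ev1i]; exact (hyt i hi).1
    · rw [← hq2 h, ev2q, uq_eq_zero_iff]
      filter_upwards [hcon] with i hi
      rw [← ev2i]; exact (hyt i hi).2.1
    · rw [← hq2 h, derivative_map, ev2q, uq_eq_zero_iff]
      filter_upwards [hcon] with i hi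
      rw [← ev2i, ← derivative_map]; exact (hyt i hi).2.2
  have e4 : ∀ᶠ i in (𝒰 : Filter ι), ∀ y t : F, y ^ p ^ m i = y → (H.map (mapRingHom (uev F i))).evalEval y t = 0 →
      ∏ l, ((Δ'.map (uev F i)).eval y * t ^ p ^ m i - ((ρ' l).map (mapRingHom (uev F i))).evalEval y t) = 0 := by
    by_contra hcon
    rw [← Ultrafilter.eventually_not] at hcon
    have : ∀ i, ∃ y t : F, ¬ (∀ y t : F, y ^ p ^ m i = y → (H.map (mapRingHom (uev F i))).evalEval y t = 0 →
      ∏ l, ((Δ'.map (uev F i)).eval y * t ^ p ^ m i - ((ρ' l).map (mapRingHom (uev F i))).evalEval y t) = 0) →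
        y ^ p ^ m i = y ∧ (H.map (mapRingHom (uev F i))).evalEval y t = 0 ∧
      ∏ l, ((Δ'.map (uev F i)).eval y * t ^ p ^ m i - ((ρ' l).map (mapRingHom (uev F i))).evalEval y t) ≠ 0 := by
      intro i
      by_cases hi : (∀ y t : F, y ^ p ^ m i = y → (H.map (mapRingHom (uev F i))).evalEval y t = 0 →
      ∏ l, ((Δ'.map (uev F i)).eval y * t ^ p ^ m i - ((ρ' l).map (mapRingHom (uev F i))).evalEval y t) = 0)
      · exact ⟨0, 0, fun h => absurd hi h⟩
      · have hi' := hi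
        push Not at hi'
        obtain ⟨y, t, h⟩ := hi'
        exact ⟨y, t, fun _ => h⟩
    choose y t hyt using this
    have hcontra := hprod (uq 𝒰 y) (uq 𝒰 t) ?_ ?_
    · have hx : ∏ l, (Δ.eval (uq 𝒰 y) * upFrob 𝒰 p m (uq 𝒰 t) - (ρ l).evalEval (uq 𝒰 y) (uq 𝒰 t)) =
          uq 𝒰 (∏ l, (Δ'.eval y * frobPi p m t - (ρ' l).evalEval y t)) := by
        rw [map_prod]
        refine Finset.prod_congr rfl fun l _ => ?_
        rw [map_sub, map_mul, ← ev1q, ← ev2q, ← upFrob_uq, hΔ', hq1, hq2]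
      rw [hx, uq_eq_zero_iff] at hcontra
      obtain ⟨i, h1, h2⟩ := (hcontra.and hcon).exists
      refine (hyt i h2).2.2 ?_
      rw [Finset.prod_apply] at h1
      refine Eq.trans (Finset.prod_congr rfl fun l _ => ?_) h1
      rw [ev1i, ev2i]
      rfl
    · rw [upFrob_fix]
      filter_upwards [hcon] with i hi
      exact (hyt i hi).1
    · rw [← hq2 h, ev2q, uq_eq_zero_iff]
      filter_upwards [hcon] with i hi
      rw [← ev2i]; exact (hyt i hi).2.1
  have e5 := hm.eventually_ge_atTop (2 * thrC D δ c0)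
  have key : ∀ᶠ i in (𝒰 : Filter ι), ∃ y t : F, y ^ p ^ m i = y ∧ (Δ'.map (uev F i)).eval y ≠ 0 ∧
      (H.map (mapRingHom (uev F i))).evalEval y t = 0 ∧
      (Δ'.map (uev F i)).eval y * t ^ p ^ m i = ((ρ' l0).map (mapRingHom (uev F i))).evalEval y t := by
    filter_upwards [e1, e2, e3, e4, e5] with i h1 h2 h3 h4 h5
    refine thmC p h5 (hHm.map _) h1 ((hHm.natDegree_map _).trans hHd) ?_ _ h2 ?_ h3
      (fun l => (ρ' l).map (mapRingHom (uev F i))) (fun l => hWt _ _ i (hρc l)) h4 l0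
    · rw [← hD]; exact hWt _ _ i hδ
    · exact (natDegree_map_le.trans (lf_natDegree_le _ h0 _)).trans (Nat.le_add_right _ _)
  have key2 : ∀ i, ∃ y t : F, (∃ y t : F, y ^ p ^ m i = y ∧ (Δ'.map (uev F i)).eval y ≠ 0 ∧
      (H.map (mapRingHom (uev F i))).evalEval y t = 0 ∧
      (Δ'.map (uev F i)).eval y * t ^ p ^ m i = ((ρ' l0).map (mapRingHom (uev F i))).evalEval y t) →
      y ^ p ^ m i = y ∧ (Δ'.map (uev F i)).eval y ≠ 0 ∧
      (H.map (mapRingHom (uev F i))).evalEval y t = 0 ∧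
      (Δ'.map (uev F i)).eval y * t ^ p ^ m i = ((ρ' l0).map (mapRingHom (uev F i))).evalEval y t := by
    intro i
    by_cases hi : (∃ y t : F, y ^ p ^ m i = y ∧ (Δ'.map (uev F i)).eval y ≠ 0 ∧
      (H.map (mapRingHom (uev F i))).evalEval y t = 0 ∧
      (Δ'.map (uev F i)).eval y * t ^ p ^ m i = ((ρ' l0).map (mapRingHom (uev F i))).evalEval y t)
    · obtain ⟨y, t, h⟩ := hi
      exact ⟨y, t, fun _ => h⟩
    · exact ⟨0, 0, fun h => absurd h hi⟩
  choose y t hyt using key2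
  refine ⟨uq 𝒰 y, uq 𝒰 t, ?_, ?_, ?_, ?_⟩
  · rw [upFrob_fix]
    filter_upwards [key] with i hi
    exact (hyt i hi).1
  · rw [← hq1 Δ, ev1q, uq_ne_zero_iff]
    filter_upwards [key] with i hi
    rw [← ev1i]; exact (hyt i hi).2.1
  · rw [← hq2 h, ev2q, uq_eq_zero_iff]
    filter_upwards [key] with i hi
    rw [← ev2i]; exact (hyt i hi).2.2.1
  · rw [← hq1 Δ, ← hq2 (ρ l0), ev1q, ev2q, upFrob_uq, ← map_mul, uq_eq_iff]
    filter_upwards [key] with i hi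
    rw [Pi.mul_apply, ← ev1i, ← ev2i]; exact (hyt i hi).2.2.2

end UP
end PRat

namespace PRat

section Sep

lemma separate {α : Type*} (F : Filter α) (E : Set α) (𝒞 : Set (Set α)) (huniv : Set.univ ∈ 𝒞)
    (hinter : ∀ A ∈ 𝒞, ∀ B ∈ 𝒞, A ∩ B ∈ 𝒞) (hcompl : ∀ A ∈ 𝒞, Aᶜ ∈ 𝒞)
    (hno : ¬ ∃ C ∈ 𝒞, ∀ᶠ x in F, x ∈ E ↔ x ∈ C) :
    ∃ 𝒰 𝒱 : Ultrafilter α, (𝒰 : Filter α) ≤ F ∧ (𝒱 : Filter α) ≤ F ∧ E ∈ 𝒰 ∧ E ∉ 𝒱 ∧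
      ∀ C ∈ 𝒞, C ∈ 𝒰 ↔ C ∈ 𝒱 := by
  let G : Filter α :=
    { sets := {S | ∃ C ∈ 𝒞, (∀ᶠ x in F, x ∈ E → x ∈ C) ∧ ∀ᶠ x in F, x ∉ E → x ∈ C → x ∈ S}
      univ_sets := ⟨Set.univ, huniv, by simp, by simp⟩
      sets_of_superset := by
        rintro S T ⟨C, hC, h1, h2⟩ hST
        exact ⟨C, hC, h1, h2.mono fun x hx h h' => hST (hx h h')⟩
      inter_sets := by
        rintro S T ⟨C, hC, h1, h2⟩ ⟨C', hC', h1', h2'⟩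
        refine ⟨C ∩ C', hinter _ hC _ hC', ?_, ?_⟩
        · filter_upwards [h1, h1'] with x a b h using ⟨a h, b h⟩
        · filter_upwards [h2, h2'] with x a b h h' using ⟨a h h'.1, b h h'.2⟩ }
  have hG : ∀ S, S ∈ G ↔ ∃ C ∈ 𝒞, (∀ᶠ x in F, x ∈ E → x ∈ C) ∧ ∀ᶠ x in F, x ∉ E → x ∈ C → x ∈ S :=
    fun S => Iff.rfl
  haveI : G.NeBot := by
    rw [Filter.neBot_iff, Ne, ← Filter.empty_mem_iff_bot, hG]
    rintro ⟨C, hC, h1, h2⟩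
    refine hno ⟨C, hC, ?_⟩
    filter_upwards [h1, h2] with x a b
    exact ⟨a, fun h => by_contra fun h' => b h' h⟩
  set 𝒱 := Ultrafilter.of G with h𝒱
  have h𝒱G : (𝒱 : Filter α) ≤ G := Ultrafilter.of_le G
  let G' : Filter α :=
    { sets := {S | ∃ C ∈ 𝒞, C ∈ 𝒱 ∧ ∀ᶠ x in F, x ∈ E → x ∈ C → x ∈ S}
      univ_sets := ⟨Set.univ, huniv, Filter.univ_mem, by simp⟩
      sets_of_superset := by
        rintro S T ⟨C, hC, h1, h2⟩ hST
        exact ⟨C, hC, h1, h2.mono fun x hx h h' => hST (hx h h')⟩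
      inter_sets := by
        rintro S T ⟨C, hC, h1, h2⟩ ⟨C', hC', h1', h2'⟩
        refine ⟨C ∩ C', hinter _ hC _ hC', Filter.inter_mem h1 h1', ?_⟩
        filter_upwards [h2, h2'] with x a b h h' using ⟨a h h'.1, b h h'.2⟩ }
  have hG' : ∀ S, S ∈ G' ↔ ∃ C ∈ 𝒞, C ∈ 𝒱 ∧ ∀ᶠ x in F, x ∈ E → x ∈ C → x ∈ S :=
    fun S => Iff.rfl
  haveI : G'.NeBot := by
    rw [Filter.neBot_iff, Ne, ← Filter.empty_mem_iff_bot, hG']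
    rintro ⟨C, hC, h1, h2⟩
    have : Cᶜ ∈ G := (hG _).mpr ⟨Cᶜ, hcompl _ hC, h2, by simp⟩
    exact (Ultrafilter.compl_mem_iff_notMem.mp (h𝒱G this)) h1
  set 𝒰 := Ultrafilter.of G' with h𝒰
  have h𝒰G : (𝒰 : Filter α) ≤ G' := Ultrafilter.of_le G'
  have hsub : ∀ C ∈ 𝒞, C ∈ 𝒱 → C ∈ 𝒰 := fun C hC h =>
    h𝒰G ((hG' _).mpr ⟨C, hC, h, Filter.Eventually.of_forall fun x _ h => h⟩)
  refine ⟨𝒰, 𝒱, ?_, ?_, ?_, ?_, ?_⟩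
  · intro S hS
    exact h𝒰G ((hG' _).mpr ⟨Set.univ, huniv, Filter.univ_mem, Filter.mem_of_superset hS fun x hx _ _ => hx⟩)
  · intro S hS
    exact h𝒱G ((hG _).mpr ⟨Set.univ, huniv, by simp, Filter.mem_of_superset hS fun x hx _ _ => hx⟩)
  · exact h𝒰G ((hG' _).mpr ⟨Set.univ, huniv, Filter.univ_mem, by simp⟩)
  · have : Eᶜ ∈ G := (hG _).mpr ⟨Set.univ, huniv, by simp, by simp⟩
    exact Ultrafilter.compl_mem_iff_notMem.mp (h𝒱G this)
  · intro C hC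
    refine ⟨fun h => ?_, hsub C hC⟩
    by_contra hn
    exact Ultrafilter.compl_mem_iff_notMem.mp (hsub _ (hcompl _ hC) (Ultrafilter.compl_mem_iff_notMem.mpr hn)) h

end Sep

/-- Boolean combinations of basic statements -/
inductive BForm (k : ℕ) : Type
  | atom (ω : OmD k) : BForm k
  | not (β : BForm k) : BForm k
  | and (β γ : BForm k) : BForm k

/-- truth of a Boolean combination -/
def BForm.Holds {k : ℕ} {K : Type*} [CommRing K] (σ : K → K) (x : Fin k → K) : BForm k → Prop
  | .atom ω => ω.Holds σ x
  | .not β => ¬ BForm.Holds σ x β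
  | .and β γ => BForm.Holds σ x β ∧ BForm.Holds σ x γ

/-- list of atoms -/
def BForm.atoms {k : ℕ} : BForm k → List (OmD k)
  | .atom ω => [ω]
  | .not β => β.atoms
  | .and β γ => β.atoms ++ γ.atoms

lemma BForm.holds_congr {k : ℕ} {K L : Type*} [CommRing K] [CommRing L] (σ : K → K) (x : Fin k → K)
    (τ : L → L) (y : Fin k → L) (β : BForm k) (h : ∀ ω ∈ β.atoms, ω.Holds σ x ↔ ω.Holds τ y) :
    β.Holds σ x ↔ β.Holds τ y := by
  induction β with
  | atom ω => exact h ω (by simp [BForm.atoms])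
  | not β ih => exact not_congr (ih h)
  | and β γ ih1 ih2 =>
    exact and_congr (ih1 fun ω hω => h ω (List.mem_append_left _ hω)) (ih2 fun ω hω => h ω (List.mem_append_right _ hω))

/-- the trivially true statement -/
def omTrue (k : ℕ) : OmD k := ⟨0, fun i => i.elim0, ∅⟩

lemma omTrue_holds {k : ℕ} {K : Type*} [CommRing K] (σ : K → K) (x : Fin k → K) : (omTrue k).Holds σ x :=
  ⟨fun i => i.elim0, fun i => i.elim0, fun i => i.elim0, fun i => i.elim0, fun q hq => absurd hq (Finset.notMem_empty q)⟩

section QE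
variable {F : Type} [Field F] [IsAlgClosed F] (p : ℕ) [Fact p.Prime] [CharP F p]

lemma los_bform {ι : Type} (𝒰 : Ultrafilter ι) (m : ι → ℕ) {k : ℕ} (β : BForm k) (x : Fin k → ι → F) :
    β.Holds (upFrob 𝒰 p m) (fun j => uq 𝒰 (x j)) ↔
      ∀ᶠ i in (𝒰 : Filter ι), β.Holds (fun y : F => y ^ p ^ m i) (fun j => x j i) := by
  induction β with
  | atom ω => exact los_om 𝒰 p m ω x
  | not β ih =>
    simp only [BForm.Holds]
    rw [Ultrafilter.eventually_not, ih]
  | and β γ ih1 ih2 =>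
    simp only [BForm.Holds]
    rw [Filter.eventually_and, ih1, ih2]

theorem qe_step {k : ℕ} (β : BForm (k + 1)) :
    ∃ (β' : BForm k) (m0 : ℕ), ∀ m ≥ m0, ∀ x : Fin k → F, (∀ j, x j ^ p ^ m = x j) →
      ((∃ y : F, y ^ p ^ m = y ∧ β.Holds (fun z : F => z ^ p ^ m) (Fin.snoc x y : Fin (k + 1) → F)) ↔
        β'.Holds (fun z : F => z ^ p ^ m) x) := by
  classical
  let α := ℕ × (Fin k → F)
  let V : Set α := {P | ∀ j, P.2 j ^ p ^ P.1 = P.2 j}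
  let 𝓕 : Filter α := Filter.comap Prod.fst Filter.atTop ⊓ Filter.principal V
  let E : Set α := {P | ∃ y : F, y ^ p ^ P.1 = y ∧ β.Holds (fun z : F => z ^ p ^ P.1) (Fin.snoc P.2 y : Fin (k + 1) → F)}
  let S : BForm k → Set α := fun β => {P | β.Holds (fun z : F => z ^ p ^ P.1) P.2}
  by_cases hyes : ∃ C ∈ Set.range S, ∀ᶠ P in 𝓕, P ∈ E ↔ P ∈ C
  · obtain ⟨_, ⟨β', rfl⟩, h⟩ := hyes
    rw [Filter.eventually_inf_principal, Filter.eventually_comap] at h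
    obtain ⟨m0, hm0⟩ := Filter.eventually_atTop.mp h
    exact ⟨β', m0, fun m hm x hx => hm0 m hm (m, x) rfl hx⟩
  exfalso
  obtain ⟨𝒰, 𝒱, h𝒰, h𝒱, hE𝒰, hE𝒱, hC⟩ := separate 𝓕 E (Set.range S) ⟨.atom (omTrue k), by
      ext P; simp only [S, Set.mem_univ, iff_true]; exact omTrue_holds _ _⟩
    (by rintro _ ⟨β, rfl⟩ _ ⟨γ, rfl⟩; exact ⟨.and β γ, rfl⟩)
    (by rintro _ ⟨β, rfl⟩; exact ⟨.not β, rfl⟩) hyes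
  have htend : ∀ 𝒲 : Ultrafilter α, (𝒲 : Filter α) ≤ 𝓕 → Filter.Tendsto (Prod.fst : α → ℕ) (𝒲 : Filter α) Filter.atTop :=
    fun 𝒲 h => Filter.tendsto_iff_comap.mpr (h.trans inf_le_left)
  have hval : ∀ 𝒲 : Ultrafilter α, (𝒲 : Filter α) ≤ 𝓕 → ∀ᶠ P in (𝒲 : Filter α), ∀ j, P.2 j ^ p ^ P.1 = P.2 j :=
    fun 𝒲 h => (h.trans inf_le_right) (Filter.mem_principal_self V)
  let X : Fin k → α → F := fun j P => P.2 j
  have hfix : ∀ 𝒲 : Ultrafilter α, (𝒲 : Filter α) ≤ 𝓕 → ∀ j, upFrob 𝒲 p Prod.fst (uq 𝒲 (X j)) = uq 𝒲 (X j) := by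
    intro 𝒲 h j
    rw [upFrob_fix]
    exact (hval 𝒲 h).mono fun P hP => hP j
  haveI := up_charP (F := F) 𝒰 p
  haveI := up_charP (F := F) 𝒱 p
  have hsn : ∀ (𝒲 : Ultrafilter α) (y : α → F), (Fin.snoc (fun j => uq 𝒲 (X j)) (uq 𝒲 y) : Fin (k + 1) → _) =
      fun j => uq 𝒲 ((Fin.snoc X y : Fin (k + 1) → α → F) j) := by
    intro 𝒲 y
    funext j
    refine Fin.lastCases ?_ (fun j => ?_) j
    · rw [Fin.snoc_last, Fin.snoc_last]
    · rw [Fin.snoc_castSucc, Fin.snoc_castSucc]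
  have hsn2 : ∀ (y : α → F) (P : α), (fun j => (Fin.snoc X y : Fin (k + 1) → α → F) j P) = (Fin.snoc P.2 (y P) : Fin (k + 1) → F) := by
    intro y P
    funext j
    refine Fin.lastCases ?_ (fun j => ?_) j
    · rw [Fin.snoc_last, Fin.snoc_last]
    · rw [Fin.snoc_castSucc, Fin.snoc_castSucc]
  have hy : ∃ y : α → F, ∀ P ∈ E, y P ^ p ^ P.1 = y P ∧ β.Holds (fun z : F => z ^ p ^ P.1) (Fin.snoc P.2 (y P) : Fin (k + 1) → F) := by
    refine ⟨fun P => if h : P ∈ E then h.choose else 0, fun P hP => ?_⟩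
    simp only [dif_pos hP]
    exact hP.choose_spec
  obtain ⟨y, hy⟩ := hy
  have htype : ∀ ω : OmD k, ω.Holds (upFrob 𝒰 p Prod.fst) (fun j => uq 𝒰 (X j)) ↔
      ω.Holds (upFrob 𝒱 p Prod.fst) (fun j => uq 𝒱 (X j)) := by
    intro ω
    rw [los_om, los_om]
    exact hC (S (.atom ω)) ⟨_, rfl⟩
  obtain ⟨c', hc', hiff⟩ := transfer_one p (upFrob (F := F) 𝒰 p Prod.fst) (upFrob (F := F) 𝒱 p Prod.fst)
    (up_PAC 𝒱 p _ (htend 𝒱 h𝒱)) (fun j => uq 𝒰 (X j)) (fun j => uq 𝒱 (X j)) (hfix 𝒰 h𝒰) (hfix 𝒱 h𝒱) htype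
    (uq 𝒰 y) ((upFrob_fix 𝒰 p _ y).mpr (Filter.mem_of_superset hE𝒰 fun P hP => (hy P hP).1)) β.atoms.get
  obtain ⟨y', rfl⟩ := uq_surj 𝒱 c'
  have h1 : β.Holds (upFrob (F := F) 𝒰 p Prod.fst) (Fin.snoc (fun j => uq 𝒰 (X j)) (uq 𝒰 y) : Fin (k + 1) → _) := by
    rw [hsn, los_bform]
    refine Filter.mem_of_superset hE𝒰 fun P hP => ?_
    have := (hy P hP).2
    rw [← hsn2] at this
    exact this
  rw [BForm.holds_congr _ _ (upFrob (F := F) 𝒱 p Prod.fst) (Fin.snoc (fun j => uq 𝒱 (X j)) (uq 𝒱 y') : Fin (k + 1) → _) β (by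
    intro ω hω
    obtain ⟨i, rfl⟩ := List.get_of_mem hω
    exact hiff i), hsn, los_bform] at h1
  rw [upFrob_fix] at hc'
  refine hE𝒱 ?_
  filter_upwards [h1, hc'] with P h1 h2
  rw [hsn2] at h1
  exact ⟨y' P, h2, h1⟩

end QE
end PRat

namespace PRat
open Polynomial

section Count
variable {K : ℕ → Type} [∀ m, Field (K m)] [∀ m, Fintype (K m)] {k : ℕ}

/-- counting function -/
noncomputable def cntF (K : ℕ → Type) [∀ m, Field (K m)] {k : ℕ} (r : ℕ) (h : Finset (MvPolynomial (Fin k ⊕ Fin r) ℤ)) :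
    (m : ℕ) → (Fin k → K m) → ℚ :=
  fun m x => (Nat.card {t : Fin r → K m // ∀ q ∈ h, mev (Sum.elim x t) q = 0} : ℚ)

lemma mev_rename {s s' : Type*} {R : Type*} [CommRing R] (f : s → s') (x : s' → R) (q : MvPolynomial s ℤ) :
    mev x (MvPolynomial.rename f q) = mev (fun i => x (f i)) q := by
  rw [mev_apply, MvPolynomial.aeval_rename]; rfl

/-- the monoid of counting functions -/
noncomputable def cntM (K : ℕ → Type) [∀ m, Field (K m)] [∀ m, Fintype (K m)] (k : ℕ) :
    Submonoid ((m : ℕ) → (Fin k → K m) → ℚ) where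
  carrier := {f | ∃ r h, f = cntF K r h}
  one_mem' := by
    refine ⟨0, ∅, ?_⟩
    funext m x
    simp only [cntF, Finset.notMem_empty, false_imp_iff, imp_true_iff, Pi.one_apply]
    simp
  mul_mem' := by
    classical
    rintro _ _ ⟨r, h, rfl⟩ ⟨r', h', rfl⟩
    refine ⟨r + r', h.image (MvPolynomial.rename (Sum.map id (Fin.castAdd r'))) ∪
      h'.image (MvPolynomial.rename (Sum.map id (Fin.natAdd r))), ?_⟩
    funext m x
    simp only [Pi.mul_apply, cntF]
    rw [← Nat.cast_mul, ← Nat.card_prod]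
    congr 1
    refine Nat.card_congr (Equiv.subtypeProdEquivProd.symm.trans (Equiv.subtypeEquiv (Fin.appendEquiv r r') ?_))
    rintro ⟨t, t'⟩
    have e1 : (fun i => Sum.elim x (Fin.append t t') (Sum.map id (Fin.castAdd r') i)) = Sum.elim x t := by
      funext i
      rcases i with i | i
      · rfl
      · simp
    have e2 : (fun i => Sum.elim x (Fin.append t t') (Sum.map id (Fin.natAdd r) i)) = Sum.elim x t' := by
      funext i
      rcases i with i | i
      · rfl
      · simp
    constructor
    · rintro ⟨h1, h2⟩ q hq
      change mev (Sum.elim x (Fin.append t t')) q = 0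
      rcases Finset.mem_union.mp hq with hq | hq
      · obtain ⟨q', hq', rfl⟩ := Finset.mem_image.mp hq
        rw [mev_rename, e1]; exact h1 q' hq'
      · obtain ⟨q', hq', rfl⟩ := Finset.mem_image.mp hq
        rw [mev_rename, e2]; exact h2 q' hq'
    · intro hh
      constructor
      · intro q hq
        have := hh _ (Finset.mem_union_left _ (Finset.mem_image_of_mem _ hq))
        change mev (Sum.elim x (Fin.append t t')) _ = 0 at this
        rw [mev_rename, e1] at this
        exact this
      · intro q hq
        have := hh _ (Finset.mem_union_right _ (Finset.mem_image_of_mem _ hq))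
        change mev (Sum.elim x (Fin.append t t')) _ = 0 at this
        rw [mev_rename, e2] at this
        exact this

/-- the algebra spanned by counting functions -/
noncomputable def cntA (K : ℕ → Type) [∀ m, Field (K m)] [∀ m, Fintype (K m)] (k : ℕ) :
    Subalgebra ℚ ((m : ℕ) → (Fin k → K m) → ℚ) :=
  Algebra.adjoin ℚ (cntM K k : Set ((m : ℕ) → (Fin k → K m) → ℚ))

lemma cntF_mem (r : ℕ) (h : Finset (MvPolynomial (Fin k ⊕ Fin r) ℤ)) : cntF K r h ∈ cntA K k :=
  Algebra.subset_adjoin ⟨r, h, rfl⟩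

lemma cntF_sum [∀ m, DecidableEq (K m)] (r : ℕ) (h : Finset (MvPolynomial (Fin k ⊕ Fin r) ℤ)) :
    ∃ (s : ℕ) (h' : Fin s → MvPolynomial (Fin (k + r)) ℤ), ∀ m,
      ∑ x : Fin k → K m, cntF K r h m x =
        (Nat.card {z : Fin (k + r) → K m // ∀ j, MvPolynomial.aeval z (h' j) = 0} : ℚ) := by
  classical
  refine ⟨h.card, fun j => MvPolynomial.rename finSumFinEquiv (h.equivFin.symm j : MvPolynomial (Fin k ⊕ Fin r) ℤ), fun m => ?_⟩
  simp only [cntF]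
  rw [← Nat.cast_sum, ← Nat.card_sigma]
  congr 1
  refine Nat.card_congr ?_
  refine (Equiv.subtypeProdEquivSigmaSubtype (fun (x : Fin k → K m) (t : Fin r → K m) => ∀ q ∈ h, mev (Sum.elim x t) q = 0)).symm.trans
    (Equiv.subtypeEquiv (Fin.appendEquiv k r) ?_)
  rintro ⟨x, t⟩
  have e1 : (fun i => Fin.append x t (finSumFinEquiv i)) = Sum.elim x t := by
    funext i
    rcases i with i | i
    · simp
    · simp
  have e2 : ∀ q, MvPolynomial.aeval (Fin.append x t) (MvPolynomial.rename finSumFinEquiv q) = mev (Sum.elim x t) q := by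
    intro q
    rw [← mev_apply, mev_rename, e1]
  constructor
  · intro hh j
    exact (e2 _).trans (hh _ (h.equivFin.symm j).2)
  · intro hh q hq
    have := hh (h.equivFin ⟨q, hq⟩)
    change MvPolynomial.aeval (Fin.append x t) _ = 0 at this
    rw [e2, Equiv.symm_apply_apply] at this
    exact this

theorem cntA_isRat [∀ m, DecidableEq (K m)] (e : ℕ)
    (hrat : ∀ (n s : ℕ) (h : Fin s → MvPolynomial (Fin n) ℤ), IsRat (fun m =>
      (Nat.card {z : Fin n → K (e * m) // ∀ j, MvPolynomial.aeval z (h j) = 0} : ℚ)))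
    (f : (m : ℕ) → (Fin k → K m) → ℚ) (hf : f ∈ cntA K k) :
    IsRat (fun m => ∑ x, f (e * m) x) := by
  have hf' : f ∈ Subalgebra.toSubmodule (cntA K k) := hf
  rw [cntA, Algebra.adjoin_eq_span, Submonoid.closure_eq] at hf'
  clear hf
  induction hf' using Submodule.span_induction with
  | mem f hf =>
    obtain ⟨r, h, rfl⟩ := hf
    obtain ⟨s, h', hh⟩ := cntF_sum (K := K) r h
    simp only [hh]
    exact hrat _ _ h'
  | zero => simpa using IsRat.zero
  | add f g _ _ hf hg =>
    simp only [Pi.add_apply, Finset.sum_add_distrib]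
    exact hf.add hg
  | smul c f _ hf =>
    simp only [Pi.smul_apply, smul_eq_mul, ← Finset.mul_sum]
    exact hf.const_mul c

lemma interp (B : ℕ) : ∃ P : ℚ[X], ∀ n ≤ B, P.eval (n : ℚ) = if n = 0 then 0 else 1 := by
  refine ⟨Lagrange.interpolate (Finset.range (B + 1)) (fun n : ℕ => (n : ℚ)) (fun n => if n = 0 then 0 else 1), fun n hn => ?_⟩
  exact Lagrange.eval_interpolate_at_node (fun n => if n = 0 then (0 : ℚ) else 1) (v := fun n : ℕ => (n : ℚ))
    (fun a _ b _ h => Nat.cast_injective h) (Finset.mem_range.mpr (Nat.lt_succ_of_le hn))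

lemma aeval_mem (A : Subalgebra ℚ ((m : ℕ) → (Fin k → K m) → ℚ)) (P : ℚ[X]) {f} (hf : f ∈ A) :
    (fun m x => P.eval (f m x)) ∈ A := by
  have h1 : Polynomial.aeval f P ∈ A := by
    have : Polynomial.aeval f P = A.val (Polynomial.aeval (⟨f, hf⟩ : A) P) := by
      rw [← aeval_algHom_apply]; rfl
    rw [this]
    exact Subtype.property _
  convert h1 using 1
  funext m x
  have h2 := aeval_algHom_apply ((Pi.evalAlgHom ℚ (fun _ : Fin k → K m => ℚ) x).comp
    (Pi.evalAlgHom ℚ (fun m => (Fin k → K m) → ℚ) m)) f P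
  change Polynomial.aeval (f m x) P = (Polynomial.aeval f P) m x at h2
  rw [← h2, coe_aeval_eq_eval]

open scoped Classical in
theorem ind_atom (ω : OmD k) : (fun m x => if ω.Holds (id : K m → K m) x then (1 : ℚ) else 0) ∈ cntA K k := by
  let G : Fin ω.r → MvPolynomial (Fin k ⊕ Fin ω.r) ℤ := fun i =>
    (ω.g i).eval₂ (MvPolynomial.rename Sum.inl : _ →ₐ[ℤ] MvPolynomial (Fin k ⊕ Fin ω.r) ℤ).toRingHom (MvPolynomial.X (Sum.inr i))
  have hG : ∀ m (x : Fin k → K m) t i, mev (Sum.elim x t) (G i) = ((ω.g i).map (mev x)).eval (t i) := by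
    intro m x t i
    simp only [G]
    rw [hom_eval₂, mev_X, eval_map]
    congr 1
    ext q
    · simp
    · change mev (Sum.elim x t) (MvPolynomial.rename Sum.inl (MvPolynomial.X q)) = mev x (MvPolynomial.X q)
      rw [mev_rename, mev_X, mev_X]; rfl
  let h : Finset (MvPolynomial (Fin k ⊕ Fin ω.r) ℤ) := ω.f ∪ Finset.univ.image G
  have hN : ∀ m (x : Fin k → K m) t, (∀ q ∈ h, mev (Sum.elim x t) q = 0) ↔
      (∀ i, ((ω.g i).map (mev x)).eval (t i) = 0) ∧ ∀ q ∈ ω.f, mev (Sum.elim x t) q = 0 := by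
    intro m x t
    constructor
    · intro hh
      refine ⟨fun i => ?_, fun q hq => hh q (Finset.mem_union_left _ hq)⟩
      rw [← hG]
      exact hh _ (Finset.mem_union_right _ (Finset.mem_image_of_mem _ (Finset.mem_univ i)))
    · rintro ⟨h1, h2⟩ q hq
      rcases Finset.mem_union.mp hq with hq | hq
      · exact h2 q hq
      · obtain ⟨i, _, rfl⟩ := Finset.mem_image.mp hq
        rw [hG]; exact h1 i
  set B := ∏ i, (ω.g i).natDegree with hB
  obtain ⟨P, hP⟩ := interp B
  let z : Fin ω.r → (m : ℕ) → (Fin k → K m) → ℚ := fun i =>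
    cntF K 0 ((ω.g i).support.image fun j => MvPolynomial.rename Sum.inl ((ω.g i).coeff j))
  have hz : ∀ i m x, z i m x = if (ω.g i).map (mev x) = 0 then 1 else 0 := by
    intro i m x
    simp only [z, cntF]
    have hiff : ∀ t : Fin 0 → K m, (∀ q ∈ ((ω.g i).support.image fun j => MvPolynomial.rename Sum.inl ((ω.g i).coeff j)),
        mev (Sum.elim x t) q = 0) ↔ (ω.g i).map (mev x) = 0 := by
      intro t
      constructor
      · intro hh
        ext j
        rw [coeff_map, coeff_zero]
        by_cases hj : j ∈ (ω.g i).support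
        · have := hh _ (Finset.mem_image_of_mem _ hj)
          rw [mev_rename] at this
          exact this
        · rw [notMem_support_iff.mp hj, map_zero]
      · intro hh q hq
        obtain ⟨j, hj, rfl⟩ := Finset.mem_image.mp hq
        rw [mev_rename]
        have := congrArg (fun Q => Q.coeff j) hh
        simp only [coeff_map, coeff_zero] at this
        exact this
    simp only [hiff]
    split_ifs with h0
    · simp [h0]
    · simp [h0]
  have hmem : (∏ i, (1 - z i)) * (fun m x => P.eval (cntF K ω.r h m x)) ∈ cntA K k := by
    refine Subalgebra.mul_mem _ (Subalgebra.prod_mem _ fun i _ => Subalgebra.sub_mem _ (Subalgebra.one_mem _) (cntF_mem _ _)) ?_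
    exact aeval_mem _ P (cntF_mem _ _)
  convert hmem using 1
  funext m x
  have hprod : (∏ i, (1 - z i)) m x = ∏ i, (1 - z i m x) := by
    rw [Finset.prod_apply, Finset.prod_apply]; rfl
  rw [Pi.mul_apply, Pi.mul_apply, hprod]
  by_cases hne : ∀ i, (ω.g i).map (mev x) ≠ 0
  · rw [Finset.prod_eq_one fun i _ => by rw [hz, if_neg (hne i), sub_zero], one_mul]
    have hcard : Nat.card {t : Fin ω.r → K m // ∀ q ∈ h, mev (Sum.elim x t) q = 0} ≤ B := by
      rw [Nat.card_eq_fintype_card, Fintype.card_subtype]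
      refine (Finset.card_le_card (t := Fintype.piFinset fun i => ((ω.g i).map (mev x)).roots.toFinset) ?_).trans ?_
      · intro t ht
        rw [Finset.mem_filter] at ht
        rw [Fintype.mem_piFinset]
        intro i
        rw [Multiset.mem_toFinset, mem_roots (hne i)]
        exact ((hN m x t).mp ht.2).1 i
      · rw [Fintype.card_piFinset]
        refine Finset.prod_le_prod' fun i _ => ?_
        exact (Multiset.toFinset_card_le _).trans ((card_roots' _).trans natDegree_map_le)
    simp only [cntF]
    rw [hP _ hcard]
    have hiff : ω.Holds (id : K m → K m) x ↔ ¬ Nat.card {t : Fin ω.r → K m // ∀ q ∈ h, mev (Sum.elim x t) q = 0} = 0 := by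
      rw [← Ne, Nat.card_ne_zero]
      constructor
      · rintro ⟨_, t, _, h1, h2⟩
        exact ⟨⟨t, (hN m x t).mpr ⟨h1, h2⟩⟩, inferInstance⟩
      · rintro ⟨⟨t, ht⟩, _⟩
        exact ⟨hne, t, fun _ => rfl, ((hN m x t).mp ht).1, ((hN m x t).mp ht).2⟩
    rw [if_congr hiff rfl rfl, ite_not]
  · rw [if_neg fun hh => hne hh.1]
    push Not at hne
    obtain ⟨i, hi⟩ := hne
    rw [Finset.prod_eq_zero (Finset.mem_univ i), zero_mul]
    rw [hz, if_pos hi, sub_self]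

open scoped Classical in
theorem ind_bform (β : BForm k) : (fun m x => if β.Holds (id : K m → K m) x then (1 : ℚ) else 0) ∈ cntA K k := by
  induction β with
  | atom ω => exact ind_atom ω
  | not β ih =>
    convert Subalgebra.sub_mem _ (Subalgebra.one_mem _) ih using 1
    funext m x
    simp only [BForm.Holds, Pi.sub_apply, Pi.one_apply]
    split_ifs <;> simp_all
  | and β γ ih1 ih2 =>
    convert Subalgebra.mul_mem _ ih1 ih2 using 1
    funext m x
    simp only [BForm.Holds, Pi.mul_apply]
    by_cases h1 : BForm.Holds id x β <;> by_cases h2 : BForm.Holds id x γ <;> simp [h1, h2]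

theorem bform_count_isRat (e : ℕ)
    (hrat : ∀ (n s : ℕ) (h : Fin s → MvPolynomial (Fin n) ℤ), IsRat (fun m =>
      (Nat.card {z : Fin n → K (e * m) // ∀ j, MvPolynomial.aeval z (h j) = 0} : ℚ))) (β : BForm k) :
    IsRat (fun m => (Nat.card {x : Fin k → K (e * m) // β.Holds id x} : ℚ)) := by
  classical
  have := cntA_isRat e hrat _ (ind_bform (K := K) β)
  refine this.congr 0 fun m _ => ?_
  rw [Nat.card_eq_fintype_card, Fintype.card_subtype, Finset.sum_boole]

end Count
end PRat

namespace PRat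
open FirstOrder

section Final

/-- terms are integer polynomials -/
lemma term_poly {s : Type} (t : Language.ring.Term s) : ∃ P : MvPolynomial s ℤ,
    ∀ (K : Type) [CommRing K] [Ring.CompatibleRing K] (v : s → K), t.realize v = mev v P := by
  induction t with
  | var a => exact ⟨MvPolynomial.X a, fun K _ _ v => by simp⟩
  | func f ts ih =>
    choose P hP using ih
    cases f with
    | add =>
      refine ⟨P 0 + P 1, fun K _ _ v => ?_⟩
      rw [map_add, ← hP 0 K v, ← hP 1 K v]
      exact Ring.CompatibleRing.funMap_add _
    | mul =>
      refine ⟨P 0 * P 1, fun K _ _ v => ?_⟩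
      rw [map_mul, ← hP 0 K v, ← hP 1 K v]
      exact Ring.CompatibleRing.funMap_mul _
    | neg =>
      refine ⟨- P 0, fun K _ _ v => ?_⟩
      rw [map_neg, ← hP 0 K v]
      exact Ring.CompatibleRing.funMap_neg _
    | zero =>
      refine ⟨0, fun K _ _ v => ?_⟩
      rw [map_zero]
      exact Ring.CompatibleRing.funMap_zero _
    | one =>
      refine ⟨1, fun K _ _ v => ?_⟩
      rw [map_one]
      exact Ring.CompatibleRing.funMap_one _

/-- the atom for a single equation -/
noncomputable def omEq {k : ℕ} (P : MvPolynomial (Fin k) ℤ) : OmD k :=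
  ⟨0, Fin.elim0, {MvPolynomial.rename Sum.inl P}⟩

lemma omEq_holds {k : ℕ} (P : MvPolynomial (Fin k) ℤ) {K : Type*} [CommRing K] (σ : K → K) (x : Fin k → K) :
    (omEq P).Holds σ x ↔ mev x P = 0 := by
  have key : ∀ t : Fin 0 → K, mev (Sum.elim x t) (MvPolynomial.rename Sum.inl P) = mev x P := by
    intro t
    rw [mev_rename]
    rfl
  constructor
  · rintro ⟨-, t, -, -, h⟩
    have := h _ (Finset.mem_singleton_self _)
    exact (key t).symm.trans this
  · intro h
    refine ⟨fun i => i.elim0, fun i => i.elim0, fun i => i.elim0, fun i => i.elim0, ?_⟩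
    intro q hq
    rw [show q = MvPolynomial.rename Sum.inl P from Finset.mem_singleton.mp hq]
    exact (key _).trans h

lemma bform_transfer {E F : Type} [Field E] [Field F] (ε : E →+* F) (σ : F → F)
    (hσ : ∀ y, σ y = y ↔ ∃ x, ε x = y) {k : ℕ} (β : BForm k) (x : Fin k → E) :
    β.Holds σ (fun i => ε (x i)) ↔ β.Holds id x := by
  have hinj : Function.Injective ε := ε.injective
  induction β with
  | atom ω =>
    have hg : ∀ i, (ω.g i).map (mev fun i => ε (x i)) = ((ω.g i).map (mev x)).map ε := by
      intro i; rw [Polynomial.map_map, comp_mev]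
    have he : ∀ t : Fin ω.r → E, (Sum.elim (fun i => ε (x i)) fun i => ε (t i)) =
        fun i => ε (Sum.elim x t i) := by
      intro t; funext i; cases i <;> rfl
    show ω.Holds σ _ ↔ ω.Holds id x
    constructor
    · rintro ⟨h1, t, h2, h3, h4⟩
      choose u hu using fun i => (hσ (t i)).1 (h2 i)
      obtain rfl : (fun i => ε (u i)) = t := funext hu
      refine ⟨fun i h => h1 i ?_, u, fun _ => rfl, fun i => ?_, fun q hq => ?_⟩
      · rw [hg, h, Polynomial.map_zero]
      · have := h3 i
        rw [hg, Polynomial.eval_map_apply] at this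
        exact (map_eq_zero ε).1 this
      · have := h4 q hq
        rw [he, ← map_mev] at this
        exact (map_eq_zero ε).1 this
    · rintro ⟨h1, u, h2, h3, h4⟩
      refine ⟨fun i h => h1 i ?_, fun i => ε (u i), fun i => (hσ _).2 ⟨_, rfl⟩, fun i => ?_, fun q hq => ?_⟩
      · rw [hg] at h
        exact (Polynomial.map_eq_zero ε).1 h
      · rw [hg, Polynomial.eval_map_apply, h3 i, map_zero]
      · rw [he, ← map_mev, h4 q hq, map_zero]
  | not β ih => exact not_congr ih
  | and β γ ih1 ih2 => exact and_congr ih1 ih2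

lemma exists_emb (p : ℕ) [Fact p.Prime] (m : ℕ) (hm : 1 ≤ m) :
    ∃ ε : GaloisField p m →+* AlgebraicClosure (ZMod p), ∀ y, y ^ p ^ m = y ↔ ∃ x, ε x = y := by
  classical
  let ε : GaloisField p m →+* AlgebraicClosure (ZMod p) :=
    (IsAlgClosed.lift : GaloisField p m →ₐ[ZMod p] AlgebraicClosure (ZMod p)).toRingHom
  letI : Fintype (GaloisField p m) := Fintype.ofFinite _
  have hcard : Fintype.card (GaloisField p m) = p ^ m := card_gf (by omega)
  have hq : 1 < p ^ m := Nat.one_lt_pow (by omega) (Fact.out : p.Prime).one_lt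
  have himg : ∀ x, ε x ^ p ^ m = ε x := by
    intro x
    rw [← map_pow, ← hcard, FiniteField.pow_card]
  refine ⟨ε, fun y => ⟨fun hy => ?_, ?_⟩⟩
  · have hne : (Polynomial.X ^ p ^ m - Polynomial.X : Polynomial (AlgebraicClosure (ZMod p))) ≠ 0 :=
      FiniteField.X_pow_card_sub_X_ne_zero _ hq
    have hsub : Finset.univ.image ε ⊆
        (Polynomial.X ^ p ^ m - Polynomial.X : Polynomial (AlgebraicClosure (ZMod p))).roots.toFinset := by
      intro z hz
      obtain ⟨x, -, rfl⟩ := Finset.mem_image.1 hz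
      rw [Multiset.mem_toFinset, Polynomial.mem_roots hne]
      simp [himg x]
    have heq := Finset.eq_of_subset_of_card_le hsub (by
      rw [Finset.card_image_of_injective _ ε.injective, Finset.card_univ, hcard]
      refine (Multiset.toFinset_card_le _).trans ((Polynomial.card_roots' _).trans ?_)
      rw [FiniteField.X_pow_card_sub_X_natDegree_eq _ hq])
    have : y ∈ Finset.univ.image ε := by
      rw [heq, Multiset.mem_toFinset, Polynomial.mem_roots hne]
      simp [hy]
    obtain ⟨x, -, hx⟩ := Finset.mem_image.1 this
    exact ⟨x, hx⟩
  · rintro ⟨x, rfl⟩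
    exact himg x

/-- `qe_step` inside the finite fields -/
lemma qe_finite (p : ℕ) [Fact p.Prime] {k : ℕ} (β : BForm (k + 1)) :
    ∃ (β' : BForm k) (m0 : ℕ), ∀ m ≥ m0, ∀ x : Fin k → GaloisField p m,
      ((∃ y, β.Holds id (Fin.snoc x y : Fin (k + 1) → GaloisField p m)) ↔ β'.Holds id x) := by
  obtain ⟨β', m0, h⟩ := qe_step (F := AlgebraicClosure (ZMod p)) p β
  refine ⟨β', max m0 1, fun m hm x => ?_⟩
  obtain ⟨ε, hε⟩ := exists_emb p m (le_trans (le_max_right _ _) hm)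
  have h1 := h m (le_trans (le_max_left _ _) hm) (fun i => ε (x i)) (fun j => (hε _).2 ⟨_, rfl⟩)
  rw [bform_transfer ε (fun z => z ^ p ^ m) hε β' x] at h1
  rw [← h1]
  have hs : ∀ y, (Fin.snoc (fun i => ε (x i)) (ε y) : Fin (k + 1) → AlgebraicClosure (ZMod p)) =
      fun i => ε ((Fin.snoc x y : Fin (k + 1) → GaloisField p m) i) := by
    intro y
    funext i
    refine Fin.lastCases ?_ (fun j => ?_) i
    · simp
    · simp
  constructor
  · rintro ⟨y, hy⟩
    refine ⟨ε y, (hε _).2 ⟨_, rfl⟩, ?_⟩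
    rw [hs, bform_transfer ε (fun z => z ^ p ^ m) hε]
    exact hy
  · rintro ⟨z, hz, hy⟩
    obtain ⟨y, rfl⟩ := (hε z).1 hz
    rw [hs, bform_transfer ε (fun z => z ^ p ^ m) hε] at hy
    exact ⟨y, hy⟩

lemma formula_bform (p : ℕ) [Fact p.Prime] {k n : ℕ} (φ : Language.ring.BoundedFormula (Fin k) n) :
    ∃ (β : BForm (k + n)) (m0 : ℕ), ∀ m ≥ m0, ∀ (x : Fin k → GaloisField p m) (xs : Fin n → GaloisField p m),
      letI := Ring.compatibleRingOfRing (GaloisField p m)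
      (φ.Realize x xs ↔ β.Holds id (Fin.append x xs)) := by
  induction φ with
  | falsum =>
    refine ⟨.not (.atom (omTrue _)), 0, fun m _ x xs => ?_⟩
    exact ⟨fun h => h.elim, fun h => h (omTrue_holds _ _)⟩
  | @equal n t1 t2 =>
    obtain ⟨P, hP⟩ := term_poly t1
    obtain ⟨Q, hQ⟩ := term_poly t2
    refine ⟨.atom (omEq (MvPolynomial.rename finSumFinEquiv (P - Q))), 0, fun m _ x xs => ?_⟩
    letI := Ring.compatibleRingOfRing (GaloisField p m)
    have hx : (fun i => Fin.append x xs (finSumFinEquiv i)) = Sum.elim x xs := by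
      funext i
      cases i <;> simp
    show (t1.realize (Sum.elim x xs) = t2.realize (Sum.elim x xs)) ↔ (omEq _).Holds id _
    rw [omEq_holds, mev_rename, hx, map_sub, sub_eq_zero, hP, hQ]
  | rel R => exact (R : Empty).elim
  | imp φ ψ ih1 ih2 =>
    obtain ⟨β, m1, h1⟩ := ih1
    obtain ⟨γ, m2, h2⟩ := ih2
    refine ⟨.not (.and β (.not γ)), max m1 m2, fun m hm x xs => ?_⟩
    letI := Ring.compatibleRingOfRing (GaloisField p m)
    have a1 := h1 m (le_trans (le_max_left _ _) hm) x xs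
    have a2 := h2 m (le_trans (le_max_right _ _) hm) x xs
    rw [Language.BoundedFormula.realize_imp, a1, a2]
    simp only [BForm.Holds]
    tauto
  | @all n φ ih =>
    obtain ⟨β, m1, h1⟩ := ih
    obtain ⟨β', m2, h2⟩ := qe_finite p (k := k + n) (.not β)
    refine ⟨.not β', max m1 m2, fun m hm x xs => ?_⟩
    letI := Ring.compatibleRingOfRing (GaloisField p m)
    have a2 := h2 m (le_trans (le_max_right _ _) hm) (Fin.append x xs)
    rw [Language.BoundedFormula.realize_all]
    show _ ↔ ¬ β'.Holds id _
    rw [← a2]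
    simp only [BForm.Holds, not_exists, not_not]
    refine forall_congr' fun y => ?_
    rw [h1 m (le_trans (le_max_left _ _) hm) x (Fin.snoc xs y), Fin.append_snoc]

theorem formula_count_isRat (p : ℕ) [Fact p.Prime] (e : ℕ) (he : 1 ≤ e)
    (k : ℕ) (φ : Language.ring.Formula (Fin k)) :
    IsRat (fun m => if m = 0 then 0 else
      ((letI := Ring.compatibleRingOfRing (GaloisField p (e * m))
        Nat.card {x : Fin k → GaloisField p (e * m) // φ.Realize x} : ℕ) : ℚ)) := by
  obtain ⟨β, m0, h⟩ := formula_bform p (n := 0) φ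
  have hK : ∀ m, Nonempty (Fintype (GaloisField p m)) := fun m => by
    exact ⟨Fintype.ofFinite _⟩
  letI : ∀ m, Fintype (GaloisField p m) := fun m => (hK m).some
  have hr := bform_count_isRat (K := fun m => GaloisField p m) e
    (fun n s hh => zeroCount_isRat p hh e he) (k := k) β
  refine hr.congr (max m0 1) fun m hm => ?_
  have hm1 : 1 ≤ m := le_trans (le_max_right _ _) hm
  have hm0 : m0 ≤ e * m := le_trans (le_trans (le_max_left _ _) hm) (Nat.le_mul_of_pos_left _ he)
  rw [if_neg (by omega)]
  congr 1
  letI := Ring.compatibleRingOfRing (GaloisField p (e * m))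
  refine Nat.card_congr (Equiv.subtypeEquivRight fun x => ?_)
  have := h (e * m) hm0 x default
  have hx : Fin.append x (default : Fin 0 → GaloisField p (e * m)) = x := by
    funext i
    exact Fin.append_left x default i
  rw [hx] at this
  refine Iff.trans (iff_of_eq ?_) this
  exact congrArg (Language.BoundedFormula.Realize φ x) (Subsingleton.elim _ _)

end Final
end PRat

open FirstOrder PowerSeries

/-- The Poincaré series `Σ_{m ≥ 1} c_m t^m` of a ring-language formula `φ` with `k` free
variables over the finite fields `GaloisField p (e * m)` (with `q^m = p^{e·m}` elements)
is a rational power series. -/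
theorem poincare_series_rational (p : ℕ) [Fact p.Prime] (e : ℕ) (he : 1 ≤ e)
    (k : ℕ) (φ : Language.ring.Formula (Fin k)) :
    ∃ a b : Polynomial ℚ, b ≠ 0 ∧
      (b : PowerSeries ℚ) *
        PowerSeries.mk (fun m => if m = 0 then 0 else
          (ringFormulaCount φ (GaloisField p (e * m)) : ℚ)) = (a : PowerSeries ℚ) := by
  exact PRat.formula_count_isRat p e he k φ
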